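/- Let A = H∞(𝔻×ℕ), let M(A) be its maximal ideal space (character space), and let f ↦ f̂ denote the Gelfand transform. If K ⊆ M(A) is a compact holomorphically convex subset, then for every continuous function g : K → ℂ∖{0} there exists a continuous function g̃ : M(A) → ℂ∖{0} such that g̃|_K = g. -/

import Mathlib

/-- The unit disk times `ℕ`: the countable disjoint union of open unit disks. -/
abbrev DiskN := (↥(Metric.ball (0 : ℂ) 1)) × ℕ

/-- The Banach algebra `A = H^∞(𝔻 × ℕ)` of bounded continuous functions on
`𝔻 × ℕ` all of whose slices `z ↦ f (z, n)` are holomorphic on `𝔻`, realized as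
a subalgebra of the bounded continuous functions `𝔻 × ℕ → ℂ` (with sup norm). -/
noncomputable def HinfAlg : Subalgebra ℂ (BoundedContinuousFunction DiskN ℂ) where
  carrier := {f | ∀ n : ℕ, ∃ g : ℂ → ℂ, DifferentiableOn ℂ g (Metric.ball 0 1) ∧
    ∀ z : ℂ, ∀ hz : z ∈ Metric.ball (0 : ℂ) 1, g z = f (⟨z, hz⟩, n)}
  add_mem' := by
    intro f₁ f₂ h₁ h₂ n
    obtain ⟨g₁, hg₁, he₁⟩ := h₁ n
    obtain ⟨g₂, hg₂, he₂⟩ := h₂ n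
    exact ⟨g₁ + g₂, hg₁.add hg₂, fun z hz => by simp [he₁ z hz, he₂ z hz]⟩
  mul_mem' := by
    intro f₁ f₂ h₁ h₂ n
    obtain ⟨g₁, hg₁, he₁⟩ := h₁ n
    obtain ⟨g₂, hg₂, he₂⟩ := h₂ n
    exact ⟨g₁ * g₂, hg₁.mul hg₂, fun z hz => by simp [he₁ z hz, he₂ z hz]⟩
  algebraMap_mem' := by
    intro c n
    exact ⟨fun _ => c, differentiableOn_const c, fun z hz => by simp⟩

open Complex MeasureTheory Set Metric Filter Topology
open scoped Real ComplexConjugate Interval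

/-- The real-linear map `v ↦ a v + b v̄`. -/
noncomputable def wirtMap (a b : ℂ) : ℂ →L[ℝ] ℂ :=
  a • (ContinuousLinearMap.id ℝ ℂ) + b • (conjCLE : ℂ →L[ℝ] ℂ)

@[simp] lemma wirtMap_apply (a b v : ℂ) : wirtMap a b v = a * v + b * conj v := by
  simp [wirtMap]

/-- `f` is real differentiable at `z` with `∂f = a` and `∂̄f = b`. -/
def HasWirt (f : ℂ → ℂ) (a b z : ℂ) : Prop := HasFDerivAt f (wirtMap a b) z

namespace HasWirt
variable {f g : ℂ → ℂ} {a b c d z : ℂ}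

lemma congr_coeff (h : HasWirt f a b z) (ha : a = c) (hb : b = d) : HasWirt f c d z := by
  subst ha hb; exact h

lemma congr_of_eventuallyEq (h : HasWirt f a b z) (he : g =ᶠ[𝓝 z] f) : HasWirt g a b z :=
  HasFDerivAt.congr_of_eventuallyEq h he

lemma continuousAt (h : HasWirt f a b z) : ContinuousAt f z := HasFDerivAt.continuousAt h

lemma const (w : ℂ) : HasWirt (fun _ => w) 0 0 z := by
  have : wirtMap 0 0 = 0 := by ext <;> simp
  simpa [HasWirt, this] using hasFDerivAt_const w z

lemma zero_of_eventuallyEq (he : f =ᶠ[𝓝 z] fun _ => 0) : HasWirt f 0 0 z :=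
  (const 0).congr_of_eventuallyEq he

lemma of_hasDerivAt (h : HasDerivAt f a z) : HasWirt f a 0 z := by
  refine HasFDerivAt.congr_fderiv (h.hasFDerivAt.restrictScalars ℝ) ?_
  ext
  simp [mul_comm]

lemma add (hf : HasWirt f a b z) (hg : HasWirt g c d z) :
    HasWirt (fun x => f x + g x) (a + c) (b + d) z := by
  refine (HasFDerivAt.add hf hg).congr_fderiv ?_
  ext <;> simp <;> ring

lemma neg (hf : HasWirt f a b z) : HasWirt (fun x => -f x) (-a) (-b) z := by
  refine (HasFDerivAt.neg hf).congr_fderiv ?_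
  ext <;> simp <;> ring

lemma sub (hf : HasWirt f a b z) (hg : HasWirt g c d z) :
    HasWirt (fun x => f x - g x) (a - c) (b - d) z := by
  refine (HasFDerivAt.sub hf hg).congr_fderiv ?_
  ext <;> simp <;> ring

lemma mul (hf : HasWirt f a b z) (hg : HasWirt g c d z) :
    HasWirt (fun x => f x * g x) (a * g z + f z * c) (b * g z + f z * d) z := by
  refine (HasFDerivAt.mul hf hg).congr_fderiv ?_
  ext <;> simp <;> ring

lemma const_mul (w : ℂ) (hf : HasWirt f a b z) :
    HasWirt (fun x => w * f x) (w * a) (w * b) z := by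
  refine ((const w).mul hf).congr_coeff ?_ ?_ <;> simp

lemma sum {ι : Type*} {s : Finset ι} {f : ι → ℂ → ℂ} {a b : ι → ℂ}
    (h : ∀ i ∈ s, HasWirt (f i) (a i) (b i) z) :
    HasWirt (fun x => ∑ i ∈ s, f i x) (∑ i ∈ s, a i) (∑ i ∈ s, b i) z := by
  classical
  induction s using Finset.induction_on with
  | empty => simpa using const 0
  | insert i s hi ih =>
    simp only [Finset.sum_insert hi]
    exact (h i (by simp)).add (ih fun j hj => h j (by simp [hj]))

lemma star (hf : HasWirt f a b z) :
    HasWirt (fun x => (starRingEnd ℂ) (f x)) ((starRingEnd ℂ) b) ((starRingEnd ℂ) a) z := by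
  have := (conjCLE : ℂ →L[ℝ] ℂ).hasFDerivAt (x := f z) |>.comp z hf
  refine HasFDerivAt.congr_fderiv this ?_
  ext <;> simp <;> ring

lemma id : HasWirt (fun x => x) 1 0 z := of_hasDerivAt (hasDerivAt_id z)

lemma star_id : HasWirt (fun x => (starRingEnd ℂ) x) 0 1 z := by
  simpa using (id (z := z)).star

/-- Composition with a holomorphic function on the outside. -/
lemma comp_hasDerivAt {F : ℂ → ℂ} {F' : ℂ} (hF : HasDerivAt F F' (f z)) (hf : HasWirt f a b z) :
    HasWirt (fun x => F (f x)) (F' * a) (F' * b) z := by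
  have := (hF.hasFDerivAt.restrictScalars ℝ).comp z hf
  refine HasFDerivAt.congr_fderiv this ?_
  ext <;> simp <;> ring

lemma inv (hf : HasWirt f a b z) (h0 : f z ≠ 0) :
    HasWirt (fun x => (f x)⁻¹) (-a / f z ^ 2) (-b / f z ^ 2) z := by
  refine (comp_hasDerivAt (hasDerivAt_inv h0) hf).congr_coeff ?_ ?_ <;> ring

/-- Composition with a holomorphic function on the inside. -/
lemma comp_inner {k : ℂ → ℂ} {k' : ℂ} (hf : HasWirt f a b (k z)) (hk : HasDerivAt k k' z) :
    HasWirt (fun x => f (k x)) (a * k') (b * (starRingEnd ℂ) k') z := by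
  have := HasFDerivAt.comp z hf (hk.hasFDerivAt.restrictScalars ℝ)
  refine HasFDerivAt.congr_fderiv this ?_
  ext <;> simp <;> ring

/-- Composition of a real-valued function with a differentiable real function. -/
lemma ofReal_comp {r : ℂ → ℝ} {ψ : ℝ → ℝ} {t : ℝ} (hr : HasWirt (fun x => (r x : ℂ)) a b z)
    (hψ : HasDerivAt ψ t (r z)) :
    HasWirt (fun x => ((ψ (r x) : ℝ) : ℂ)) (t * a) (t * b) z := by
  have h1 : HasFDerivAt r (reCLM.comp (wirtMap a b)) z := by
    simpa [Function.comp_def] using reCLM.hasFDerivAt.comp z hr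
  have hreal : ∀ v, ((wirtMap a b v).re : ℂ) = wirtMap a b v := by
    have h2 := ofRealCLM.hasFDerivAt.comp z h1
    have h3 := HasFDerivAt.unique (h2 : HasFDerivAt (fun x => (r x : ℂ)) _ z) hr
    intro v
    simpa using congrArg (fun L : ℂ →L[ℝ] ℂ => L v) h3
  have h4 := ofRealCLM.hasFDerivAt.comp z (hψ.hasFDerivAt.comp z h1)
  refine HasFDerivAt.congr_fderiv h4 ?_
  ext v
  all_goals
    simp only [ContinuousLinearMap.comp_apply, ofRealCLM_apply, reCLM_apply,
      ContinuousLinearMap.toSpanSingleton_apply, smul_eq_mul, ofReal_mul, hreal]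
    simp
    ring

lemma normSq (hf : HasDerivAt f a z) :
    HasWirt (fun x => ((‖f x‖ ^ 2 : ℝ) : ℂ)) (a * (starRingEnd ℂ) (f z))
      (f z * (starRingEnd ℂ) a) z := by
  have h := (of_hasDerivAt hf).mul (of_hasDerivAt hf).star
  have e : (fun x => ((‖f x‖ ^ 2 : ℝ) : ℂ)) = fun x => f x * (starRingEnd ℂ) (f x) := by
    funext x; rw [mul_conj, normSq_eq_norm_sq]
  rw [e]
  refine h.congr_coeff ?_ ?_ <;> simp

/-- Derivative along a differentiable curve. -/
lemma comp_curve {γ : ℝ → ℂ} {γ' : ℂ} {t : ℝ} (hf : HasWirt f a b (γ t))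
    (hγ : HasDerivAt γ γ' t) :
    HasDerivAt (fun s => f (γ s)) (a * γ' + b * (starRingEnd ℂ) γ') t := by
  have := HasFDerivAt.comp_hasDerivAt t hf hγ
  rw [wirtMap_apply] at this
  exact this

end HasWirt

/-- Integration over the unit circle with respect to arc length. -/
noncomputable def circInt {E : Type*} [NormedAddCommGroup E] [NormedSpace ℝ E] (F : ℂ → E) : E :=
  ∫ θ in (0 : ℝ)..2 * π, F (circleMap 0 1 θ)

lemma norm_circleMap_zero_one (θ : ℝ) : ‖circleMap 0 1 θ‖ = 1 := by simp

lemma continuousOn_comp_circleMap {E : Type*} [TopologicalSpace E] {F : ℂ → E}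
    (hF : ContinuousOn F (sphere 0 1)) : Continuous fun θ : ℝ => F (circleMap 0 1 θ) :=
  hF.comp_continuous (continuous_circleMap 0 1) fun θ => by simp

lemma hasDerivAt_ofReal_mul_const (e : ℂ) (r : ℝ) :
    HasDerivAt (fun s : ℝ => (s : ℂ) * e) e r := by
  simpa using (HasDerivAt.ofReal_comp (hasDerivAt_id r)).mul_const e

lemma complex_polarCoord_symm_eq (p : ℝ × ℝ) :
    Complex.polarCoord.symm p = p.1 * circleMap 0 1 p.2 := by
  rw [Complex.polarCoord_symm_apply, circleMap, Complex.exp_mul_I]; simp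

lemma continuousOn_polar {E : Type*} [TopologicalSpace E] {f : ℂ → E}
    (hf : ContinuousOn f (closedBall 0 1)) :
    ContinuousOn (fun p : ℝ × ℝ => f (p.1 * circleMap 0 1 p.2)) (Icc 0 1 ×ˢ univ) := by
  refine hf.comp (Continuous.continuousOn ?_) ?_
  · exact (continuous_ofReal.comp continuous_fst).mul ((continuous_circleMap 0 1).comp continuous_snd)
  · rintro ⟨r, θ⟩ ⟨hr, -⟩
    simp only [mem_closedBall, dist_zero_right, norm_mul, norm_circleMap_zero_one, mul_one,
      norm_real, Real.norm_eq_abs]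
    rw [abs_of_nonneg hr.1]; exact hr.2

lemma setIntegral_ball_eq_polar {E : Type*} [NormedAddCommGroup E] [NormedSpace ℝ E] (f : ℂ → E) :
    ∫ z in ball (0 : ℂ) 1, f z =
      ∫ p in Ioc (0 : ℝ) 1 ×ˢ Ioc (-π) π, p.1 • f (p.1 * circleMap 0 1 p.2) := by
  rw [← integral_indicator measurableSet_ball, ← Complex.integral_comp_polarCoord_symm,
    polarCoord_target]
  have e : (Ioc (0 : ℝ) 1 ×ˢ Ioc (-π) π : Set (ℝ × ℝ)) =ᵐ[volume]
      (Ioo (0 : ℝ) 1 ×ˢ Ioo (-π) π : Set (ℝ × ℝ)) := by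
    rw [Measure.volume_eq_prod]
    exact Measure.set_prod_ae_eq Ioo_ae_eq_Ioc.symm Ioo_ae_eq_Ioc.symm
  rw [setIntegral_congr_set e]
  have hs : (Ioo (0 : ℝ) 1 ×ˢ Ioo (-π) π) ⊆ (Ioi (0 : ℝ) ×ˢ Ioo (-π) π) :=
    prod_mono Ioo_subset_Ioi_self Subset.rfl
  rw [setIntegral_eq_of_subset_of_forall_sdiff_eq_zero
    (measurableSet_Ioi.prod measurableSet_Ioo) hs]
  · refine setIntegral_congr_fun (measurableSet_Ioo.prod measurableSet_Ioo) ?_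
    rintro ⟨r, θ⟩ ⟨hr, -⟩
    simp only [complex_polarCoord_symm_eq]
    rw [indicator_of_mem]
    simp [abs_of_pos hr.1, hr.2]
  · rintro ⟨r, θ⟩ ⟨⟨hr, hθ⟩, hn⟩
    simp only [complex_polarCoord_symm_eq]
    rw [indicator_of_notMem, smul_zero]
    intro hm
    apply hn
    simp only [mem_ball, dist_zero_right, norm_mul, norm_circleMap_zero_one, mul_one,
      norm_real, Real.norm_eq_abs, abs_of_pos (mem_Ioi.1 hr)] at hm
    exact ⟨⟨hr, hm⟩, hθ⟩

lemma integral_circle_shift {E : Type*} [NormedAddCommGroup E] [NormedSpace ℝ E] (F : ℂ → E) :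
    ∫ θ in (-π)..π, F (circleMap 0 1 θ) = circInt F := by
  have hp : Function.Periodic (fun θ => F (circleMap 0 1 θ)) (2 * π) := fun θ => by
    simp [periodic_circleMap 0 1 θ]
  have := hp.intervalIntegral_add_eq (-π) 0
  rw [zero_add, show -π + 2 * π = π by ring] at this
  exact this

lemma integrable_polar {E : Type*} [NormedAddCommGroup E] [NormedSpace ℝ E] {f : ℂ → E}
    (hf : ContinuousOn f (closedBall 0 1)) :
    IntegrableOn (fun p : ℝ × ℝ => f (p.1 * circleMap 0 1 p.2))
      (Ioc 0 1 ×ˢ Ioc (-π) π) := by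
  refine IntegrableOn.mono_set (ContinuousOn.integrableOn_compact
    (isCompact_Icc.prod isCompact_Icc) ((continuousOn_polar hf).mono ?_))
    (prod_mono Ioc_subset_Icc_self Ioc_subset_Icc_self)
  exact prod_mono Subset.rfl (subset_univ _)

/-- Stokes' theorem on the unit disc. -/
theorem integral_wirt_conj {F a b : ℂ → ℂ}
    (hF : ∀ z ∈ closedBall (0 : ℂ) 1, HasWirt F (a z) (b z) z)
    (ha : ContinuousOn a (closedBall 0 1)) (hb : ContinuousOn b (closedBall 0 1)) :
    ∫ z in ball (0 : ℂ) 1, b z = (1 / 2 : ℂ) * circInt fun z => F z * z := by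
  have hFc : ContinuousOn F (closedBall 0 1) := fun z hz => (hF z hz).continuousAt.continuousWithinAt
  have hmem : ∀ r ∈ Icc (0 : ℝ) 1, ∀ θ : ℝ, (r : ℂ) * circleMap 0 1 θ ∈ closedBall (0 : ℂ) 1 := by
    intro r hr θ
    simp [abs_of_nonneg hr.1, hr.2]
  set e : ℝ → ℂ := circleMap 0 1 with he
  -- radial and angular derivatives
  let R : ℝ × ℝ → ℂ := fun p => e p.2 * F (p.1 * e p.2) +
    p.1 * e p.2 * (a (p.1 * e p.2) * e p.2 + b (p.1 * e p.2) * conj (e p.2))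
  let S : ℝ × ℝ → ℂ := fun p => e p.2 * F (p.1 * e p.2) +
    p.1 * e p.2 * (a (p.1 * e p.2) * e p.2 - b (p.1 * e p.2) * conj (e p.2))
  have hee : ∀ θ, e θ * conj (e θ) = 1 := fun θ => by
    rw [mul_conj, normSq_eq_norm_sq, he, norm_circleMap_zero_one]; simp
  have hRd : ∀ θ : ℝ, ∀ r ∈ Icc (0 : ℝ) 1,
      HasDerivAt (fun s : ℝ => s * e θ * F (s * e θ)) (R (r, θ)) r := by
    intro θ r hr
    have h1 := HasWirt.comp_curve (γ := fun s : ℝ => (s : ℂ) * e θ) (hF _ (hmem r hr θ))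
      (hasDerivAt_ofReal_mul_const (e θ) r)
    have h2 := (hasDerivAt_ofReal_mul_const (e θ) r).mul h1
    exact h2
  have hSd : ∀ r ∈ Icc (0 : ℝ) 1, ∀ θ : ℝ,
      HasDerivAt (fun s : ℝ => e s * F (r * e s)) (I * S (r, θ)) θ := by
    intro r hr θ
    have h0 : HasDerivAt e (e θ * I) θ := by simpa [he] using hasDerivAt_circleMap 0 1 θ
    have h1 := HasWirt.comp_curve (γ := fun s : ℝ => (r : ℂ) * e s) (hF _ (hmem r hr θ))
      (h0.const_mul (r : ℂ))
    refine (h0.mul h1).congr_deriv ?_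
    simp only [S, map_mul, conj_I, conj_ofReal]
    ring
  have hi : ∀ f : ℂ → ℂ, ContinuousOn f (closedBall 0 1) →
      ContinuousOn (fun p : ℝ × ℝ => f (p.1 * e p.2)) (Icc 0 1 ×ˢ univ) :=
    fun f hf => continuousOn_polar hf
  have hec : Continuous e := continuous_circleMap 0 1
  have hRc : ContinuousOn R (Icc 0 1 ×ˢ univ) := by
    have h1 := hi F hFc
    have h2 := hi a ha
    have h3 := hi b hb
    have h4 : Continuous fun p : ℝ × ℝ => e p.2 := hec.comp continuous_snd
    have h5 : Continuous fun p : ℝ × ℝ => (p.1 : ℂ) := continuous_ofReal.comp continuous_fst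
    have h6 : Continuous fun p : ℝ × ℝ => conj (e p.2) := continuous_conj.comp h4
    exact (h4.continuousOn.mul h1).add ((h5.mul h4).continuousOn.mul
      ((h2.mul h4.continuousOn).add (h3.mul h6.continuousOn)))
  have hSc : ContinuousOn S (Icc 0 1 ×ˢ univ) := by
    have h1 := hi F hFc
    have h2 := hi a ha
    have h3 := hi b hb
    have h4 : Continuous fun p : ℝ × ℝ => e p.2 := hec.comp continuous_snd
    have h5 : Continuous fun p : ℝ × ℝ => (p.1 : ℂ) := continuous_ofReal.comp continuous_fst
    have h6 : Continuous fun p : ℝ × ℝ => conj (e p.2) := continuous_conj.comp h4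
    exact (h4.continuousOn.mul h1).add ((h5.mul h4).continuousOn.mul
      ((h2.mul h4.continuousOn).sub (h3.mul h6.continuousOn)))
  have hintg : ∀ G : ℝ × ℝ → ℂ, ContinuousOn G (Icc 0 1 ×ˢ univ) →
      IntegrableOn G (Ioc (0 : ℝ) 1 ×ˢ Ioc (-π) π) (volume.prod volume) := by
    intro G hG
    rw [← Measure.volume_eq_prod]
    refine IntegrableOn.mono_set (ContinuousOn.integrableOn_compact
      (isCompact_Icc.prod isCompact_Icc) (hG.mono ?_))
      (prod_mono Ioc_subset_Icc_self Ioc_subset_Icc_self)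
    exact prod_mono Subset.rfl (subset_univ _)
  have hpi : -π ≤ π := by linarith [Real.pi_pos]
  have hRint : ∫ p in Ioc (0 : ℝ) 1 ×ˢ Ioc (-π) π, R p = circInt fun z => F z * z := by
    rw [← integral_circle_shift (fun z => F z * z), Measure.volume_eq_prod,
      intervalIntegral.integral_of_le hpi]
    rw [← setIntegral_prod_swap, setIntegral_prod (fun z : ℝ × ℝ => R z.swap) ((hintg R hRc).swap)]
    refine setIntegral_congr_fun measurableSet_Ioc fun θ _ => ?_
    simp only [Prod.swap_prod_mk]
    rw [← intervalIntegral.integral_of_le zero_le_one,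
      intervalIntegral.integral_eq_sub_of_hasDerivAt (f := fun s : ℝ => s * e θ * F (s * e θ))]
    · simp [mul_comm, he]
    · intro r hr
      rw [uIcc_of_le zero_le_one] at hr
      exact hRd θ r hr
    · apply ContinuousOn.intervalIntegrable
      rw [uIcc_of_le zero_le_one]
      exact hRc.comp (by fun_prop) fun r hr => ⟨hr, mem_univ _⟩
  have hSint : ∫ p in Ioc (0 : ℝ) 1 ×ˢ Ioc (-π) π, S p = 0 := by
    rw [Measure.volume_eq_prod, setIntegral_prod _ (hintg S hSc)]
    refine setIntegral_eq_zero_of_forall_eq_zero fun r hr => ?_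
    rw [← intervalIntegral.integral_of_le hpi]
    have hr' : r ∈ Icc (0 : ℝ) 1 := Ioc_subset_Icc_self hr
    have h1 : ∫ θ in (-π)..π, I * S (r, θ) = 0 := by
      rw [intervalIntegral.integral_eq_sub_of_hasDerivAt (f := fun s : ℝ => e s * F (r * e s))]
      · have : e (-π) = e π := by
          have := periodic_circleMap 0 1 (-π)
          rw [show -π + 2 * π = π by ring] at this
          exact this.symm
        simp [this]
      · intro θ _
        exact hSd r hr' θ
      · apply Continuous.intervalIntegrable
        refine continuous_const.mul ?_
        exact hSc.comp_continuous (by fun_prop) fun θ => ⟨hr', mem_univ _⟩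
    rw [intervalIntegral.integral_const_mul] at h1
    simpa using h1
  rw [setIntegral_ball_eq_polar]
  have hpt : ∀ p : ℝ × ℝ, p.1 • b (p.1 * e p.2) = (1 / 2 : ℂ) * (R p - S p) := by
    intro p
    simp only [R, S, real_smul]
    linear_combination (-(p.1 : ℂ) * b (p.1 * e p.2)) * hee p.2
  simp_rw [← he, hpt]
  rw [integral_const_mul, integral_sub (by rw [Measure.volume_eq_prod]; exact hintg R hRc)
    (by rw [Measure.volume_eq_prod]; exact hintg S hSc), hSint, hRint, sub_zero]

section CircInt
variable {E : Type*} [NormedAddCommGroup E] [NormedSpace ℝ E]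

omit [NormedSpace ℝ E] in
lemma intervalIntegrable_circ {F : ℂ → E} (hF : ContinuousOn F (sphere 0 1)) (a b : ℝ) :
    IntervalIntegrable (fun θ => F (circleMap 0 1 θ)) volume a b :=
  (continuousOn_comp_circleMap hF).intervalIntegrable a b

lemma circInt_congr {F G : ℂ → E} (h : ∀ z ∈ sphere (0 : ℂ) 1, F z = G z) :
    circInt F = circInt G := by
  unfold circInt
  exact intervalIntegral.integral_congr fun θ _ => h _ (by simp)

lemma circInt_add {F G : ℂ → E} (hF : ContinuousOn F (sphere 0 1))
    (hG : ContinuousOn G (sphere 0 1)) :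
    circInt (fun z => F z + G z) = circInt F + circInt G :=
  intervalIntegral.integral_add (intervalIntegrable_circ hF _ _) (intervalIntegrable_circ hG _ _)

lemma circInt_sub {F G : ℂ → E} (hF : ContinuousOn F (sphere 0 1))
    (hG : ContinuousOn G (sphere 0 1)) :
    circInt (fun z => F z - G z) = circInt F - circInt G :=
  intervalIntegral.integral_sub (intervalIntegrable_circ hF _ _) (intervalIntegrable_circ hG _ _)

lemma circInt_const_mul (c : ℝ) (F : ℂ → ℝ) : circInt (fun z => c * F z) = c * circInt F :=
  intervalIntegral.integral_const_mul c _

lemma circInt_const_mul_complex (c : ℂ) (F : ℂ → ℂ) :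
    circInt (fun z => c * F z) = c * circInt F :=
  intervalIntegral.integral_const_mul c _

lemma circInt_const (c : ℝ) : circInt (fun _ => c) = 2 * π * c := by
  simp [circInt]

lemma circInt_mono {F G : ℂ → ℝ} (hF : ContinuousOn F (sphere 0 1))
    (hG : ContinuousOn G (sphere 0 1)) (h : ∀ z ∈ sphere (0 : ℂ) 1, F z ≤ G z) :
    circInt F ≤ circInt G :=
  intervalIntegral.integral_mono_on (by positivity) (intervalIntegrable_circ hF _ _)
    (intervalIntegrable_circ hG _ _) fun θ _ => h _ (by simp)

lemma circInt_nonneg {F : ℂ → ℝ} (h : ∀ z ∈ sphere (0 : ℂ) 1, 0 ≤ F z) : 0 ≤ circInt F :=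
  intervalIntegral.integral_nonneg (by positivity) fun θ _ => h _ (by simp)

lemma norm_circInt_le (F : ℂ → E) : ‖circInt F‖ ≤ circInt fun z => ‖F z‖ :=
  intervalIntegral.norm_integral_le_integral_norm (by positivity)

lemma circInt_conj (F : ℂ → ℂ) : circInt (fun z => conj (F z)) = conj (circInt F) := by
  unfold circInt
  rw [intervalIntegral.integral_of_le (by positivity), intervalIntegral.integral_of_le
    (by positivity), integral_conj]

lemma circInt_ofReal (F : ℂ → ℝ) : circInt (fun z => (F z : ℂ)) = ((circInt F : ℝ) : ℂ) :=
  intervalIntegral.integral_ofReal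

end CircInt

lemma mul_conj_of_mem_sphere {z : ℂ} (hz : z ∈ sphere (0 : ℂ) 1) : z * conj z = 1 := by
  rw [mul_conj, normSq_eq_norm_sq, mem_sphere_zero_iff_norm.1 hz]; simp

/-- Stokes' theorem on the unit disc, for `∂`. -/
theorem integral_wirt {F a b : ℂ → ℂ}
    (hF : ∀ z ∈ closedBall (0 : ℂ) 1, HasWirt F (a z) (b z) z)
    (ha : ContinuousOn a (closedBall 0 1)) (hb : ContinuousOn b (closedBall 0 1)) :
    ∫ z in ball (0 : ℂ) 1, a z = (1 / 2 : ℂ) * circInt fun z => F z * conj z := by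
  have h := integral_wirt_conj (fun z hz => (hF z hz).star)
    (continuous_conj.comp_continuousOn hb) (continuous_conj.comp_continuousOn ha)
  have h2 := congrArg conj h
  rw [← integral_conj, map_mul, ← circInt_conj] at h2
  simpa only [map_div₀, map_one, map_ofNat, map_mul, RingHomCompTriple.comp_apply, RingHom.id_apply, conj_conj] using h2

lemma integrableOn_inv_norm_sub (z : ℂ) (R : ℝ) :
    IntegrableOn (fun ξ : ℂ => ‖ξ - z‖⁻¹) (ball 0 R) := by
  have h1 : Integrable (fun x : ℂ => (indicator (Iio (R + ‖z‖)) fun y : ℝ => y⁻¹) ‖x‖) := by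
    rw [integrable_fun_norm_addHaar]
    have h2 : IntegrableOn (indicator (Iio (R + ‖z‖)) fun _ : ℝ => (1 : ℝ)) (Ioi 0) := by
      rw [IntegrableOn, integrable_indicator_iff measurableSet_Iio, IntegrableOn,
        Measure.restrict_restrict measurableSet_Iio, Iio_inter_Ioi]
      exact integrableOn_const (by simp)
    refine h2.congr_fun (fun y hy => ?_) measurableSet_Ioi
    by_cases hyR : y < R + ‖z‖
    · simp [hyR, (mem_Ioi.1 hy).ne', Complex.finrank_real_complex]
    · simp [hyR]
  have h3 := h1.comp_sub_right z
  refine (h3.integrableOn (s := ball 0 R)).congr_fun (fun ξ hξ => ?_) measurableSet_ball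
  have : ‖ξ - z‖ < R + ‖z‖ := (norm_sub_le _ _).trans_lt (by simpa using hξ)
  simp [this]

lemma integrableOn_ball_of_continuousOn {E : Type*} [NormedAddCommGroup E] {f : ℂ → E}
    (hf : ContinuousOn f (closedBall 0 1)) : IntegrableOn f (ball 0 1) :=
  (hf.integrableOn_compact (isCompact_closedBall 0 1)).mono_set ball_subset_closedBall

lemma circInt_cauchy_kernel {z : ℂ} (hz : z ∈ ball (0 : ℂ) 1) :
    circInt (fun ζ => ζ / (ζ - z)) = 2 * π := by
  have h := circleIntegral.integral_sub_inv_of_mem_ball hz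
  rw [circleIntegral] at h
  simp only [deriv_circleMap, smul_eq_mul] at h
  have h2 : circInt (fun ζ => I * (ζ / (ζ - z))) = 2 * π * I := by
    rw [← h]; unfold circInt
    congr 1; funext θ; ring_nf
  rw [circInt_const_mul_complex] at h2
  have := I_ne_zero
  apply mul_left_cancel₀ this
  rw [h2]; ring

lemma exists_lipschitz_of_hasWirt {F a b : ℂ → ℂ}
    (hF : ∀ z ∈ closedBall (0 : ℂ) 1, HasWirt F (a z) (b z) z)
    (ha : ContinuousOn a (closedBall 0 1)) (hb : ContinuousOn b (closedBall 0 1)) :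
    ∃ C, 0 ≤ C ∧ ∀ z ∈ closedBall (0 : ℂ) 1, ∀ w ∈ closedBall (0 : ℂ) 1,
      ‖F w - F z‖ ≤ C * ‖w - z‖ := by
  obtain ⟨A, hA⟩ := (isCompact_closedBall (0 : ℂ) 1).exists_bound_of_continuousOn ha
  obtain ⟨B, hB⟩ := (isCompact_closedBall (0 : ℂ) 1).exists_bound_of_continuousOn hb
  have h0 : (0 : ℂ) ∈ closedBall (0 : ℂ) 1 := by simp
  have hA0 := (norm_nonneg _).trans (hA 0 h0)
  have hB0 := (norm_nonneg _).trans (hB 0 h0)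
  refine ⟨A + B, by positivity, fun z hz w hw => ?_⟩
  refine Convex.norm_image_sub_le_of_norm_hasFDerivWithin_le (f' := fun x => wirtMap (a x) (b x))
    (fun x hx => (hF x hx).hasFDerivWithinAt) (fun x hx => ?_) (convex_closedBall 0 1) hz hw
  refine ContinuousLinearMap.opNorm_le_bound _ (by positivity) fun v => ?_
  rw [wirtMap_apply, add_mul]
  refine (norm_add_le _ _).trans (add_le_add ?_ ?_)
  · rw [norm_mul]; gcongr; exact hA x hx
  · rw [norm_mul, RCLike.norm_conj]; gcongr; exact hB x hx

/-- The Cauchy–Pompeiu formula. -/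
theorem cauchy_pompeiu {F a b : ℂ → ℂ}
    (hF : ∀ z ∈ closedBall (0 : ℂ) 1, HasWirt F (a z) (b z) z)
    (ha : ContinuousOn a (closedBall 0 1)) (hb : ContinuousOn b (closedBall 0 1))
    {z : ℂ} (hz : z ∈ ball (0 : ℂ) 1) :
    π * F z = (1 / 2 : ℂ) * circInt (fun ζ => F ζ * (ζ / (ζ - z)))
      - ∫ ξ in ball (0 : ℂ) 1, b ξ * (ξ - z)⁻¹ := by
  let D : ℝ → ℂ → ℂ := fun ε ξ => (ξ - z) * conj (ξ - z) + (ε : ℂ) ^ 2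
  have hDr : ∀ ε ξ, D ε ξ = ((‖ξ - z‖ ^ 2 + ε ^ 2 : ℝ) : ℂ) := by
    intro ε ξ
    simp only [D]; rw [mul_conj, normSq_eq_norm_sq]; push_cast; ring
  have hD0 : ∀ ε : ℝ, 0 < ε → ∀ ξ, D ε ξ ≠ 0 := by
    intro ε hε ξ
    rw [hDr]; exact_mod_cast (by positivity : (‖ξ - z‖ ^ 2 + ε ^ 2 : ℝ) ≠ 0)
  have hDc : ∀ ε, Continuous (D ε) := fun ε => by fun_prop
  let k : ℝ → ℂ → ℂ := fun ε ξ => conj (ξ - z) * (D ε ξ)⁻¹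
  let m : ℝ → ℂ → ℂ := fun ε ξ => (ε : ℂ) ^ 2 * ((D ε ξ)⁻¹) ^ 2
  let p : ℝ → ℂ → ℂ := fun ε ξ => -(conj (ξ - z)) ^ 2 * ((D ε ξ)⁻¹) ^ 2
  have hDic : ∀ ε : ℝ, 0 < ε → Continuous fun ξ => (D ε ξ)⁻¹ := fun ε hε =>
    (hDc ε).inv₀ (hD0 ε hε)
  have hkw : ∀ ε : ℝ, 0 < ε → ∀ ξ, HasWirt (k ε) (p ε ξ) (m ε ξ) ξ := by
    intro ε hε ξ
    have h1 : HasWirt (fun ξ => ξ - z) 1 0 ξ := by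
      simpa using HasWirt.id.sub (HasWirt.const z)
    have h2 : HasWirt (fun ξ => conj (ξ - z)) 0 1 ξ := by simpa using h1.star
    have h3 : HasWirt (D ε) (conj (ξ - z)) (ξ - z) ξ := by
      refine ((h1.mul h2).add (HasWirt.const ((ε : ℂ) ^ 2))).congr_coeff ?_ ?_ <;> simp
    have h4 := h2.mul (h3.inv (hD0 ε hε ξ))
    refine h4.congr_coeff ?_ ?_
    · simp only [p]; ring_nf
    · simp only [m]
      have := hD0 ε hε ξ
      field_simp
      simp only [D]; ring_nf
  have hkc : ∀ ε : ℝ, 0 < ε → Continuous (k ε) := fun ε hε =>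
    (continuous_conj.comp (continuous_id.sub continuous_const)).mul (hDic ε hε)
  have hmc : ∀ ε : ℝ, 0 < ε → Continuous (m ε) := fun ε hε =>
    continuous_const.mul ((hDic ε hε).pow 2)
  have hpc : ∀ ε : ℝ, 0 < ε → Continuous (p ε) := fun ε hε =>
    ((continuous_conj.comp (continuous_id.sub continuous_const)).pow 2).neg.mul ((hDic ε hε).pow 2)
  have hFc : ContinuousOn F (closedBall 0 1) := fun w hw => (hF w hw).continuousAt.continuousWithinAt
  -- Stokes for `(F - F z) k`
  have stokes : ∀ ε : ℝ, 0 < ε →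
      (∫ ξ in ball (0 : ℂ) 1, b ξ * k ε ξ) + ∫ ξ in ball (0 : ℂ) 1, (F ξ - F z) * m ε ξ =
        (1 / 2 : ℂ) * circInt fun ζ => (F ζ - F z) * k ε ζ * ζ := by
    intro ε hε
    rw [← integral_add (f := fun ξ => b ξ * k ε ξ) (g := fun ξ => (F ξ - F z) * m ε ξ)
      (integrableOn_ball_of_continuousOn (hb.mul (hkc ε hε).continuousOn))
      (integrableOn_ball_of_continuousOn
        ((hFc.sub continuousOn_const).mul (hmc ε hε).continuousOn))]
    refine integral_wirt_conj (F := fun ξ => (F ξ - F z) * k ε ξ)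
      (a := fun ξ => a ξ * k ε ξ + (F ξ - F z) * p ε ξ) (fun ξ hξ => ?_) ?_ ?_
    · refine (((hF ξ hξ).sub (HasWirt.const (F z))).mul (hkw ε hε ξ)).congr_coeff ?_ ?_ <;> simp
    · exact (ha.mul (hkc ε hε).continuousOn).add
        ((hFc.sub continuousOn_const).mul (hpc ε hε).continuousOn)
    · exact (hb.mul (hkc ε hε).continuousOn).add
        ((hFc.sub continuousOn_const).mul (hmc ε hε).continuousOn)
  have hk_le : ∀ ε : ℝ, 0 < ε → ∀ ξ, ‖k ε ξ‖ ≤ ‖ξ - z‖⁻¹ := by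
    intro ε hε ξ
    simp only [k, norm_mul, RCLike.norm_conj, norm_inv, hDr, norm_real, Real.norm_eq_abs]
    rw [abs_of_pos (by positivity)]
    rcases eq_or_lt_of_le (norm_nonneg (ξ - z)) with h | h
    · rw [← h]; simp
    · rw [← div_eq_mul_inv, div_le_iff₀ (by positivity), inv_mul_eq_div, le_div_iff₀ h]
      nlinarith [sq_nonneg ε]
  have hk_lim : ∀ ξ, ξ ≠ z → Tendsto (fun ε => k ε ξ) (𝓝[>] 0) (𝓝 (ξ - z)⁻¹) := by
    intro ξ hξ
    have h0 : ξ - z ≠ 0 := sub_ne_zero.2 hξ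
    have hc0 : conj (ξ - z) ≠ 0 := (map_ne_zero _).2 h0
    have h1 : ContinuousAt (fun ε : ℝ => k ε ξ) 0 := by
      simp only [k, D]
      refine continuousAt_const.mul (ContinuousAt.inv₀ (by fun_prop) ?_)
      simpa using ⟨h0, by simpa using hc0⟩
    have h2 : k 0 ξ = (ξ - z)⁻¹ := by
      simp only [k, D]; rw [ofReal_zero, zero_pow two_ne_zero, add_zero, mul_inv]; field_simp
    exact h2 ▸ (h1.tendsto.mono_left nhdsWithin_le_nhds)
  have hm_lim : ∀ ξ, ξ ≠ z → Tendsto (fun ε => m ε ξ) (𝓝[>] 0) (𝓝 0) := by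
    intro ξ hξ
    have h0 : ξ - z ≠ 0 := sub_ne_zero.2 hξ
    have hc0 : conj (ξ - z) ≠ 0 := (map_ne_zero _).2 h0
    have h1 : ContinuousAt (fun ε : ℝ => m ε ξ) 0 := by
      simp only [m, D]
      refine ContinuousAt.mul (by fun_prop) (ContinuousAt.pow (ContinuousAt.inv₀ (by fun_prop) ?_) 2)
      simpa using ⟨h0, by simpa using hc0⟩
    have h2 : m 0 ξ = 0 := by simp [m]
    exact h2 ▸ (h1.tendsto.mono_left nhdsWithin_le_nhds)
  have hz_ae : ∀ᵐ ξ : ℂ ∂volume.restrict (ball 0 1), ξ ≠ z :=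
    ae_restrict_of_ae (by simp [ae_iff, measure_singleton])
  have hpos : ∀ᶠ ε : ℝ in 𝓝[>] 0, 0 < ε := self_mem_nhdsWithin
  obtain ⟨B, hB⟩ := (isCompact_closedBall (0 : ℂ) 1).exists_bound_of_continuousOn hb
  have lim1 : Tendsto (fun ε => ∫ ξ in ball (0 : ℂ) 1, b ξ * k ε ξ) (𝓝[>] 0)
      (𝓝 (∫ ξ in ball (0 : ℂ) 1, b ξ * (ξ - z)⁻¹)) := by
    refine tendsto_integral_filter_of_dominated_convergence (fun ξ => B * ‖ξ - z‖⁻¹) ?_ ?_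
      ((integrableOn_inv_norm_sub z 1).const_mul B) ?_
    · filter_upwards [hpos] with ε hε
      exact (integrableOn_ball_of_continuousOn
        (hb.mul (hkc ε hε).continuousOn)).aestronglyMeasurable
    · filter_upwards [hpos] with ε hε
      filter_upwards [ae_restrict_mem measurableSet_ball] with ξ hξ
      rw [norm_mul]
      have h1 := hB ξ (ball_subset_closedBall hξ)
      exact mul_le_mul h1 (hk_le ε hε ξ) (norm_nonneg _) ((norm_nonneg _).trans h1)
    · filter_upwards [hz_ae] with ξ hξ
      exact (hk_lim ξ hξ).const_mul _
  obtain ⟨C, hC0, hC⟩ := exists_lipschitz_of_hasWirt hF ha hb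
  have lim2 : Tendsto (fun ε => ∫ ξ in ball (0 : ℂ) 1, (F ξ - F z) * m ε ξ) (𝓝[>] 0) (𝓝 0) := by
    suffices h : Tendsto (fun ε => ∫ ξ in ball (0 : ℂ) 1, (F ξ - F z) * m ε ξ) (𝓝[>] 0)
        (𝓝 (∫ ξ in ball (0 : ℂ) 1, (0 : ℂ))) by simpa using h
    refine tendsto_integral_filter_of_dominated_convergence (fun ξ => C * ‖ξ - z‖⁻¹) ?_ ?_
      ((integrableOn_inv_norm_sub z 1).const_mul C) ?_
    · filter_upwards [hpos] with ε hε
      exact (integrableOn_ball_of_continuousOn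
        ((hFc.sub continuousOn_const).mul (hmc ε hε).continuousOn)).aestronglyMeasurable
    · filter_upwards [hpos] with ε hε
      filter_upwards [ae_restrict_mem measurableSet_ball] with ξ hξ
      have h1 := hC z (ball_subset_closedBall hz) ξ (ball_subset_closedBall hξ)
      rw [norm_mul]
      refine (mul_le_mul_of_nonneg_right h1 (norm_nonneg _)).trans ?_
      rw [mul_assoc]
      refine mul_le_mul_of_nonneg_left ?_ hC0
      simp only [m, norm_mul, norm_pow, norm_inv, hDr, norm_real, Real.norm_eq_abs]
      rw [abs_of_pos hε, abs_of_pos (by positivity : 0 < ‖ξ - z‖ ^ 2 + ε ^ 2)]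
      rcases eq_or_lt_of_le (norm_nonneg (ξ - z)) with h | h
      · rw [← h]; simp
      · set x := ‖ξ - z‖
        rw [inv_pow, ← mul_assoc, ← div_eq_mul_inv, div_le_iff₀ (by positivity), inv_mul_eq_div,
          le_div_iff₀ h]
        nlinarith [sq_nonneg (x ^ 2 - ε ^ 2), sq_nonneg (x * ε)]
    · filter_upwards [hz_ae] with ξ hξ
      simpa using (hm_lim ξ hξ).const_mul (F ξ - F z)
  have hne : ∀ ζ ∈ sphere (0 : ℂ) 1, ζ - z ≠ 0 := by
    intro ζ hζ h
    rw [sub_eq_zero] at h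
    rw [mem_sphere_zero_iff_norm] at hζ
    rw [mem_ball_zero_iff, ← h, hζ] at hz
    exact lt_irrefl _ hz
  have hcc : ContinuousOn (fun ζ => (ζ - z)⁻¹) (sphere (0 : ℂ) 1) :=
    (continuousOn_id.sub continuousOn_const).inv₀ hne
  have hFs : ContinuousOn F (sphere 0 1) := hFc.mono sphere_subset_closedBall
  have lim3 : Tendsto (fun ε => circInt fun ζ => (F ζ - F z) * k ε ζ * ζ) (𝓝[>] 0)
      (𝓝 (circInt fun ζ => (F ζ - F z) * (ζ - z)⁻¹ * ζ)) := by
    have hbd : ContinuousOn (fun ζ => ‖F ζ - F z‖ * ‖ζ - z‖⁻¹) (sphere (0 : ℂ) 1) :=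
      (hFs.sub continuousOn_const).norm.mul (by simpa using hcc.norm)
    refine intervalIntegral.tendsto_integral_filter_of_dominated_convergence
      (fun θ => ‖F (circleMap 0 1 θ) - F z‖ * ‖circleMap 0 1 θ - z‖⁻¹) ?_ ?_
      (intervalIntegrable_circ hbd _ _) ?_
    · filter_upwards [hpos] with ε hε
      exact (continuousOn_comp_circleMap (F := fun ζ => (F ζ - F z) * k ε ζ * ζ)
        (((hFs.sub continuousOn_const).mul (hkc ε hε).continuousOn).mul
          continuousOn_id)).aestronglyMeasurable
    · filter_upwards [hpos] with ε hε
      refine Eventually.of_forall fun θ _ => ?_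
      rw [norm_mul, norm_mul, norm_circleMap_zero_one, mul_one]
      gcongr
      exact hk_le ε hε _
    · refine Eventually.of_forall fun θ _ => ?_
      refine ((hk_lim _ ?_).const_mul _).mul_const _
      exact sub_ne_zero.1 (hne _ (by simp))
  have hlim := (lim1.add lim2).congr' (by
    filter_upwards [hpos] with ε hε using stokes ε hε)
  have := tendsto_nhds_unique hlim (lim3.const_mul _)
  rw [add_zero] at this
  have hsplit : (circInt fun ζ => (F ζ - F z) * (ζ - z)⁻¹ * ζ) =
      circInt (fun ζ => F ζ * (ζ / (ζ - z))) - F z * (2 * π) := by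
    rw [← circInt_cauchy_kernel hz, ← circInt_const_mul_complex, ← circInt_sub]
    · exact circInt_congr fun ζ _ => by ring
    · exact hFs.mul (continuousOn_id.mul hcc)
    · exact continuousOn_const.mul (continuousOn_id.mul hcc)
  rw [this, hsplit]; ring

lemma normSq_le_one_of_mem {z : ℂ} (hz : z ∈ closedBall (0 : ℂ) 1) : ‖z‖ ^ 2 ≤ 1 := by
  have := mem_closedBall_zero_iff.1 hz
  nlinarith [norm_nonneg z]

lemma hasWirt_one_sub_normSq (z : ℂ) :
    HasWirt (fun z => ((1 - ‖z‖ ^ 2 : ℝ) : ℂ)) (-conj z) (-z) z := by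
  have h := (HasWirt.const (z := z) 1).sub (HasWirt.normSq (hasDerivAt_id z))
  have e : (fun z : ℂ => ((1 - ‖z‖ ^ 2 : ℝ) : ℂ)) = fun x => 1 - ((‖id x‖ ^ 2 : ℝ) : ℂ) := by
    funext x; simp
  rw [e]
  refine h.congr_coeff ?_ ?_ <;> simp

/-- Green's formula with weight `1 - |z|²`. -/
lemma green_formula {Ψ : ℂ → ℝ} {A A₂ : ℂ → ℂ} {L : ℂ → ℝ}
    (hΨ : ∀ z ∈ closedBall (0 : ℂ) 1, HasWirt (fun z => (Ψ z : ℂ)) (A z) (conj (A z)) z)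
    (hA : ∀ z ∈ closedBall (0 : ℂ) 1, HasWirt A (A₂ z) (L z) z)
    (hA₂ : ContinuousOn A₂ (closedBall 0 1)) (hL : ContinuousOn L (closedBall 0 1)) :
    (∫ z in ball (0 : ℂ) 1, (1 - ‖z‖ ^ 2) * L z) + ∫ z in ball (0 : ℂ) 1, Ψ z =
      1 / 2 * circInt Ψ := by
  have hAc : ContinuousOn A (closedBall 0 1) := fun z hz => (hA z hz).continuousAt.continuousWithinAt
  have hΨc : ContinuousOn (fun z => (Ψ z : ℂ)) (closedBall 0 1) :=
    fun z hz => (hΨ z hz).continuousAt.continuousWithinAt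
  have hLc : ContinuousOn (fun z => (L z : ℂ)) (closedBall 0 1) :=
    continuous_ofReal.comp_continuousOn hL
  have hw : Continuous fun z : ℂ => ((1 - ‖z‖ ^ 2 : ℝ) : ℂ) := by fun_prop
  have h1 := integral_wirt_conj (F := fun z => ((1 - ‖z‖ ^ 2 : ℝ) : ℂ) * A z)
    (a := fun z => -conj z * A z + ((1 - ‖z‖ ^ 2 : ℝ) : ℂ) * A₂ z)
    (b := fun z => -z * A z + ((1 - ‖z‖ ^ 2 : ℝ) : ℂ) * L z)
    (fun z hz => (hasWirt_one_sub_normSq z).mul (hA z hz))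
    ((continuous_conj.neg.continuousOn.mul hAc).add (hw.continuousOn.mul hA₂))
    ((continuousOn_id.neg.mul hAc).add (hw.continuousOn.mul hLc))
  have h2 := integral_wirt (F := fun z => z * (Ψ z : ℂ))
    (a := fun z => 1 * (Ψ z : ℂ) + z * A z) (b := fun z => 0 * (Ψ z : ℂ) + z * conj (A z))
    (fun z hz => HasWirt.id.mul (hΨ z hz))
    ((continuousOn_const.mul hΨc).add (continuousOn_id.mul hAc))
    ((continuousOn_const.mul hΨc).add (continuousOn_id.mul (continuous_conj.comp_continuousOn hAc)))
  have e1 : (circInt fun z => ((1 - ‖z‖ ^ 2 : ℝ) : ℂ) * A z * z) = 0 := by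
    rw [circInt_congr (G := fun _ => (0 : ℂ))]
    · simp [circInt]
    · intro z hz; simp [mem_sphere_zero_iff_norm.1 hz]
  have e2 : (circInt fun z => z * (Ψ z : ℂ) * conj z) = ((circInt Ψ : ℝ) : ℂ) := by
    rw [← circInt_ofReal]
    refine circInt_congr fun z hz => ?_
    linear_combination (Ψ z : ℂ) * mul_conj_of_mem_sphere hz
  rw [e1, mul_zero] at h1
  rw [e2] at h2
  have h3 := congrArg₂ (fun x y : ℂ => x + y) h1 h2
  beta_reduce at h3
  rw [← integral_add] at h3
  · have h4 : ∫ z in ball (0 : ℂ) 1, (((1 - ‖z‖ ^ 2) * L z + Ψ z : ℝ) : ℂ) =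
        1 / 2 * ((circInt Ψ : ℝ) : ℂ) := by
      rw [← zero_add (1 / 2 * ((circInt Ψ : ℝ) : ℂ)), ← h3]
      congr 1; funext z; push_cast; ring
    rw [integral_complex_ofReal] at h4
    rw [← integral_add]
    · refine ofReal_injective (h4.trans ?_)
      push_cast; rfl
    · exact integrableOn_ball_of_continuousOn (ContinuousOn.mul (by fun_prop) hL)
    · exact integrableOn_ball_of_continuousOn
        ((continuous_re.comp_continuousOn hΨc).congr fun z _ => by simp)
  · exact integrableOn_ball_of_continuousOn
      ((continuousOn_id.neg.mul hAc).add (hw.continuousOn.mul hLc))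
  · exact integrableOn_ball_of_continuousOn
      ((continuousOn_const.mul hΨc).add (continuousOn_id.mul hAc))

/-- The smoothed modulus `√(|w|² + ε²)`. -/
noncomputable def smoothAbs (ε : ℝ) (w : ℂ) : ℝ := √(‖w‖ ^ 2 + ε ^ 2)

lemma smoothAbs_sq (ε : ℝ) (w : ℂ) : smoothAbs ε w ^ 2 = ‖w‖ ^ 2 + ε ^ 2 :=
  Real.sq_sqrt (by positivity)

lemma smoothAbs_pos {ε : ℝ} (hε : 0 < ε) (w : ℂ) : 0 < smoothAbs ε w :=
  Real.sqrt_pos.2 (by positivity)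

lemma norm_le_smoothAbs (ε : ℝ) (w : ℂ) : ‖w‖ ≤ smoothAbs ε w :=
  Real.le_sqrt_of_sq_le (by nlinarith [sq_nonneg ε])

lemma smoothAbs_le {ε : ℝ} (hε : 0 < ε) (w : ℂ) : smoothAbs ε w ≤ ‖w‖ + ε :=
  Real.sqrt_le_iff.2 ⟨by positivity, by nlinarith [norm_nonneg w]⟩

lemma continuous_smoothAbs (ε : ℝ) : Continuous (smoothAbs ε) := by
  unfold smoothAbs; fun_prop

lemma hasWirt_smoothAbs {ε : ℝ} (hε : 0 < ε) {k : ℂ → ℂ} {k' z : ℂ} (hk : HasDerivAt k k' z) :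
    HasWirt (fun z => (smoothAbs ε (k z) : ℂ)) (k' * conj (k z) / (2 * smoothAbs ε (k z)))
      (k z * conj k' / (2 * smoothAbs ε (k z))) z := by
  have h0 : ‖k z‖ ^ 2 + ε ^ 2 ≠ 0 := by positivity
  have h1 := (HasWirt.normSq hk).ofReal_comp (ψ := fun t => √(t + ε ^ 2))
    (((hasDerivAt_id _).add_const (ε ^ 2)).sqrt h0)
  have h2 : (smoothAbs ε (k z) : ℂ) ≠ 0 := by exact_mod_cast (smoothAbs_pos hε (k z)).ne'
  refine h1.congr_coeff ?_ ?_ <;>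
  · simp only [id, ← smoothAbs.eq_1]
    push_cast
    field_simp

lemma AnalyticOnNhd.hasDerivAt_closedBall {k : ℂ → ℂ} (hk : AnalyticOnNhd ℂ k (closedBall 0 1))
    {z : ℂ} (hz : z ∈ closedBall (0 : ℂ) 1) : HasDerivAt k (deriv k z) z :=
  (hk z hz).differentiableAt.hasDerivAt

/-- Green's formula for `e^φ √(|k|² + ε²)`, followed by a lower bound for the Laplacian. -/
lemma exp_weight_ineq {ε : ℝ} (hε : 0 < ε) {φ : ℂ → ℝ} {p p₂ : ℂ → ℂ} {l : ℂ → ℝ}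
    (hφ : ∀ z ∈ closedBall (0 : ℂ) 1, HasWirt (fun z => (φ z : ℂ)) (p z) (conj (p z)) z)
    (hp : ∀ z ∈ closedBall (0 : ℂ) 1, HasWirt p (p₂ z) (l z) z)
    (hp₂ : ContinuousOn p₂ (closedBall 0 1)) (hl : ContinuousOn l (closedBall 0 1))
    {k : ℂ → ℂ} (hk : AnalyticOnNhd ℂ k (closedBall 0 1)) :
    ∃ S : ℂ → ℝ, ContinuousOn S (closedBall 0 1) ∧
      (∀ z ∈ closedBall (0 : ℂ) 1, Real.exp (φ z) * l z * smoothAbs ε (k z) ≤ S z) ∧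
      (∀ z ∈ closedBall (0 : ℂ) 1, p z = 0 → l z = 0 →
        Real.exp (φ z) * (‖deriv k z‖ ^ 2 / (4 * smoothAbs ε (k z))) ≤ S z) ∧
      (∫ z in ball (0 : ℂ) 1, (1 - ‖z‖ ^ 2) * S z) +
          ∫ z in ball (0 : ℂ) 1, Real.exp (φ z) * smoothAbs ε (k z) =
        1 / 2 * circInt fun z => Real.exp (φ z) * smoothAbs ε (k z) := by
  have hpc : ContinuousOn p (closedBall 0 1) := fun z hz => (hp z hz).continuousAt.continuousWithinAt
  have hφc : ContinuousOn φ (closedBall 0 1) := fun z hz => by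
    have := continuous_re.continuousAt.comp (hφ z hz).continuousAt
    exact (this.congr (Eventually.of_forall fun x => by simp)).continuousWithinAt
  have hkc : ContinuousOn k (closedBall 0 1) := hk.continuousOn
  have hk1c : ContinuousOn (deriv k) (closedBall 0 1) := hk.deriv.continuousOn
  have hk2c : ContinuousOn (deriv (deriv k)) (closedBall 0 1) := hk.deriv.deriv.continuousOn
  let s : ℂ → ℝ := fun z => smoothAbs ε (k z)
  have hs : ∀ z, 0 < s z := fun z => smoothAbs_pos hε _
  have hsc : ContinuousOn s (closedBall 0 1) := (continuous_smoothAbs ε).comp_continuousOn hkc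
  have hsC : ContinuousOn (fun z => (s z : ℂ)) (closedBall 0 1) :=
    continuous_ofReal.comp_continuousOn hsc
  have hs0 : ∀ z, (s z : ℂ) ≠ 0 := fun z => by exact_mod_cast (hs z).ne'
  let q : ℂ → ℂ := fun z => deriv k z * conj (k z) * (s z : ℂ)⁻¹ * (1 / 2)
  have hqc : ContinuousOn q (closedBall 0 1) :=
    ((hk1c.mul (continuous_conj.comp_continuousOn hkc)).mul (hsC.inv₀ fun z _ => hs0 z)).mul
      continuousOn_const
  let q₂ : ℂ → ℂ := fun z => (deriv (deriv k) z * conj (k z) * (s z : ℂ)⁻¹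
    - deriv k z * conj (k z) * q z * ((s z : ℂ)⁻¹) ^ 2) * (1 / 2)
  let ls : ℂ → ℝ := fun z => ‖deriv k z‖ ^ 2 * (‖k z‖ ^ 2 + 2 * ε ^ 2) / (4 * s z ^ 3)
  have hls : ContinuousOn ls (closedBall 0 1) :=
    ((hk1c.norm.pow 2).mul ((hkc.norm.pow 2).add continuousOn_const)).div
      (continuousOn_const.mul (hsc.pow 3)) fun z _ => by have := hs z; positivity
  have hsw : ∀ z ∈ closedBall (0 : ℂ) 1, HasWirt (fun z => (s z : ℂ)) (q z) (conj (q z)) z := by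
    intro z hz
    refine (hasWirt_smoothAbs hε (hk.hasDerivAt_closedBall hz)).congr_coeff ?_ ?_
    · simp only [q, s]; have := hs0 z; field_simp
    · simp only [q, s, map_mul, map_inv₀, conj_ofReal, RingHomCompTriple.comp_apply,
        RingHom.id_apply, map_div₀, map_one, map_ofNat]
      have := hs0 z; field_simp
  have hqw : ∀ z ∈ closedBall (0 : ℂ) 1, HasWirt q (q₂ z) (ls z) z := by
    intro z hz
    have h1 := HasWirt.of_hasDerivAt (hk.deriv.hasDerivAt_closedBall hz)
    have h2 := (HasWirt.of_hasDerivAt (hk.hasDerivAt_closedBall hz)).star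
    refine (((h1.mul h2).mul ((hsw z hz).inv (hs0 z))).mul (HasWirt.const (1 / 2))).congr_coeff ?_ ?_
    · simp only [q₂]; have := hs0 z; field_simp; simp; ring
    · have h3 : ((‖deriv k z‖ ^ 2 : ℝ) : ℂ) = deriv k z * conj (deriv k z) := by
        rw [mul_conj, normSq_eq_norm_sq]
      have h4 : ((‖k z‖ ^ 2 : ℝ) : ℂ) = k z * conj (k z) := by
        rw [mul_conj, normSq_eq_norm_sq]
      have h5 : (ε : ℂ) ^ 2 = (s z : ℂ) ^ 2 - k z * conj (k z) := by
        have := smoothAbs_sq ε (k z)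
        rw [← h4]
        have h6 : ((s z ^ 2 : ℝ) : ℂ) = ((‖k z‖ ^ 2 + ε ^ 2 : ℝ) : ℂ) := congrArg _ this
        push_cast at h6 ⊢
        rw [h6]; ring
      simp only [ls, q]
      push_cast at h3 h4 ⊢
      rw [h3, h4, h5]
      simp only [map_mul, map_inv₀, conj_ofReal, RingHomCompTriple.comp_apply,
        RingHom.id_apply, map_div₀, map_one, map_ofNat]
      have := hs0 z
      field_simp
      ring
  let x : ℂ → ℝ := fun z => Real.exp (φ z)
  have hxc : ContinuousOn x (closedBall 0 1) := Real.continuous_exp.comp_continuousOn hφc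
  have hxC : ContinuousOn (fun z => (x z : ℂ)) (closedBall 0 1) :=
    continuous_ofReal.comp_continuousOn hxc
  have hxw : ∀ z ∈ closedBall (0 : ℂ) 1,
      HasWirt (fun z => (x z : ℂ)) (x z * p z) (x z * conj (p z)) z := fun z hz =>
    (hφ z hz).ofReal_comp (Real.hasDerivAt_exp _)
  let S : ℂ → ℝ := fun z => x z * (‖p z‖ ^ 2 * s z + 2 * (p z * conj (q z)).re + l z * s z + ls z)
  have hScont : ContinuousOn S (closedBall 0 1) := by
    refine hxc.mul (((((hpc.norm.pow 2).mul hsc).add (continuousOn_const.mul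
      (continuous_re.comp_continuousOn (hpc.mul (continuous_conj.comp_continuousOn hqc))))).add
      (hl.mul hsc)).add hls)
  have hq_norm : ∀ z, ‖q z‖ = ‖deriv k z‖ * ‖k z‖ / (2 * s z) := by
    intro z
    simp only [q, norm_mul, norm_inv, RCLike.norm_conj, norm_real, Real.norm_eq_abs, abs_of_pos (hs z)]
    simp; ring
  refine ⟨S, hScont, fun z hz => ?_, fun z hz hp0 hl0 => ?_, ?_⟩
  · have h1 : -(‖p z‖ * ‖q z‖) ≤ (p z * conj (q z)).re := by
      have := neg_le_of_abs_le (abs_re_le_norm (p z * conj (q z)))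
      rwa [norm_mul, RCLike.norm_conj] at this
    have h2 : ‖q z‖ ^ 2 / s z ≤ ls z := by
      rw [hq_norm]
      simp only [ls]
      have := hs z
      rw [div_pow, div_div, div_le_div_iff₀ (by positivity) (by positivity)]
      have : 0 ≤ ‖deriv k z‖ ^ 2 * ε ^ 2 * s z ^ 3 := by positivity
      nlinarith
    have h3 : 0 ≤ ‖p z‖ ^ 2 * s z - 2 * (‖p z‖ * ‖q z‖) + ‖q z‖ ^ 2 / s z := by
      have := hs z
      have e : ‖p z‖ ^ 2 * s z - 2 * (‖p z‖ * ‖q z‖) + ‖q z‖ ^ 2 / s z =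
        (‖p z‖ * s z - ‖q z‖) ^ 2 / s z := by field_simp; ring
      rw [e]; positivity
    have h4 : 0 < x z := Real.exp_pos _
    change x z * l z * s z ≤ S z
    simp only [S]
    rw [mul_assoc]
    exact mul_le_mul_of_nonneg_left (by linarith) h4.le
  · change x z * _ ≤ S z
    simp only [S, hp0, hl0]
    refine mul_le_mul_of_nonneg_left ?_ (Real.exp_pos _).le
    simp only [norm_zero, zero_mul, zero_re, ls]
    have h := hs z
    have h2 : s z ^ 2 = ‖k z‖ ^ 2 + ε ^ 2 := smoothAbs_sq ε (k z)
    change _ / (4 * s z) ≤ _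
    rw [div_le_iff₀ (by positivity)]
    have : (0 ^ 2 * s z + 2 * 0 + 0 + ‖deriv k z‖ ^ 2 * (‖k z‖ ^ 2 + 2 * ε ^ 2) / (4 * s z ^ 3)) *
        (4 * s z) = ‖deriv k z‖ ^ 2 * ((‖k z‖ ^ 2 + 2 * ε ^ 2) / s z ^ 2) := by field_simp; ring
    rw [this]
    refine le_mul_of_one_le_right (by positivity) ?_
    rw [one_le_div (by positivity), h2]
    nlinarith [sq_nonneg ε]
  · refine green_formula (Ψ := fun z => x z * s z) (A := fun z => x z * p z * s z + x z * q z)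
      (A₂ := fun z => (x z * p z * p z + x z * p₂ z) * s z + x z * p z * q z +
        (x z * p z * q z + x z * q₂ z)) ?_ ?_ ?_ hScont
    · intro z hz
      have := (hxw z hz).mul (hsw z hz)
      simp only [ofReal_mul]
      refine this.congr_coeff rfl ?_
      simp
    · intro z hz
      have h1 := (((hxw z hz).mul (hp z hz)).mul (hsw z hz)).add ((hxw z hz).mul (hqw z hz))
      refine h1.congr_coeff rfl ?_
      have h3 : ((‖p z‖ ^ 2 : ℝ) : ℂ) = p z * conj (p z) := by
        rw [mul_conj, normSq_eq_norm_sq]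
      have h4 : ((2 * (p z * conj (q z)).re : ℝ) : ℂ) = p z * conj (q z) + conj (p z) * q z := by
        rw [← add_conj]; simp
      simp only [S]
      rw [ofReal_mul, ofReal_add, ofReal_add, ofReal_add, h4, ofReal_mul, h3]
      push_cast
      ring
    · have hq2c : ContinuousOn q₂ (closedBall 0 1) :=
        (((hk2c.mul (continuous_conj.comp_continuousOn hkc)).mul (hsC.inv₀ fun z _ => hs0 z)).sub
          (((hk1c.mul (continuous_conj.comp_continuousOn hkc)).mul hqc).mul
            ((hsC.inv₀ fun z _ => hs0 z).pow 2))).mul continuousOn_const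
      exact (((((hxC.mul hpc).mul hpc).add (hxC.mul hp₂)).mul hsC).add ((hxC.mul hpc).mul hqc)).add
        (((hxC.mul hpc).mul hqc).add (hxC.mul hq2c))

lemma one_sub_normSq_nonneg {z : ℂ} (hz : z ∈ closedBall (0 : ℂ) 1) : 0 ≤ 1 - ‖z‖ ^ 2 := by
  have := normSq_le_one_of_mem hz; linarith

lemma setIntegral_ball_mono {f g : ℂ → ℝ} (hf : IntegrableOn f (ball 0 1))
    (hg : IntegrableOn g (ball 0 1)) (h : ∀ z ∈ closedBall (0 : ℂ) 1, f z ≤ g z) :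
    ∫ z in ball (0 : ℂ) 1, f z ≤ ∫ z in ball (0 : ℂ) 1, g z :=
  setIntegral_mono_on hf hg measurableSet_ball fun z hz => h z (ball_subset_closedBall hz)

section
variable {ε M : ℝ} {f k : ℂ → ℂ}

lemma continuousOn_smoothAbs_comp (hk : AnalyticOnNhd ℂ k (closedBall 0 1)) :
    ContinuousOn (fun z => smoothAbs ε (k z)) (closedBall 0 1) :=
  (continuous_smoothAbs ε).comp_continuousOn hk.continuousOn

/-- `|f'|² (1 - |z|²)` is a Carleson measure for bounded `f`. -/
lemma littlewood_paley_bounded (hε : 0 < ε) (hf : AnalyticOnNhd ℂ f (closedBall 0 1))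
    (hfM : ∀ z ∈ closedBall (0 : ℂ) 1, ‖f z‖ ≤ M) (hk : AnalyticOnNhd ℂ k (closedBall 0 1)) :
    ∫ z in ball (0 : ℂ) 1, (1 - ‖z‖ ^ 2) * (‖deriv f z‖ ^ 2 * smoothAbs ε (k z)) ≤
      Real.exp (M ^ 2) / 2 * circInt fun z => smoothAbs ε (k z) := by
  have hfc := hf.continuousOn
  have hf1 := hf.deriv.continuousOn
  have hf2 := hf.deriv.deriv.continuousOn
  have hs := continuousOn_smoothAbs_comp (ε := ε) hk
  obtain ⟨S, hS, hS1, -, hS3⟩ := exp_weight_ineq hε (φ := fun z => ‖f z‖ ^ 2)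
    (p := fun z => deriv f z * conj (f z)) (p₂ := fun z => deriv (deriv f) z * conj (f z))
    (l := fun z => ‖deriv f z‖ ^ 2)
    (fun z hz => (HasWirt.normSq (hf.hasDerivAt_closedBall hz)).congr_coeff rfl (by simp [mul_comm]))
    (fun z hz => ((HasWirt.of_hasDerivAt (hf.deriv.hasDerivAt_closedBall hz)).mul
      (HasWirt.of_hasDerivAt (hf.hasDerivAt_closedBall hz)).star).congr_coeff (by simp)
        (by rw [zero_mul, zero_add, mul_conj, normSq_eq_norm_sq]))
    (hf2.mul (continuous_conj.comp_continuousOn hfc)) (hf1.norm.pow 2) hk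
  have hec : ContinuousOn (fun z => Real.exp (‖f z‖ ^ 2)) (closedBall 0 1) :=
    Real.continuous_exp.comp_continuousOn (hfc.norm.pow 2)
  have h1 : ∫ z in ball (0 : ℂ) 1, (1 - ‖z‖ ^ 2) * (‖deriv f z‖ ^ 2 * smoothAbs ε (k z)) ≤
      ∫ z in ball (0 : ℂ) 1, (1 - ‖z‖ ^ 2) * S z := by
    refine setIntegral_ball_mono (integrableOn_ball_of_continuousOn ?_)
      (integrableOn_ball_of_continuousOn ?_) fun z hz => ?_
    · exact ContinuousOn.mul (by fun_prop) ((hf1.norm.pow 2).mul hs)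
    · exact ContinuousOn.mul (by fun_prop) hS
    · refine mul_le_mul_of_nonneg_left (le_trans ?_ (hS1 z hz)) (one_sub_normSq_nonneg hz)
      rw [mul_assoc]
      have := smoothAbs_pos hε (k z)
      exact le_mul_of_one_le_left (by positivity) (Real.one_le_exp (by positivity))
  have h2 : 0 ≤ ∫ z in ball (0 : ℂ) 1, Real.exp (‖f z‖ ^ 2) * smoothAbs ε (k z) :=
    integral_nonneg fun z => mul_nonneg (Real.exp_pos _).le (smoothAbs_pos hε _).le
  have h3 : (circInt fun z => Real.exp (‖f z‖ ^ 2) * smoothAbs ε (k z)) ≤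
      circInt fun z => Real.exp (M ^ 2) * smoothAbs ε (k z) := by
    refine circInt_mono ((hec.mul hs).mono sphere_subset_closedBall)
      ((continuousOn_const.mul hs).mono sphere_subset_closedBall) fun z hz => ?_
    have := hfM z (sphere_subset_closedBall hz)
    have := smoothAbs_pos hε (k z)
    gcongr
  rw [circInt_const_mul] at h3
  linarith

lemma littlewood_paley_smoothAbs (hε : 0 < ε) (hk : AnalyticOnNhd ℂ k (closedBall 0 1)) :
    (∫ z in ball (0 : ℂ) 1, (1 - ‖z‖ ^ 2) * (‖deriv k z‖ ^ 2 / smoothAbs ε (k z)) ≤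
      2 * circInt fun z => smoothAbs ε (k z)) ∧
    ∫ z in ball (0 : ℂ) 1, smoothAbs ε (k z) ≤ 1 / 2 * circInt fun z => smoothAbs ε (k z) := by
  have hs := continuousOn_smoothAbs_comp (ε := ε) hk
  have hk1 := hk.deriv.continuousOn
  obtain ⟨S, hS, -, hS2, hS3⟩ := exp_weight_ineq hε (φ := fun _ => 0)
    (p := fun _ => 0) (p₂ := fun _ => 0) (l := fun _ => 0)
    (fun z _ => (HasWirt.const 0).congr_coeff rfl (by simp))
    (fun z _ => (HasWirt.const 0).congr_coeff rfl (by simp))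
    continuousOn_const continuousOn_const hk
  simp only [Real.exp_zero, one_mul, forall_const] at hS2 hS3
  have h1 : ∫ z in ball (0 : ℂ) 1, (1 - ‖z‖ ^ 2) * (‖deriv k z‖ ^ 2 / smoothAbs ε (k z)) ≤
      ∫ z in ball (0 : ℂ) 1, 4 * ((1 - ‖z‖ ^ 2) * S z) := by
    refine setIntegral_ball_mono (integrableOn_ball_of_continuousOn ?_)
      (integrableOn_ball_of_continuousOn ?_) fun z hz => ?_
    · exact ContinuousOn.mul (by fun_prop)
        ((hk1.norm.pow 2).div hs fun z _ => (smoothAbs_pos hε _).ne')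
    · exact continuousOn_const.mul (ContinuousOn.mul (by fun_prop) hS)
    · have h4 := hS2 z hz
      have h5 := one_sub_normSq_nonneg hz
      have h6 : ‖deriv k z‖ ^ 2 / smoothAbs ε (k z) = 4 * (‖deriv k z‖ ^ 2 / (4 * smoothAbs ε (k z))) := by
        field_simp
      rw [h6]
      nlinarith [mul_le_mul_of_nonneg_left h4 h5]
  rw [integral_const_mul] at h1
  have h2 : 0 ≤ ∫ z in ball (0 : ℂ) 1, smoothAbs ε (k z) :=
    integral_nonneg fun z => (smoothAbs_pos hε _).le
  have h3 : 0 ≤ ∫ z in ball (0 : ℂ) 1, (1 - ‖z‖ ^ 2) * S z := by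
    refine setIntegral_nonneg measurableSet_ball fun z hz => ?_
    have hz := ball_subset_closedBall hz
    refine mul_nonneg (one_sub_normSq_nonneg hz) (le_trans ?_ (hS2 z hz))
    have := smoothAbs_pos hε (k z)
    positivity
  constructor <;> linarith

lemma circInt_smoothAbs_le (hε : 0 < ε) (hk : AnalyticOnNhd ℂ k (closedBall 0 1)) :
    (circInt fun z => smoothAbs ε (k z)) ≤ (circInt fun z => ‖k z‖) + 2 * π * ε := by
  have hs := (continuousOn_smoothAbs_comp (ε := ε) hk).mono sphere_subset_closedBall
  have hn := hk.continuousOn.norm.mono sphere_subset_closedBall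
  rw [← circInt_const, ← circInt_add hn continuousOn_const]
  exact circInt_mono hs (hn.add continuousOn_const) fun z _ => smoothAbs_le hε _

/-- To bound by `C ∮|k|` it is enough to bound by `C ∮ √(|k|² + ε²)`. -/
lemma le_circInt_norm_of_forall_smoothAbs {X C : ℝ} (hC : 0 ≤ C)
    (hk : AnalyticOnNhd ℂ k (closedBall 0 1))
    (h : ∀ ε : ℝ, 0 < ε → X ≤ C * circInt fun z => smoothAbs ε (k z)) :
    X ≤ C * circInt fun z => ‖k z‖ := by
  refine le_of_forall_pos_le_add fun δ hδ => ?_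
  have hε : 0 < δ / (C * (2 * π) + 1) := by positivity
  refine (h _ hε).trans ?_
  have h1 := mul_le_mul_of_nonneg_left (circInt_smoothAbs_le hε hk) hC
  have h2 : C * (2 * π * (δ / (C * (2 * π) + 1))) ≤ δ := by
    rw [← mul_assoc, mul_div_assoc', div_le_iff₀ (by positivity)]
    nlinarith
  linarith

end

/-- A form of Wolff's theorem on `∂̄`. -/
theorem wolff_bound {ι : Type*} [Fintype ι] (M C₀ C₁ : ℝ) (hC₀ : 0 ≤ C₀) (hC₁ : 0 ≤ C₁) :
    ∃ C, 0 ≤ C ∧ ∀ (F : ι → ℂ → ℂ) (f T a b k : ℂ → ℂ),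
      (∀ j, AnalyticOnNhd ℂ (F j) (closedBall 0 1)) →
      (∀ j, ∀ z ∈ closedBall (0 : ℂ) 1, ‖F j z‖ ≤ M) →
      AnalyticOnNhd ℂ f (closedBall 0 1) →
      (∀ z ∈ closedBall (0 : ℂ) 1, ‖f z‖ ≤ M) →
      (∀ z ∈ closedBall (0 : ℂ) 1, HasWirt T (a z) (b z) z) →
      ContinuousOn a (closedBall 0 1) → ContinuousOn b (closedBall 0 1) →
      (∀ z ∈ closedBall (0 : ℂ) 1, ‖T z‖ ≤ C₀) →
      (∀ z ∈ closedBall (0 : ℂ) 1, ‖a z‖ ^ 2 ≤ C₁ * ∑ j, ‖deriv (F j) z‖ ^ 2) →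
      AnalyticOnNhd ℂ k (closedBall 0 1) →
      ‖∫ z in ball (0 : ℂ) 1, T z * conj (deriv f z) * k z‖ ≤ C * circInt fun z => ‖k z‖ := by
  refine ⟨C₀ * (Real.exp (M ^ 2) / 2 + 1 / 2) + (C₁ * (Fintype.card ι * (Real.exp (M ^ 2) / 2))
    + Real.exp (M ^ 2) / 2) + C₀ * (Real.exp (M ^ 2) / 2 + 2), by positivity, ?_⟩
  intro F f T a b k hF hFM hf hfM hT ha hb hT0 ha1 hk
  refine le_circInt_norm_of_forall_smoothAbs (by positivity) hk fun ε hε => ?_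
  have hTc : ContinuousOn T (closedBall 0 1) := fun z hz => (hT z hz).continuousAt.continuousWithinAt
  have hf1 := hf.deriv.continuousOn
  have hf1c := continuous_conj.comp_continuousOn hf1
  have hf2c := continuous_conj.comp_continuousOn hf.deriv.deriv.continuousOn
  have hkc := hk.continuousOn
  have hk1 := hk.deriv.continuousOn
  have hs := continuousOn_smoothAbs_comp (ε := ε) hk
  have hw : ContinuousOn (fun z : ℂ => ((1 - ‖z‖ ^ 2 : ℝ) : ℂ)) (closedBall 0 1) := by fun_prop
  let Q : ℂ → ℂ := fun z => ((1 - ‖z‖ ^ 2 : ℝ) : ℂ) *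
    (2 * (T z * conj (deriv f z) * k z) + a z * conj (deriv f z) * z * k z +
      T z * conj (deriv f z) * z * deriv k z)
  have hQ : ContinuousOn Q (closedBall 0 1) :=
    hw.mul (((continuousOn_const.mul ((hTc.mul hf1c).mul hkc)).add
      (((ha.mul hf1c).mul continuousOn_id).mul hkc)).add
      (((hTc.mul hf1c).mul continuousOn_id).mul hk1))
  have hωk : ContinuousOn (fun z => T z * conj (deriv f z) * k z) (closedBall 0 1) :=
    (hTc.mul hf1c).mul hkc
  have hst := integral_wirt
    (F := fun z => ((1 - ‖z‖ ^ 2 : ℝ) : ℂ) * (T z * conj (deriv f z) * z * k z))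
    (a := fun z => Q z - T z * conj (deriv f z) * k z)
    (b := fun z => -z * (T z * conj (deriv f z) * z * k z) + ((1 - ‖z‖ ^ 2 : ℝ) : ℂ) *
      ((b z * conj (deriv f z) + T z * conj (deriv (deriv f) z)) * z * k z)) ?_ ?_ ?_
  rotate_left
  · intro z hz
    have h1 := (hT z hz).mul (HasWirt.of_hasDerivAt (hf.deriv.hasDerivAt_closedBall hz)).star
    have h2 := (hasWirt_one_sub_normSq z).mul
      ((h1.mul HasWirt.id).mul (HasWirt.of_hasDerivAt (hk.hasDerivAt_closedBall hz)))
    refine h2.congr_coeff ?_ (by simp)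
    simp only [Q, map_zero]
    have e : ((‖z‖ ^ 2 : ℝ) : ℂ) = z * conj z := by rw [mul_conj, normSq_eq_norm_sq]
    push_cast at e ⊢
    rw [e]; ring
  · exact hQ.sub hωk
  · exact (continuousOn_id.neg.mul (((hTc.mul hf1c).mul continuousOn_id).mul hkc)).add
      (hw.mul ((((hb.mul hf1c).add (hTc.mul hf2c)).mul continuousOn_id).mul hkc))
  have e0 : (circInt fun z => ((1 - ‖z‖ ^ 2 : ℝ) : ℂ) *
      (T z * conj (deriv f z) * z * k z) * conj z) = 0 := by
    rw [circInt_congr (G := fun _ => (0 : ℂ))]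
    · simp [circInt]
    · intro z hz; simp [mem_sphere_zero_iff_norm.1 hz]
  rw [e0, mul_zero, integral_sub (integrableOn_ball_of_continuousOn hQ)
    (integrableOn_ball_of_continuousOn hωk), sub_eq_zero] at hst
  rw [← hst]
  let s : ℂ → ℝ := fun z => smoothAbs ε (k z)
  have hs0 : ∀ z, 0 < s z := fun z => smoothAbs_pos hε _
  let A : ℂ → ℝ := fun z => (1 - ‖z‖ ^ 2) * (‖deriv f z‖ ^ 2 * s z)
  let B : ι → ℂ → ℝ := fun j z => (1 - ‖z‖ ^ 2) * (‖deriv (F j) z‖ ^ 2 * s z)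
  let E : ℂ → ℝ := fun z => (1 - ‖z‖ ^ 2) * (‖deriv k z‖ ^ 2 / s z)
  have hwr : ContinuousOn (fun z : ℂ => (1 - ‖z‖ ^ 2 : ℝ)) (closedBall 0 1) := by fun_prop
  have hA : IntegrableOn A (ball 0 1) :=
    integrableOn_ball_of_continuousOn (hwr.mul ((hf1.norm.pow 2).mul hs))
  have hB : ∀ j, IntegrableOn (B j) (ball 0 1) := fun j =>
    integrableOn_ball_of_continuousOn (hwr.mul (((hF j).deriv.continuousOn.norm.pow 2).mul hs))
  have hE : IntegrableOn E (ball 0 1) := integrableOn_ball_of_continuousOn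
    (hwr.mul ((hk1.norm.pow 2).div hs fun z _ => (hs0 z).ne'))
  have hsi : IntegrableOn s (ball 0 1) := integrableOn_ball_of_continuousOn hs
  have hpt : ∀ z ∈ closedBall (0 : ℂ) 1, ‖Q z‖ ≤
      C₀ * (A z + s z) + (C₁ * ∑ j, B j z + A z) + C₀ * (A z + E z) := by
    intro z hz
    have hw0 := one_sub_normSq_nonneg hz
    have hz1 : ‖z‖ ≤ 1 := mem_closedBall_zero_iff.1 hz
    have hsz := hs0 z
    have hks : ‖k z‖ ≤ s z := norm_le_smoothAbs ε (k z)
    have hn : ‖Q z‖ ≤ (1 - ‖z‖ ^ 2) * (2 * (‖T z‖ * ‖deriv f z‖ * ‖k z‖) +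
        ‖a z‖ * ‖deriv f z‖ * ‖z‖ * ‖k z‖ + ‖T z‖ * ‖deriv f z‖ * ‖z‖ * ‖deriv k z‖) := by
      simp only [Q, norm_mul, norm_real, Real.norm_eq_abs, abs_of_nonneg hw0]
      refine mul_le_mul_of_nonneg_left ?_ hw0
      refine (norm_add₃_le).trans (le_of_eq ?_)
      simp
    refine hn.trans ?_
    have hsum : ∑ j, B j z = (1 - ‖z‖ ^ 2) * ((∑ j, ‖deriv (F j) z‖ ^ 2) * s z) := by
      rw [Finset.sum_mul, Finset.mul_sum]
    have t1 : 2 * (‖T z‖ * ‖deriv f z‖ * ‖k z‖) ≤ C₀ * ((‖deriv f z‖ ^ 2 + 1) * s z) := by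
      have : 2 * ‖deriv f z‖ ≤ ‖deriv f z‖ ^ 2 + 1 := by nlinarith [sq_nonneg (‖deriv f z‖ - 1)]
      calc _ = ‖T z‖ * ((2 * ‖deriv f z‖) * ‖k z‖) := by ring
        _ ≤ _ := by have := hT0 z hz; gcongr
    have t2 : ‖a z‖ * ‖deriv f z‖ * ‖z‖ * ‖k z‖ ≤
        (C₁ * ∑ j, ‖deriv (F j) z‖ ^ 2 + ‖deriv f z‖ ^ 2) * s z := by
      have : ‖a z‖ * ‖deriv f z‖ ≤ C₁ * ∑ j, ‖deriv (F j) z‖ ^ 2 + ‖deriv f z‖ ^ 2 := by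
        nlinarith [ha1 z hz, sq_nonneg (‖a z‖ - ‖deriv f z‖), sq_nonneg ‖a z‖,
          sq_nonneg ‖deriv f z‖]
      calc _ ≤ ‖a z‖ * ‖deriv f z‖ * 1 * s z := by gcongr
        _ ≤ _ := by rw [mul_one]; gcongr
    have t3 : ‖T z‖ * ‖deriv f z‖ * ‖z‖ * ‖deriv k z‖ ≤
        C₀ * (‖deriv f z‖ ^ 2 * s z + ‖deriv k z‖ ^ 2 / s z) := by
      have h : ‖deriv f z‖ * ‖deriv k z‖ ≤ ‖deriv f z‖ ^ 2 * s z + ‖deriv k z‖ ^ 2 / s z := by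
        have e : ‖deriv f z‖ ^ 2 * s z + ‖deriv k z‖ ^ 2 / s z - 2 * (‖deriv f z‖ * ‖deriv k z‖)
          = (‖deriv f z‖ * s z - ‖deriv k z‖) ^ 2 / s z := by field_simp; ring
        have h2 : 0 ≤ (‖deriv f z‖ * s z - ‖deriv k z‖) ^ 2 / s z := by positivity
        have h3 : 0 ≤ ‖deriv f z‖ * ‖deriv k z‖ := by positivity
        linarith
      calc _ = ‖T z‖ * ‖z‖ * (‖deriv f z‖ * ‖deriv k z‖) := by ring
        _ ≤ C₀ * 1 * (‖deriv f z‖ ^ 2 * s z + ‖deriv k z‖ ^ 2 / s z) := by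
          have := hT0 z hz; gcongr
        _ = _ := by ring
    rw [hsum]
    have hlast : (1 - ‖z‖ ^ 2) * s z ≤ s z := by nlinarith [sq_nonneg ‖z‖]
    have h4 := mul_le_mul_of_nonneg_left (add_le_add (add_le_add t1 t2) t3) hw0
    refine h4.trans ?_
    simp only [A, E]
    have h5 := mul_le_mul_of_nonneg_left hlast hC₀
    linear_combination h5
  have hsumB : IntegrableOn (fun z => ∑ j, B j z) (ball 0 1) :=
    integrable_finset_sum _ fun j _ => hB j
  have i1 : IntegrableOn (fun z => C₀ * (A z + s z)) (ball 0 1) := (hA.add hsi).const_mul _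
  have i2 : IntegrableOn (fun z => C₁ * ∑ j, B j z + A z) (ball 0 1) := (hsumB.const_mul _).add hA
  have i3 : IntegrableOn (fun z => C₀ * (A z + E z)) (ball 0 1) := (hA.add hE).const_mul _
  have i12 : IntegrableOn (fun z => C₀ * (A z + s z) + (C₁ * ∑ j, B j z + A z)) (ball 0 1) :=
    i1.add i2
  refine (norm_integral_le_integral_norm _).trans ((setIntegral_ball_mono
    (integrableOn_ball_of_continuousOn hQ.norm) (i12.add i3) hpt).trans ?_)
  simp only [Pi.add_apply]
  rw [integral_add i12 i3, integral_add i1 i2, integral_const_mul, integral_const_mul,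
    integral_add hA hsi, integral_add hA hE, integral_add (hsumB.const_mul _) hA,
    integral_const_mul, integral_finsetSum _ fun j _ => hB j]
  have l1 := littlewood_paley_bounded hε hf hfM hk
  have l2 := fun j => littlewood_paley_bounded hε (hF j) (hFM j) hk
  obtain ⟨l3, l4⟩ := littlewood_paley_smoothAbs hε hk
  have l5 : ∑ j, ∫ z in ball (0 : ℂ) 1, B j z ≤
      Fintype.card ι * (Real.exp (M ^ 2) / 2 * circInt fun z => smoothAbs ε (k z)) := by
    refine (Finset.sum_le_sum fun j _ => l2 j).trans (le_of_eq ?_)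
    simp
  have l6 := mul_le_mul_of_nonneg_left (add_le_add l1 l4) hC₀
  have l7 := mul_le_mul_of_nonneg_left (add_le_add l1 l3) hC₀
  have l8 := mul_le_mul_of_nonneg_left l5 hC₁
  simp only [A, E, s]
  linear_combination l6 + l7 + l8 + l1

/-- The automorphism of the disc taking `0` to `ζ`. -/
noncomputable def moeb (ζ w : ℂ) : ℂ := (w + ζ) / (1 + conj ζ * w)

lemma one_add_conj_mul_ne_zero {ζ w : ℂ} (hζ : ζ ∈ ball (0 : ℂ) 1) (hw : w ∈ closedBall (0 : ℂ) 1) :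
    1 + conj ζ * w ≠ 0 := by
  intro h
  have h1 : ‖conj ζ * w‖ = 1 := by
    rw [show conj ζ * w = -1 by linear_combination h]; simp
  rw [norm_mul, RCLike.norm_conj] at h1
  have := mem_ball_zero_iff.1 hζ
  have := mem_closedBall_zero_iff.1 hw
  nlinarith [norm_nonneg ζ, norm_nonneg w]

lemma one_sub_conj_mul_ne_zero {ζ w : ℂ} (hζ : ζ ∈ ball (0 : ℂ) 1) (hw : w ∈ closedBall (0 : ℂ) 1) :
    1 - conj ζ * w ≠ 0 := by
  have := one_add_conj_mul_ne_zero (ζ := -ζ) (by simpa using hζ) hw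
  simpa [sub_eq_add_neg] using this

lemma ofReal_one_sub_normSq (z : ℂ) : ((1 - ‖z‖ ^ 2 : ℝ) : ℂ) = 1 - z * conj z := by
  rw [mul_conj, normSq_eq_norm_sq]; simp

lemma one_sub_normSq_pos {z : ℂ} (hz : z ∈ ball (0 : ℂ) 1) : 0 < 1 - ‖z‖ ^ 2 := by
  have := mem_ball_zero_iff.1 hz
  nlinarith [norm_nonneg z]

section
variable {ζ w : ℂ} (hζ : ζ ∈ ball (0 : ℂ) 1) (hw : w ∈ closedBall (0 : ℂ) 1)
include hζ hw

lemma one_sub_conj_mul_moeb :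
    1 - conj ζ * moeb ζ w = ((1 - ‖ζ‖ ^ 2 : ℝ) : ℂ) / (1 + conj ζ * w) := by
  have := one_add_conj_mul_ne_zero hζ hw
  rw [ofReal_one_sub_normSq, moeb]; field_simp; ring

lemma moeb_sub_self : moeb ζ w - ζ = w * ((1 - ‖ζ‖ ^ 2 : ℝ) : ℂ) / (1 + conj ζ * w) := by
  have := one_add_conj_mul_ne_zero hζ hw
  have h2 : 1 + w * conj ζ ≠ 0 := by rwa [mul_comm w]
  rw [ofReal_one_sub_normSq, moeb]; field_simp; ring

lemma one_sub_normSq_moeb :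
    1 - ‖moeb ζ w‖ ^ 2 = (1 - ‖ζ‖ ^ 2) * (1 - ‖w‖ ^ 2) / ‖1 + conj ζ * w‖ ^ 2 := by
  have h := one_add_conj_mul_ne_zero hζ hw
  have h0 : 1 + w * conj ζ ≠ 0 := by rwa [mul_comm w]
  have h2 : 1 + ζ * conj w ≠ 0 := by
    have := (map_ne_zero (starRingEnd ℂ)).2 h
    simpa using this
  have h3 : ((‖1 + conj ζ * w‖ ^ 2 : ℝ) : ℂ) = (1 + conj ζ * w) * (1 + ζ * conj w) := by
    rw [← normSq_eq_norm_sq, ← mul_conj]; simp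
  refine ofReal_injective ?_
  rw [ofReal_div, ofReal_mul, h3, ofReal_one_sub_normSq, ofReal_one_sub_normSq,
    ofReal_one_sub_normSq, moeb]
  simp only [map_div₀, map_add, map_mul, map_one, RingHomCompTriple.comp_apply, RingHom.id_apply]
  field_simp
  ring

lemma moeb_mem_closedBall : moeb ζ w ∈ closedBall (0 : ℂ) 1 := by
  have h := one_sub_normSq_moeb hζ hw
  have h1 := one_sub_normSq_nonneg hw
  have h2 := one_sub_normSq_pos hζ
  have h3 : 0 ≤ 1 - ‖moeb ζ w‖ ^ 2 := by rw [h]; positivity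
  rw [mem_closedBall_zero_iff]
  nlinarith [norm_nonneg (moeb ζ w)]

lemma hasDerivAt_moeb :
    HasDerivAt (moeb ζ) (((1 - ‖ζ‖ ^ 2 : ℝ) : ℂ) / (1 + conj ζ * w) ^ 2) w := by
  have h := one_add_conj_mul_ne_zero hζ hw
  have h1 := ((hasDerivAt_id w).add_const ζ).div
    (((hasDerivAt_id w).const_mul (conj ζ)).const_add 1) h
  refine h1.congr_deriv ?_
  rw [ofReal_one_sub_normSq]
  simp only [id]
  field_simp; ring

lemma analyticAt_moeb : AnalyticAt ℂ (moeb ζ) w := by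
  unfold moeb
  have := one_add_conj_mul_ne_zero hζ hw
  fun_prop (disch := assumption)

lemma moeb_neg_moeb : moeb (-ζ) (moeb ζ w) = w := by
  have h := one_sub_conj_mul_moeb hζ hw
  have h2 := moeb_sub_self hζ hw
  have h3 := one_add_conj_mul_ne_zero hζ hw
  have h4 : ((1 - ‖ζ‖ ^ 2 : ℝ) : ℂ) ≠ 0 := by exact_mod_cast (one_sub_normSq_pos hζ).ne'
  rw [moeb, map_neg, neg_mul, ← sub_eq_add_neg, ← sub_eq_add_neg, h, h2,
    div_div_div_cancel_right₀ h3, mul_div_cancel_right₀ _ h4]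

lemma norm_moeb_sub_self : ‖moeb ζ w - ζ‖ = ‖w‖ * ‖1 - conj ζ * moeb ζ w‖ := by
  rw [moeb_sub_self hζ hw, one_sub_conj_mul_moeb hζ hw, ← norm_mul, mul_div_assoc]

end

lemma moeb_mem_ball {ζ w : ℂ} (hζ : ζ ∈ ball (0 : ℂ) 1) (hw : w ∈ ball (0 : ℂ) 1) :
    moeb ζ w ∈ ball (0 : ℂ) 1 := by
  have hw' := ball_subset_closedBall hw
  have h := one_sub_normSq_moeb hζ hw'
  have h1 := one_sub_normSq_pos hw
  have h2 := one_sub_normSq_pos hζ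
  have h4 : 0 < ‖1 + conj ζ * w‖ := norm_pos_iff.2 (one_add_conj_mul_ne_zero hζ hw')
  have h3 : 0 < 1 - ‖moeb ζ w‖ ^ 2 := by rw [h]; positivity
  rw [mem_ball_zero_iff]
  nlinarith [norm_nonneg (moeb ζ w)]

lemma neg_mem_ball {ζ : ℂ} (hζ : ζ ∈ ball (0 : ℂ) 1) : -ζ ∈ ball (0 : ℂ) 1 := by simpa using hζ

lemma moeb_moeb_neg {ζ w : ℂ} (hζ : ζ ∈ ball (0 : ℂ) 1) (hw : w ∈ closedBall (0 : ℂ) 1) :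
    moeb ζ (moeb (-ζ) w) = w := by
  have := moeb_neg_moeb (neg_mem_ball hζ) hw
  rwa [neg_neg] at this

lemma moeb_injOn {ζ : ℂ} (hζ : ζ ∈ ball (0 : ℂ) 1) : InjOn (moeb ζ) (ball 0 1) := by
  intro x hx y hy h
  rw [← moeb_neg_moeb hζ (ball_subset_closedBall hx), h, moeb_neg_moeb hζ (ball_subset_closedBall hy)]

lemma moeb_image_ball {ζ : ℂ} (hζ : ζ ∈ ball (0 : ℂ) 1) : moeb ζ '' ball 0 1 = ball 0 1 := by
  refine Subset.antisymm ?_ fun x hx => ?_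
  · rintro _ ⟨w, hw, rfl⟩; exact moeb_mem_ball hζ hw
  · exact ⟨moeb (-ζ) x, moeb_mem_ball (neg_mem_ball hζ) hx, moeb_moeb_neg hζ (ball_subset_closedBall hx)⟩

lemma det_restrictScalars_toSpanSingleton (c : ℂ) :
    ((ContinuousLinearMap.toSpanSingleton ℂ c).restrictScalars ℝ).det = ‖c‖ ^ 2 := by
  rw [← normSq_eq_norm_sq, ← Algebra.norm_complex_apply, Algebra.norm_apply, ContinuousLinearMap.det]
  congr 1
  ext <;> simp [mul_comm]

/-- The Jacobian of `moeb ζ`. -/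
noncomputable def moebJac (ζ w : ℂ) : ℝ := ((1 - ‖ζ‖ ^ 2) / ‖1 + conj ζ * w‖ ^ 2) ^ 2

lemma hasFDerivWithinAt_moeb {ζ : ℂ} (hζ : ζ ∈ ball (0 : ℂ) 1) : ∀ w ∈ ball (0 : ℂ) 1,
    HasFDerivWithinAt (moeb ζ) ((ContinuousLinearMap.toSpanSingleton ℂ
      (((1 - ‖ζ‖ ^ 2 : ℝ) : ℂ) / (1 + conj ζ * w) ^ 2)).restrictScalars ℝ) (ball 0 1) w := fun w hw =>
  ((hasDerivAt_moeb hζ (ball_subset_closedBall hw)).hasFDerivAt.restrictScalars ℝ).hasFDerivWithinAt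

lemma abs_det_moeb {ζ : ℂ} (hζ : ζ ∈ ball (0 : ℂ) 1) (w : ℂ) :
    |((ContinuousLinearMap.toSpanSingleton ℂ
      (((1 - ‖ζ‖ ^ 2 : ℝ) : ℂ) / (1 + conj ζ * w) ^ 2)).restrictScalars ℝ).det| = moebJac ζ w := by
  rw [det_restrictScalars_toSpanSingleton, abs_of_nonneg (by positivity), norm_div, norm_pow,
    norm_real, Real.norm_eq_abs, abs_of_pos (one_sub_normSq_pos hζ), moebJac]

lemma setIntegral_ball_moeb {E : Type*} [NormedAddCommGroup E] [NormedSpace ℝ E] {ζ : ℂ}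
    (hζ : ζ ∈ ball (0 : ℂ) 1) (g : ℂ → E) :
    ∫ ξ in ball (0 : ℂ) 1, g ξ = ∫ w in ball (0 : ℂ) 1, moebJac ζ w • g (moeb ζ w) := by
  conv_lhs => rw [← moeb_image_ball hζ]
  rw [integral_image_eq_integral_abs_det_fderiv_smul volume measurableSet_ball
    (hasFDerivWithinAt_moeb hζ) (moeb_injOn hζ)]
  simp_rw [abs_det_moeb hζ]

/-- The kernel `(1-|ζ|²)² / (|1-ζ̄ξ|³ |ξ-ζ|)`. -/
noncomputable def poleKer (ζ ξ : ℂ) : ℝ :=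
  (1 - ‖ζ‖ ^ 2) ^ 2 / (‖1 - conj ζ * ξ‖ ^ 3 * ‖ξ - ζ‖)

lemma poleKer_nonneg (ζ ξ : ℂ) : 0 ≤ poleKer ζ ξ := by unfold poleKer; positivity

lemma moebJac_mul_poleKer {ζ w : ℂ} (hζ : ζ ∈ ball (0 : ℂ) 1) (hw : w ∈ closedBall (0 : ℂ) 1) :
    moebJac ζ w * poleKer ζ (moeb ζ w) = ‖w‖⁻¹ := by
  have h4 : 0 < ‖1 + conj ζ * w‖ := norm_pos_iff.2 (one_add_conj_mul_ne_zero hζ hw)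
  have h2 := one_sub_normSq_pos hζ
  rw [moebJac, poleKer, norm_moeb_sub_self hζ hw, one_sub_conj_mul_moeb hζ hw, norm_div,
    norm_real, Real.norm_eq_abs, abs_of_pos h2]
  rcases eq_or_ne w 0 with rfl | h0
  · simp
  · have := norm_pos_iff.2 h0
    field_simp

lemma setIntegral_poleKer_mul {ζ : ℂ} (hζ : ζ ∈ ball (0 : ℂ) 1) (g : ℂ → ℝ) :
    ∫ ξ in ball (0 : ℂ) 1, poleKer ζ ξ * g ξ =
      ∫ w in ball (0 : ℂ) 1, ‖w‖⁻¹ * g (moeb ζ w) := by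
  rw [setIntegral_ball_moeb hζ]
  refine setIntegral_congr_fun measurableSet_ball fun w hw => ?_
  simp only [smul_eq_mul]
  rw [← mul_assoc, moebJac_mul_poleKer hζ (ball_subset_closedBall hw)]

lemma integrableOn_poleKer_mul {ζ : ℂ} (hζ : ζ ∈ ball (0 : ℂ) 1) {g : ℂ → ℝ}
    (hg : ContinuousOn g (closedBall 0 1)) :
    IntegrableOn (fun ξ => poleKer ζ ξ * g ξ) (ball 0 1) := by
  have h1 : ContinuousOn (fun ξ => (1 - ‖ζ‖ ^ 2) ^ 2 / ‖1 - conj ζ * ξ‖ ^ 3 * g ξ)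
      (closedBall 0 1) := by
    refine ContinuousOn.mul (ContinuousOn.div continuousOn_const (by fun_prop) fun ξ hξ => ?_) hg
    have := norm_pos_iff.2 (one_sub_conj_mul_ne_zero hζ hξ)
    positivity
  obtain ⟨C, hC⟩ := (isCompact_closedBall (0 : ℂ) 1).exists_bound_of_continuousOn h1
  have h2 := (integrableOn_inv_norm_sub ζ 1).bdd_mul (f := fun ξ => (1 - ‖ζ‖ ^ 2) ^ 2 /
    ‖1 - conj ζ * ξ‖ ^ 3 * g ξ) (c := C)
    ((h1.mono ball_subset_closedBall).aestronglyMeasurable measurableSet_ball)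
    ((ae_restrict_mem measurableSet_ball).mono fun ξ hξ => hC ξ (ball_subset_closedBall hξ))
  refine h2.congr (Eventually.of_forall fun ξ => ?_)
  simp only [poleKer]
  rw [← div_div]; ring

lemma setIntegral_inv_norm_mul {g : ℂ → ℝ} (hg : ContinuousOn g (closedBall 0 1)) :
    ∫ w in ball (0 : ℂ) 1, ‖w‖⁻¹ * g w =
      ∫ θ in (-π)..π, ∫ r in (0 : ℝ)..1, g (r * circleMap 0 1 θ) := by
  have hi := integrable_polar hg
  have h : ∫ w in ball (0 : ℂ) 1, ‖w‖⁻¹ * g w =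
      ∫ p in Ioc (0 : ℝ) 1 ×ˢ Ioc (-π) π, g (p.1 * circleMap 0 1 p.2) := by
    rw [setIntegral_ball_eq_polar]
    refine setIntegral_congr_fun (measurableSet_Ioc.prod measurableSet_Ioc) ?_
    rintro ⟨r, θ⟩ ⟨hr, -⟩
    have : 0 < r := hr.1
    simp [abs_of_pos this]
    field_simp
  rw [h, intervalIntegral.integral_of_le (by linarith [Real.pi_pos])]
  rw [Measure.volume_eq_prod] at hi ⊢
  rw [← Measure.prod_restrict, integral_prod_symm]
  · simp_rw [intervalIntegral.integral_of_le (zero_le_one' ℝ)]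
  · rw [Measure.prod_restrict]; exact hi

lemma setIntegral_inv_norm_mul_radial {g : ℂ → ℝ} (hg : ContinuousOn g (closedBall 0 1)) :
    ∫ w in ball (0 : ℂ) 1, ‖w‖⁻¹ * g w = ∫ r in (0 : ℝ)..1, circInt fun z => g (r * z) := by
  have hi := integrable_polar hg
  have h : ∫ w in ball (0 : ℂ) 1, ‖w‖⁻¹ * g w =
      ∫ p in Ioc (0 : ℝ) 1 ×ˢ Ioc (-π) π, g (p.1 * circleMap 0 1 p.2) := by
    rw [setIntegral_ball_eq_polar]
    refine setIntegral_congr_fun (measurableSet_Ioc.prod measurableSet_Ioc) ?_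
    rintro ⟨r, θ⟩ ⟨hr, -⟩
    have : 0 < r := hr.1
    simp [abs_of_pos this]
    field_simp
  rw [h, Measure.volume_eq_prod, setIntegral_prod _ hi, intervalIntegral.integral_of_le zero_le_one]
  refine setIntegral_congr_fun measurableSet_Ioc fun r _ => ?_
  simp only
  rw [← integral_circle_shift (fun z => g (r * z)),
    intervalIntegral.integral_of_le (by linarith [Real.pi_pos])]

lemma circInt_poisson {a : ℂ} (ha : a ∈ ball (0 : ℂ) 1) :
    (circInt fun z => (1 - ‖a‖ ^ 2) / ‖1 - conj a * z‖ ^ 2) = 2 * π := by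
  have hne : ∀ z ∈ sphere (0 : ℂ) 1, z - a ≠ 0 := by
    intro z hz h
    have := mem_ball_zero_iff.1 ha
    rw [sub_eq_zero] at h
    rw [← h, mem_sphere_zero_iff_norm.1 hz] at this
    exact lt_irrefl _ this
  have hc : ContinuousOn (fun z : ℂ => z / (z - a)) (sphere 0 1) :=
    continuousOn_id.div (by fun_prop) hne
  have h1 : circInt (fun z => z / (z - a) + conj (z / (z - a)) - 1) = 2 * π := by
    have hcc : ContinuousOn (fun z : ℂ => conj (z / (z - a))) (sphere 0 1) :=
      continuous_conj.comp_continuousOn hc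
    have hadd : ContinuousOn (fun z : ℂ => z / (z - a) + conj (z / (z - a))) (sphere 0 1) :=
      hc.add hcc
    rw [circInt_sub hadd continuousOn_const, circInt_add hc hcc, circInt_conj,
      circInt_cauchy_kernel ha]
    have : circInt (fun _ : ℂ => (1 : ℂ)) = 2 * π := by simp [circInt]
    rw [this, map_mul, conj_ofReal, map_ofNat]; ring
  refine ofReal_injective ?_
  rw [← circInt_ofReal]
  push_cast
  rw [← h1]
  refine circInt_congr fun z hz => ?_
  have e1 := mul_conj_of_mem_sphere hz
  have e2 : 1 - conj a * z = z * conj (z - a) := by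
    rw [map_sub, mul_sub, e1]; ring
  have e3 : ((‖1 - conj a * z‖ : ℝ) : ℂ) ^ 2 = (z - a) * conj (z - a) := by
    rw [e2, norm_mul, mem_sphere_zero_iff_norm.1 hz, one_mul, RCLike.norm_conj, mul_conj,
      normSq_eq_norm_sq]; push_cast; ring
  have e4 : ((‖a‖ : ℝ) : ℂ) ^ 2 = a * conj a := by
    rw [mul_conj, normSq_eq_norm_sq]; push_cast; ring
  have h2 := hne z hz
  have h3 : conj z - conj a ≠ 0 := by
    rw [← map_sub]; exact (map_ne_zero _).2 h2
  rw [e3, e4, map_div₀, map_sub]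
  field_simp
  linear_combination -e1

lemma setIntegral_poleKer {ζ : ℂ} (hζ : ζ ∈ ball (0 : ℂ) 1) :
    ∫ ξ in ball (0 : ℂ) 1, poleKer ζ ξ = 2 * π := by
  have h := setIntegral_poleKer_mul hζ (fun _ => 1)
  rw [setIntegral_inv_norm_mul continuousOn_const] at h
  simp only [mul_one] at h
  rw [h]
  simp; ring

/-- Möbius change of variables, for the integral in the centre of the kernel. -/
lemma setIntegral_poleKer_swap_le {ξ : ℂ} (hξ : ξ ∈ ball (0 : ℂ) 1) :
    ∫ ζ in ball (0 : ℂ) 1, poleKer ξ ζ * ((1 - ‖ζ‖ ^ 2) / (1 - ‖ξ‖ ^ 2)) ≤ 2 * π := by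
  have hξ' := one_sub_normSq_pos hξ
  rw [setIntegral_poleKer_mul hξ]
  have e : ∫ w in ball (0 : ℂ) 1, ‖w‖⁻¹ * ((1 - ‖moeb ξ w‖ ^ 2) / (1 - ‖ξ‖ ^ 2)) =
      ∫ w in ball (0 : ℂ) 1, ‖w‖⁻¹ * ((1 - ‖w‖ ^ 2) / ‖1 + conj ξ * w‖ ^ 2) := by
    refine setIntegral_congr_fun measurableSet_ball fun w hw => ?_
    rw [one_sub_normSq_moeb hξ (ball_subset_closedBall hw)]
    field_simp
  have hc : ContinuousOn (fun w : ℂ => (1 - ‖w‖ ^ 2) / ‖1 + conj ξ * w‖ ^ 2) (closedBall 0 1) :=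
    ContinuousOn.div (by fun_prop) (by fun_prop) fun w hw => by
      have := norm_pos_iff.2 (one_add_conj_mul_ne_zero hξ hw); positivity
  rw [e, setIntegral_inv_norm_mul_radial hc]
  have hpt : ∀ r ∈ Icc (0 : ℝ) 1, (circInt fun z : ℂ =>
      (1 - ‖(r : ℂ) * z‖ ^ 2) / ‖1 + conj ξ * (r * z)‖ ^ 2) ≤ 2 * π := by
    intro r hr
    have hrξ : r * ‖ξ‖ ≤ ‖ξ‖ := mul_le_of_le_one_left (norm_nonneg _) hr.2
    have hm : -(r * ξ) ∈ ball (0 : ℂ) 1 := by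
      rw [mem_ball_zero_iff, norm_neg, norm_mul, norm_real, Real.norm_eq_abs, abs_of_nonneg hr.1]
      exact hrξ.trans_lt (mem_ball_zero_iff.1 hξ)
    have hne : ∀ z ∈ sphere (0 : ℂ) 1, 0 < ‖1 + conj ξ * (r * z)‖ := fun z hz => by
      refine norm_pos_iff.2 (one_add_conj_mul_ne_zero hξ ?_)
      simp [mem_sphere_zero_iff_norm.1 hz, abs_of_nonneg hr.1, hr.2]
    rw [← circInt_poisson hm]
    have eq : ∀ z : ℂ, 1 - conj (-(r * ξ)) * z = 1 + conj ξ * (r * z) := fun z => by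
      simp; ring
    simp_rw [eq]
    refine circInt_mono (ContinuousOn.div (by fun_prop) (by fun_prop) fun z hz => ?_)
      (ContinuousOn.div (by fun_prop) (by fun_prop) fun z hz => ?_) fun z hz => ?_
    · have := hne z hz; positivity
    · have := hne z hz; positivity
    · refine div_le_div_of_nonneg_right ?_ (by positivity)
      rw [norm_neg, norm_mul, norm_mul, mem_sphere_zero_iff_norm.1 hz, norm_real, Real.norm_eq_abs,
        abs_of_nonneg hr.1, mul_one]
      have := mem_ball_zero_iff.1 hξ
      have : r * ‖ξ‖ ≤ r := mul_le_of_le_one_right hr.1 this.le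
      have : 0 ≤ r * ‖ξ‖ := mul_nonneg hr.1 (norm_nonneg _)
      nlinarith
  by_cases hintg : IntervalIntegrable (fun r : ℝ => circInt fun z : ℂ =>
      (1 - ‖(r : ℂ) * z‖ ^ 2) / ‖1 + conj ξ * (r * z)‖ ^ 2) volume 0 1
  · refine (intervalIntegral.integral_mono_on zero_le_one hintg
      (intervalIntegrable_const (c := 2 * π)) hpt).trans (by simp)
  · rw [intervalIntegral.integral_undef hintg]; positivity

lemma norm_deriv_le_of_bounded {f : ℂ → ℂ} {M : ℝ} (hf : AnalyticOnNhd ℂ f (closedBall 0 1))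
    (hM : ∀ z ∈ closedBall (0 : ℂ) 1, ‖f z‖ ≤ M) {z : ℂ} (hz : z ∈ closedBall (0 : ℂ) 1) :
    (1 - ‖z‖ ^ 2) * ‖deriv f z‖ ≤ 2 * M := by
  have hM0 : 0 ≤ M := (norm_nonneg _).trans (hM z hz)
  have hz1 := mem_closedBall_zero_iff.1 hz
  rcases hz1.eq_or_lt with h | h
  · rw [h]; linarith
  have hR : 0 < 1 - ‖z‖ := by linarith
  have hsub : closedBall z (1 - ‖z‖) ⊆ closedBall (0 : ℂ) 1 := by
    refine closedBall_subset_closedBall' ?_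
    rw [dist_zero_right]; linarith
  have h1 := Complex.norm_deriv_le_of_forall_mem_sphere_norm_le (f := f) (c := z) (C := M) hR
    (((hf.mono hsub).differentiableOn.diffContOnCl_ball Subset.rfl))
    fun w hw => hM w (hsub (sphere_subset_closedBall hw))
  rw [le_div_iff₀ hR] at h1
  nlinarith [norm_nonneg (deriv f z), norm_nonneg z]

section
variable {ε M : ℝ} {F k : ℂ → ℂ}

lemma smoothAbs_radial_le (hε : 0 < ε) (hk : AnalyticOnNhd ℂ k (closedBall 0 1)) {e : ℂ}
    (he : ‖e‖ = 1) :
    ∫ r in (0 : ℝ)..1, smoothAbs ε (k (r * e)) ≤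
      smoothAbs ε (k 0) + ∫ r in (0 : ℝ)..1, (1 - ‖(r : ℂ) * e‖ ^ 2) * ‖deriv k (r * e)‖ := by
  have hmem : ∀ r ∈ Icc (0 : ℝ) 1, (r : ℂ) * e ∈ closedBall (0 : ℂ) 1 := fun r hr => by
    simp [he, abs_of_nonneg hr.1, hr.2]
  have hmaps : MapsTo (fun r : ℝ => (r : ℂ) * e) (Icc 0 1) (closedBall 0 1) := hmem
  have hγ : ContinuousOn (fun r : ℝ => (r : ℂ) * e) (Icc 0 1) := by fun_prop
  have hkc := hk.continuousOn.comp hγ hmaps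
  have hk1 := hk.deriv.continuousOn.comp hγ hmaps
  have hs := (continuous_smoothAbs ε).comp_continuousOn hkc
  let q : ℝ → ℂ := fun r => deriv k (r * e) * conj (k (r * e)) / (2 * smoothAbs ε (k (r * e))) * e +
    k (r * e) * conj (deriv k (r * e)) / (2 * smoothAbs ε (k (r * e))) * conj e
  have hs0 : ∀ r : ℝ, (2 * smoothAbs ε (k (r * e)) : ℂ) ≠ 0 := fun r => by
    exact_mod_cast (mul_pos two_pos (smoothAbs_pos hε _)).ne'
  have hsC : ContinuousOn (fun r : ℝ => (smoothAbs ε (k (r * e)) : ℂ)) (Icc 0 1) :=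
    continuous_ofReal.comp_continuousOn hs
  have hqc : ContinuousOn q (Icc 0 1) :=
    (((hk1.mul (continuous_conj.comp_continuousOn hkc)).div (continuousOn_const.mul hsC)
      fun r _ => hs0 r).mul continuousOn_const).add
    (((hkc.mul (continuous_conj.comp_continuousOn hk1)).div (continuousOn_const.mul hsC)
      fun r _ => hs0 r).mul continuousOn_const)
  have hqn : ∀ r : ℝ, ‖q r‖ ≤ ‖deriv k (r * e)‖ := by
    intro r
    refine (norm_add_le _ _).trans ?_
    have hp := smoothAbs_pos hε (k (r * e))
    have hle := norm_le_smoothAbs ε (k (r * e))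
    simp only [norm_mul, norm_div, RCLike.norm_conj, he, mul_one, norm_real, Real.norm_eq_abs,
      abs_of_pos hp, RCLike.norm_ofNat]
    rw [← add_div, div_le_iff₀ (by positivity)]
    nlinarith [norm_nonneg (deriv k (r * e))]
  have hd : ∀ r ∈ Icc (0 : ℝ) 1, HasDerivAt
      (fun r : ℝ => ((r : ℂ) - 1) * (smoothAbs ε (k (r * e)) : ℂ))
      (smoothAbs ε (k (r * e)) + ((r : ℂ) - 1) * q r) r := by
    intro r hr
    have h1 := HasWirt.comp_curve (γ := fun s : ℝ => (s : ℂ) * e)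
      (hasWirt_smoothAbs hε (hk.hasDerivAt_closedBall (hmem r hr))) (hasDerivAt_ofReal_mul_const e r)
    have h2 := ((HasDerivAt.ofReal_comp (hasDerivAt_id r)).sub_const (1 : ℂ)).mul h1
    refine h2.congr_deriv ?_
    simp [q]
  have hi1 : IntervalIntegrable (fun r : ℝ => (smoothAbs ε (k (r * e)) : ℂ)) volume 0 1 :=
    hsC.intervalIntegrable_of_Icc zero_le_one
  have hi2 : IntervalIntegrable (fun r : ℝ => ((r : ℂ) - 1) * q r) volume 0 1 :=
    (ContinuousOn.mul (by fun_prop) hqc).intervalIntegrable_of_Icc zero_le_one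
  have h := intervalIntegral.integral_eq_sub_of_hasDerivAt
    (fun r hr => hd r (by rwa [uIcc_of_le zero_le_one] at hr)) (hi1.add hi2)
  rw [intervalIntegral.integral_add hi1 hi2, intervalIntegral.integral_ofReal] at h
  simp only [ofReal_one, sub_self, zero_mul, ofReal_zero, zero_sub, neg_mul, one_mul,
    sub_neg_eq_add, zero_add] at h
  have h3 : ‖∫ r in (0 : ℝ)..1, ((r : ℂ) - 1) * q r‖ ≤
      ∫ r in (0 : ℝ)..1, (1 - ‖(r : ℂ) * e‖ ^ 2) * ‖deriv k (r * e)‖ := by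
    refine (intervalIntegral.norm_integral_le_integral_norm zero_le_one).trans ?_
    refine intervalIntegral.integral_mono_on zero_le_one hi2.norm
      ((ContinuousOn.mul (by fun_prop) hk1.norm).intervalIntegrable_of_Icc zero_le_one) ?_
    intro r hr
    have e1 : ‖(r : ℂ) - 1‖ = 1 - r := by
      rw [← ofReal_one, ← ofReal_sub, norm_real, Real.norm_eq_abs, abs_of_nonpos (by linarith [hr.2])]
      ring
    have e2 : ‖(r : ℂ) * e‖ = r := by simp [he, abs_of_nonneg hr.1]
    rw [norm_mul, e1, e2]
    refine mul_le_mul ?_ (hqn r) (norm_nonneg _) ?_ <;> nlinarith [hr.1, hr.2]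
  have h4 : (∫ r in (0 : ℝ)..1, smoothAbs ε (k (r * e))) =
      (smoothAbs ε (k 0) : ℝ) - (∫ r in (0 : ℝ)..1, ((r : ℂ) - 1) * q r).re := by
    have := congrArg re h
    simp only [add_re, ofReal_re] at this
    linarith
  rw [h4]
  have := neg_le_of_abs_le ((abs_re_le_norm _).trans h3)
  linarith

lemma inv_norm_smoothAbs_le (hε : 0 < ε) (hk : AnalyticOnNhd ℂ k (closedBall 0 1)) :
    ∫ w in ball (0 : ℂ) 1, ‖w‖⁻¹ * smoothAbs ε (k w) ≤
      2 * π * smoothAbs ε (k 0) +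
        ∫ w in ball (0 : ℂ) 1, ‖w‖⁻¹ * ((1 - ‖w‖ ^ 2) * ‖deriv k w‖) := by
  have hs := continuousOn_smoothAbs_comp (ε := ε) hk
  have hd : ContinuousOn (fun w : ℂ => (1 - ‖w‖ ^ 2) * ‖deriv k w‖) (closedBall 0 1) :=
    ContinuousOn.mul (by fun_prop) hk.deriv.continuousOn.norm
  have hintg : ∀ {g : ℂ → ℝ}, ContinuousOn g (closedBall 0 1) → IntervalIntegrable
      (fun θ : ℝ => ∫ r in (0 : ℝ)..1, g (r * circleMap 0 1 θ)) volume (-π) π := by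
    intro g hg
    have hi := integrable_polar hg
    rw [IntegrableOn, Measure.volume_eq_prod, ← Measure.prod_restrict] at hi
    rw [intervalIntegrable_iff_integrableOn_Ioc_of_le (by linarith [Real.pi_pos])]
    refine hi.integral_prod_right.congr (Eventually.of_forall fun θ => ?_)
    simp only
    rw [intervalIntegral.integral_of_le zero_le_one]
  rw [setIntegral_inv_norm_mul hs, setIntegral_inv_norm_mul hd]
  have h := intervalIntegral.integral_mono_on (by linarith [Real.pi_pos]) (hintg hs)
    ((intervalIntegrable_const (c := smoothAbs ε (k 0))).add (hintg hd))
    fun θ _ => smoothAbs_radial_le hε hk (norm_circleMap_zero_one θ)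
  rw [intervalIntegral.integral_add intervalIntegrable_const (hintg hd)] at h
  refine h.trans (le_of_eq ?_)
  rw [intervalIntegral.integral_const, smul_eq_mul]; ring

lemma poleKer_smoothAbs_le (hε : 0 < ε) (hk : AnalyticOnNhd ℂ k (closedBall 0 1)) {ζ : ℂ}
    (hζ : ζ ∈ ball (0 : ℂ) 1) :
    ∫ ξ in ball (0 : ℂ) 1, poleKer ζ ξ * smoothAbs ε (k ξ) ≤ 2 * π * smoothAbs ε (k ζ) +
      ∫ ξ in ball (0 : ℂ) 1, poleKer ζ ξ * ((1 - ‖ξ‖ ^ 2) * ‖deriv k ξ‖) := by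
  rw [setIntegral_poleKer_mul hζ, setIntegral_poleKer_mul hζ]
  have hkm : AnalyticOnNhd ℂ (fun w => k (moeb ζ w)) (closedBall 0 1) := fun w hw =>
    (hk _ (moeb_mem_closedBall hζ hw)).comp (analyticAt_moeb hζ hw)
  have h := inv_norm_smoothAbs_le hε hkm
  have e0 : moeb ζ 0 = ζ := by simp [moeb]
  rw [e0] at h
  refine h.trans (le_of_eq ?_)
  congr 1
  refine setIntegral_congr_fun measurableSet_ball fun w hw => ?_
  have hw' := ball_subset_closedBall hw
  have hd := (HasDerivAt.comp w (hk.hasDerivAt_closedBall (moeb_mem_closedBall hζ hw'))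
    (hasDerivAt_moeb hζ hw')).deriv
  have hd' : deriv (fun w => k (moeb ζ w)) w = _ := hd
  rw [hd', one_sub_normSq_moeb hζ hw', norm_mul, norm_div, norm_pow, norm_real, Real.norm_eq_abs,
    abs_of_pos (one_sub_normSq_pos hζ)]
  ring

end

lemma measurable_poleKer : Measurable fun p : ℂ × ℂ => poleKer p.1 p.2 := by
  unfold poleKer
  refine Measurable.div (Continuous.measurable (by fun_prop)) (Continuous.measurable (by fun_prop))

instance : IsFiniteMeasure (volume.restrict (ball (0 : ℂ) 1)) :=
  ⟨by simp [measure_ball_lt_top]⟩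

lemma aestronglyMeasurable_poleKer_mul {g : ℂ → ℝ} (hg : ContinuousOn g (closedBall 0 1)) :
    AEStronglyMeasurable (fun p : ℂ × ℂ => poleKer p.1 p.2 * g p.2)
      ((volume.restrict (ball (0 : ℂ) 1)).prod (volume.restrict (ball (0 : ℂ) 1))) :=
  measurable_poleKer.aestronglyMeasurable.mul
    (((hg.mono ball_subset_closedBall).aestronglyMeasurable measurableSet_ball).comp_snd)

/-- The potential of a continuous function is integrable against bounded continuous weights. -/
lemma integrableOn_mul_poleKer_potential {g h : ℂ → ℝ} (hg : ContinuousOn g (closedBall 0 1))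
    (hh : ContinuousOn h (closedBall 0 1)) :
    IntegrableOn (fun ζ => h ζ * ∫ ξ in ball (0 : ℂ) 1, poleKer ζ ξ * g ξ) (ball 0 1) := by
  obtain ⟨C, hC⟩ := (isCompact_closedBall (0 : ℂ) 1).exists_bound_of_continuousOn hg
  have hb : IntegrableOn (fun ζ => ∫ ξ in ball (0 : ℂ) 1, poleKer ζ ξ * g ξ) (ball 0 1) := by
    refine Integrable.of_bound (C := 2 * π * C)
      (aestronglyMeasurable_poleKer_mul hg).integral_prod_right' ?_
    refine (ae_restrict_mem measurableSet_ball).mono fun ζ hζ => ?_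
    refine (norm_integral_le_integral_norm _).trans ?_
    rw [← setIntegral_poleKer hζ, ← integral_mul_const]
    refine setIntegral_ball_mono (integrableOn_poleKer_mul hζ hg).norm ?_ fun ξ hξ => ?_
    · exact integrableOn_poleKer_mul hζ continuousOn_const
    · rw [norm_mul, Real.norm_of_nonneg (poleKer_nonneg _ _)]
      exact mul_le_mul_of_nonneg_left (hC ξ hξ) (poleKer_nonneg _ _)
  obtain ⟨C', hC'⟩ := (isCompact_closedBall (0 : ℂ) 1).exists_bound_of_continuousOn hh
  exact hb.bdd_mul (c := C') ((hh.mono ball_subset_closedBall).aestronglyMeasurable measurableSet_ball)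
    ((ae_restrict_mem measurableSet_ball).mono fun ξ hξ => hC' ξ (ball_subset_closedBall hξ))

section
variable {ε M : ℝ} {F k : ℂ → ℂ}

lemma poleKer_smoothAbs_le_of_absorb (hε : 0 < ε) (hk : AnalyticOnNhd ℂ k (closedBall 0 1)) {ζ : ℂ}
    (hζ : ζ ∈ ball (0 : ℂ) 1) :
    ∫ ξ in ball (0 : ℂ) 1, poleKer ζ ξ * smoothAbs ε (k ξ) ≤ 4 * π * smoothAbs ε (k ζ) +
      ∫ ξ in ball (0 : ℂ) 1, poleKer ζ ξ *
        ((1 - ‖ξ‖ ^ 2) ^ 2 * (‖deriv k ξ‖ ^ 2 / smoothAbs ε (k ξ))) := by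
  have h := poleKer_smoothAbs_le hε hk hζ
  have hs := continuousOn_smoothAbs_comp (ε := ε) hk
  have hE : ContinuousOn (fun ξ : ℂ => (1 - ‖ξ‖ ^ 2) ^ 2 * (‖deriv k ξ‖ ^ 2 / smoothAbs ε (k ξ)))
      (closedBall 0 1) := ContinuousOn.mul (by fun_prop)
        ((hk.deriv.continuousOn.norm.pow 2).div hs fun z _ => (smoothAbs_pos hε _).ne')
  have hd : ContinuousOn (fun ξ : ℂ => (1 - ‖ξ‖ ^ 2) * ‖deriv k ξ‖) (closedBall 0 1) :=
    ContinuousOn.mul (by fun_prop) hk.deriv.continuousOn.norm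
  have i1 := (integrableOn_poleKer_mul hζ hs).const_mul (1 / 2)
  have i2 := (integrableOn_poleKer_mul hζ hE).const_mul (1 / 2)
  have h2 : ∫ ξ in ball (0 : ℂ) 1, poleKer ζ ξ * ((1 - ‖ξ‖ ^ 2) * ‖deriv k ξ‖) ≤
      ∫ ξ in ball (0 : ℂ) 1, (1 / 2 * (poleKer ζ ξ * smoothAbs ε (k ξ)) +
        1 / 2 * (poleKer ζ ξ * ((1 - ‖ξ‖ ^ 2) ^ 2 * (‖deriv k ξ‖ ^ 2 / smoothAbs ε (k ξ))))) := by
    refine setIntegral_ball_mono (integrableOn_poleKer_mul hζ hd) (i1.add i2) fun ξ _ => ?_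
    rw [show ∀ a b c : ℝ, 1 / 2 * (a * b) + 1 / 2 * (a * c) = a * (1 / 2 * (b + c)) by intros; ring]
    refine mul_le_mul_of_nonneg_left ?_ (poleKer_nonneg _ _)
    have hp := smoothAbs_pos hε (k ξ)
    have e : smoothAbs ε (k ξ) + (1 - ‖ξ‖ ^ 2) ^ 2 * (‖deriv k ξ‖ ^ 2 / smoothAbs ε (k ξ)) -
        2 * ((1 - ‖ξ‖ ^ 2) * ‖deriv k ξ‖) =
        (smoothAbs ε (k ξ) - (1 - ‖ξ‖ ^ 2) * ‖deriv k ξ‖) ^ 2 / smoothAbs ε (k ξ) := by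
      field_simp; ring
    have : 0 ≤ (smoothAbs ε (k ξ) - (1 - ‖ξ‖ ^ 2) * ‖deriv k ξ‖) ^ 2 / smoothAbs ε (k ξ) := by
      positivity
    linarith
  rw [integral_add i1 i2, integral_const_mul, integral_const_mul] at h2
  linarith

lemma poleKer_carleson_swap (hε : 0 < ε) (hF : AnalyticOnNhd ℂ F (closedBall 0 1))
    (hM : ∀ z ∈ closedBall (0 : ℂ) 1, ‖F z‖ ≤ M) (hk : AnalyticOnNhd ℂ k (closedBall 0 1)) :
    ∫ ζ in ball (0 : ℂ) 1, (1 - ‖ζ‖ ^ 2) * ‖deriv F ζ‖ ^ 2 * (∫ ξ in ball (0 : ℂ) 1,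
      poleKer ζ ξ * ((1 - ‖ξ‖ ^ 2) ^ 2 * (‖deriv k ξ‖ ^ 2 / smoothAbs ε (k ξ)))) ≤
    8 * π * M ^ 2 * ∫ ξ in ball (0 : ℂ) 1, (1 - ‖ξ‖ ^ 2) * (‖deriv k ξ‖ ^ 2 / smoothAbs ε (k ξ)) := by
  have hs := continuousOn_smoothAbs_comp (ε := ε) hk
  let e : ℂ → ℝ := fun ξ => ‖deriv k ξ‖ ^ 2 / smoothAbs ε (k ξ)
  have he0 : ∀ ξ, 0 ≤ e ξ := fun ξ => by have := smoothAbs_pos hε (k ξ); positivity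
  have he : ContinuousOn e (closedBall 0 1) :=
    (hk.deriv.continuousOn.norm.pow 2).div hs fun z _ => (smoothAbs_pos hε _).ne'
  have hE : ContinuousOn (fun ξ : ℂ => (1 - ‖ξ‖ ^ 2) ^ 2 * e ξ) (closedBall 0 1) :=
    ContinuousOn.mul (by fun_prop) he
  let h : ℂ → ℝ := fun ζ => (1 - ‖ζ‖ ^ 2) * ‖deriv F ζ‖ ^ 2
  have hh : ContinuousOn h (closedBall 0 1) :=
    ContinuousOn.mul (by fun_prop) (hF.deriv.continuousOn.norm.pow 2)
  have hG : Integrable (fun p : ℂ × ℂ => h p.1 * (poleKer p.1 p.2 * ((1 - ‖p.2‖ ^ 2) ^ 2 * e p.2)))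
      ((volume.restrict (ball (0 : ℂ) 1)).prod (volume.restrict (ball (0 : ℂ) 1))) := by
    rw [integrable_prod_iff]
    · refine ⟨(ae_restrict_mem measurableSet_ball).mono fun ζ hζ =>
        (integrableOn_poleKer_mul hζ hE).const_mul (h ζ), ?_⟩
      refine (integrableOn_mul_poleKer_potential hE hh).congr ?_
      refine (ae_restrict_mem measurableSet_ball).mono fun ζ hζ => ?_
      simp only
      rw [← integral_const_mul]
      refine integral_congr_ae (Eventually.of_forall fun ξ => ?_)
      have h1 : 0 ≤ h ζ := mul_nonneg (one_sub_normSq_pos hζ).le (by positivity)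
      have h2 : 0 ≤ (1 - ‖ξ‖ ^ 2) ^ 2 * e ξ := mul_nonneg (by positivity) (he0 ξ)
      exact (Real.norm_of_nonneg (mul_nonneg h1 (mul_nonneg (poleKer_nonneg _ _) h2))).symm
    · exact (((hh.mono ball_subset_closedBall).aestronglyMeasurable measurableSet_ball).comp_fst).mul
        (aestronglyMeasurable_poleKer_mul hE)
  have hsw := integral_integral_swap
    (f := fun ζ ξ => h ζ * (poleKer ζ ξ * ((1 - ‖ξ‖ ^ 2) ^ 2 * e ξ))) hG
  simp only [integral_const_mul] at hsw
  change ∫ ζ in ball (0 : ℂ) 1, h ζ * (∫ ξ in ball (0 : ℂ) 1,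
    poleKer ζ ξ * ((1 - ‖ξ‖ ^ 2) ^ 2 * e ξ)) ≤ _
  rw [hsw, ← integral_const_mul]
  refine setIntegral_mono_on hG.integral_prod_right ?_ measurableSet_ball fun ξ hξ => ?_
  · exact (integrableOn_ball_of_continuousOn (ContinuousOn.mul (by fun_prop) he)).const_mul _
  have hξ0 := one_sub_normSq_pos hξ
  have hpt : ∀ ζ ∈ closedBall (0 : ℂ) 1, h ζ * (poleKer ζ ξ * ((1 - ‖ξ‖ ^ 2) ^ 2 * e ξ)) ≤
      4 * M ^ 2 * ((1 - ‖ξ‖ ^ 2) * e ξ) *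
        (poleKer ξ ζ * ((1 - ‖ζ‖ ^ 2) / (1 - ‖ξ‖ ^ 2))) := by
    intro ζ hζ
    have h1 := norm_deriv_le_of_bounded hF hM hζ
    have h2 := one_sub_normSq_nonneg hζ
    have h3 : ((1 - ‖ζ‖ ^ 2) * ‖deriv F ζ‖) ^ 2 ≤ (2 * M) ^ 2 := by
      gcongr
    have h4 : ‖1 - conj ζ * ξ‖ = ‖1 - conj ξ * ζ‖ := by
      rw [← RCLike.norm_conj]; simp [mul_comm]
    simp only [h, poleKer]
    rw [h4, norm_sub_rev ξ ζ]
    set D := ‖1 - conj ξ * ζ‖ ^ 3 * ‖ζ - ξ‖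
    have hD : 0 ≤ D := by positivity
    have hee := he0 ξ
    calc _ = ((1 - ‖ζ‖ ^ 2) * ‖deriv F ζ‖) ^ 2 * ((1 - ‖ζ‖ ^ 2) * ((1 - ‖ξ‖ ^ 2) ^ 2 * e ξ) / D) := by
          ring
      _ ≤ (2 * M) ^ 2 * ((1 - ‖ζ‖ ^ 2) * ((1 - ‖ξ‖ ^ 2) ^ 2 * e ξ) / D) := by gcongr
      _ = _ := by field_simp; ring
  have hJ := setIntegral_poleKer_swap_le hξ
  have hi : IntegrableOn (fun ζ => poleKer ξ ζ * ((1 - ‖ζ‖ ^ 2) / (1 - ‖ξ‖ ^ 2))) (ball 0 1) :=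
    integrableOn_poleKer_mul hξ (by fun_prop)
  have hl : ∫ ζ in ball (0 : ℂ) 1, h ζ * (poleKer ζ ξ * ((1 - ‖ξ‖ ^ 2) ^ 2 * e ξ)) ≤
      ∫ ζ in ball (0 : ℂ) 1, 4 * M ^ 2 * ((1 - ‖ξ‖ ^ 2) * e ξ) *
        (poleKer ξ ζ * ((1 - ‖ζ‖ ^ 2) / (1 - ‖ξ‖ ^ 2))) := by
    refine integral_mono_of_nonneg ?_ (hi.const_mul _) ?_
    · refine (ae_restrict_mem measurableSet_ball).mono fun ζ hζ => ?_
      have h1 : 0 ≤ h ζ := mul_nonneg (one_sub_normSq_pos hζ).le (by positivity)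
      have h2 : 0 ≤ (1 - ‖ξ‖ ^ 2) ^ 2 * e ξ := mul_nonneg (by positivity) (he0 ξ)
      exact mul_nonneg h1 (mul_nonneg (poleKer_nonneg _ _) h2)
    · exact (ae_restrict_mem measurableSet_ball).mono fun ζ hζ => hpt ζ (ball_subset_closedBall hζ)
  rw [integral_const_mul] at hl
  refine hl.trans ?_
  have h5 : 0 ≤ 4 * M ^ 2 * ((1 - ‖ξ‖ ^ 2) * e ξ) := by
    have := he0 ξ; positivity
  have h6 := mul_le_mul_of_nonneg_left hJ h5
  refine h6.trans (le_of_eq ?_)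
  simp only [e]; ring

/-- Carleson estimate for averages of `|k|` over hyperbolic neighbourhoods. -/
theorem carleson_average_bound (hF : AnalyticOnNhd ℂ F (closedBall 0 1))
    (hM : ∀ z ∈ closedBall (0 : ℂ) 1, ‖F z‖ ≤ M) (hk : AnalyticOnNhd ℂ k (closedBall 0 1)) :
    ∫ ζ in ball (0 : ℂ) 1, (1 - ‖ζ‖ ^ 2) * ‖deriv F ζ‖ ^ 2 * (∫ ξ in ball (0 : ℂ) 1,
      poleKer ζ ξ * ‖k ξ‖) ≤ (2 * π * Real.exp (M ^ 2) + 16 * π * M ^ 2) * circInt fun z => ‖k z‖ := by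
  refine le_circInt_norm_of_forall_smoothAbs (by positivity) hk fun ε hε => ?_
  have hs := continuousOn_smoothAbs_comp (ε := ε) hk
  have hE : ContinuousOn (fun ξ : ℂ => (1 - ‖ξ‖ ^ 2) ^ 2 * (‖deriv k ξ‖ ^ 2 / smoothAbs ε (k ξ)))
      (closedBall 0 1) := ContinuousOn.mul (by fun_prop)
        ((hk.deriv.continuousOn.norm.pow 2).div hs fun z _ => (smoothAbs_pos hε _).ne')
  have hh : ContinuousOn (fun ζ : ℂ => (1 - ‖ζ‖ ^ 2) * ‖deriv F ζ‖ ^ 2) (closedBall 0 1) :=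
    ContinuousOn.mul (by fun_prop) (hF.deriv.continuousOn.norm.pow 2)
  have i1 : IntegrableOn (fun ζ : ℂ => 4 * π * ((1 - ‖ζ‖ ^ 2) * (‖deriv F ζ‖ ^ 2 *
      smoothAbs ε (k ζ)))) (ball 0 1) :=
    (integrableOn_ball_of_continuousOn (ContinuousOn.mul (by fun_prop)
      ((hF.deriv.continuousOn.norm.pow 2).mul hs))).const_mul _
  have i2 := integrableOn_mul_poleKer_potential hE hh
  have hle := setIntegral_mono_on (integrableOn_mul_poleKer_potential hk.continuousOn.norm hh)
    (i1.add i2) measurableSet_ball fun ζ hζ => by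
      have h1 : ∫ ξ in ball (0 : ℂ) 1, poleKer ζ ξ * ‖k ξ‖ ≤
          ∫ ξ in ball (0 : ℂ) 1, poleKer ζ ξ * smoothAbs ε (k ξ) :=
        setIntegral_ball_mono (integrableOn_poleKer_mul hζ hk.continuousOn.norm)
          (integrableOn_poleKer_mul hζ hs) fun ξ _ =>
            mul_le_mul_of_nonneg_left (norm_le_smoothAbs _ _) (poleKer_nonneg _ _)
      have h2 := h1.trans (poleKer_smoothAbs_le_of_absorb hε hk hζ)
      have h3 : 0 ≤ (1 - ‖ζ‖ ^ 2) * ‖deriv F ζ‖ ^ 2 :=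
        mul_nonneg (one_sub_normSq_pos hζ).le (by positivity)
      refine (mul_le_mul_of_nonneg_left h2 h3).trans (le_of_eq ?_)
      rw [Pi.add_apply, mul_add]
      congr 1
      ring
  refine hle.trans ?_
  simp only [Pi.add_apply]
  rw [integral_add i1 i2, integral_const_mul]
  have l1 := littlewood_paley_bounded hε hF hM hk
  have l2 := (littlewood_paley_smoothAbs hε hk).1
  have l3 := poleKer_carleson_swap hε hF hM hk
  have l4 := mul_le_mul_of_nonneg_left l1 (show 0 ≤ 4 * π by positivity)
  have l5 := mul_le_mul_of_nonneg_left l2 (show 0 ≤ 8 * π * M ^ 2 by positivity)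
  linarith

end

/-- Wolff's estimate against the kernel `(1-|z|²)/((ξ-z)(1-z̄ξ))`. -/
theorem wolff_pole_bound {ι : Type*} [Fintype ι] (M C₀ C₁ : ℝ) (hC₀ : 0 ≤ C₀) (hC₁ : 0 ≤ C₁) :
    ∃ C, 0 ≤ C ∧ ∀ (F : ι → ℂ → ℂ) (f T a b : ℂ → ℂ) (z : ℂ),
      (∀ j, AnalyticOnNhd ℂ (F j) (closedBall 0 1)) →
      (∀ j, ∀ z ∈ closedBall (0 : ℂ) 1, ‖F j z‖ ≤ M) →
      AnalyticOnNhd ℂ f (closedBall 0 1) →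
      (∀ z ∈ closedBall (0 : ℂ) 1, ‖f z‖ ≤ M) →
      (∀ z ∈ closedBall (0 : ℂ) 1, HasWirt T (a z) (b z) z) →
      ContinuousOn a (closedBall 0 1) → ContinuousOn b (closedBall 0 1) →
      (∀ z ∈ closedBall (0 : ℂ) 1, ‖T z‖ ≤ C₀) →
      (∀ z ∈ closedBall (0 : ℂ) 1, ‖a z‖ ^ 2 ≤ C₁ * ∑ j, ‖deriv (F j) z‖ ^ 2) →
      z ∈ ball (0 : ℂ) 1 →
      ‖∫ ξ in ball (0 : ℂ) 1, T ξ * conj (deriv f ξ) *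
        (((1 - ‖z‖ ^ 2 : ℝ) : ℂ) / ((ξ - z) * (1 - conj z * ξ)))‖ ≤ C := by
  obtain ⟨C, hC, hW⟩ := wolff_bound (ι := ι) M C₀ C₁ hC₀ hC₁
  refine ⟨C * (2 * π) + C₀ * (2 * |M|) * (2 * π), by positivity, ?_⟩
  intro F f T a b z hF hFM hf hfM hT ha hb hT0 ha1 hz
  have hTc : ContinuousOn T (closedBall 0 1) := fun z hz => (hT z hz).continuousAt.continuousWithinAt
  have hz' := ball_subset_closedBall hz
  have hz0 := one_sub_normSq_pos hz
  have hne : ∀ ξ ∈ closedBall (0 : ℂ) 1, 1 - conj z * ξ ≠ 0 := fun ξ hξ =>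
    one_sub_conj_mul_ne_zero hz hξ
  let κ : ℂ → ℂ := fun ξ => ((1 - ‖z‖ ^ 2 : ℝ) : ℂ) / (1 - conj z * ξ) ^ 2
  have hκ : AnalyticOnNhd ℂ κ (closedBall 0 1) := fun ξ hξ => by
    have := pow_ne_zero 2 (hne ξ hξ)
    simp only [κ]
    fun_prop (disch := assumption)
  have hκi : (circInt fun ξ => ‖κ ξ‖) = 2 * π := by
    rw [← circInt_poisson hz]
    refine circInt_congr fun ξ _ => ?_
    simp only [κ]
    rw [norm_div, norm_pow, norm_real, Real.norm_eq_abs, abs_of_pos hz0]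
  -- the automorphism sending `z` to `0`
  have hτ : ∀ ξ ∈ closedBall (0 : ℂ) 1, moeb (-z) ξ = (ξ - z) / (1 - conj z * ξ) := fun ξ _ => by
    simp [moeb, sub_eq_add_neg]
  have hmz := neg_mem_ball hz
  have hτa : ∀ ξ ∈ closedBall (0 : ℂ) 1, HasWirt (fun ξ => T ξ * conj (moeb (-z) ξ))
      (a ξ * conj (moeb (-z) ξ))
      (b ξ * conj (moeb (-z) ξ) + T ξ * conj (((1 - ‖z‖ ^ 2 : ℝ) : ℂ) / (1 - conj z * ξ) ^ 2)) ξ := by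
    intro ξ hξ
    refine ((hT ξ hξ).mul (HasWirt.of_hasDerivAt (hasDerivAt_moeb hmz hξ)).star).congr_coeff
      (by simp) ?_
    simp [sub_eq_add_neg]
  have hτc : ContinuousOn (moeb (-z)) (closedBall 0 1) := fun ξ hξ =>
    (analyticAt_moeb hmz hξ).continuousAt.continuousWithinAt
  have hτcc := continuous_conj.comp_continuousOn hτc
  have hτn : ∀ ξ ∈ closedBall (0 : ℂ) 1, ‖moeb (-z) ξ‖ ≤ 1 := fun ξ hξ =>
    mem_closedBall_zero_iff.1 (moeb_mem_closedBall hmz hξ)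
  have h1 := hW F f (fun ξ => T ξ * conj (moeb (-z) ξ)) _ _ κ hF hFM hf hfM hτa
    (ha.mul hτcc) ((hb.mul hτcc).add (hTc.mul (continuous_conj.comp_continuousOn hκ.continuousOn)))
    (fun ξ hξ => by
      rw [norm_mul, RCLike.norm_conj]
      exact (mul_le_of_le_one_right (norm_nonneg _) (hτn ξ hξ)).trans (hT0 ξ hξ))
    (fun ξ hξ => by
      rw [norm_mul, RCLike.norm_conj]
      refine le_trans ?_ (ha1 ξ hξ)
      have := mul_le_of_le_one_right (norm_nonneg (a ξ)) (hτn ξ hξ)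
      gcongr)
    hκ
  rw [hκi] at h1
  -- the remainder is dominated by the kernel
  let r : ℂ → ℂ := fun ξ => T ξ * conj (deriv f ξ) *
    (((1 - ‖z‖ ^ 2 : ℝ) : ℂ) / ((ξ - z) * (1 - conj z * ξ)) - conj (moeb (-z) ξ) * κ ξ)
  have hr : ∀ ξ ∈ ball (0 : ℂ) 1, ξ ≠ z → ‖r ξ‖ ≤ C₀ * (2 * |M|) * poleKer z ξ := by
    intro ξ hξ hξz
    have hξ' := ball_subset_closedBall hξ
    have hn := hne ξ hξ'
    have hs : ξ - z ≠ 0 := sub_ne_zero.2 hξz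
    have hξ0 := one_sub_normSq_pos hξ
    have e : ((1 - ‖z‖ ^ 2 : ℝ) : ℂ) / ((ξ - z) * (1 - conj z * ξ)) - conj (moeb (-z) ξ) * κ ξ =
        κ ξ * ((1 - conj z * ξ) / (ξ - z)) * ((1 - ‖moeb (-z) ξ‖ ^ 2 : ℝ) : ℂ) := by
      rw [ofReal_one_sub_normSq (moeb (-z) ξ)]
      generalize hw : conj (moeb (-z) ξ) = w
      rw [hτ ξ hξ']
      simp only [κ]
      clear_value κ r
      generalize 1 - conj z * ξ = D at hn ⊢
      generalize ξ - z = S at hs ⊢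
      field_simp
    have e2 := one_sub_normSq_moeb hmz hξ'
    rw [map_neg, neg_mul, ← sub_eq_add_neg, norm_neg] at e2
    have e3 : ‖r ξ‖ = ‖T ξ‖ * ((1 - ‖ξ‖ ^ 2) * ‖deriv f ξ‖) * poleKer z ξ := by
      simp only [r]
      rw [e, e2]
      simp only [κ, poleKer, norm_mul, norm_div, norm_pow, norm_real, Real.norm_eq_abs,
        RCLike.norm_conj, abs_of_pos hz0, abs_of_pos hξ0, abs_norm, abs_div, abs_mul, abs_pow]
      have := norm_pos_iff.2 hn
      have := norm_pos_iff.2 hs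
      field_simp
    rw [e3]
    have h3 := norm_deriv_le_of_bounded hf hfM hξ'
    refine mul_le_mul_of_nonneg_right ?_ (poleKer_nonneg _ _)
    refine mul_le_mul (hT0 ξ hξ') (h3.trans ?_) (by positivity) hC₀
    linarith [le_abs_self M]
  have hnez : ∀ᵐ ξ ∂(volume.restrict (ball (0 : ℂ) 1)), ξ ≠ z :=
    ae_restrict_of_ae (Measure.ae_ne volume z)
  have hk1 : IntegrableOn (fun ξ => poleKer z ξ) (ball 0 1) := by
    simpa using integrableOn_poleKer_mul hz (g := fun _ => 1) continuousOn_const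
  have hbd : ∀ᵐ ξ ∂(volume.restrict (ball (0 : ℂ) 1)), ‖r ξ‖ ≤ C₀ * (2 * |M|) * poleKer z ξ := by
    filter_upwards [ae_restrict_mem measurableSet_ball, hnez] with ξ h h' using hr ξ h h'
  have hmain : ContinuousOn (fun ξ => T ξ * conj (moeb (-z) ξ) * conj (deriv f ξ) * κ ξ)
      (closedBall 0 1) :=
    ((hTc.mul hτcc).mul (continuous_conj.comp_continuousOn hf.deriv.continuousOn)).mul hκ.continuousOn
  have hf1m : AEStronglyMeasurable (fun ξ => T ξ * conj (deriv f ξ))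
      (volume.restrict (ball (0 : ℂ) 1)) :=
    (((hTc.mul (continuous_conj.comp_continuousOn hf.deriv.continuousOn))).mono
      ball_subset_closedBall).aestronglyMeasurable measurableSet_ball
  have hrm : AEStronglyMeasurable r (volume.restrict (ball (0 : ℂ) 1)) := by
    refine hf1m.mul (AEStronglyMeasurable.sub ?_ ?_)
    · refine Measurable.aestronglyMeasurable ?_
      exact measurable_const.div (Continuous.measurable (by fun_prop))
    · exact ((hτcc.mul hκ.continuousOn).mono ball_subset_closedBall).aestronglyMeasurable
        measurableSet_ball
  have hri : IntegrableOn r (ball 0 1) := Integrable.mono' (hk1.const_mul _) hrm hbd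
  have hsplit : ∫ ξ in ball (0 : ℂ) 1, T ξ * conj (deriv f ξ) *
        (((1 - ‖z‖ ^ 2 : ℝ) : ℂ) / ((ξ - z) * (1 - conj z * ξ))) =
      (∫ ξ in ball (0 : ℂ) 1, T ξ * conj (moeb (-z) ξ) * conj (deriv f ξ) * κ ξ) +
        ∫ ξ in ball (0 : ℂ) 1, r ξ := by
    rw [← integral_add (integrableOn_ball_of_continuousOn hmain) hri]
    congr 1
    funext ξ
    simp only [r]; ring
  rw [hsplit]
  refine (norm_add_le _ _).trans (add_le_add h1 ?_)
  refine (norm_integral_le_integral_norm _).trans ?_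
  refine (integral_mono_ae hri.norm (hk1.const_mul _) hbd).trans (le_of_eq ?_)
  rw [integral_const_mul, setIntegral_poleKer hz]

open scoped Convolution

lemma clm_ext_one_I {E : Type*} [AddCommGroup E] [Module ℝ E] [TopologicalSpace E]
    {f g : ℂ →L[ℝ] E} (h1 : f 1 = g 1) (hI : f I = g I) : f = g := by
  ext v
  have : v = v.re • (1 : ℂ) + v.im • I := by simp
  rw [this]
  simp only [map_add, map_smul, h1, hI]

lemma eq_wirtMap (f : ℂ →L[ℝ] ℂ) : f = wirtMap ((f 1 - I * f I) / 2) ((f 1 + I * f I) / 2) := by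
  refine clm_ext_one_I ?_ ?_
  · simp; ring
  · simp only [wirtMap_apply, conj_I]
    linear_combination (f I) * I_sq

lemma wirtMap_eq_zero {a b : ℂ} (h : wirtMap a b = 0) : a = 0 ∧ b = 0 := by
  have h1 : a + b = 0 := by simpa using DFunLike.congr_fun h 1
  have h2 := DFunLike.congr_fun h I
  simp only [wirtMap_apply, conj_I, ContinuousLinearMap.zero_apply] at h2
  have h3 : a - b = 0 := by
    have : (a - b) * I = 0 := by rw [← h2]; ring
    simpa using this
  constructor
  · linear_combination (h1 + h3) / 2
  · linear_combination (h1 - h3) / 2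

lemma HasWirt.unique {f : ℂ → ℂ} {a b c d z : ℂ} (h : HasWirt f a b z) (h' : HasWirt f c d z) :
    a = c ∧ b = d := by
  have e : wirtMap (a - c) (b - d) = 0 := by
    rw [← sub_eq_zero.2 (HasFDerivAt.unique h h')]
    ext
    simp
    ring
  have := wirtMap_eq_zero e
  exact ⟨sub_eq_zero.1 this.1, sub_eq_zero.1 this.2⟩

lemma HasWirt.hasDerivAt {f : ℂ → ℂ} {a z : ℂ} (h : HasWirt f a 0 z) : HasDerivAt f a z := by
  have h1 : wirtMap a 0 = ((ContinuousLinearMap.toSpanSingleton ℂ a)).restrictScalars ℝ := by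
    ext <;> simp [mul_comm]
  rw [HasWirt, h1] at h
  exact hasFDerivAt_of_restrictScalars ℝ h rfl

lemma locallyIntegrable_inv : LocallyIntegrable (fun z : ℂ => z⁻¹) := by
  intro z
  refine ⟨ball 0 (‖z‖ + 1), isOpen_ball.mem_nhds (by simp), ?_⟩
  have := integrableOn_inv_norm_sub 0 (‖z‖ + 1)
  refine (integrable_norm_iff (by fun_prop)).1 ?_
  simpa [IntegrableOn] using this

/-- The Cauchy transform solves `∂̄u = g` for compactly supported `C¹` data. -/
lemma exists_wirt_solution_of_hasCompactSupport {g a b : ℂ → ℂ} (hg : HasCompactSupport g)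
    (hw : ∀ z, HasWirt g (a z) (b z) z) (ha : Continuous a) (hb : Continuous b) :
    ∃ u p : ℂ → ℂ, Continuous p ∧ ∀ z, HasWirt u (p z) (g z) z := by
  have hfd : ∀ z, fderiv ℝ g z = wirtMap (a z) (b z) := fun z => HasFDerivAt.fderiv (hw z)
  have hW : Continuous fun z => wirtMap (a z) (b z) := by
    unfold wirtMap; fun_prop
  have hC : ContDiff ℝ 1 g := contDiff_one_iff_hasFDerivAt.2 ⟨_, hW, hw⟩
  have hsup : ∀ z, z ∉ tsupport g → a z = 0 ∧ b z = 0 := fun z hz => by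
    refine wirtMap_eq_zero ?_
    rw [← hfd]
    exact image_eq_zero_of_notMem_tsupport fun h => hz (tsupport_fderiv_subset ℝ h)
  have hac : HasCompactSupport a := hg.of_isClosed_subset (isClosed_tsupport _) <|
    closure_minimal (fun z hz => by_contra fun h => hz (hsup z h).1) (isClosed_tsupport _)
  have hbc : HasCompactSupport b := hg.of_isClosed_subset (isClosed_tsupport _) <|
    closure_minimal (fun z hz => by_contra fun h => hz (hsup z h).2) (isClosed_tsupport _)
  let L := ContinuousLinearMap.mul ℝ ℂ
  let k : ℂ → ℂ := fun z => z⁻¹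
  have hk : LocallyIntegrable k := locallyIntegrable_inv
  have hL : ∀ (h : ℂ → ℂ) x, (k ⋆[L] h) x = ∫ t, t⁻¹ * h (x - t) := fun h x => rfl
  have hintg : ∀ (h : ℂ → ℂ), HasCompactSupport h → Continuous h → ∀ x,
      Integrable fun t => t⁻¹ * h (x - t) := fun h h1 h2 x =>
    h1.convolutionExists_right L hk h2 x
  have hder : ∀ x, HasWirt (k ⋆[L] g) ((k ⋆[L] a) x) ((k ⋆[L] b) x) x := by
    intro x
    have h := hg.hasFDerivAt_convolution_right L hk hC x
    refine HasFDerivAt.congr_fderiv h (ContinuousLinearMap.ext fun v => ?_)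
    rw [convolution_precompR_apply L hk (hg.fderiv ℝ) (hC.continuous_fderiv one_ne_zero), hL,
      wirtMap_apply, hL, hL]
    simp only [hfd, wirtMap_apply]
    rw [← integral_mul_const, ← integral_mul_const, ← integral_add]
    · congr 1; ext t; ring
    · exact (hintg a hac ha x).mul_const v
    · exact (hintg b hbc hb x).mul_const (conj v)
  have hval : ∀ z, (k ⋆[L] b) z = π * g z := by
    intro z
    obtain ⟨R, hR⟩ := hg.isBounded.subset_ball (0 : ℂ)
    let S : ℝ := |R| + ‖z‖ + 1
    have hS : 0 < S := by positivity
    have hout : ∀ ξ : ℂ, 1 ≤ ‖ξ‖ → z - S * ξ ∉ tsupport g := by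
      intro ξ hξ h
      have h1 := mem_ball_zero_iff.1 (hR h)
      have h2 := norm_sub_norm_le (S * ξ : ℂ) z
      rw [norm_mul, norm_real, Real.norm_of_nonneg hS.le, norm_sub_rev] at h2
      have h3 : S ≤ S * ‖ξ‖ := le_mul_of_one_le_right hS.le hξ
      have := le_abs_self R
      simp only [S] at h2 h3
      linarith
    have hG : ∀ ξ, HasWirt (fun ξ : ℂ => g (z + (-S : ℂ) * ξ)) (a (z + (-S : ℂ) * ξ) * (-S))
        (b (z + (-S : ℂ) * ξ) * conj (-S : ℂ)) ξ := by
      intro ξ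
      refine (hw (z + (-S : ℂ) * ξ)).comp_inner (k := fun ξ => z + (-S : ℂ) * ξ) (k' := -S) ?_
      simpa using ((hasDerivAt_id ξ).const_mul (-S : ℂ)).const_add z
    have h := cauchy_pompeiu (z := 0) (fun ξ _ => hG ξ)
      (by fun_prop) (by fun_prop) (by simp)
    have hz0 : (circInt fun ζ => g (z + (-S : ℂ) * ζ) * (ζ / (ζ - 0))) = 0 := by
      rw [circInt_congr (G := fun _ => (0 : ℂ))]
      · simp [circInt]
      · intro ζ hζ
        have := image_eq_zero_of_notMem_tsupport (hout ζ (mem_sphere_zero_iff_norm.1 hζ).ge)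
        rw [neg_mul, ← sub_eq_add_neg, this, zero_mul]
    rw [hz0] at h
    simp only [mul_zero, add_zero, zero_sub, sub_zero] at h
    rw [h, setIntegral_eq_integral_of_forall_compl_eq_zero]
    · have h5 := Measure.integral_comp_smul (volume : Measure ℂ) (fun t => t⁻¹ * b (z - t)) S
      rw [Complex.finrank_real_complex, abs_of_pos (by positivity)] at h5
      rw [hL, ← integral_neg]
      have hS' : (S : ℂ) ≠ 0 := by exact_mod_cast hS.ne'
      have h6 : (∫ t, t⁻¹ * b (z - t)) = (S : ℂ) ^ 2 * ∫ x : ℂ, (S • x)⁻¹ * b (z - S • x) := by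
        rw [h5, real_smul]
        push_cast
        field_simp
      rw [h6, ← integral_const_mul]
      congr 1
      ext ξ
      simp only [real_smul, map_neg, conj_ofReal, mul_inv, neg_mul, ← sub_eq_add_neg]
      field_simp
    · intro ξ hξ
      have := (hsup _ (hout ξ (by simpa using hξ))).2
      rw [neg_mul, ← sub_eq_add_neg, this]; simp
  refine ⟨fun z => (π : ℂ)⁻¹ * (k ⋆[L] g) z, fun z => (π : ℂ)⁻¹ * (k ⋆[L] a) z,
    continuous_const.mul (hac.continuous_convolution_right L hk ha), fun z => ?_⟩
  refine ((hder z).const_mul _).congr_coeff rfl ?_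
  have : (π : ℂ) ≠ 0 := by exact_mod_cast Real.pi_ne_zero
  rw [hval]; field_simp

/-- Local solution of `∂̄u = ω` near the closed disc. -/
lemma exists_wirt_solution {R : ℝ} (hR : 1 < R) {ω a b : ℂ → ℂ}
    (hw : ∀ z ∈ ball (0 : ℂ) R, HasWirt ω (a z) (b z) z)
    (ha : ContinuousOn a (ball 0 R)) (hb : ContinuousOn b (ball 0 R)) :
    ∃ u p : ℂ → ℂ, Continuous p ∧ ∀ z ∈ closedBall (0 : ℂ) 1, HasWirt u (p z) (ω z) z := by
  let χ : ContDiffBump (0 : ℂ) := ⟨1, (1 + R) / 2, one_pos, by linarith⟩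
  have hχ1 : ∀ z ∈ closedBall (0 : ℂ) 1, χ z = 1 := fun z hz => χ.one_of_mem_closedBall hz
  have hχ0 : ∀ z, z ∉ ball (0 : ℂ) R → (fun z => (χ z : ℂ)) =ᶠ[𝓝 z] fun _ => 0 := by
    intro z hz
    have : z ∈ (closedBall (0 : ℂ) ((1 + R) / 2))ᶜ := fun h => hz <| by
      simp only [mem_closedBall, mem_ball] at h ⊢; linarith
    filter_upwards [isClosed_closedBall.isOpen_compl.mem_nhds this] with y hy
    rw [χ.zero_of_le_dist (le_of_lt (by simpa using hy))]; simp
  have hχc : ContDiff ℝ 1 fun z => (χ z : ℂ) := (ofRealCLM.contDiff.comp χ.contDiff)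
  let cf := fderiv ℝ fun z => (χ z : ℂ)
  have hcf : Continuous cf := hχc.continuous_fderiv one_ne_zero
  let c : ℂ → ℂ := fun z => (cf z 1 - I * cf z I) / 2
  let d : ℂ → ℂ := fun z => (cf z 1 + I * cf z I) / 2
  have hχw : ∀ z, HasWirt (fun z => (χ z : ℂ)) (c z) (d z) z := fun z =>
    HasFDerivAt.congr_fderiv ((hχc.differentiable one_ne_zero z).hasFDerivAt) (eq_wirtMap (cf z))
  have hcc : Continuous c := by simp only [c]; fun_prop
  have hdc : Continuous d := by simp only [d]; fun_prop
  have hω : ContinuousOn ω (ball 0 R) := fun z hz => (hw z hz).continuousAt.continuousWithinAt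
  have hext2 : ∀ (e : ℂ → ℂ), Continuous e → (∀ z, z ∉ ball (0 : ℂ) R → e =ᶠ[𝓝 z] fun _ => 0) →
      ∀ h : ℂ → ℂ, ContinuousOn h (ball 0 R) → Continuous fun z => e z * h z := by
    intro e he he0 h hh
    refine continuous_iff_continuousAt.2 fun z => ?_
    by_cases hz : z ∈ ball (0 : ℂ) R
    · exact he.continuousAt.mul (hh.continuousAt (isOpen_ball.mem_nhds hz))
    · have e' : (fun z => e z * h z) =ᶠ[𝓝 z] fun _ => 0 := by
        filter_upwards [he0 z hz] with y hy
        rw [hy, zero_mul]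
      exact continuousAt_const.congr e'.symm
  have hd0 : ∀ z, z ∉ ball (0 : ℂ) R → c =ᶠ[𝓝 z] (fun _ => 0) ∧ d =ᶠ[𝓝 z] fun _ => 0 := by
    intro z hz
    have h1 : ∀ᶠ y in 𝓝 z, c y = 0 ∧ d y = 0 := by
      filter_upwards [(hχ0 z hz).eventually_nhds] with y hy
      exact (hχw y).unique (HasWirt.zero_of_eventuallyEq hy)
    exact ⟨h1.mono fun _ h => h.1, h1.mono fun _ h => h.2⟩
  have hcs : HasCompactSupport fun z => (χ z : ℂ) * ω z :=
    (χ.hasCompactSupport.comp_left (g := ((↑) : ℝ → ℂ)) ofReal_zero).mul_right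
  have hpw : ∀ z, HasWirt (fun z => (χ z : ℂ) * ω z) (c z * ω z + χ z * a z)
      (d z * ω z + χ z * b z) z := by
    intro z
    by_cases hz : z ∈ ball (0 : ℂ) R
    · exact (hχw z).mul (hw z hz)
    · have h0 := (hχ0 z hz).self_of_nhds
      simp only at h0
      refine (HasWirt.zero_of_eventuallyEq ?_).congr_coeff ?_ ?_
      · filter_upwards [hχ0 z hz] with y hy
        rw [hy, zero_mul]
      · rw [(hd0 z hz).1.self_of_nhds, h0]; simp
      · rw [(hd0 z hz).2.self_of_nhds, h0]; simp
  obtain ⟨u, p, hp, hu⟩ := exists_wirt_solution_of_hasCompactSupport hcs hpw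
    ((hext2 c hcc (fun z hz => (hd0 z hz).1) ω hω).add (hext2 _ hχc.continuous hχ0 a ha))
    ((hext2 d hdc (fun z hz => (hd0 z hz).2) ω hω).add (hext2 _ hχc.continuous hχ0 b hb))
  exact ⟨u, p, hp, fun z hz => (hu z).congr_coeff rfl (by rw [hχ1 z hz]; simp)⟩

/-- Functions on the plane whose restriction to the unit circle is continuous. -/
def circCont : Submodule ℂ (ℂ → ℂ) where
  carrier := {φ | ContinuousOn φ (sphere 0 1)}
  add_mem' h1 h2 := ContinuousOn.add h1 h2
  zero_mem' := continuousOn_const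
  smul_mem' c _ h := ContinuousOn.const_smul h c

/-- The `L¹` seminorm over the unit circle. -/
noncomputable def circSeminorm : Seminorm ℂ circCont where
  toFun φ := circInt fun z => ‖φ.1 z‖
  map_zero' := by simp [circInt]
  add_le' φ ψ := by
    rw [← circInt_add φ.2.norm ψ.2.norm]
    exact circInt_mono (φ.2.add ψ.2).norm (φ.2.norm.add ψ.2.norm) fun z _ => norm_add_le _ _
  neg' φ := by simp
  smul' c φ := by
    rw [← circInt_const_mul]
    simp

lemma circInt_le_of_norm_le {φ : ℂ → ℂ} (hφ : ContinuousOn φ (sphere 0 1)) {B : ℝ}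
    (h : ∀ z ∈ sphere (0 : ℂ) 1, ‖φ z‖ ≤ B) : (circInt fun z => ‖φ z‖) ≤ 2 * π * B := by
  rw [← circInt_const]
  exact circInt_mono hφ.norm continuousOn_const h

/-- The Cauchy kernel on the circle (zero for `z` outside the disc). -/
noncomputable def cauchyKer (z : ℂ) : circCont :=
  open scoped Classical in
  if h : z ∈ ball (0 : ℂ) 1 then ⟨fun ζ => ζ / (ζ - z), continuousOn_id.div (by fun_prop)
    fun ζ hζ e => by
      rw [sub_eq_zero.1 e, mem_sphere_zero_iff_norm] at hζ
      exact absurd (mem_ball_zero_iff.1 h) (by linarith)⟩ else 0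

lemma cauchyKer_apply {z : ℂ} (h : z ∈ ball (0 : ℂ) 1) (ζ : ℂ) :
    (cauchyKer z).1 ζ = ζ / (ζ - z) := by
  simp only [cauchyKer, dif_pos h]

/-- Continuous functionals of the Cauchy kernel are holomorphic. -/
lemma differentiableOn_cauchyKer (ℓ : circCont →ₗ[ℂ] ℂ) (B : ℝ)
    (hℓ : ∀ (φ : circCont) (N : ℝ), (∀ z ∈ sphere (0 : ℂ) 1, ‖φ.1 z‖ ≤ N) → ‖ℓ φ‖ ≤ B * N) :
    DifferentiableOn ℂ (fun z => ℓ (cauchyKer z)) (ball 0 1) := by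
  intro z hz
  have hz1 := mem_ball_zero_iff.1 hz
  have hne : ∀ ζ ∈ sphere (0 : ℂ) 1, ∀ w ∈ ball (0 : ℂ) 1, 1 - ‖w‖ ≤ ‖ζ - w‖ := by
    intro ζ hζ w _
    have := norm_sub_norm_le ζ w
    rwa [mem_sphere_zero_iff_norm.1 hζ] at this
  have hne0 : ∀ ζ ∈ sphere (0 : ℂ) 1, ∀ w ∈ ball (0 : ℂ) 1, ζ - w ≠ 0 := by
    intro ζ hζ w hw
    have h1 := hne ζ hζ w hw
    have h2 := mem_ball_zero_iff.1 hw
    exact norm_pos_iff.1 (by linarith)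
  let d : circCont := ⟨fun ζ => ζ / (ζ - z) ^ 2, continuousOn_id.div (by fun_prop)
    fun ζ hζ => pow_ne_zero 2 (hne0 ζ hζ z hz)⟩
  suffices HasDerivAt (fun z => ℓ (cauchyKer z)) (ℓ d) z from
    this.differentiableAt.differentiableWithinAt
  set r := (1 - ‖z‖) / 2 with hr
  have hr0 : 0 < r := by simp only [hr]; linarith
  rw [hasDerivAt_iff_isLittleO]
  have hO : (fun w => ℓ (cauchyKer w) - ℓ (cauchyKer z) - (w - z) • ℓ d) =O[𝓝 z]
      fun w => ‖w - z‖ ^ 2 := by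
    refine Asymptotics.IsBigO.of_bound (|B| * (r ^ 3)⁻¹) ?_
    filter_upwards [ball_mem_nhds z hr0] with w hw
    rw [mem_ball, dist_eq_norm] at hw
    have hw1 : ‖w‖ ≤ 1 - r := by
      have := norm_le_norm_add_norm_sub' w z
      simp only [hr] at *
      linarith
    have hwb : w ∈ ball (0 : ℂ) 1 := mem_ball_zero_iff.2 (by linarith)
    rw [← map_sub, ← map_smul, ← map_sub]
    refine (hℓ _ ((r ^ 3)⁻¹ * ‖w - z‖ ^ 2) ?_).trans ?_
    · intro ζ hζ
      have e : (cauchyKer w - cauchyKer z - (w - z) • d).1 ζ =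
          ζ * (w - z) ^ 2 / ((ζ - w) * (ζ - z) ^ 2) := by
        have e1 : (cauchyKer w - cauchyKer z - (w - z) • d).1 ζ =
          (cauchyKer w).1 ζ - (cauchyKer z).1 ζ - (w - z) * (ζ / (ζ - z) ^ 2) := rfl
        rw [e1, cauchyKer_apply hwb, cauchyKer_apply hz]
        have h1 := hne0 ζ hζ w hwb
        have h2 := hne0 ζ hζ z hz
        field_simp
        ring
      rw [e, norm_div, norm_mul, norm_mul, norm_pow, norm_pow, mem_sphere_zero_iff_norm.1 hζ,
        one_mul, div_eq_inv_mul]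
      have h1 : r ≤ ‖ζ - w‖ := le_trans (by linarith) (hne ζ hζ w hwb)
      have h2 : r ≤ ‖ζ - z‖ := le_trans (by linarith) (hne ζ hζ z hz)
      have h3 : r ^ 3 ≤ ‖ζ - w‖ * ‖ζ - z‖ ^ 2 := by
        rw [pow_succ' r 2]; gcongr
      gcongr
    · rw [Real.norm_of_nonneg (by positivity), mul_assoc]
      gcongr
      exact le_abs_self B
  refine hO.trans_isLittleO ?_
  refine (Asymptotics.isLittleO_norm_right.1 ?_)
  refine Asymptotics.isLittleO_iff.2 fun ε hε => ?_
  filter_upwards [ball_mem_nhds z hε] with w hw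
  rw [mem_ball, dist_eq_norm] at hw
  rw [Real.norm_of_nonneg (by positivity), norm_norm, pow_two]
  gcongr

/-- Multiples of `ζ` by functions holomorphic near the closed disc. -/
def circHol : Submodule ℂ circCont where
  carrier := {φ | ∃ k : ℂ → ℂ, AnalyticOnNhd ℂ k (closedBall 0 1) ∧
    ∀ ζ ∈ sphere (0 : ℂ) 1, φ.1 ζ = ζ * k ζ}
  add_mem' := by
    rintro φ ψ ⟨k, hk, hk'⟩ ⟨l, hl, hl'⟩
    refine ⟨fun z => k z + l z, hk.add hl, fun ζ hζ => ?_⟩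
    change φ.1 ζ + ψ.1 ζ = _
    rw [hk' ζ hζ, hl' ζ hζ]; ring
  zero_mem' := ⟨fun _ => 0, analyticOnNhd_const, fun ζ _ => by simp⟩
  smul_mem' := by
    rintro c φ ⟨k, hk, hk'⟩
    refine ⟨fun z => c * k z, analyticOnNhd_const.mul hk, fun ζ hζ => ?_⟩
    change c * φ.1 ζ = _
    rw [hk' ζ hζ]; ring

/-- Pairing with a function continuous on the circle. -/
noncomputable def circPair (u : ℂ → ℂ) (hu : ContinuousOn u (sphere 0 1)) : circCont →ₗ[ℂ] ℂ where
  toFun φ := circInt fun ζ => u ζ * φ.1 ζ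
  map_add' φ ψ := by
    have h1 : ContinuousOn (fun ζ => u ζ * φ.1 ζ) (sphere 0 1) := hu.mul φ.2
    have h2 : ContinuousOn (fun ζ => u ζ * ψ.1 ζ) (sphere 0 1) := hu.mul ψ.2
    rw [← circInt_add h1 h2]
    refine circInt_congr fun ζ _ => ?_
    change u ζ * (φ.1 ζ + ψ.1 ζ) = _
    ring
  map_smul' c φ := by
    rw [RingHom.id_apply, smul_eq_mul, ← circInt_const_mul_complex]
    refine circInt_congr fun ζ _ => ?_
    change u ζ * (c * φ.1 ζ) = _
    ring

/-- Bounded solution of `∂̄β = T · conj f'` for Wolff data smooth past the boundary. -/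
theorem dbar_bounded_smooth {ι : Type*} [Fintype ι] (M C₀ C₁ : ℝ) (hC₀ : 0 ≤ C₀) (hC₁ : 0 ≤ C₁) :
    ∃ C, 0 ≤ C ∧ ∀ (R : ℝ) (F : ι → ℂ → ℂ) (f T a b : ℂ → ℂ), 1 < R →
      (∀ j, DifferentiableOn ℂ (F j) (ball 0 R)) →
      (∀ j, ∀ z ∈ closedBall (0 : ℂ) 1, ‖F j z‖ ≤ M) →
      DifferentiableOn ℂ f (ball 0 R) →
      (∀ z ∈ closedBall (0 : ℂ) 1, ‖f z‖ ≤ M) →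
      (∀ z ∈ ball (0 : ℂ) R, HasWirt T (a z) (b z) z) →
      ContinuousOn a (ball 0 R) → ContinuousOn b (ball 0 R) →
      (∀ z ∈ closedBall (0 : ℂ) 1, ‖T z‖ ≤ C₀) →
      (∀ z ∈ closedBall (0 : ℂ) 1, ‖a z‖ ^ 2 ≤ C₁ * ∑ j, ‖deriv (F j) z‖ ^ 2) →
      ∃ β : ℂ → ℂ, (∀ z ∈ ball (0 : ℂ) 1, ∃ p, HasWirt β p (T z * conj (deriv f z)) z) ∧
        ∀ z ∈ ball (0 : ℂ) 1, ‖β z‖ ≤ C := by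
  obtain ⟨CW, hCW, hW⟩ := wolff_bound (ι := ι) M C₀ C₁ hC₀ hC₁
  obtain ⟨CP, hCP, hP⟩ := wolff_pole_bound (ι := ι) M C₀ C₁ hC₀ hC₁
  refine ⟨π⁻¹ * CP + 2 * CW, by positivity, ?_⟩
  intro R F f T a b hR hF hFM hf hfM hT ha hb hT0 ha1
  have hsub : closedBall (0 : ℂ) 1 ⊆ ball 0 R := closedBall_subset_ball hR
  have hana : ∀ h : ℂ → ℂ, DifferentiableOn ℂ h (ball 0 R) → AnalyticOnNhd ℂ h (closedBall 0 1) :=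
    fun h hh => (hh.analyticOnNhd isOpen_ball).mono hsub
  have hFa := fun j => hana _ (hF j)
  have hfa := hana _ hf
  have hfaR := hf.analyticOnNhd isOpen_ball
  have hTc : ContinuousOn T (ball 0 R) := fun z hz => (hT z hz).continuousAt.continuousWithinAt
  let ω : ℂ → ℂ := fun z => T z * conj (deriv f z)
  have hωw : ∀ z ∈ ball (0 : ℂ) R, HasWirt ω (a z * conj (deriv f z))
      (b z * conj (deriv f z) + T z * conj (deriv (deriv f) z)) z := fun z hz =>
    ((hT z hz).mul (HasWirt.of_hasDerivAt
      (hfaR.deriv z hz).differentiableAt.hasDerivAt).star).congr_coeff (by simp) rfl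
  have hdf : ContinuousOn (fun z => conj (deriv f z)) (ball 0 R) :=
    continuous_conj.comp_continuousOn hfaR.deriv.continuousOn
  have hddf : ContinuousOn (fun z => conj (deriv (deriv f) z)) (ball 0 R) :=
    continuous_conj.comp_continuousOn hfaR.deriv.deriv.continuousOn
  obtain ⟨u, p, hp, hu⟩ := exists_wirt_solution hR hωw (ha.mul hdf)
    ((hb.mul hdf).add (hTc.mul hddf))
  have huc : ContinuousOn u (closedBall 0 1) := fun z hz =>
    (hu z hz).continuousAt.continuousWithinAt
  have hus := huc.mono sphere_subset_closedBall
  have hωc : ContinuousOn ω (closedBall 0 1) := (hTc.mul hdf).mono hsub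
  let β := circPair u hus
  let cS : NNReal := ⟨2 * CW, by positivity⟩
  have hβS : ∀ φ : circHol, ‖β φ.1‖ ≤ cS • circSeminorm φ.1 := by
    rintro ⟨φ, k, hk, hφ⟩
    have hkd : ∀ z ∈ closedBall (0 : ℂ) 1, HasDerivAt k (deriv k z) z := fun z hz =>
      (hk z hz).differentiableAt.hasDerivAt
    have h1 := integral_wirt_conj (F := fun z => u z * k z) (a := fun z => p z * k z + u z * deriv k z)
      (b := fun z => ω z * k z)
      (fun z hz => ((hu z hz).mul (HasWirt.of_hasDerivAt (hkd z hz))).congr_coeff rfl (by simp [ω]))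
      ((hp.continuousOn.mul hk.continuousOn).add (huc.mul hk.deriv.continuousOn))
      (hωc.mul hk.continuousOn)
    have h2 := hW F f T a b k hFa hFM hfa hfM (fun z hz => hT z (hsub hz)) (ha.mono hsub)
      (hb.mono hsub) hT0 ha1 hk
    change ‖∫ z in ball (0 : ℂ) 1, ω z * k z‖ ≤ _ at h2
    have h3 : β φ = 2 * ∫ z in ball (0 : ℂ) 1, ω z * k z := by
      rw [h1, ← mul_assoc]
      have h5 : β φ = circInt fun z => u z * k z * z :=
        circInt_congr (F := fun ζ => u ζ * φ.1 ζ) fun ζ hζ => by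
          rw [hφ ζ hζ]; ring
      rw [h5]
      norm_num
    have h4 : circSeminorm φ = circInt fun z => ‖k z‖ :=
      circInt_congr (F := fun ζ => ‖φ.1 ζ‖) fun ζ hζ => by
        rw [hφ ζ hζ, norm_mul, mem_sphere_zero_iff_norm.1 hζ, one_mul]
    change ‖β φ‖ ≤ 2 * CW * circSeminorm φ
    rw [h3, h4, norm_mul]
    simp only [norm_ofNat]
    linarith
  obtain ⟨Λ, hΛ1, hΛ2⟩ := Module.Dual.exists_extension_of_le_seminorm circHol
    (β.comp circHol.subtype) (p := cS • circSeminorm) hβS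
  have hΛ3 : ∀ φ : circCont, ‖Λ φ‖ ≤ 2 * CW * circInt fun z => ‖φ.1 z‖ := hΛ2
  let ℓ : circCont →ₗ[ℂ] ℂ := β - Λ
  have hℓ0 : ∀ φ ∈ circHol, ℓ φ = 0 := fun φ hφ => by
    have := hΛ1 ⟨φ, hφ⟩
    simp only [ℓ, LinearMap.sub_apply]
    rw [sub_eq_zero]
    exact this.symm
  obtain ⟨B, hB⟩ := (isCompact_sphere (0 : ℂ) 1).exists_bound_of_continuousOn hus
  have hH : DifferentiableOn ℂ (fun z => ℓ (cauchyKer z)) (ball 0 1) := by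
    refine differentiableOn_cauchyKer ℓ ((|B| + 2 * CW) * (2 * π)) fun φ N hN => ?_
    have h1 := circInt_le_of_norm_le φ.2 hN
    have h2 : ‖β φ‖ ≤ 2 * π * (|B| * N) := by
      refine (norm_circInt_le _).trans (circInt_le_of_norm_le (φ := fun ζ => u ζ * φ.1 ζ)
        (hus.mul φ.2) fun ζ hζ => ?_)
      rw [norm_mul]
      exact mul_le_mul ((hB ζ hζ).trans (le_abs_self B)) (hN ζ hζ) (norm_nonneg _) (abs_nonneg _)
    have h3 : ‖Λ φ‖ ≤ 2 * CW * (2 * π * N) :=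
      (hΛ3 φ).trans (mul_le_mul_of_nonneg_left h1 (by positivity))
    calc _ ≤ ‖β φ‖ + ‖Λ φ‖ := norm_sub_le _ _
      _ ≤ _ := by linarith
  refine ⟨fun z => u z - (2 * π : ℂ)⁻¹ * ℓ (cauchyKer z), fun z hz => ⟨p z - (2 * π : ℂ)⁻¹ *
    deriv (fun z => ℓ (cauchyKer z)) z, ?_⟩, fun z hz => ?_⟩
  · have h1 := HasWirt.of_hasDerivAt ((hH.differentiableAt (isOpen_ball.mem_nhds hz)).hasDerivAt)
    exact ((hu z (ball_subset_closedBall hz)).sub (h1.const_mul _)).congr_coeff rfl (by simp [ω])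
  have hz0 := one_sub_normSq_pos hz
  have hne : ∀ ξ ∈ closedBall (0 : ℂ) 1, 1 - conj z * ξ ≠ 0 := fun ξ hξ =>
    one_sub_conj_mul_ne_zero hz hξ
  have hker : ContinuousOn (fun ζ => conj z * ζ / (1 - conj z * ζ)) (sphere 0 1) :=
    ContinuousOn.div (by fun_prop) (by fun_prop) fun ζ hζ => hne ζ (sphere_subset_closedBall hζ)
  let ψ : circCont := ⟨fun ζ => conj z * ζ / (1 - conj z * ζ), hker⟩
  have hψ : ψ ∈ circHol := by
    refine ⟨fun ζ => conj z / (1 - conj z * ζ), fun ζ hζ => ?_, fun ζ _ => ?_⟩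
    · have := hne ζ hζ
      fun_prop (disch := assumption)
    · change conj z * ζ / (1 - conj z * ζ) = _
      ring
  let P : circCont := cauchyKer z + ψ
  have hns : ∀ ζ ∈ sphere (0 : ℂ) 1, ζ - z ≠ 0 := fun ζ hζ e => by
    rw [sub_eq_zero.1 e, mem_sphere_zero_iff_norm] at hζ
    exact absurd (mem_ball_zero_iff.1 hz) (by linarith)
  have hPv : ∀ ζ ∈ sphere (0 : ℂ) 1, P.1 ζ = ((1 - ‖z‖ ^ 2 : ℝ) : ℂ) / (1 - conj z * ζ) *
      (ζ / (ζ - z)) := by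
    intro ζ hζ
    have h1 := hne ζ (sphere_subset_closedBall hζ)
    have h2 := hns ζ hζ
    rw [ofReal_one_sub_normSq]
    change (cauchyKer z).1 ζ + conj z * ζ / (1 - conj z * ζ) = _
    rw [cauchyKer_apply hz, div_add_div _ _ h2 h1, div_mul_div_comm, mul_comm (1 - conj z * ζ)]
    congr 1
    ring
  have hPn : ∀ ζ ∈ sphere (0 : ℂ) 1, ‖P.1 ζ‖ = (1 - ‖z‖ ^ 2) / ‖1 - conj z * ζ‖ ^ 2 := by
    intro ζ hζ
    have h1 : ‖ζ - z‖ = ‖1 - conj z * ζ‖ := by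
      have : 1 - conj z * ζ = ζ * conj (ζ - z) := by
        rw [map_sub, mul_sub, mul_conj_of_mem_sphere hζ]; ring
      rw [this, norm_mul, RCLike.norm_conj, mem_sphere_zero_iff_norm.1 hζ, one_mul]
    rw [hPv ζ hζ, norm_mul, norm_div, norm_div, h1, mem_sphere_zero_iff_norm.1 hζ, norm_real,
      Real.norm_of_nonneg hz0.le]
    ring
  have e1 : ℓ (cauchyKer z) = β P - Λ P := by
    have : ℓ P = ℓ (cauchyKer z) := by
      rw [map_add, hℓ0 ψ hψ, add_zero]
    rw [← this]; rfl
  have e2 : ‖Λ P‖ ≤ 2 * CW * (2 * π) := by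
    rw [← circInt_poisson hz, ← circInt_congr hPn]
    exact hΛ3 P
  have e3 : π * u z = 1 / 2 * β P - ∫ ξ in ball (0 : ℂ) 1, T ξ * conj (deriv f ξ) *
        (((1 - ‖z‖ ^ 2 : ℝ) : ℂ) / ((ξ - z) * (1 - conj z * ξ))) := by
    let κ : ℂ → ℂ := fun ξ => ((1 - ‖z‖ ^ 2 : ℝ) : ℂ) / (1 - conj z * ξ)
    have hκ : AnalyticOnNhd ℂ κ (closedBall 0 1) := fun ξ hξ => by
      have := hne ξ hξ
      simp only [κ]
      fun_prop (disch := assumption)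
    have h1 := cauchy_pompeiu (F := fun ξ => u ξ * κ ξ)
      (fun ξ hξ => (hu ξ hξ).mul (HasWirt.of_hasDerivAt (hκ ξ hξ).differentiableAt.hasDerivAt))
      ((hp.continuousOn.mul hκ.continuousOn).add (huc.mul hκ.deriv.continuousOn))
      ((hωc.mul hκ.continuousOn).add (huc.mul continuousOn_const)) hz
    have h2 : κ z = 1 := by
      have h3 := hne z (ball_subset_closedBall hz)
      simp only [κ]
      rw [ofReal_one_sub_normSq, mul_comm z]
      exact div_self h3
    rw [h2, mul_one] at h1
    rw [h1]
    congr 1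
    · congr 1
      refine circInt_congr (G := fun ζ => u ζ * P.1 ζ) fun ζ hζ => ?_
      rw [hPv ζ hζ]
      ring
    · refine setIntegral_congr_fun measurableSet_ball fun ξ hξ => ?_
      simp only [ω, κ, mul_zero, add_zero, div_eq_mul_inv, mul_inv]
      ring
  have e4 := hP F f T a b z hFa hFM hfa hfM (fun z hz => hT z (hsub hz)) (ha.mono hsub)
      (hb.mono hsub) hT0 ha1 hz
  set X := ∫ ξ in ball (0 : ℂ) 1, T ξ * conj (deriv f ξ) *
        (((1 - ‖z‖ ^ 2 : ℝ) : ℂ) / ((ξ - z) * (1 - conj z * ξ)))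
  have hpi : (π : ℂ) ≠ 0 := by exact_mod_cast Real.pi_ne_zero
  have e5 : u z - (2 * π : ℂ)⁻¹ * ℓ (cauchyKer z) = (2 * π : ℂ)⁻¹ * Λ P - (π : ℂ)⁻¹ * X := by
    rw [e1]
    have : u z = (π : ℂ)⁻¹ * (1 / 2 * β P - X) := by rw [← e3]; field_simp
    rw [this]
    field_simp
    ring
  change ‖u z - (2 * π : ℂ)⁻¹ * ℓ (cauchyKer z)‖ ≤ _
  rw [e5]
  refine (norm_sub_le _ _).trans ?_
  rw [norm_mul, norm_mul, norm_inv, norm_inv, norm_mul, norm_real, Real.norm_of_nonneg Real.pi_pos.le]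
  simp only [norm_ofNat]
  have h6 : (2 * π)⁻¹ * ‖Λ P‖ ≤ (2 * π)⁻¹ * (2 * CW * (2 * π)) := by gcongr
  have h7 : π⁻¹ * ‖X‖ ≤ π⁻¹ * CP := by gcongr
  have h8 : (2 * π)⁻¹ * (2 * CW * (2 * π)) = 2 * CW := by field_simp
  linarith

/-- Bounded holomorphic functions are uniformly Lipschitz away from the boundary. -/
lemma norm_sub_le_of_differentiableOn_of_bounded {g : ℂ → ℂ} {c : ℂ} {s B : ℝ} (hs : 0 < s)
    (hg : DifferentiableOn ℂ g (ball c (3 * s))) (hB : ∀ z ∈ ball c (3 * s), ‖g z‖ ≤ B)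
    {x y : ℂ} (hx : x ∈ ball c s) (hy : y ∈ ball c s) : ‖g x - g y‖ ≤ B / s * ‖x - y‖ := by
  refine (convex_ball c s).norm_image_sub_le_of_norm_deriv_le (𝕜 := ℂ) (fun w hw => ?_)
    (fun w hw => ?_) hy hx
  · exact hg.differentiableAt (isOpen_ball.mem_nhds (ball_subset_ball (by linarith) hw))
  · have hsub : closedBall w s ⊆ ball c (3 * s) := by
      refine closedBall_subset_ball' ?_
      rw [mem_ball] at hw; linarith
    refine norm_deriv_le_of_forall_mem_sphere_norm_le hs ?_ fun z hz =>
      hB z (hsub (sphere_subset_closedBall hz))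
    exact ((hg.mono hsub).diffContOnCl_ball (closedBall_subset_closedBall le_rfl))

/-- A pointwise limit of bounded holomorphic functions is holomorphic. -/
lemma differentiableOn_of_tendsto_of_bounded {α : Type*} {l : Filter α} [NeBot l]
    {g : α → ℂ → ℂ} {G : ℂ → ℂ} {U : Set ℂ} (hU : IsOpen U) {B : ℝ}
    (hg : ∀ᶠ n in l, DifferentiableOn ℂ (g n) U ∧ ∀ z ∈ U, ‖g n z‖ ≤ B)
    (hG : ∀ z ∈ U, Tendsto (fun n => g n z) l (𝓝 (G z))) : DifferentiableOn ℂ G U := by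
  have hloc : TendstoLocallyUniformlyOn g G l U := by
    rw [Metric.tendstoLocallyUniformlyOn_iff]
    intro ε hε z hz
    obtain ⟨r, hr, hrU⟩ := Metric.isOpen_iff.1 hU z hz
    set s := r / 3 with hs
    have hs0 : 0 < s := by positivity
    have hs3 : 3 * s = r := by simp only [hs]; ring
    have hB : 0 ≤ B := by
      obtain ⟨n, hn⟩ := hg.exists
      exact (norm_nonneg _).trans (hn.2 z hz)
    have hlip : ∀ᶠ n in l, ∀ y ∈ ball z s, ‖g n z - g n y‖ ≤ B / s * ‖z - y‖ := by
      filter_upwards [hg] with n hn y hy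
      refine norm_sub_le_of_differentiableOn_of_bounded hs0 (hn.1.mono ?_) (fun w hw => hn.2 w ?_)
        (mem_ball_self hs0) hy
      · rwa [hs3]
      · rw [hs3] at hw; exact hrU hw
    have hlipG : ∀ y ∈ ball z s, ‖G z - G y‖ ≤ B / s * ‖z - y‖ := by
      intro y hy
      have hyU : y ∈ U := hrU (ball_subset_ball (by linarith) hy)
      exact le_of_tendsto ((hG z hz).sub (hG y hyU)).norm (hlip.mono fun n hn => hn y hy)
    set δ := min s (ε / (4 * (B / s + 1))) with hδ
    have hδ0 : 0 < δ := by positivity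
    refine ⟨ball z δ, mem_nhdsWithin_of_mem_nhds (ball_mem_nhds z hδ0), ?_⟩
    have hz1 := (Metric.tendsto_nhds.1 (hG z hz)) (ε / 4) (by positivity)
    filter_upwards [hlip, hz1] with n h1 h2 y hy
    have hys : y ∈ ball z s := ball_subset_ball (min_le_left _ _) hy
    have h3 := h1 y hys
    have h4 := hlipG y hys
    have h5 : B / s * ‖z - y‖ ≤ ε / 4 := by
      have h6 : ‖z - y‖ ≤ ε / (4 * (B / s + 1)) := by
        rw [← dist_eq_norm, dist_comm]
        exact (mem_ball.1 hy).le.trans (min_le_right _ _)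
      calc _ ≤ (B / s + 1) * (ε / (4 * (B / s + 1))) := by gcongr; linarith
        _ = _ := by field_simp
    rw [dist_eq_norm, norm_sub_rev] at h2
    rw [dist_eq_norm]
    have e : G y - g n y = -(G z - G y) + (G z - g n z) + (g n z - g n y) := by ring
    rw [e]
    refine (norm_add₃_le).trans_lt ?_
    rw [norm_neg]
    linarith
  exact hloc.differentiableOn (hg.mono fun n hn => hn.1) hU

lemma exists_ultrafilter_limit {E : Type*} [NormedAddCommGroup E] [ProperSpace E]
    {α : Type*} (l : Ultrafilter α) {x : α → E} {B : ℝ}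
    (hx : ∀ᶠ n in (l : Filter α), ‖x n‖ ≤ B) : ∃ w, ‖w‖ ≤ B ∧ Tendsto x l (𝓝 w) := by
  obtain ⟨w, hw, hl⟩ := (isCompact_closedBall (0 : E) B).ultrafilter_le_nhds (l.map x) (by
    rw [le_principal_iff]
    exact hx.mono fun n hn => by simpa using hn)
  exact ⟨w, by simpa using hw, hl⟩

/-- Wolff's theorem: bounded solution of `∂̄β = T · conj f'` in the open disc. -/
theorem dbar_bounded {ι : Type*} [Fintype ι] (M C₀ C₁ : ℝ) (hC₀ : 0 ≤ C₀) (hC₁ : 0 ≤ C₁) :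
    ∃ C, 0 ≤ C ∧ ∀ (F : ι → ℂ → ℂ) (f T a b : ℂ → ℂ),
      (∀ j, DifferentiableOn ℂ (F j) (ball 0 1)) →
      (∀ j, ∀ z ∈ ball (0 : ℂ) 1, ‖F j z‖ ≤ M) →
      DifferentiableOn ℂ f (ball 0 1) →
      (∀ z ∈ ball (0 : ℂ) 1, ‖f z‖ ≤ M) →
      (∀ z ∈ ball (0 : ℂ) 1, HasWirt T (a z) (b z) z) →
      ContinuousOn a (ball 0 1) → ContinuousOn b (ball 0 1) →
      (∀ z ∈ ball (0 : ℂ) 1, ‖T z‖ ≤ C₀) →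
      (∀ z ∈ ball (0 : ℂ) 1, ‖a z‖ ^ 2 ≤ C₁ * ∑ j, ‖deriv (F j) z‖ ^ 2) →
      ∃ β : ℂ → ℂ, (∀ z ∈ ball (0 : ℂ) 1, ∃ p, HasWirt β p (T z * conj (deriv f z)) z) ∧
        ∀ z ∈ ball (0 : ℂ) 1, ‖β z‖ ≤ C := by
  obtain ⟨C, hC, hD⟩ := dbar_bounded_smooth (ι := ι) M C₀ C₁ hC₀ hC₁
  refine ⟨C, hC, ?_⟩
  intro F f T a b hF hFM hf hfM hT ha hb hT0 ha1
  have hdil : ∀ r : ℝ, 0 < r → r < 1 → ∃ γ : ℂ → ℂ, ∀ z ∈ ball (0 : ℂ) r,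
      (∃ p, HasWirt γ p (T z * conj (deriv f z)) z) ∧ ‖γ z‖ ≤ C := by
    intro r hr0 hr1
    have hrc : (r : ℂ) ≠ 0 := by exact_mod_cast hr0.ne'
    have hmap : ∀ z ∈ ball (0 : ℂ) r⁻¹, (r : ℂ) * z ∈ ball (0 : ℂ) 1 := by
      intro z hz
      rw [mem_ball_zero_iff] at *
      rw [norm_mul, norm_real, Real.norm_of_nonneg hr0.le]
      calc _ < r * r⁻¹ := by gcongr
        _ = 1 := by field_simp
    have hmap1 : ∀ z ∈ closedBall (0 : ℂ) 1, (r : ℂ) * z ∈ ball (0 : ℂ) 1 := fun z hz =>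
      hmap z (closedBall_subset_ball ((one_lt_inv₀ hr0).2 hr1) hz)
    have hlin : ∀ z, HasDerivAt (fun z : ℂ => (r : ℂ) * z) r z := fun z => by
      simpa using (hasDerivAt_id z).const_mul (r : ℂ)
    have hdc : ∀ h : ℂ → ℂ, DifferentiableOn ℂ h (ball 0 1) → ∀ z ∈ ball (0 : ℂ) r⁻¹,
        HasDerivAt (fun z => h (r * z)) (deriv h (r * z) * r) z := fun h hh z hz =>
      ((hh.differentiableAt (isOpen_ball.mem_nhds (hmap z hz))).hasDerivAt).comp z (hlin z)
    have hdd : ∀ h : ℂ → ℂ, DifferentiableOn ℂ h (ball 0 1) →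
        DifferentiableOn ℂ (fun z => h (r * z)) (ball 0 r⁻¹) := fun h hh z hz =>
      (hdc h hh z hz).differentiableAt.differentiableWithinAt
    have hcc : ∀ h : ℂ → ℂ, ContinuousOn h (ball 0 1) →
        ContinuousOn (fun z => h (r * z) * r) (ball 0 r⁻¹) := fun h hh =>
      (hh.comp (by fun_prop) hmap).mul continuousOn_const
    have hball : closedBall (0 : ℂ) 1 ⊆ ball 0 r⁻¹ :=
      closedBall_subset_ball ((one_lt_inv₀ hr0).2 hr1)
    obtain ⟨β, hβ1, hβ2⟩ := hD r⁻¹ (fun j z => F j (r * z)) (fun z => f (r * z))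
      (fun z => T (r * z)) (fun z => a (r * z) * r) (fun z => b (r * z) * r)
      ((one_lt_inv₀ hr0).2 hr1) (fun j => hdd _ (hF j)) (fun j z hz => hFM j _ (hmap1 z hz))
      (hdd f hf) (fun z hz => hfM _ (hmap1 z hz))
      (fun z hz => by
        have := (hT _ (hmap z hz)).comp_inner (k := fun z => (r : ℂ) * z) (hlin z)
        rwa [conj_ofReal] at this)
      (hcc a ha) (hcc b hb) (fun z hz => hT0 _ (hmap1 z hz)) (fun z hz => by
        have h1 := ha1 _ (hmap1 z hz)
        have h2 : ∀ j, ‖deriv (fun z => F j (r * z)) z‖ ^ 2 = ‖deriv (F j) (r * z)‖ ^ 2 * r ^ 2 := by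
          intro j
          rw [(hdc _ (hF j) z (hball hz)).deriv, norm_mul, mul_pow, norm_real, Real.norm_eq_abs, sq_abs]
        simp only [h2]
        rw [← Finset.sum_mul, norm_mul, mul_pow, norm_real, Real.norm_eq_abs, sq_abs, ← mul_assoc]
        gcongr)
    refine ⟨fun z => β ((r : ℂ)⁻¹ * z), fun z hz => ?_⟩
    have hz1 : (r : ℂ)⁻¹ * z ∈ ball (0 : ℂ) 1 := by
      rw [mem_ball_zero_iff] at *
      rw [norm_mul, norm_inv, norm_real, Real.norm_of_nonneg hr0.le, inv_mul_lt_one₀ hr0]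
      exact hz
    refine ⟨?_, hβ2 _ hz1⟩
    obtain ⟨p, hp⟩ := hβ1 _ hz1
    have hl' : HasDerivAt (fun z : ℂ => (r : ℂ)⁻¹ * z) ((r : ℂ)⁻¹) z := by
      simpa using (hasDerivAt_id z).const_mul ((r : ℂ)⁻¹)
    refine ⟨_, (hp.comp_inner (k := fun z : ℂ => (r : ℂ)⁻¹ * z) hl').congr_coeff rfl ?_⟩
    have h3 : (r : ℂ) * ((r : ℂ)⁻¹ * z) = z := by field_simp
    rw [(hdc f hf _ (ball_subset_ball ((one_lt_inv₀ hr0).2 hr1).le hz1)).deriv, h3, map_mul,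
      map_inv₀, conj_ofReal]
    field_simp
  let r : ℕ → ℝ := fun n => 1 - 1 / ((n : ℝ) + 2)
  have hr0 : ∀ n, 0 < r n := fun n => by
    have : 1 / ((n : ℝ) + 2) < 1 := by rw [div_lt_one (by positivity)]; linarith [n.cast_nonneg (α := ℝ)]
    simp only [r]; linarith
  have hr1 : ∀ n, r n < 1 := fun n => by
    have : 0 < 1 / ((n : ℝ) + 2) := by positivity
    simp only [r]; linarith
  have hrt : Tendsto r atTop (𝓝 1) := by
    have h1 : Tendsto (fun n : ℕ => 1 / ((n : ℝ) + 2)) atTop (𝓝 0) := by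
      simp_rw [one_div]
      exact tendsto_inv_atTop_zero.comp (tendsto_natCast_atTop_atTop.atTop_add tendsto_const_nhds)
    simpa [r] using h1.const_sub 1
  choose γ hγ using fun n => hdil (r n) (hr0 n) (hr1 n)
  have hev : ∀ ρ < 1, ∀ᶠ n in (hyperfilter ℕ : Filter ℕ), ρ < r n := fun ρ hρ =>
    Nat.hyperfilter_le_atTop (hrt.eventually (lt_mem_nhds hρ))
  have hlim : ∀ z ∈ ball (0 : ℂ) 1, ∃ w, ‖w‖ ≤ C ∧ Tendsto (fun n => γ n z) (hyperfilter ℕ) (𝓝 w) :=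
    fun z hz => exists_ultrafilter_limit _ <| (hev ‖z‖ (mem_ball_zero_iff.1 hz)).mono fun n hn =>
      (hγ n z (mem_ball_zero_iff.2 hn)).2
  choose! β hβ1 hβ2 using hlim
  refine ⟨β, fun z hz => ?_, hβ1⟩
  obtain ⟨ρ, hzρ, hρ1⟩ := exists_between (mem_ball_zero_iff.1 hz)
  obtain ⟨m, hm⟩ := (hev ρ hρ1).exists
  have hdiff : DifferentiableOn ℂ (fun w => β w - γ m w) (ball 0 ρ) := by
    refine differentiableOn_of_tendsto_of_bounded (l := (hyperfilter ℕ : Filter ℕ))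
      (g := fun n w => γ n w - γ m w) (B := C + C) isOpen_ball ?_ fun w hw =>
        (hβ2 w (ball_subset_ball hρ1.le hw)).sub_const _
    filter_upwards [hev ρ hρ1] with n hn
    refine ⟨fun w hw => ?_, fun w hw => (norm_sub_le _ _).trans ?_⟩
    · obtain ⟨p, hp⟩ := (hγ n w (ball_subset_ball hn.le hw)).1
      obtain ⟨q, hq⟩ := (hγ m w (ball_subset_ball hm.le hw)).1
      exact ((hp.sub hq).congr_coeff rfl (sub_self _)).hasDerivAt.differentiableAt.differentiableWithinAt
    · exact add_le_add (hγ n w (ball_subset_ball hn.le hw)).2 (hγ m w (ball_subset_ball hm.le hw)).2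
  have hzρ' : z ∈ ball (0 : ℂ) ρ := mem_ball_zero_iff.2 hzρ
  obtain ⟨q, hq⟩ := (hγ m z (ball_subset_ball hm.le hzρ')).1
  refine ⟨_, ((HasWirt.of_hasDerivAt (hdiff.differentiableAt
    (isOpen_ball.mem_nhds hzρ')).hasDerivAt).add hq).congr_of_eventuallyEq ?_ |>.congr_coeff rfl
    (zero_add _)⟩
  exact Eventually.of_forall fun w => by simp

section
variable {ι : Type*} [Fintype ι] [DecidableEq ι]

/-- The Wirtinger derivative `∂/∂w_j` of a function of several complex variables. -/
noncomputable def pdHol (G : (ι → ℂ) → ℂ) (j : ι) (w : ι → ℂ) : ℂ :=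
  (fderiv ℝ G w (Pi.single j 1) - I * fderiv ℝ G w (Pi.single j I)) / 2

/-- The Wirtinger derivative `∂/∂w̄_j` of a function of several complex variables. -/
noncomputable def pdBar (G : (ι → ℂ) → ℂ) (j : ι) (w : ι → ℂ) : ℂ :=
  (fderiv ℝ G w (Pi.single j 1) + I * fderiv ℝ G w (Pi.single j I)) / 2

lemma HasWirt.comp_pi {G : (ι → ℂ) → ℂ} {F : ι → ℂ → ℂ} {F' : ι → ℂ} {z : ℂ}
    (hG : DifferentiableAt ℝ G (fun j => F j z)) (hF : ∀ j, HasDerivAt (F j) (F' j) z) :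
    HasWirt (fun x => G fun j => F j x) (∑ j, pdHol G j (fun j => F j z) * F' j)
      (∑ j, pdBar G j (fun j => F j z) * conj (F' j)) z := by
  have h1 : HasFDerivAt (fun x j => F j x) (ContinuousLinearMap.pi fun j => wirtMap (F' j) 0) z :=
    hasFDerivAt_pi.2 fun j => HasWirt.of_hasDerivAt (hF j)
  refine (hG.hasFDerivAt.comp z h1).congr_fderiv (ContinuousLinearMap.ext fun v => ?_)
  set w := fun j => F j z
  have h2 : (fun j => F' j * v) = ∑ j, ((F' j * v).re • (Pi.single j (1 : ℂ) : ι → ℂ) +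
      (F' j * v).im • (Pi.single j I : ι → ℂ)) := by
    ext i
    rw [Finset.sum_apply, Finset.sum_eq_single i]
    · simp only [Pi.add_apply, Pi.smul_apply, Pi.single_eq_same, real_smul, mul_one]
      exact (re_add_im _).symm
    · intro j _ hj
      simp [Pi.single_eq_of_ne hj.symm]
    · simp
  have h3 : (ContinuousLinearMap.pi fun j => wirtMap (F' j) 0) v = fun j => F' j * v := by
    ext j; simp
  rw [ContinuousLinearMap.comp_apply, h3, h2, map_sum, wirtMap_apply, Finset.sum_mul,
    Finset.sum_mul, ← Finset.sum_add_distrib]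
  refine Finset.sum_congr rfl fun j _ => ?_
  rw [map_add, map_smul, map_smul, real_smul, real_smul]
  simp only [pdHol, pdBar]
  rw [mul_assoc _ (F' j) v, mul_assoc _ (conj (F' j)) (conj v), ← map_mul]
  generalize F' j * v = t
  set A := fderiv ℝ G w (Pi.single j 1)
  set B := fderiv ℝ G w (Pi.single j I)
  have e1 : t = t.re + t.im * I := (re_add_im t).symm
  have e2 : conj t = t.re - t.im * I := by
    apply Complex.ext <;> simp
  rw [e2]
  nth_rewrite 3 [e1]
  linear_combination ((t.im : ℂ) * B) * I_sq

lemma continuousOn_pdHol {G : (ι → ℂ) → ℂ} {V : Set (ι → ℂ)} (hV : IsOpen V)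
    (hG : ContDiffOn ℝ 1 G V) (j : ι) : ContinuousOn (pdHol G j) V := by
  have h := hG.continuousOn_fderiv_of_isOpen hV le_rfl
  unfold pdHol; fun_prop

lemma continuousOn_pdBar {G : (ι → ℂ) → ℂ} {V : Set (ι → ℂ)} (hV : IsOpen V)
    (hG : ContDiffOn ℝ 1 G V) (j : ι) : ContinuousOn (pdBar G j) V := by
  have h := hG.continuousOn_fderiv_of_isOpen hV le_rfl
  unfold pdBar; fun_prop

lemma contDiffOn_pdBar {G : (ι → ℂ) → ℂ} {V : Set (ι → ℂ)} (hV : IsOpen V) {n : ℕ}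
    (hG : ContDiffOn ℝ (n + 1) G V) (j : ι) : ContDiffOn ℝ n (pdBar G j) V := by
  have h := hG.fderiv_of_isOpen hV (m := n) le_rfl
  unfold pdBar; fun_prop

/-- Bounded solutions of `∂̄β = μ G(F) conj F_l'` with `G` of class `C¹` and `μ` a holomorphic
multiplier. -/
theorem dbar_comp {V K : Set (ι → ℂ)} (hV : IsOpen V) (hK : IsCompact K) (hKV : K ⊆ V)
    {G : (ι → ℂ) → ℂ} (hG : ContDiffOn ℝ 1 G V) (l : ι) :
    ∃ C, 0 ≤ C ∧ ∀ (F : ι → ℂ → ℂ) (μ : ℂ → ℂ), (∀ j, DifferentiableOn ℂ (F j) (ball 0 1)) →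
      (∀ z ∈ ball (0 : ℂ) 1, (fun j => F j z) ∈ K) →
      (∀ z ∈ ball (0 : ℂ) 1, (AnalyticAt ℂ μ z ∧ ‖μ z‖ ≤ 1 ∧
        ‖deriv μ z‖ ≤ ∑ j, ‖deriv (F j) z‖) ∨ ∀ᶠ w in 𝓝 z, G (fun j => F j w) = 0) →
      ∃ β : ℂ → ℂ, (∀ z ∈ ball (0 : ℂ) 1, ∃ p, HasWirt β p
        (μ z * G (fun j => F j z) * conj (deriv (F l) z)) z) ∧ ∀ z ∈ ball (0 : ℂ) 1, ‖β z‖ ≤ C := by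
  obtain ⟨B₀, hB₀⟩ := hK.exists_bound_of_continuousOn (hG.continuousOn.mono hKV)
  choose B₁ hB₁ using fun j => hK.exists_bound_of_continuousOn ((continuousOn_pdHol hV hG j).mono hKV)
  obtain ⟨M, hM⟩ := hK.isBounded.exists_norm_le
  let B := ∑ j, |B₁ j|
  have hB : ∀ j, |B₁ j| ≤ B := fun j =>
    Finset.single_le_sum (f := fun j => |B₁ j|) (fun i _ => abs_nonneg _) (Finset.mem_univ j)
  have hB0 : 0 ≤ B := Finset.sum_nonneg fun i _ => abs_nonneg _
  obtain ⟨C, hC, hD⟩ := dbar_bounded (ι := ι) M |B₀| ((|B₀| + B) ^ 2 * Fintype.card ι)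
    (abs_nonneg _) (by positivity)
  refine ⟨C, hC, fun F μ hF hFK hμ => ?_⟩
  have hFa := fun j => (hF j).analyticOnNhd isOpen_ball
  have hFM : ∀ j, ∀ z ∈ ball (0 : ℂ) 1, ‖F j z‖ ≤ M := fun j z hz =>
    (norm_le_pi_norm (fun j => F j z) j).trans (hM _ (hFK z hz))
  let GF : ℂ → ℂ := fun z => G fun j => F j z
  let a₀ : ℂ → ℂ := fun z => ∑ j, pdHol G j (fun j => F j z) * deriv (F j) z
  let b₀ : ℂ → ℂ := fun z => ∑ j, pdBar G j (fun j => F j z) * conj (deriv (F j) z)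
  have hFc : ContinuousOn (fun z j => F j z) (ball 0 1) :=
    continuousOn_pi.2 fun j => (hF j).continuousOn
  have hGF : ∀ z ∈ ball (0 : ℂ) 1, HasWirt GF (a₀ z) (b₀ z) z := fun z hz =>
    HasWirt.comp_pi ((hG.differentiableOn one_ne_zero).differentiableAt
      (hV.mem_nhds (hKV (hFK z hz)))) fun j => (hFa j z hz).differentiableAt.hasDerivAt
  have ha₀ : ContinuousOn a₀ (ball 0 1) := continuousOn_finsetSum _ fun j _ =>
    ((continuousOn_pdHol hV hG j).comp hFc fun z hz => hKV (hFK z hz)).mul (hFa j).deriv.continuousOn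
  have hb₀ : ContinuousOn b₀ (ball 0 1) := continuousOn_finsetSum _ fun j _ =>
    ((continuousOn_pdBar hV hG j).comp hFc fun z hz => hKV (hFK z hz)).mul
      (continuous_conj.comp_continuousOn (hFa j).deriv.continuousOn)
  have hGFc : ContinuousOn GF (ball 0 1) := fun z hz => (hGF z hz).continuousAt.continuousWithinAt
  have hzero : ∀ z ∈ ball (0 : ℂ) 1, (∀ᶠ w in 𝓝 z, GF w = 0) →
      ∀ᶠ w in 𝓝 z, GF w = 0 ∧ a₀ w = 0 ∧ b₀ w = 0 := by
    intro z hz h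
    filter_upwards [h.eventually_nhds, isOpen_ball.mem_nhds hz] with w hw hwb
    exact ⟨hw.self_of_nhds, (hGF w hwb).unique (HasWirt.zero_of_eventuallyEq hw)⟩
  have hS : ∀ z, (∑ j, ‖deriv (F j) z‖) ^ 2 ≤ Fintype.card ι * ∑ j, ‖deriv (F j) z‖ ^ 2 := fun z =>
    sq_sum_le_card_mul_sum_sq
  refine hD F (F l) (fun z => μ z * GF z) (fun z => deriv μ z * GF z + μ z * a₀ z)
    (fun z => μ z * b₀ z) hF hFM (hF l) (hFM l) ?_ ?_ ?_ ?_ ?_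
  · intro z hz
    rcases hμ z hz with ⟨h, -, -⟩ | h
    · exact ((HasWirt.of_hasDerivAt h.differentiableAt.hasDerivAt).mul (hGF z hz)).congr_coeff rfl
        (by simp)
    · have h0 := (hzero z hz h).self_of_nhds
      refine (HasWirt.zero_of_eventuallyEq ?_).congr_coeff ?_ ?_
      · exact h.mono fun w hw => by simp only [GF, hw, mul_zero]
      · simp [h0]
      · simp [h0]
  · intro z hz
    refine ContinuousAt.continuousWithinAt ?_
    have hn := isOpen_ball.mem_nhds hz
    rcases hμ z hz with ⟨h, -, -⟩ | h
    · exact (h.deriv.continuousAt.mul (hGFc.continuousAt hn)).add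
        (h.continuousAt.mul (ha₀.continuousAt hn))
    · refine (continuousAt_const (y := (0 : ℂ))).congr ?_
      filter_upwards [hzero z hz h] with w hw
      simp [hw]
  · intro z hz
    refine ContinuousAt.continuousWithinAt ?_
    have hn := isOpen_ball.mem_nhds hz
    rcases hμ z hz with ⟨h, -, -⟩ | h
    · exact h.continuousAt.mul (hb₀.continuousAt hn)
    · refine (continuousAt_const (y := (0 : ℂ))).congr ?_
      filter_upwards [hzero z hz h] with w hw
      simp [hw]
  · intro z hz
    rcases hμ z hz with ⟨-, h, -⟩ | h
    · rw [norm_mul]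
      exact (mul_le_of_le_one_left (norm_nonneg _) h).trans ((hB₀ _ (hFK z hz)).trans (le_abs_self _))
    · rw [(hzero z hz h).self_of_nhds.1]; simp
  · intro z hz
    rcases hμ z hz with ⟨-, h1, h2⟩ | h
    · refine le_trans ?_ ((mul_le_mul_of_nonneg_left (hS z) (sq_nonneg (|B₀| + B))).trans_eq
        (mul_assoc _ _ _).symm)
      rw [← mul_pow]
      gcongr
      refine (norm_add_le _ _).trans ?_
      rw [add_mul, norm_mul, norm_mul]
      refine add_le_add ?_ ?_
      · rw [mul_comm]
        exact mul_le_mul ((hB₀ _ (hFK z hz)).trans (le_abs_self _)) h2 (norm_nonneg _) (abs_nonneg _)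
      · refine (mul_le_of_le_one_left (norm_nonneg _) h1).trans ?_
        rw [Finset.mul_sum]
        refine (norm_sum_le _ _).trans (Finset.sum_le_sum fun j _ => ?_)
        rw [norm_mul]
        gcongr
        exact ((hB₁ j _ (hFK z hz)).trans (le_abs_self _)).trans (hB j)
    · have h0 := (hzero z hz h).self_of_nhds
      simp only [h0]
      simp
      positivity
end

section
variable {ι : Type*} [Fintype ι] [DecidableEq ι]

/-- A smooth cutoff function on `ℂ^ι`: equal to `1` for `‖w‖ ≤ 5`, to `0` if some `‖w j‖ ≥ 7`. -/
noncomputable def polyCut (w : ι → ℂ) : ℂ :=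
  ((∏ j, (⟨5, 7, by norm_num, by norm_num⟩ : ContDiffBump (0 : ℂ)) (w j) : ℝ) : ℂ)

lemma contDiff_polyCut {n : ℕ∞} : ContDiff ℝ n (polyCut (ι := ι)) :=
  ofRealCLM.contDiff.comp (contDiff_prod fun j _ =>
    (ContDiffBump.contDiff _).comp (contDiff_apply ℝ ℂ j))

lemma norm_polyCut_le (w : ι → ℂ) : ‖polyCut w‖ ≤ 1 := by
  rw [polyCut, norm_real, Real.norm_of_nonneg (Finset.prod_nonneg fun j _ => ContDiffBump.nonneg _)]
  exact Finset.prod_le_one (fun j _ => ContDiffBump.nonneg _) fun j _ => ContDiffBump.le_one _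

lemma polyCut_eq_one {w : ι → ℂ} (h : ∀ j, ‖w j‖ ≤ 5) : polyCut w = 1 := by
  rw [polyCut, Finset.prod_eq_one fun j _ => ContDiffBump.one_of_mem_closedBall _ (by simpa using h j),
    ofReal_one]

lemma polyCut_eq_zero {w : ι → ℂ} {j : ι} (h : 7 ≤ ‖w j‖) : polyCut w = 0 := by
  have h1 : (⟨5, 7, by norm_num, by norm_num⟩ : ContDiffBump (0 : ℂ)) (w j) = 0 :=
    ContDiffBump.zero_of_le_dist _ (by simpa using h)
  rw [polyCut, Finset.prod_eq_zero (Finset.mem_univ j) h1, ofReal_zero]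

lemma pdBar_eq_zero_of_eventually {G : (ι → ℂ) → ℂ} {w : ι → ℂ} (h : ∀ᶠ v in 𝓝 w, G v = 0)
    (j : ι) : pdBar G j w = 0 := by
  have : fderiv ℝ G w = 0 := by
    rw [Filter.EventuallyEq.fderiv_eq (f := fun _ => 0) h]; simp
  simp [pdBar, this]

lemma pdBar_polyCut_eq_zero {w : ι → ℂ} {l : ι} (h : ‖w l‖ < 5) : pdBar polyCut l w = 0 := by
  have hd : DifferentiableAt ℝ (polyCut (ι := ι)) w :=
    (contDiff_polyCut (n := 1)).differentiable one_ne_zero w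
  have key : ∀ v : ℂ, fderiv ℝ polyCut w (Pi.single l v) = 0 := by
    intro v
    have h1 : HasDerivAt (fun t : ℝ => w + t • (Pi.single l v : ι → ℂ)) (Pi.single l v) 0 := by
      simpa using ((hasDerivAt_id (0 : ℝ)).smul_const (Pi.single l v : ι → ℂ)).const_add w
    have h2 : HasDerivAt (fun t : ℝ => polyCut (w + t • (Pi.single l v : ι → ℂ)))
        (fderiv ℝ polyCut w (Pi.single l v)) 0 := by
      have h3 : HasFDerivAt (polyCut (ι := ι)) (fderiv ℝ polyCut w)
          (w + (0 : ℝ) • (Pi.single l v : ι → ℂ)) := by simpa using hd.hasFDerivAt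
      exact h3.comp_hasDerivAt (0 : ℝ) h1
    refine h2.unique ((hasDerivAt_const (0 : ℝ) (polyCut w)).congr_of_eventuallyEq ?_)
    have h4 : ContinuousAt (fun t : ℝ => ‖w l + t • v‖) 0 := by fun_prop
    filter_upwards [h4.eventually_lt (continuousAt_const (y := (5 : ℝ))) (by simpa using h)] with t ht
    simp only [polyCut]
    congr 1
    refine Finset.prod_congr rfl fun j _ => ?_
    by_cases hj : j = l
    · subst hj
      rw [ContDiffBump.one_of_mem_closedBall _ (by simpa using ht.le),
        ContDiffBump.one_of_mem_closedBall _ (by simpa using h.le)]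
    · simp [Pi.single_eq_of_ne hj]
  simp [pdBar, key]

/-- Approximate idempotents: a relatively clopen piece `E` of the set `{|h_i| < 8}` is separated from
its complement over `{|h_i| < 1}` by a bounded holomorphic function. -/
theorem exists_approx_indicator (ι : Type*) [Fintype ι] (M : ℝ) :
    ∃ C, 0 ≤ C ∧ ∀ (h : ι → ℂ → ℂ) (E E' : Set ℂ), (∀ j, DifferentiableOn ℂ (h j) (ball 0 1)) →
      (∀ j, ∀ z ∈ ball (0 : ℂ) 1, ‖h j z‖ ≤ M) → IsOpen E → IsOpen E' → Disjoint E E' →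
      (∀ z ∈ ball (0 : ℂ) 1, (∀ j, ‖h j z‖ < 8) → z ∈ E ∪ E') →
      ∃ e : ℂ → ℂ, DifferentiableOn ℂ e (ball 0 1) ∧ (∀ z ∈ ball (0 : ℂ) 1, ‖e z‖ ≤ C) ∧
        (∀ z ∈ ball (0 : ℂ) 1, (∀ j, ‖h j z‖ < 1) → z ∈ E → ‖e z - 1‖ ≤ 1 / 4) ∧
        (∀ z ∈ ball (0 : ℂ) 1, (∀ j, ‖h j z‖ < 1) → z ∈ E' → ‖e z‖ ≤ 1 / 4) := by
  classical
  have hG : ∀ l, ContDiffOn ℝ 1 (pdBar (polyCut (ι := ι)) l) univ := fun l => by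
    have := contDiffOn_pdBar (n := 1) isOpen_univ
      ((contDiff_polyCut (ι := ι) (n := 2)).contDiffOn (s := univ)) l
    exact_mod_cast this
  choose C₀ hC₀ hD using fun l => dbar_comp isOpen_univ
    (isCompact_closedBall (0 : ι → ℂ) |M|) (subset_univ _) (hG l) l
  obtain ⟨N, hN⟩ : ∃ N : ℕ, ∑ l, ((N : ℝ) + 1) / 4 ^ N * C₀ l ≤ 1 / 4 := by
    have h1 : Tendsto (fun N : ℕ => ((N : ℝ) + 1) / 4 ^ N) atTop (𝓝 0) := by
      have := (tendsto_pow_const_div_const_pow_of_one_lt 1 (r := (4 : ℝ)) (by norm_num)).add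
        (tendsto_pow_const_div_const_pow_of_one_lt 0 (r := (4 : ℝ)) (by norm_num))
      simpa [add_div] using this
    have h2 : Tendsto (fun N : ℕ => ∑ l, ((N : ℝ) + 1) / 4 ^ N * C₀ l) atTop (𝓝 0) := by
      simpa using tendsto_finsetSum Finset.univ fun l _ => h1.mul_const (C₀ l)
    exact (h2.eventually (ge_mem_nhds (by norm_num : (0 : ℝ) < 1 / 4))).exists
  refine ⟨1 + ∑ l, |M| ^ N * (((N : ℝ) + 1) / 4 ^ N * C₀ l),
    add_nonneg zero_le_one (Finset.sum_nonneg fun l _ => by have := hC₀ l; positivity),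
    fun h E E' hh hM hE hE' hEE hcov => ?_⟩
  let oneE : ℂ → ℂ := E.indicator fun _ => 1
  have hoE : ∀ z ∈ E, ∀ᶠ w in 𝓝 z, oneE w = 1 := fun z hz => by
    filter_upwards [hE.mem_nhds hz] with w hw using indicator_of_mem hw _
  have hoE' : ∀ z ∈ E', ∀ᶠ w in 𝓝 z, oneE w = 0 := fun z hz => by
    filter_upwards [hE'.mem_nhds hz] with w hw
    exact indicator_of_notMem (fun hw' => hEE.le_bot ⟨hw', hw⟩) _
  have hha := fun j => (hh j).analyticOnNhd isOpen_ball
  have hbig : ∀ z ∈ ball (0 : ℂ) 1, z ∉ E ∪ E' →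
      ∀ᶠ w in 𝓝 z, ∀ᶠ v in 𝓝 (fun j => h j w), polyCut v = 0 := by
    intro z hz hzE
    obtain ⟨j, hj⟩ : ∃ j, 8 ≤ ‖h j z‖ := by
      by_contra! hc
      exact hzE (hcov z hz hc)
    have h1 : ∀ᶠ w in 𝓝 z, 7 < ‖h j w‖ :=
      (hha j z hz).continuousAt.norm.eventually (lt_mem_nhds (by linarith))
    filter_upwards [h1] with w hw
    have h2 : ∀ᶠ v : ι → ℂ in 𝓝 (fun j => h j w), 7 < ‖v j‖ :=
      (continuous_apply j).norm.continuousAt.eventually (lt_mem_nhds hw)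
    filter_upwards [h2] with v hv using polyCut_eq_zero hv.le
  let μ : ι → ℂ → ℂ := fun l z => oneE z * (((N : ℂ) + 1)⁻¹ * 4 ^ N * (h l z ^ N)⁻¹)
  have hN1 : ((N : ℂ) + 1) ≠ 0 := by exact_mod_cast N.succ_ne_zero
  have hμ : ∀ l, ∀ z ∈ ball (0 : ℂ) 1, (AnalyticAt ℂ (μ l) z ∧ ‖μ l z‖ ≤ 1 ∧
      ‖deriv (μ l) z‖ ≤ ∑ j, ‖deriv (h j) z‖) ∨
      ∀ᶠ w in 𝓝 z, pdBar polyCut l (fun j => h j w) = 0 := by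
    intro l z hz
    by_cases hzE : z ∈ E ∪ E'
    swap
    · right
      filter_upwards [hbig z hz hzE] with w hw using pdBar_eq_zero_of_eventually hw l
    rcases lt_or_ge ‖h l z‖ 5 with hs | hs
    · right
      filter_upwards [(hha l z hz).continuousAt.norm.eventually (gt_mem_nhds hs)] with w hw
      exact pdBar_polyCut_eq_zero hw
    left
    have h0 : h l z ≠ 0 := fun h0 => by rw [h0, norm_zero] at hs; linarith
    rcases hzE with hzE | hzE
    · have he : μ l =ᶠ[𝓝 z] fun w => ((N : ℂ) + 1)⁻¹ * 4 ^ N * (h l w ^ N)⁻¹ := by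
        filter_upwards [hoE z hzE] with w hw
        simp only [μ, hw, one_mul]
      have hd : HasDerivAt (fun w => ((N : ℂ) + 1)⁻¹ * 4 ^ N * (h l w ^ N)⁻¹)
          (((N : ℂ) + 1)⁻¹ * 4 ^ N * (-(N * h l z ^ (N - 1) * deriv (h l) z) / (h l z ^ N) ^ 2)) z :=
        (((hha l z hz).differentiableAt.hasDerivAt.pow N).inv (pow_ne_zero N h0)).const_mul _
      have h5 : (4 : ℝ) ^ N * (‖h l z‖ ^ N)⁻¹ ≤ 1 := by
        rw [← div_eq_mul_inv, ← div_pow]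
        exact pow_le_one₀ (by positivity) ((div_le_one (by linarith)).2 (by linarith))
      have h6 : ‖((N : ℂ) + 1)⁻¹‖ = ((N : ℝ) + 1)⁻¹ := by
        rw [norm_inv]; norm_cast
      refine ⟨(analyticAt_const.mul (((hha l z hz).pow N).inv (pow_ne_zero N h0))).congr he.symm,
        ?_, ?_⟩
      · rw [he.self_of_nhds]
        simp only [mul_assoc _ ((4 : ℂ) ^ N)]
        rw [ norm_mul, h6]
        refine mul_le_one₀ (inv_le_one_of_one_le₀ (by linarith [N.cast_nonneg (α := ℝ)]))
          (norm_nonneg _) (by simpa using h5)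
      · rw [he.deriv_eq, hd.deriv]
        refine le_trans ?_ (Finset.single_le_sum (f := fun j => ‖deriv (h j) z‖)
          (fun i _ => norm_nonneg _) (Finset.mem_univ l))
        rcases N.eq_zero_or_pos with rfl | hNp
        · simp
        have h7 : ((N : ℂ) + 1)⁻¹ * 4 ^ N * (-(N * h l z ^ (N - 1) * deriv (h l) z) / (h l z ^ N) ^ 2)
            = -(((N : ℂ) + 1)⁻¹ * N * (4 ^ N * (h l z ^ N)⁻¹) * (h l z)⁻¹ * deriv (h l) z) := by
          obtain ⟨n, rfl⟩ := Nat.exists_eq_succ_of_ne_zero hNp.ne'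
          simp only [Nat.succ_eq_add_one, Nat.add_sub_cancel]
          field_simp
          ring
        rw [h7, norm_neg, norm_mul]
        refine mul_le_of_le_one_left (norm_nonneg _) ?_
        rw [norm_mul, norm_mul, norm_mul, h6]
        refine mul_le_one₀ (mul_le_one₀ ?_ (norm_nonneg _) ?_) (norm_nonneg _) ?_
        · rw [inv_mul_le_one₀ (by positivity)]; simp
        · simpa using h5
        · rw [norm_inv]; exact inv_le_one_of_one_le₀ (by linarith)
    · have he : μ l =ᶠ[𝓝 z] fun w => 0 := by
        filter_upwards [hoE' z hzE] with w hw
        simp only [μ, hw, zero_mul]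
      refine ⟨analyticAt_const.congr he.symm, by rw [he.self_of_nhds]; simp, ?_⟩
      rw [he.deriv_eq]
      simpa using Finset.sum_nonneg fun i _ => norm_nonneg _
  choose β hβ hβC using fun l => hD l h (μ l) hh (fun z hz => by
    rw [mem_closedBall_zero_iff, pi_norm_le_iff_of_nonneg (abs_nonneg M)]
    exact fun j => (hM j z hz).trans (le_abs_self M)) (hμ l)
  let e : ℂ → ℂ := fun z => oneE z * polyCut (fun j => h j z) -
    ∑ l, h l z ^ N * (((N : ℂ) + 1) / 4 ^ N * β l z)
  have hcoef : ‖((N : ℂ) + 1) / 4 ^ N‖ = ((N : ℝ) + 1) / 4 ^ N := by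
    rw [norm_div, norm_pow]; norm_cast
  have hone : ∀ z, ‖oneE z‖ ≤ 1 := fun z => by
    by_cases hz : z ∈ E
    · simp [oneE, hz]
    · simp [oneE, hz]
  have hsmall : ∀ z ∈ ball (0 : ℂ) 1, (∀ j, ‖h j z‖ < 1) →
      ‖∑ l, h l z ^ N * (((N : ℂ) + 1) / 4 ^ N * β l z)‖ ≤ 1 / 4 := by
    intro z hz hz1
    refine ((norm_sum_le _ _).trans (Finset.sum_le_sum fun l _ => ?_)).trans hN
    rw [norm_mul, norm_mul, hcoef, norm_pow]
    refine (mul_le_of_le_one_left (by positivity) (pow_le_one₀ (norm_nonneg _) (hz1 l).le)).trans ?_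
    gcongr
    exact hβC l z hz
  refine ⟨e, ?_, ?_, ?_, ?_⟩
  · intro z hz
    suffices hw : ∃ a, HasWirt e a 0 z from
      hw.choose_spec.hasDerivAt.differentiableAt.differentiableWithinAt
    have h1 : HasWirt (fun x => polyCut fun j => h j x) _ _ z :=
      HasWirt.comp_pi ((contDiff_polyCut (n := 1)).differentiable one_ne_zero _)
        fun j => (hha j z hz).differentiableAt.hasDerivAt
    have hΦ : ∃ a, HasWirt (fun x => oneE x * polyCut fun j => h j x) a
        (oneE z * ∑ j, pdBar polyCut j (fun j => h j z) * conj (deriv (h j) z)) z := by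
      by_cases hzE : z ∈ E ∪ E'
      · obtain ⟨c, hc⟩ : ∃ c, ∀ᶠ w in 𝓝 z, oneE w = c :=
          hzE.elim (fun h => ⟨1, hoE z h⟩) fun h => ⟨0, hoE' z h⟩
        refine ⟨_, ((h1.const_mul c).congr_of_eventuallyEq ?_).congr_coeff rfl ?_⟩
        · filter_upwards [hc] with w hw
          rw [hw]
        · rw [hc.self_of_nhds]
      · refine ⟨0, (HasWirt.zero_of_eventuallyEq ?_).congr_coeff rfl ?_⟩
        · filter_upwards [hbig z hz hzE] with w hw
          simp only [hw.self_of_nhds, mul_zero]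
        · simp only [pdBar_eq_zero_of_eventually (hbig z hz hzE).self_of_nhds, zero_mul,
            Finset.sum_const_zero, mul_zero]
    obtain ⟨a, ha⟩ := hΦ
    choose p hp using fun l => hβ l z hz
    refine ⟨_, (ha.sub (HasWirt.sum (s := Finset.univ) fun l _ =>
      ((HasWirt.of_hasDerivAt ((hha l z hz).differentiableAt.hasDerivAt.pow N)).mul
        ((hp l).const_mul (((N : ℂ) + 1) / 4 ^ N))))).congr_coeff rfl ?_⟩
    rw [Finset.mul_sum, ← Finset.sum_sub_distrib]
    refine Finset.sum_eq_zero fun l _ => ?_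
    rcases lt_or_ge ‖h l z‖ 5 with hs | hs
    · have h8 : pdBar polyCut l (fun j => h j z) = 0 := pdBar_polyCut_eq_zero hs
      simp [h8]
    · have h0 : h l z ≠ 0 := fun h0 => by rw [h0, norm_zero] at hs; linarith
      simp only [μ, Pi.pow_apply]
      field_simp
      ring
  · intro z hz
    refine (norm_sub_le _ _).trans (add_le_add ?_ ((norm_sum_le _ _).trans
      (Finset.sum_le_sum fun l _ => ?_)))
    · rw [norm_mul]; exact mul_le_one₀ (hone z) (norm_nonneg _) (norm_polyCut_le _)
    · rw [norm_mul, norm_mul, hcoef, norm_pow]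
      gcongr
      · exact (hM l z hz).trans (le_abs_self M)
      · exact hβC l z hz
  · intro z hz hz1 hzE
    simp only [e]
    rw [(hoE z hzE).self_of_nhds, polyCut_eq_one (fun j => by linarith [hz1 j] )]
    simpa using hsmall z hz hz1
  · intro z hz hz1 hzE
    simp only [e]
    rw [(hoE' z hzE).self_of_nhds]
    simpa using hsmall z hz hz1
end

section
variable {ι : Type*} [Fintype ι]

/-- The smooth solution `w̄_j / |w|²` of the Bézout equation `∑ w_j φ_j = 1`. -/
noncomputable def bezoutSol (j : ι) (w : ι → ℂ) : ℂ :=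
  conj (w j) * (((∑ i, ‖w i‖ ^ 2 : ℝ) : ℂ))⁻¹

lemma isOpen_bezoutDom : IsOpen {w : ι → ℂ | 0 < ∑ i, ‖w i‖ ^ 2} :=
  isOpen_lt continuous_const (by fun_prop)

lemma contDiffOn_bezoutSol {n : ℕ∞} (j : ι) :
    ContDiffOn ℝ n (bezoutSol j) {w : ι → ℂ | 0 < ∑ i, ‖w i‖ ^ 2} := by
  refine (conjCLE.contDiff.comp (contDiff_apply ℝ ℂ j)).contDiffOn.mul (ContDiffOn.inv ?_ ?_)
  · exact (ofRealCLM.contDiff.comp (ContDiff.sum fun i _ => (contDiff_apply ℝ ℂ i).norm_sq ℝ)).contDiffOn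
  · intro w hw
    exact ofReal_ne_zero.2 (ne_of_gt hw)

lemma sum_mul_bezoutSol {w : ι → ℂ} (hw : 0 < ∑ i, ‖w i‖ ^ 2) : ∑ j, w j * bezoutSol j w = 1 := by
  simp only [bezoutSol, ← mul_assoc]
  rw [← Finset.sum_mul]
  have : ∑ j, w j * conj (w j) = ((∑ i, ‖w i‖ ^ 2 : ℝ) : ℂ) := by
    push_cast
    exact Finset.sum_congr rfl fun j _ => by rw [mul_conj, normSq_eq_norm_sq]; push_cast; rfl
  rw [this, mul_inv_cancel₀ (ofReal_ne_zero.2 hw.ne')]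

end

/-- The corona theorem for the disc, with bounds depending only on the data. -/
theorem corona_disc (ι : Type*) [Fintype ι] (M : ℝ) {δ : ℝ} (hδ : 0 < δ) :
    ∃ C, 0 ≤ C ∧ ∀ f : ι → ℂ → ℂ, (∀ j, DifferentiableOn ℂ (f j) (ball 0 1)) →
      (∀ j, ∀ z ∈ ball (0 : ℂ) 1, ‖f j z‖ ≤ M) →
      (∀ z ∈ ball (0 : ℂ) 1, δ ≤ ∑ j, ‖f j z‖ ^ 2) →
      ∃ g : ι → ℂ → ℂ, (∀ j, DifferentiableOn ℂ (g j) (ball 0 1)) ∧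
        (∀ j, ∀ z ∈ ball (0 : ℂ) 1, ‖g j z‖ ≤ C) ∧
        ∀ z ∈ ball (0 : ℂ) 1, ∑ j, f j z * g j z = 1 := by
  classical
  let V : Set (ι → ℂ) := {w | 0 < ∑ i, ‖w i‖ ^ 2}
  let K : Set (ι → ℂ) := closedBall 0 |M| ∩ {w | δ ≤ ∑ i, ‖w i‖ ^ 2}
  have hK : IsCompact K := (isCompact_closedBall _ _).inter_right
    (isClosed_le continuous_const (by fun_prop))
  have hKV : K ⊆ V := fun w hw => hδ.trans_le hw.2
  have hφ1 : ∀ j, ContDiffOn ℝ 1 (bezoutSol j) V := fun j => contDiffOn_bezoutSol (n := 1) j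
  have hG : ∀ p : ι × ι × ι, ContDiffOn ℝ 1 (fun w => bezoutSol p.1 w * pdBar (bezoutSol p.2.1) p.2.2 w)
      V := fun p => by
    have h2 := contDiffOn_pdBar (n := 1) isOpen_bezoutDom (contDiffOn_bezoutSol (n := 2) p.2.1) p.2.2
    exact (hφ1 p.1).mul (by exact_mod_cast h2)
  choose C₀ hC₀ hD using fun p : ι × ι × ι => dbar_comp isOpen_bezoutDom hK hKV (hG p) p.2.2
  choose B hB using fun j => hK.exists_bound_of_continuousOn ((hφ1 j).continuousOn.mono hKV)
  let C₁ := ∑ p, C₀ p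
  have hC₁ : 0 ≤ C₁ := Finset.sum_nonneg fun p _ => hC₀ p
  let c : ℝ := Fintype.card ι
  have hc : 0 ≤ c := Nat.cast_nonneg _
  refine ⟨∑ j, |B j| + c * ((c * C₁ + c * C₁) * |M|), by positivity, fun f hf hM hfδ => ?_⟩
  have hfa := fun j => (hf j).analyticOnNhd isOpen_ball
  have hfK : ∀ z ∈ ball (0 : ℂ) 1, (fun j => f j z) ∈ K := fun z hz => by
    refine ⟨?_, hfδ z hz⟩
    rw [mem_closedBall_zero_iff, pi_norm_le_iff_of_nonneg (abs_nonneg M)]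
    exact fun j => (hM j z hz).trans (le_abs_self M)
  choose β hβ hβC using fun p : ι × ι × ι => hD p f (fun _ => 1) hf hfK (fun z hz =>
    Or.inl ⟨analyticAt_const, by simp, by simpa using Finset.sum_nonneg fun i _ => norm_nonneg _⟩)
  let b : ι → ι → ℂ → ℂ := fun j k z => ∑ l, β (j, k, l) z
  let φ : ι → ℂ → ℂ := fun j z => bezoutSol j fun i => f i z
  let g : ι → ℂ → ℂ := fun j z => φ j z + ∑ k, (b j k z - b k j z) * f k z
  have hbC : ∀ j k, ∀ z ∈ ball (0 : ℂ) 1, ‖b j k z‖ ≤ c * C₁ := fun j k z hz => by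
    refine (norm_sum_le _ _).trans ((Finset.sum_le_card_nsmul _ _ C₁ fun l _ => ?_).trans_eq
      (by simp [c]))
    exact (hβC _ z hz).trans (Finset.single_le_sum (fun p _ => hC₀ p) (Finset.mem_univ _))
  refine ⟨g, fun j z hz => ?_, fun j z hz => ?_, fun z hz => ?_⟩
  · suffices hw : ∃ a, HasWirt (g j) a 0 z from
      hw.choose_spec.hasDerivAt.differentiableAt.differentiableWithinAt
    let D : ι → ℂ := fun k => ∑ l, pdBar (bezoutSol k) l (fun i => f i z) * conj (deriv (f l) z)
    have hφ : ∀ k, ∃ a, HasWirt (φ k) a (D k) z := fun k =>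
      ⟨_, HasWirt.comp_pi (((hφ1 k).differentiableOn one_ne_zero).differentiableAt
        (isOpen_bezoutDom.mem_nhds (hKV (hfK z hz)))) fun i =>
          (hfa i z hz).differentiableAt.hasDerivAt⟩
    choose a ha using hφ
    have hb : ∀ i k, ∃ p, HasWirt (b i k) p (φ i z * D k) z := fun i k => by
      choose p hp using fun l => hβ (i, k, l) z hz
      refine ⟨_, (HasWirt.sum (s := Finset.univ) fun l _ => hp l).congr_coeff rfl ?_⟩
      simp only [D, φ, Finset.mul_sum, one_mul, mul_assoc]
    choose p hp using hb
    have hf' : ∀ k, HasWirt (f k) (deriv (f k) z) 0 z := fun k =>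
      HasWirt.of_hasDerivAt (hfa k z hz).differentiableAt.hasDerivAt
    have hD0 : ∑ k, f k z * D k = 0 := by
      have h1 := HasWirt.sum (s := Finset.univ) fun k _ => (hf' k).mul (ha k)
      have h2 : HasWirt (fun x => ∑ k, f k x * φ k x) 0 0 z := by
        refine (HasWirt.const 1).congr_of_eventuallyEq ?_
        filter_upwards [isOpen_ball.mem_nhds hz] with w hw
        exact sum_mul_bezoutSol (hKV (hfK w hw))
      simpa using (h1.unique h2).2
    refine ⟨_, ((ha j).add (HasWirt.sum (s := Finset.univ) fun k _ =>
      ((hp j k).sub (hp k j)).mul (hf' k))).congr_coeff rfl ?_⟩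
    have h3 : ∑ k, f k z * φ k z = 1 := sum_mul_bezoutSol (hKV (hfK z hz))
    have h4 : ∑ k, ((φ j z * D k - φ k z * D j) * f k z + (b j k z - b k j z) * 0)
        = φ j z * ∑ k, f k z * D k - D j * ∑ k, f k z * φ k z := by
      rw [Finset.mul_sum, Finset.mul_sum, ← Finset.sum_sub_distrib]
      exact Finset.sum_congr rfl fun k _ => by ring
    rw [h4, hD0, h3]
    ring
  · refine (norm_add_le _ _).trans (add_le_add ?_ ?_)
    · exact ((hB j _ (hfK z hz)).trans (le_abs_self _)).trans
        (Finset.single_le_sum (f := fun j => |B j|) (fun i _ => abs_nonneg _) (Finset.mem_univ j))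
    · refine (norm_sum_le _ _).trans ((Finset.sum_le_card_nsmul _ _
        ((c * C₁ + c * C₁) * |M|) fun k _ => ?_).trans_eq (by simp [c]))
      rw [norm_mul]
      gcongr
      · exact (norm_sub_le _ _).trans (add_le_add (hbC j k z hz) (hbC k j z hz))
      · exact (hM k z hz).trans (le_abs_self M)
  · have h3 : ∑ k, f k z * φ k z = 1 := sum_mul_bezoutSol (hKV (hfK z hz))
    simp only [g, mul_add, Finset.sum_add_distrib, h3, Finset.mul_sum]
    have h5 : ∑ j, ∑ k, f j z * ((b j k z - b k j z) * f k z) =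
        ∑ j, ∑ k, f j z * f k z * b j k z - ∑ j, ∑ k, f j z * f k z * b k j z := by
      rw [← Finset.sum_sub_distrib]
      refine Finset.sum_congr rfl fun j _ => ?_
      rw [← Finset.sum_sub_distrib]
      exact Finset.sum_congr rfl fun k _ => by ring
    rw [h5, Finset.sum_comm (f := fun j k => f j z * f k z * b k j z)]
    have h6 : ∀ j k, f k z * f j z * b j k z = f j z * f k z * b j k z := fun j k => by ring
    simp only [h6, sub_self, add_zero]

lemma hasDerivAt_posPart_pow (n : ℕ) (t : ℝ) :
    HasDerivAt (fun t : ℝ => max t 0 ^ (n + 2)) ((n + 2) * max t 0 ^ (n + 1)) t := by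
  rcases lt_trichotomy t 0 with h | rfl | h
  · rw [max_eq_right h.le, zero_pow (by omega), mul_zero]
    refine (hasDerivAt_const t (0 : ℝ)).congr_of_eventuallyEq ?_
    filter_upwards [gt_mem_nhds h] with s hs
    rw [max_eq_right hs.le, zero_pow (by omega)]
  · rw [max_self, zero_pow (by omega), mul_zero]
    rw [hasDerivAt_iff_tendsto_slope_zero]
    have h1 : Tendsto (fun s : ℝ => |s| ^ (n + 1)) (𝓝[≠] 0) (𝓝 0) := by
      have : Continuous fun s : ℝ => |s| ^ (n + 1) := by fun_prop
      simpa using (this.tendsto 0).mono_left nhdsWithin_le_nhds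
    refine squeeze_zero_norm (fun s => ?_) h1
    rw [zero_add, max_self, zero_pow (by omega), sub_zero, norm_smul, norm_inv, norm_pow,
      Real.norm_eq_abs, Real.norm_eq_abs]
    rcases eq_or_ne s 0 with rfl | hs
    · simp
    rw [inv_mul_le_iff₀ (abs_pos.2 hs), ← pow_succ']
    refine pow_le_pow_left₀ (abs_nonneg _) ?_ _
    rw [abs_of_nonneg (le_max_right s 0)]
    exact max_le (le_abs_self s) (abs_nonneg s)
  · rw [max_eq_left h.le]
    refine ((hasDerivAt_pow (n + 2) t).congr_of_eventuallyEq ?_).congr_deriv (by push_cast; simp)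
    filter_upwards [lt_mem_nhds h] with s hs
    rw [max_eq_left hs.le]

lemma setIntegral_ball_of_analytic {φ : ℂ → ℂ} (hφ : AnalyticOnNhd ℂ φ (closedBall 0 1)) :
    ∫ z in ball (0 : ℂ) 1, φ z = π * φ 0 := by
  have h1 : ∀ z ∈ closedBall (0 : ℂ) 1, HasWirt φ (deriv φ z) 0 z := fun z hz =>
    HasWirt.of_hasDerivAt (hφ.hasDerivAt_closedBall hz)
  have h2 := cauchy_pompeiu (b := fun _ => 0) h1 hφ.deriv.continuousOn continuousOn_const
    (mem_ball_self one_pos)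
  have h3 := integral_wirt_conj (F := fun z => φ z * conj z) (a := fun z => deriv φ z * conj z)
    (b := φ) (fun z hz => ((h1 z hz).mul HasWirt.star_id).congr_coeff (by simp) (by simp))
    (hφ.deriv.continuousOn.mul continuous_conj.continuousOn) hφ.continuousOn
  rw [h3, h2]
  simp only [zero_mul, integral_zero, sub_zero]
  congr 1
  refine circInt_congr fun z hz => ?_
  have h0 : z ≠ 0 := by rintro rfl; simp at hz
  rw [div_self h0, mul_assoc, mul_comm (conj z), mul_conj_of_mem_sphere hz]

lemma mul_abs_im_le_setIntegral {f : ℂ → ℂ} {r : ℝ} (hr : 0 < r)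
    (hf : AnalyticOnNhd ℂ f (closedBall 0 r)) :
    π * r ^ 2 * |(f 0).im| ≤ ∫ z in ball (0 : ℂ) r, |(f z).im| := by
  have hmem : ∀ z ∈ closedBall (0 : ℂ) 1, r • z ∈ closedBall (0 : ℂ) r := fun z hz => by
    rw [mem_closedBall_zero_iff] at hz ⊢
    rw [norm_smul, Real.norm_of_nonneg hr.le]
    nlinarith
  have hφ : AnalyticOnNhd ℂ (fun z => f (r • z)) (closedBall 0 1) := fun z hz => by
    have h1 : AnalyticAt ℂ (fun z : ℂ => r • z) z := by
      simp only [real_smul]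
      exact analyticAt_const.mul analyticAt_id
    exact (hf _ (hmem z hz)).comp_of_eq' h1 rfl
  have h1 := setIntegral_ball_of_analytic hφ
  have h2 : π * (f 0).im = ∫ z in ball (0 : ℂ) 1, (f (r • z)).im := by
    have h3 := congrArg Complex.im h1
    have h4 := integral_im (𝕜 := ℂ) (integrableOn_ball_of_continuousOn hφ.continuousOn)
    simp only [RCLike.im_to_complex] at h4
    rw [h4, h3, smul_zero, im_ofReal_mul]
  have h5 : π * |(f 0).im| ≤ ∫ z in ball (0 : ℂ) 1, |(f (r • z)).im| := by
    have h6 : π * |(f 0).im| = |π * (f 0).im| := by rw [abs_mul, abs_of_pos Real.pi_pos]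
    rw [h6, h2]
    exact abs_integral_le_integral_abs
  rw [MeasureTheory.Measure.setIntegral_comp_smul_of_pos volume (fun z => |(f z).im|) _ hr,
    smul_unitBall_of_pos hr, finrank_real_complex, smul_eq_mul] at h5
  have hr2 : 0 < r ^ 2 := by positivity
  calc π * r ^ 2 * |(f 0).im| = r ^ 2 * (π * |(f 0).im|) := by ring
    _ ≤ r ^ 2 * ((r ^ 2)⁻¹ * ∫ z in ball (0 : ℂ) r, |(f z).im|) := by gcongr
    _ = _ := by field_simp

/-- The cutoff `(|k|² - 9)₊³`. -/
noncomputable def keyCut (k : ℂ → ℂ) (z : ℂ) : ℝ := max (‖k z‖ ^ 2 - 9) 0 ^ 3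

/-- The derivative `∂` of `keyCut k`. -/
noncomputable def keyCutD (k : ℂ → ℂ) (z : ℂ) : ℂ :=
  ((3 * max (‖k z‖ ^ 2 - 9) 0 ^ 2 : ℝ) : ℂ) * (deriv k z * conj (k z))

/-- The derivative `∂̄∂` of `keyCut k`. -/
noncomputable def keyCutL (k : ℂ → ℂ) (z : ℂ) : ℝ :=
  (6 * max (‖k z‖ ^ 2 - 9) 0 * ‖k z‖ ^ 2 + 3 * max (‖k z‖ ^ 2 - 9) 0 ^ 2) * ‖deriv k z‖ ^ 2

/-- The derivative `∂∂` of `keyCut k`. -/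
noncomputable def keyCutDD (k : ℂ → ℂ) (z : ℂ) : ℂ :=
  ((6 * max (‖k z‖ ^ 2 - 9) 0 : ℝ) : ℂ) * (deriv k z * conj (k z)) * (deriv k z * conj (k z)) +
    ((3 * max (‖k z‖ ^ 2 - 9) 0 ^ 2 : ℝ) : ℂ) * (deriv (deriv k) z * conj (k z))

section
variable {k : ℂ → ℂ} {z : ℂ}

lemma hasWirt_keyCut (hk : AnalyticAt ℂ k z) :
    HasWirt (fun z => (keyCut k z : ℂ)) (keyCutD k z) (conj (keyCutD k z)) z := by
  have h1 : HasDerivAt (fun t : ℝ => max (t - 9) 0 ^ 3) (3 * max (‖k z‖ ^ 2 - 9) 0 ^ 2) (‖k z‖ ^ 2) := by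
    have h := (hasDerivAt_posPart_pow 1 (‖k z‖ ^ 2 - 9)).comp_sub_const (‖k z‖ ^ 2) 9
    norm_num at h
    exact h
  refine ((HasWirt.normSq hk.differentiableAt.hasDerivAt).ofReal_comp h1).congr_coeff rfl ?_
  simp only [keyCutD, map_mul, conj_ofReal, conj_conj]
  ring

lemma hasWirt_keyCutD (hk : AnalyticAt ℂ k z) :
    HasWirt (keyCutD k) (keyCutDD k z) (keyCutL k z : ℂ) z := by
  have h1 : HasDerivAt (fun t : ℝ => 3 * max (t - 9) 0 ^ 2) (6 * max (‖k z‖ ^ 2 - 9) 0) (‖k z‖ ^ 2) := by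
    have h := ((hasDerivAt_posPart_pow 0 (‖k z‖ ^ 2 - 9)).comp_sub_const (‖k z‖ ^ 2) 9).const_mul 3
    norm_num at h
    exact h.congr_deriv (by ring)
  refine (((HasWirt.normSq hk.differentiableAt.hasDerivAt).ofReal_comp h1).mul
    ((HasWirt.of_hasDerivAt hk.deriv.differentiableAt.hasDerivAt).mul
      (HasWirt.of_hasDerivAt hk.differentiableAt.hasDerivAt).star)).congr_coeff ?_ ?_
  · simp only [keyCutDD, map_zero, mul_zero, add_zero]
  · have e1 : k z * conj (k z) = ((‖k z‖ ^ 2 : ℝ) : ℂ) := by rw [mul_conj, normSq_eq_norm_sq]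
    have e2 : deriv k z * conj (deriv k z) = ((‖deriv k z‖ ^ 2 : ℝ) : ℂ) := by
      rw [mul_conj, normSq_eq_norm_sq]
    simp only [keyCutL, zero_mul, zero_add]
    push_cast at e1 e2 ⊢
    rw [← e1, ← e2]
    ring

lemma keyCut_nonneg : 0 ≤ keyCut k z := pow_nonneg (le_max_right _ _) _

lemma keyCutL_nonneg : 0 ≤ keyCutL k z := by unfold keyCutL; positivity

lemma keyCut_eq_zero (h : ‖k z‖ ≤ 3) :
    keyCut k z = 0 ∧ keyCutD k z = 0 ∧ keyCutL k z = 0 ∧ keyCutDD k z = 0 := by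
  have h1 : max (‖k z‖ ^ 2 - 9) 0 = 0 := max_eq_right (by nlinarith [norm_nonneg (k z)])
  simp [keyCut, keyCutD, keyCutL, keyCutDD, h1]

end

/-- An interior estimate for the imaginary part of a function which is only defined where
`|k| ≥ 3`, and whose imaginary part vanishes on the corresponding part of the unit circle. -/
theorem abs_im_le_integral_deriv (M : ℝ) : ∃ C, 0 ≤ C ∧ ∀ k 𝓚 : ℂ → ℂ,
    AnalyticOnNhd ℂ k (closedBall 0 1) → (∀ z ∈ closedBall (0 : ℂ) 1, ‖k z‖ ≤ M) →
    4 ≤ ‖k 0‖ → (∀ z ∈ closedBall (0 : ℂ) 1, 3 ≤ ‖k z‖ → AnalyticAt ℂ 𝓚 z) →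
    (∀ z ∈ sphere (0 : ℂ) 1, 3 ≤ ‖k z‖ → (𝓚 z).im = 0) →
    |(𝓚 0).im| ≤ C * ∫ z in ball (0 : ℂ) 1 ∩ {z | 3 < ‖k z‖}, ‖deriv 𝓚 z‖ := by
  by_cases hM0 : M < 0
  · refine ⟨0, le_rfl, fun k _ _ h _ _ _ => ?_⟩
    linarith [h 0 (by simp), norm_nonneg (k 0)]
  push Not at hM0
  let r : ℝ := 1 / (8 * (M + 1))
  have hr : 0 < r := by positivity
  have hr1 : r ≤ 1 / 8 := by
    simp only [r]; gcongr; linarith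
  let C₁ : ℝ := M ^ 6 + 3 * M ^ 4 * (2 * M * M)
  refine ⟨C₁ / (π * r ^ 2), by positivity, fun k 𝓚 hk hkM hk0 h𝓚 h𝓚im => ?_⟩
  set S : Set ℂ := ball (0 : ℂ) 1 ∩ {z | 3 < ‖k z‖} with hS
  set J := ∫ z in S, ‖deriv 𝓚 z‖ with hJ
  have hkc : ContinuousOn k (closedBall 0 1) := hk.continuousOn
  have hSo : IsOpen S := by
    have := (hkc.mono ball_subset_closedBall).norm.isOpen_inter_preimage isOpen_ball
      (isOpen_Ioi (a := (3 : ℝ)))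
    exact this
  have hKc : IsCompact (closedBall (0 : ℂ) 1 ∩ {z | 3 ≤ ‖k z‖}) := by
    have := hkc.norm.preimage_isClosed_of_isClosed isClosed_closedBall (isClosed_Ici (a := (3 : ℝ)))
    exact (isCompact_closedBall (0 : ℂ) 1).of_isClosed_subset this inter_subset_left
  have hdc : ContinuousOn (deriv 𝓚) (closedBall (0 : ℂ) 1 ∩ {z | 3 ≤ ‖k z‖}) := fun z hz =>
    (h𝓚 z hz.1 hz.2).deriv.continuousAt.continuousWithinAt
  have hSK : S ⊆ closedBall (0 : ℂ) 1 ∩ {z | 3 ≤ ‖k z‖} := fun z hz =>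
    ⟨ball_subset_closedBall hz.1, (mem_setOf_eq.mp hz.2 : 3 < ‖k z‖).le⟩
  have hintg : IntegrableOn (fun z => ‖deriv 𝓚 z‖) S := by
    obtain ⟨B, hB⟩ := hKc.exists_bound_of_continuousOn hdc
    refine IntegrableOn.of_bound (C := B)
      ((measure_mono inter_subset_left).trans_lt measure_ball_lt_top)
      ((hdc.mono hSK).norm.aestronglyMeasurable hSo.measurableSet) ?_
    filter_upwards [ae_restrict_mem hSo.measurableSet] with z hz
    simpa using hB z (hSK hz)
  have key : ∀ ε > 0, π * r ^ 2 * (|(𝓚 0).im| - ε) ≤ C₁ * J := by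
    intro ε hε
    let N : ℂ → ℝ := fun z => √((𝓚 z).im ^ 2 + ε ^ 2)
    have hN0 : ∀ z, 0 < N z := fun z => Real.sqrt_pos.2 (by positivity)
    have hNge : ∀ z, |(𝓚 z).im| ≤ N z := fun z => Real.abs_le_sqrt (by linarith [sq_nonneg ε])
    have hNε : ∀ z, ε ≤ N z := fun z => Real.le_sqrt_of_sq_le (by linarith [sq_nonneg (𝓚 z).im])
    let uD : ℂ → ℂ := fun z => (((𝓚 z).im / N z : ℝ) : ℂ) * (deriv 𝓚 z / (2 * I))
    have hu : ∀ z, AnalyticAt ℂ 𝓚 z →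
        HasWirt (fun z => ((N z - ε : ℝ) : ℂ)) (uD z) (conj (uD z)) z := by
      intro z hz
      have h1 : HasWirt (fun z => (((𝓚 z).im : ℝ) : ℂ)) (deriv 𝓚 z / (2 * I))
          (conj (deriv 𝓚 z / (2 * I))) z := by
        have h2 := HasWirt.of_hasDerivAt hz.differentiableAt.hasDerivAt
        refine (((h2.sub h2.star).const_mul (1 / (2 * I))).congr_of_eventuallyEq
          (Eventually.of_forall fun x => ?_)).congr_coeff ?_ ?_
        · simp only [sub_conj]; push_cast; field_simp [I_ne_zero]
        · rw [map_zero, sub_zero]; ring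
        · rw [map_div₀, map_mul, conj_I, zero_sub, show conj (2 : ℂ) = 2 from map_ofNat _ 2]
          field_simp
      have h3 : HasDerivAt (fun t : ℝ => √(t ^ 2 + ε ^ 2) - ε) ((𝓚 z).im / N z) ((𝓚 z).im) := by
        have h4 := (((hasDerivAt_pow 2 (𝓚 z).im).add_const (ε ^ 2)).sqrt (by positivity)).sub_const ε
        refine h4.congr_deriv ?_
        simp only [N]
        have := (hN0 z).ne'
        field_simp
        simp
      refine (h1.ofReal_comp h3).congr_coeff rfl ?_
      simp only [uD, map_mul, conj_ofReal]
    let G : ℂ → ℂ := fun z => ((1 - ‖z‖ ^ 2 : ℝ) : ℂ)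
    let B : ℂ → ℂ := fun z => -(keyCut k z : ℂ) * conj z - G z * keyCutD k z
    let Ba : ℂ → ℂ := fun z => -keyCutD k z * conj z + conj z * keyCutD k z - G z * keyCutDD k z
    let Bb : ℂ → ℂ := fun z => -conj (keyCutD k z) * conj z - keyCut k z + z * keyCutD k z
      - G z * keyCutL k z
    have hB : ∀ z ∈ closedBall (0 : ℂ) 1, HasWirt B (Ba z) (Bb z) z := fun z hz => by
      refine (((hasWirt_keyCut (hk z hz)).neg.mul HasWirt.star_id).sub
        ((hasWirt_one_sub_normSq z).mul (hasWirt_keyCutD (hk z hz)))).congr_coeff ?_ ?_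
      · simp only [Ba, G]; ring
      · simp only [Bb, G]; ring
    have hB0 : ∀ z, ‖k z‖ ≤ 3 → B z = 0 ∧ Ba z = 0 ∧ Bb z = 0 := fun z hz => by
      obtain ⟨e1, e2, e3, e4⟩ := keyCut_eq_zero hz
      simp [B, Ba, Bb, e1, e2, e3, e4]
    have hnear : ∀ z ∈ closedBall (0 : ℂ) 1, ‖k z‖ < 3 →
        ∀ᶠ w in 𝓝 z, B w = 0 ∧ Ba w = 0 ∧ Bb w = 0 := fun z hz h => by
      filter_upwards [(hk z hz).continuousAt.norm.eventually (gt_mem_nhds h)] with w hw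
      exact hB0 w hw.le
    let F : ℂ → ℂ := fun z => ((N z - ε : ℝ) : ℂ) * B z
    let a : ℂ → ℂ := fun z => uD z * B z + ((N z - ε : ℝ) : ℂ) * Ba z
    let b : ℂ → ℂ := fun z => conj (uD z) * B z + ((N z - ε : ℝ) : ℂ) * Bb z
    have hF : ∀ z ∈ closedBall (0 : ℂ) 1, HasWirt F (a z) (b z) z := fun z hz => by
      rcases lt_or_ge ‖k z‖ 3 with h | h
      · obtain ⟨e1, e2, e3⟩ := hB0 z h.le
        refine (HasWirt.zero_of_eventuallyEq ?_).congr_coeff ?_ ?_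
        · filter_upwards [hnear z hz h] with w hw
          simp [F, hw.1]
        · simp [a, e1, e2]
        · simp [b, e1, e3]
      · exact (hu z (h𝓚 z hz h)).mul (hB z hz)
    have hcB : ∀ z ∈ closedBall (0 : ℂ) 1,
        ContinuousAt B z ∧ ContinuousAt Ba z ∧ ContinuousAt Bb z := fun z hz => by
      have c1 := (hk z hz).continuousAt
      have c2 := (hk z hz).deriv.continuousAt
      have c3 := (hk z hz).deriv.deriv.continuousAt
      refine ⟨(hB z hz).continuousAt, ?_, ?_⟩
      · simp only [Ba, G, keyCutD, keyCutDD]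
        fun_prop
      · simp only [Bb, G, keyCutD, keyCut, keyCutL]
        fun_prop
    have hcu : ∀ z ∈ closedBall (0 : ℂ) 1, 3 ≤ ‖k z‖ → ContinuousAt N z ∧ ContinuousAt uD z :=
      fun z hz h => by
      have c1 := (h𝓚 z hz h).continuousAt
      have c2 := (h𝓚 z hz h).deriv.continuousAt
      have c3 : ContinuousAt N z :=
        ((((Complex.continuous_im.continuousAt (x := 𝓚 z)).comp c1).pow 2).add
          continuousAt_const).sqrt
      refine ⟨c3, ?_⟩
      refine (Complex.continuous_ofReal.continuousAt.comp
        (((Complex.continuous_im.continuousAt (x := 𝓚 z)).comp c1).div c3 (hN0 z).ne')).mul ?_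
      exact c2.div_const _
    have hac : ContinuousOn a (closedBall 0 1) := fun z hz => by
      refine ContinuousAt.continuousWithinAt ?_
      rcases lt_or_ge ‖k z‖ 3 with h | h
      · refine (continuousAt_const (y := (0 : ℂ))).congr ?_
        filter_upwards [hnear z hz h] with w hw
        simp [a, hw.1, hw.2.1]
      · obtain ⟨c1, c2⟩ := hcu z hz h
        obtain ⟨c3, c4, c5⟩ := hcB z hz
        exact (c2.mul c3).add
          ((Complex.continuous_ofReal.continuousAt.comp (c1.sub continuousAt_const)).mul c4)
    have hbc : ContinuousOn b (closedBall 0 1) := fun z hz => by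
      refine ContinuousAt.continuousWithinAt ?_
      rcases lt_or_ge ‖k z‖ 3 with h | h
      · refine (continuousAt_const (y := (0 : ℂ))).congr ?_
        filter_upwards [hnear z hz h] with w hw
        simp [b, hw.1, hw.2.2]
      · obtain ⟨c1, c2⟩ := hcu z hz h
        obtain ⟨c3, c4, c5⟩ := hcB z hz
        exact ((continuous_conj.continuousAt.comp c2).mul c3).add
          ((Complex.continuous_ofReal.continuousAt.comp (c1.sub continuousAt_const)).mul c5)
    have hb0 : ∫ z in ball (0 : ℂ) 1, b z = 0 := by
      rw [integral_wirt_conj hF hac hbc, circInt_congr (G := fun _ => 0) fun z hz => ?_]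
      · simp [circInt]
      · rcases le_or_gt ‖k z‖ 3 with h | h
        · simp [F, (hB0 z h).1]
        · have : N z = ε := by
            simp only [N]
            rw [h𝓚im z hz h.le]
            simp [Real.sqrt_sq hε.le]
          simp [F, this]
    have hbi : IntegrableOn b (ball 0 1) := integrableOn_ball_of_continuousOn hbc
    have hb0re : ∫ z in ball (0 : ℂ) 1, (b z).re = 0 := by
      have h4 := integral_re (𝕜 := ℂ) hbi
      simp only [RCLike.re_to_complex] at h4
      rw [h4, hb0, zero_re]
    have hpt : ∀ z ∈ ball (0 : ℂ) 1,
        (N z - ε) * keyCut k z ≤ -(b z).re + C₁ * S.indicator (fun z => ‖deriv 𝓚 z‖) z := by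
      intro z hz
      have hz' := ball_subset_closedBall hz
      rcases le_or_gt ‖k z‖ 3 with h | h
      · obtain ⟨e1, e2, e3⟩ := hB0 z h
        have hnS : z ∉ S := fun h' => absurd h'.2 (not_lt.2 h)
        simp [b, e1, e3, (keyCut_eq_zero h).1, hnS]
      have hzS : z ∈ S := ⟨hz, h⟩
      rw [indicator_of_mem hzS]
      have hG0 : 0 ≤ 1 - ‖z‖ ^ 2 := one_sub_normSq_nonneg hz'
      have hre : (b z).re = (conj (uD z) * B z).re
          - (N z - ε) * (keyCut k z + (1 - ‖z‖ ^ 2) * keyCutL k z) := by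
        have e1 : (Bb z).re = -(keyCut k z + (1 - ‖z‖ ^ 2) * keyCutL k z) := by
          have e2 : Bb z = (z * keyCutD k z - conj (z * keyCutD k z)) -
              ((keyCut k z + (1 - ‖z‖ ^ 2) * keyCutL k z : ℝ) : ℂ) := by
            simp only [Bb, G, map_mul]
            push_cast
            ring
          rw [e2, sub_re, ofReal_re, sub_conj]
          simp
        simp only [b, add_re, re_ofReal_mul, e1]
        ring
      have hkz := hkM z hz'
      have hk0z := norm_nonneg (k z)
      have hm0 : 0 ≤ max (‖k z‖ ^ 2 - 9) 0 := le_max_right _ _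
      have hm : max (‖k z‖ ^ 2 - 9) 0 ≤ M ^ 2 :=
        max_le (by nlinarith) (by positivity)
      have hd := norm_deriv_le_of_bounded hk hkM hz'
      have hBn : ‖B z‖ ≤ C₁ := by
        have hz1 : ‖z‖ ≤ 1 := mem_closedBall_zero_iff.1 hz'
        have b1 : ‖(keyCut k z : ℂ)‖ ≤ M ^ 6 := by
          rw [norm_real, Real.norm_of_nonneg keyCut_nonneg, show M ^ 6 = (M ^ 2) ^ 3 by ring]
          exact pow_le_pow_left₀ hm0 hm _
        have b2 : ‖G z * keyCutD k z‖ ≤ 3 * M ^ 4 * (2 * M * M) := by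
          simp only [G, keyCutD]
          rw [norm_mul, norm_mul, norm_mul, norm_real, norm_real, norm_conj,
            Real.norm_of_nonneg hG0, Real.norm_of_nonneg (by positivity)]
          calc (1 - ‖z‖ ^ 2) * (3 * max (‖k z‖ ^ 2 - 9) 0 ^ 2 * (‖deriv k z‖ * ‖k z‖))
              = 3 * max (‖k z‖ ^ 2 - 9) 0 ^ 2 * ((1 - ‖z‖ ^ 2) * ‖deriv k z‖ * ‖k z‖) := by ring
            _ ≤ 3 * (M ^ 2) ^ 2 * (2 * M * M) := by gcongr
            _ = _ := by ring
        calc ‖B z‖ ≤ ‖(keyCut k z : ℂ)‖ * ‖z‖ + ‖G z * keyCutD k z‖ := by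
              simp only [B]
              refine (norm_sub_le _ _).trans ?_
              rw [norm_mul, norm_neg, norm_conj]
          _ ≤ ‖(keyCut k z : ℂ)‖ * 1 + ‖G z * keyCutD k z‖ := by gcongr
          _ ≤ C₁ := by simp only [C₁]; linarith
      have hun : ‖uD z‖ ≤ ‖deriv 𝓚 z‖ := by
        simp only [uD]
        rw [norm_mul, norm_real, norm_div, norm_div, norm_mul, norm_I, Real.norm_eq_abs,
          Real.norm_of_nonneg (hN0 z).le]
        have h1 : |(𝓚 z).im| / N z ≤ 1 := (div_le_one (hN0 z)).2 (hNge z)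
        have h2 : ‖deriv 𝓚 z‖ / (‖(2 : ℂ)‖ * 1) ≤ ‖deriv 𝓚 z‖ := by
          simp
        calc _ ≤ 1 * ‖deriv 𝓚 z‖ := by gcongr
          _ = _ := one_mul _
      have h3 : (conj (uD z) * B z).re ≤ C₁ * ‖deriv 𝓚 z‖ := by
        refine (re_le_norm _).trans ?_
        rw [norm_mul, norm_conj, mul_comm]
        gcongr
      have h4 : 0 ≤ (N z - ε) * ((1 - ‖z‖ ^ 2) * keyCutL k z) :=
        mul_nonneg (sub_nonneg.2 (hNε z)) (mul_nonneg hG0 keyCutL_nonneg)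
      rw [hre]
      linarith
    have hindi : IntegrableOn (S.indicator (fun z => ‖deriv 𝓚 z‖)) (ball 0 1) := by
      rw [integrableOn_indicator_iff hSo.measurableSet]
      exact hintg.mono_set inter_subset_left
    have hri : IntegrableOn (fun z => -(b z).re + C₁ * S.indicator (fun z => ‖deriv 𝓚 z‖) z)
        (ball 0 1) := (hbi.re.neg).add (hindi.const_mul C₁)
    have hrI : ∫ z in ball (0 : ℂ) 1, (-(b z).re + C₁ * S.indicator (fun z => ‖deriv 𝓚 z‖) z)
        = C₁ * J := by
      have hbr : IntegrableOn (fun z => (b z).re) (ball 0 1) := hbi.re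
      rw [integral_add (f := fun z => -(b z).re) hbr.neg (hindi.const_mul C₁), integral_neg, hb0re, integral_const_mul,
        setIntegral_indicator hSo.measurableSet, inter_eq_self_of_subset_right inter_subset_left]
      rw [neg_zero, zero_add]
    have hrsub : ball (0 : ℂ) r ⊆ ball 0 1 := ball_subset_ball (by linarith)
    have hrsub' : closedBall (0 : ℂ) r ⊆ ball 0 1 := closedBall_subset_ball (by linarith)
    have hk35 : ∀ z ∈ closedBall (0 : ℂ) r, (7 / 2 : ℝ) ≤ ‖k z‖ := fun z hz => by
      have h1 := (convex_closedBall (0 : ℂ) r).norm_image_sub_le_of_norm_deriv_le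
        (f := k) (C := 3 * M)
        (fun w hw => (hk w (ball_subset_closedBall (hrsub' hw))).differentiableAt)
        (fun w hw => by
          have h2 := norm_deriv_le_of_bounded hk hkM (ball_subset_closedBall (hrsub' hw))
          have h3 : ‖w‖ ≤ 1 / 8 := (mem_closedBall_zero_iff.1 hw).trans hr1
          have h4 : 63 / 64 ≤ 1 - ‖w‖ ^ 2 := by nlinarith [norm_nonneg w]
          nlinarith [norm_nonneg (deriv k w)])
        (mem_closedBall_self hr.le) hz
      have h5 : 3 * M * ‖z - 0‖ ≤ 1 / 2 := by
        rw [sub_zero]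
        calc 3 * M * ‖z‖ ≤ 3 * M * r := by
              gcongr; exact mem_closedBall_zero_iff.1 hz
          _ ≤ 1 / 2 := by
              simp only [r]
              rw [mul_one_div, div_le_iff₀ (by positivity)]
              linarith
      have h6 := norm_sub_norm_le (k 0) (k z)
      rw [norm_sub_rev] at h6
      linarith
    have h𝓚r : AnalyticOnNhd ℂ 𝓚 (closedBall 0 r) := fun z hz =>
      h𝓚 z (ball_subset_closedBall (hrsub' hz)) (by linarith [hk35 z hz])
    have hIr : IntegrableOn (fun z => |(𝓚 z).im|) (ball 0 r) :=
      (((Complex.continuous_im.comp_continuousOn h𝓚r.continuousOn).abs.integrableOn_compact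
        (isCompact_closedBall 0 r)).mono_set ball_subset_closedBall)
    have hcst : IntegrableOn (fun _ : ℂ => ε) (ball 0 r) :=
      integrableOn_const measure_ball_lt_top.ne
    calc π * r ^ 2 * (|(𝓚 0).im| - ε)
        = π * r ^ 2 * |(𝓚 0).im| - ∫ z in ball (0 : ℂ) r, ε := by
          rw [setIntegral_const, Measure.real, Complex.volume_ball]
          simp [ENNReal.toReal_ofReal hr.le]
          ring
      _ ≤ (∫ z in ball (0 : ℂ) r, |(𝓚 z).im|) - ∫ z in ball (0 : ℂ) r, ε := by
          gcongr
          exact mul_abs_im_le_setIntegral hr h𝓚r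
      _ = ∫ z in ball (0 : ℂ) r, (|(𝓚 z).im| - ε) := (integral_sub hIr hcst).symm
      _ ≤ ∫ z in ball (0 : ℂ) r, (-(b z).re + C₁ * S.indicator (fun z => ‖deriv 𝓚 z‖) z) := by
          refine setIntegral_mono_on (hIr.sub hcst) (hri.mono_set hrsub) measurableSet_ball
            fun z hz => ?_
          refine le_trans ?_ (hpt z (hrsub hz))
          have h1 : 1 ≤ keyCut k z := by
            have h2 := hk35 z (ball_subset_closedBall hz)
            unfold keyCut
            refine one_le_pow₀ (le_max_of_le_left ?_)
            nlinarith
          nlinarith [hNge z, hNε z]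
      _ ≤ ∫ z in ball (0 : ℂ) 1, (-(b z).re + C₁ * S.indicator (fun z => ‖deriv 𝓚 z‖) z) := by
          refine setIntegral_mono_set hri ?_ (Eventually.of_forall hrsub)
          filter_upwards [ae_restrict_mem measurableSet_ball] with z hz
          exact (mul_nonneg (sub_nonneg.2 (hNε z)) keyCut_nonneg).trans (hpt z hz)
      _ = C₁ * J := hrI
  have hpr : 0 < π * r ^ 2 := by positivity
  rw [div_mul_eq_mul_div, le_div_iff₀ hpr, mul_comm]
  refine le_of_forall_pos_le_add fun ε hε => ?_
  have := key (ε / (π * r ^ 2)) (by positivity)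
  rw [mul_sub, mul_div_cancel₀ _ hpr.ne'] at this
  linarith

lemma integrableOn_ball_of_le_inv {E : Type*} [NormedAddCommGroup E]
    [MeasurableSpace E] [BorelSpace E] [SecondCountableTopology E] {F : ℂ → E} {z : ℂ} {C : ℝ}
    (hF : ContinuousOn F (ball 0 1 \ {z}))
    (hC : ∀ ξ ∈ ball (0 : ℂ) 1, ξ ≠ z → ‖F ξ‖ ≤ C * ‖ξ - z‖⁻¹) : IntegrableOn F (ball 0 1) := by
  have h0 : ball (0 : ℂ) 1 =ᵐ[volume] (ball 0 1 \ {z} : Set ℂ) :=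
    (diff_null_ae_eq_self (measure_singleton z)).symm
  have hm : MeasurableSet (ball (0 : ℂ) 1 \ {z}) := measurableSet_ball.diff (measurableSet_singleton z)
  have h1 : IntegrableOn F (ball 0 1 \ {z}) := by
    refine (((integrableOn_inv_norm_sub z 1).mono_set sdiff_subset).const_mul C).mono'
      (hF.aestronglyMeasurable hm) ?_
    filter_upwards [ae_restrict_mem hm] with ξ hξ
    exact hC ξ hξ.1 hξ.2
  exact h1.congr_set_ae h0

/-- A pointwise bound for the imaginary part of a function with pole-like singularities away from
`{‖h‖ ≥ 3 / 2}`, by an average of its derivative. -/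
theorem abs_im_le_poleKer_average (M : ℝ) : ∃ C, 0 ≤ C ∧ ∀ (h 𝓗 : ℂ → ℂ) (E : ℂ → ℝ),
    AnalyticOnNhd ℂ h (closedBall 0 1) → (∀ z ∈ closedBall (0 : ℂ) 1, ‖h z‖ ≤ M) →
    (∀ z ∈ closedBall (0 : ℂ) 1, 3 / 2 ≤ ‖h z‖ → AnalyticAt ℂ 𝓗 z) →
    (∀ z ∈ sphere (0 : ℂ) 1, 3 / 2 ≤ ‖h z‖ → (𝓗 z).im = 0) →
    ContinuousOn E (closedBall 0 1) → (∀ z ∈ ball (0 : ℂ) 1, 0 ≤ E z) →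
    (∀ z ∈ ball (0 : ℂ) 1, 3 / 2 < ‖h z‖ → ‖deriv 𝓗 z‖ ≤ E z) →
    ∀ ζ ∈ ball (0 : ℂ) 1, 4 ≤ ‖h ζ‖ →
    |(𝓗 ζ).im| ≤ C * ((1 - ‖ζ‖ ^ 2) * ∫ ξ in ball (0 : ℂ) 1, poleKer ζ ξ * E ξ) := by
  obtain ⟨C, hC0, hC⟩ := abs_im_le_integral_deriv (2 * M)
  refine ⟨C * (M ^ 2 / 9), by positivity, fun h 𝓗 E hh hM h𝓗 him hE hE0 hdE ζ hζ hζ4 => ?_⟩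
  let k : ℂ → ℂ := fun w => h (moeb ζ w) * (1 + conj ζ * w)
  have hζ1 := one_sub_normSq_pos hζ
  have hζn : ‖ζ‖ ≤ 1 := (mem_ball_zero_iff.1 hζ).le
  have hm : ∀ w ∈ closedBall (0 : ℂ) 1, moeb ζ w ∈ closedBall (0 : ℂ) 1 := fun w hw =>
    moeb_mem_closedBall hζ hw
  have hw2 : ∀ w ∈ closedBall (0 : ℂ) 1, ‖1 + conj ζ * w‖ ≤ 2 := fun w hw => by
    refine (norm_add_le _ _).trans ?_
    rw [norm_mul, norm_conj, norm_one]
    have := mem_closedBall_zero_iff.1 hw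
    nlinarith [norm_nonneg w, norm_nonneg ζ]
  have hkn : ∀ w, ‖k w‖ = ‖h (moeb ζ w)‖ * ‖1 + conj ζ * w‖ := fun w => norm_mul _ _
  have h32 : ∀ w ∈ closedBall (0 : ℂ) 1, 3 ≤ ‖k w‖ → 3 / 2 ≤ ‖h (moeb ζ w)‖ := fun w hw h3 => by
    rw [hkn] at h3
    nlinarith [hw2 w hw, norm_nonneg (h (moeb ζ w))]
  have h32' : ∀ w ∈ closedBall (0 : ℂ) 1, 3 < ‖k w‖ → 3 / 2 < ‖h (moeb ζ w)‖ := fun w hw h3 => by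
    rw [hkn] at h3
    nlinarith [hw2 w hw, norm_nonneg (h (moeb ζ w))]
  have hm0 : moeb ζ 0 = ζ := by simp [moeb]
  have han : ∀ w ∈ closedBall (0 : ℂ) 1, AnalyticAt ℂ (moeb ζ) w := fun w hw =>
    analyticAt_moeb hζ hw
  have hM0 : 0 ≤ M := (norm_nonneg _).trans (hM 0 (by simp))
  have hEm : ContinuousOn (fun w => E (moeb ζ w)) (closedBall 0 1) :=
    hE.comp (fun w hw => (han w hw).continuousAt.continuousWithinAt) hm
  have hcst : 0 ≤ M ^ 2 / 9 * (1 - ‖ζ‖ ^ 2) := by positivity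
  have h1 := hC k (fun w => 𝓗 (moeb ζ w))
    (fun w hw => ((hh _ (hm w hw)).comp (han w hw)).mul (by fun_prop))
    (fun w hw => by
      rw [hkn, mul_comm 2]
      exact mul_le_mul (hM _ (hm w hw)) (hw2 w hw) (norm_nonneg _) hM0)
    (by rw [hkn, hm0]; simpa using hζ4)
    (fun w hw h3 => (h𝓗 _ (hm w hw) (h32 w hw h3)).comp (han w hw))
    (fun w hw h3 => by
      have hw' := sphere_subset_closedBall hw
      refine him _ ?_ (h32 w hw' h3)
      have h4 := one_sub_normSq_moeb hζ hw'
      rw [mem_sphere_zero_iff_norm] at hw ⊢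
      rw [hw, one_pow, sub_self, mul_zero, zero_div] at h4
      nlinarith [norm_nonneg (moeb ζ w)])
  rw [hm0] at h1
  have hkc : ContinuousOn k (ball 0 1) := fun w hw =>
    (((hh _ (hm w (ball_subset_closedBall hw))).comp (han w (ball_subset_closedBall hw))).mul
      (by fun_prop)).continuousAt.continuousWithinAt
  have hSo : IsOpen (ball (0 : ℂ) 1 ∩ {z | 3 < ‖k z‖}) :=
    hkc.norm.isOpen_inter_preimage isOpen_ball (isOpen_Ioi (a := (3 : ℝ)))
  have i1 : IntegrableOn (fun w => M ^ 2 / 9 * (1 - ‖ζ‖ ^ 2) * E (moeb ζ w)) (ball 0 1) :=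
    (integrableOn_ball_of_continuousOn hEm).const_mul _
  have i2 : IntegrableOn (fun w => M ^ 2 / 9 * (1 - ‖ζ‖ ^ 2) * (‖w‖⁻¹ * E (moeb ζ w)))
      (ball 0 1) := by
    refine Integrable.const_mul ?_ _
    obtain ⟨B, hB⟩ := (isCompact_closedBall (0 : ℂ) 1).exists_bound_of_continuousOn hEm
    refine integrableOn_ball_of_le_inv (z := 0) (C := B) ?_ fun ξ hξ _ => ?_
    · exact ContinuousOn.mul (continuousOn_id.norm.inv₀ fun w hw => norm_ne_zero_iff.2 hw.2)
        (hEm.mono (sdiff_subset.trans ball_subset_closedBall))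
    · rw [norm_mul, norm_inv, norm_norm, sub_zero, mul_comm]
      gcongr
      exact hB ξ (ball_subset_closedBall hξ)
  have hE0' : ∀ w ∈ ball (0 : ℂ) 1, 0 ≤ E (moeb ζ w) := fun w hw => hE0 _ (moeb_mem_ball hζ hw)
  refine h1.trans ?_
  rw [mul_assoc C]
  refine mul_le_mul_of_nonneg_left ?_ hC0
  rw [setIntegral_poleKer_mul hζ, ← mul_assoc, ← integral_const_mul]
  calc ∫ w in ball (0 : ℂ) 1 ∩ {z | 3 < ‖k z‖}, ‖deriv (fun w => 𝓗 (moeb ζ w)) w‖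
      ≤ ∫ w in ball (0 : ℂ) 1 ∩ {z | 3 < ‖k z‖}, M ^ 2 / 9 * (1 - ‖ζ‖ ^ 2) * E (moeb ζ w) := by
        refine integral_mono_of_nonneg (Eventually.of_forall fun _ => norm_nonneg _)
          (i1.mono_set inter_subset_left) ?_
        filter_upwards [ae_restrict_mem hSo.measurableSet] with w hw
        have hw' := ball_subset_closedBall hw.1
        have h3 : 3 < ‖k w‖ := hw.2
        have h4 := h32' w hw' h3
        have h5 : deriv (fun w => 𝓗 (moeb ζ w)) w =
            deriv 𝓗 (moeb ζ w) * (((1 - ‖ζ‖ ^ 2 : ℝ) : ℂ) / (1 + conj ζ * w) ^ 2) :=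
          ((h𝓗 _ (hm w hw') h4.le).differentiableAt.hasDerivAt.comp w (hasDerivAt_moeb hζ hw')).deriv
        have h6 := hdE _ (moeb_mem_ball hζ hw.1) h4
        have h7 : 0 < ‖1 + conj ζ * w‖ := norm_pos_iff.2 (one_add_conj_mul_ne_zero hζ hw')
        have h8 : 3 ≤ M * ‖1 + conj ζ * w‖ := by
          rw [hkn] at h3
          exact h3.le.trans (mul_le_mul_of_nonneg_right (hM _ (hm w hw')) h7.le)
        rw [h5, norm_mul, norm_div, norm_pow, norm_real, Real.norm_of_nonneg hζ1.le]
        have h9 : (1 - ‖ζ‖ ^ 2) / ‖1 + conj ζ * w‖ ^ 2 ≤ M ^ 2 / 9 * (1 - ‖ζ‖ ^ 2) := by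
          rw [div_le_iff₀ (by positivity)]
          have : 9 ≤ M ^ 2 * ‖1 + conj ζ * w‖ ^ 2 := by nlinarith
          nlinarith
        rw [mul_comm]
        exact mul_le_mul h9 h6 (norm_nonneg _) hcst
    _ ≤ ∫ w in ball (0 : ℂ) 1, M ^ 2 / 9 * (1 - ‖ζ‖ ^ 2) * E (moeb ζ w) := by
        refine setIntegral_mono_set i1 ?_ (Eventually.of_forall inter_subset_left)
        filter_upwards [ae_restrict_mem measurableSet_ball] with w hw
        exact mul_nonneg hcst (hE0' w hw)
    _ ≤ ∫ w in ball (0 : ℂ) 1, M ^ 2 / 9 * (1 - ‖ζ‖ ^ 2) * (‖w‖⁻¹ * E (moeb ζ w)) := by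
        refine integral_mono_ae i1 i2 ?_
        filter_upwards [ae_restrict_mem measurableSet_ball,
          ae_restrict_of_ae (measure_eq_zero_iff_ae_notMem.1 (measure_singleton (0 : ℂ)))]
          with w hw hw0
        have h3 : 1 ≤ ‖w‖⁻¹ := (one_le_inv₀ (norm_pos_iff.2 hw0)).2 (mem_ball_zero_iff.1 hw).le
        have := hE0' w hw
        gcongr
        nlinarith
    _ = _ := by simp only [mul_assoc]

section
variable {F a b : ℂ → ℂ} (hF : ∀ z ∈ closedBall (0 : ℂ) 1, HasWirt F (a z) (b z) z)
  (ha : ContinuousOn a (closedBall 0 1)) (hb : ContinuousOn b (closedBall 0 1))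
include hF ha hb

lemma cauchy_pompeiu_reflected {z : ℂ} (hz : z ∈ ball (0 : ℂ) 1) :
    π * F z = (∫ ξ in ball (0 : ℂ) 1, (b ξ * conj (ξ / (1 - conj z * ξ)) +
      F ξ * conj (1 / (1 - conj z * ξ) ^ 2))) - ∫ ξ in ball (0 : ℂ) 1, b ξ * (ξ - z)⁻¹ := by
  have hFc : ContinuousOn F (closedBall 0 1) := fun ξ hξ => (hF ξ hξ).continuousAt.continuousWithinAt
  have hne : ∀ ξ ∈ closedBall (0 : ℂ) 1, 1 - conj z * ξ ≠ 0 := fun ξ hξ =>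
    one_sub_conj_mul_ne_zero hz hξ
  have c1 : ContinuousOn (fun ξ => conj (ξ / (1 - conj z * ξ))) (closedBall 0 1) :=
    continuous_conj.comp_continuousOn (continuousOn_id.div (by fun_prop) hne)
  have c2 : ContinuousOn (fun ξ => conj (1 / (1 - conj z * ξ) ^ 2)) (closedBall 0 1) :=
    continuous_conj.comp_continuousOn (continuousOn_const.div (by fun_prop)
      fun ξ hξ => pow_ne_zero 2 (hne ξ hξ))
  have h1 := integral_wirt_conj (F := fun ξ => F ξ * conj (ξ / (1 - conj z * ξ)))
    (a := fun ξ => a ξ * conj (ξ / (1 - conj z * ξ)))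
    (b := fun ξ => b ξ * conj (ξ / (1 - conj z * ξ)) + F ξ * conj (1 / (1 - conj z * ξ) ^ 2))
    (fun ξ hξ => by
      have h2 : HasDerivAt (fun ξ => ξ / (1 - conj z * ξ)) (1 / (1 - conj z * ξ) ^ 2) ξ := by
        have h3 := (hasDerivAt_id ξ).div
          (((hasDerivAt_id ξ).const_mul (conj z)).const_sub 1) (hne ξ hξ)
        refine h3.congr_deriv ?_
        simp only [id_eq, mul_one, one_mul]
        congr 1
        ring
      refine ((hF ξ hξ).mul (HasWirt.of_hasDerivAt h2).star).congr_coeff ?_ ?_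
      · simp
      · simp)
    (ha.mul c1) ((hb.mul c1).add (hFc.mul c2))
  rw [h1, cauchy_pompeiu hF ha hb hz]
  congr 2
  refine circInt_congr fun ζ hζ => ?_
  have h0 : ζ ≠ 0 := by rintro rfl; simp at hζ
  have h2 : ζ - z ≠ 0 := by
    rintro h
    rw [sub_eq_zero.1 h] at hζ
    rw [mem_sphere_zero_iff_norm] at hζ
    rw [mem_ball_zero_iff] at hz
    exact hz.ne hζ
  have h3 := hne ζ (sphere_subset_closedBall hζ)
  have h4 : conj ζ * (ζ - z) = 1 - conj ζ * z := by
    rw [mul_sub, mul_comm, mul_conj_of_mem_sphere hζ]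
  have h5 : conj (1 - conj z * ζ) = 1 - conj ζ * z := by simp [mul_comm]
  have h6 : conj ζ ≠ 0 := (map_ne_zero _).2 h0
  rw [map_div₀, h5, ← h4]
  field_simp

lemma integral_wirt_log {z : ℂ} (hz : z ∈ ball (0 : ℂ) 1) :
    IntegrableOn (fun ξ => b ξ * (Real.log ‖moeb (-z) ξ‖ : ℂ)) (ball 0 1) ∧
    ∫ ξ in ball (0 : ℂ) 1, b ξ * (Real.log ‖moeb (-z) ξ‖ : ℂ) =
      -(1 / 2 : ℂ) * ∫ ξ in ball (0 : ℂ) 1,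
        F ξ * conj (((1 - ‖z‖ ^ 2 : ℝ) : ℂ) / ((ξ - z) * (1 - conj z * ξ))) := by
  have hFc : ContinuousOn F (closedBall 0 1) := fun ξ hξ => (hF ξ hξ).continuousAt.continuousWithinAt
  have hz' := neg_mem_ball hz
  have hz1 := mem_ball_zero_iff.1 hz
  set τ := moeb (-z) with hτ
  have hτe : ∀ ξ, τ ξ = (ξ - z) / (1 - conj z * ξ) := fun ξ => by
    simp only [hτ, moeb, map_neg]; ring_nf
  have hne : ∀ ξ ∈ closedBall (0 : ℂ) 1, 1 - conj z * ξ ≠ 0 := fun ξ hξ =>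
    one_sub_conj_mul_ne_zero hz hξ
  have hτa : AnalyticOnNhd ℂ τ (closedBall 0 1) := fun ξ hξ => analyticAt_moeb hz' hξ
  have hτ1 : ∀ ξ ∈ closedBall (0 : ℂ) 1, ‖τ ξ‖ ≤ 1 := fun ξ hξ =>
    mem_closedBall_zero_iff.1 (moeb_mem_closedBall hz' hξ)
  have hτ0 : ∀ ξ ∈ closedBall (0 : ℂ) 1, ξ ≠ z → τ ξ ≠ 0 := fun ξ hξ h => by
    rw [hτe]; exact div_ne_zero (sub_ne_zero.2 h) (hne ξ hξ)
  have hτd : ∀ ξ ∈ closedBall (0 : ℂ) 1, ξ ≠ z →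
      deriv τ ξ / τ ξ = ((1 - ‖z‖ ^ 2 : ℝ) : ℂ) / ((ξ - z) * (1 - conj z * ξ)) := fun ξ hξ h => by
    have h1 := hne ξ hξ
    have h2 := sub_ne_zero.2 h
    rw [(hasDerivAt_moeb hz' hξ).deriv, hτe, norm_neg, map_neg, neg_mul, ← sub_eq_add_neg]
    field_simp
  have hτinv : ∀ ξ ∈ ball (0 : ℂ) 1, ‖τ ξ‖⁻¹ ≤ 2 * ‖ξ - z‖⁻¹ := fun ξ hξ => by
    rw [hτe, norm_div, inv_div, div_eq_mul_inv]
    gcongr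
    refine (norm_sub_le _ _).trans ?_
    rw [norm_mul, norm_conj, norm_one]
    nlinarith [mem_ball_zero_iff.1 hξ, norm_nonneg ξ, norm_nonneg z]
  have hkn : ∀ ξ ∈ ball (0 : ℂ) 1,
      ‖((1 - ‖z‖ ^ 2 : ℝ) : ℂ) / ((ξ - z) * (1 - conj z * ξ))‖ ≤ 2 * ‖ξ - z‖⁻¹ := fun ξ hξ => by
    have h0 := norm_pos_iff.2 (hne ξ (ball_subset_closedBall hξ))
    have h1 : 1 - ‖z‖ ≤ ‖1 - conj z * ξ‖ := by
      have := norm_sub_norm_le 1 (conj z * ξ)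
      rw [norm_mul, norm_conj, norm_one] at this
      nlinarith [mem_ball_zero_iff.1 hξ, norm_nonneg ξ, norm_nonneg z]
    rw [norm_div, norm_mul, norm_real, Real.norm_of_nonneg (one_sub_normSq_pos hz).le, mul_comm ‖ξ - z‖,
      ← div_div, div_eq_mul_inv _ ‖ξ - z‖]
    gcongr
    rw [div_le_iff₀ h0]
    nlinarith [norm_nonneg z]
  let ε : ℕ → ℝ := fun n => 1 / ((n : ℝ) + 1)
  have hε : ∀ n, 0 < ε n := fun n => by positivity
  have hε0 : Tendsto ε atTop (𝓝 0) := tendsto_one_div_add_atTop_nhds_zero_nat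
  let L : ℕ → ℂ → ℝ := fun n ξ => 1 / 2 * Real.log ((‖τ ξ‖ ^ 2 + ε n) / (1 + ε n))
  let μ : ℕ → ℂ → ℂ := fun n ξ =>
    ((1 / 2 / (‖τ ξ‖ ^ 2 + ε n) : ℝ) : ℂ) * (τ ξ * conj (deriv τ ξ))
  have hpos : ∀ n ξ, 0 < ‖τ ξ‖ ^ 2 + ε n := fun n ξ => by have := hε n; positivity
  have hτn : ContinuousOn (fun ξ => ‖τ ξ‖ ^ 2) (closedBall 0 1) := hτa.continuousOn.norm.pow 2
  have hLc : ∀ n, ContinuousOn (fun ξ => (L n ξ : ℂ)) (closedBall 0 1) := fun n => by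
    refine Complex.continuous_ofReal.comp_continuousOn (continuousOn_const.mul (ContinuousOn.log
      ((hτn.add continuousOn_const).div_const _) fun ξ _ => ?_))
    have := hε n
    have := hpos n ξ
    positivity
  have hψc : ∀ n, ContinuousOn (fun ξ => ((1 / 2 / (‖τ ξ‖ ^ 2 + ε n) : ℝ) : ℂ)) (closedBall 0 1) :=
    fun n => Complex.continuous_ofReal.comp_continuousOn (continuousOn_const.div
      (hτn.add continuousOn_const) fun ξ _ => (hpos n ξ).ne')
  have hμc : ∀ n, ContinuousOn (μ n) (closedBall 0 1) := fun n =>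
    (hψc n).mul (hτa.continuousOn.mul (continuous_conj.comp_continuousOn hτa.deriv.continuousOn))
  have hνc : ∀ n, ContinuousOn (fun ξ => ((1 / 2 / (‖τ ξ‖ ^ 2 + ε n) : ℝ) : ℂ) *
      (deriv τ ξ * conj (τ ξ))) (closedBall 0 1) := fun n =>
    (hψc n).mul (hτa.deriv.continuousOn.mul (continuous_conj.comp_continuousOn hτa.continuousOn))
  have hLw : ∀ n, ∀ ξ ∈ closedBall (0 : ℂ) 1, HasWirt (fun ξ => (L n ξ : ℂ))
      (((1 / 2 / (‖τ ξ‖ ^ 2 + ε n) : ℝ) : ℂ) * (deriv τ ξ * conj (τ ξ))) (μ n ξ) ξ := by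
    intro n ξ hξ
    have h1 : HasDerivAt (fun t : ℝ => 1 / 2 * Real.log ((t + ε n) / (1 + ε n)))
        (1 / 2 / (‖τ ξ‖ ^ 2 + ε n)) (‖τ ξ‖ ^ 2) := by
      have h2 := ((((hasDerivAt_id (‖τ ξ‖ ^ 2)).add_const (ε n)).div_const (1 + ε n)).log
        (div_pos (hpos n ξ) (by linarith [hε n])).ne').const_mul (1 / 2)
      refine h2.congr_deriv ?_
      have := hpos n ξ
      have := hε n
      simp only [id_eq]
      field_simp
    exact (HasWirt.normSq (hτa.hasDerivAt_closedBall hξ)).ofReal_comp h1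
  have key : ∀ n, ∫ ξ in ball (0 : ℂ) 1, b ξ * (L n ξ : ℂ) =
      -∫ ξ in ball (0 : ℂ) 1, F ξ * μ n ξ := fun n => by
    have h1 := integral_wirt_conj (fun ξ hξ => (hF ξ hξ).mul (hLw n ξ hξ))
      ((ha.mul (hLc n)).add (hFc.mul (hνc n))) ((hb.mul (hLc n)).add (hFc.mul (hμc n)))
    rw [integral_add (f := fun ξ => b ξ * (L n ξ : ℂ)) (g := fun ξ => F ξ * μ n ξ)
      (integrableOn_ball_of_continuousOn (hb.mul (hLc n)))
      (integrableOn_ball_of_continuousOn (hFc.mul (hμc n))),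
      circInt_congr (G := fun _ => 0) fun ξ hξ => ?_] at h1
    · rw [eq_neg_iff_add_eq_zero, h1]; simp [circInt]
    · have h2 : ‖τ ξ‖ ^ 2 = 1 := by
        have h4 := one_sub_normSq_moeb hz' (sphere_subset_closedBall hξ)
        rw [mem_sphere_zero_iff_norm.1 hξ, one_pow, sub_self, mul_zero, zero_div] at h4
        linarith
      have : L n ξ = 0 := by
        simp only [L, h2]
        rw [div_self (by linarith [hε n]), Real.log_one, mul_zero]
      simp [this]
  obtain ⟨Bb, hBb⟩ := (isCompact_closedBall (0 : ℂ) 1).exists_bound_of_continuousOn hb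
  obtain ⟨BF, hBF⟩ := (isCompact_closedBall (0 : ℂ) 1).exists_bound_of_continuousOn hFc
  have hlog : ∀ ξ ∈ ball (0 : ℂ) 1, ξ ≠ z → -Real.log ‖τ ξ‖ ≤ 2 * ‖ξ - z‖⁻¹ ∧
      0 ≤ -Real.log ‖τ ξ‖ := fun ξ hξ h => by
    have h0 := norm_pos_iff.2 (hτ0 ξ (ball_subset_closedBall hξ) h)
    refine ⟨?_, ?_⟩
    · rw [← Real.log_inv]
      refine (Real.log_le_sub_one_of_pos (inv_pos.2 h0)).trans ?_
      linarith [hτinv ξ hξ]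
    · linarith [Real.log_nonpos h0.le (hτ1 ξ (ball_subset_closedBall hξ))]
  have hdom : ∀ B : ℝ, IntegrableOn (fun ξ => B * (2 * ‖ξ - z‖⁻¹)) (ball 0 1) := fun B =>
    ((integrableOn_inv_norm_sub z 1).const_mul 2).const_mul B
  have hae : ∀ᵐ ξ ∂volume.restrict (ball (0 : ℂ) 1), ξ ∈ ball (0 : ℂ) 1 ∧ ξ ≠ z := by
    filter_upwards [ae_restrict_mem measurableSet_ball,
      ae_restrict_of_ae (measure_eq_zero_iff_ae_notMem.1 (measure_singleton z))] with ξ h1 h2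
    exact ⟨h1, h2⟩
  have t1 : Tendsto (fun n => ∫ ξ in ball (0 : ℂ) 1, b ξ * (L n ξ : ℂ)) atTop
      (𝓝 (∫ ξ in ball (0 : ℂ) 1, b ξ * (Real.log ‖τ ξ‖ : ℂ))) := by
    refine tendsto_integral_of_dominated_convergence _ (fun n =>
      (integrableOn_ball_of_continuousOn (hb.mul (hLc n))).aestronglyMeasurable) (hdom Bb)
      (fun n => ?_) ?_
    · filter_upwards [hae] with ξ hξ
      have hξ' := ball_subset_closedBall hξ.1
      have h0 := norm_pos_iff.2 (hτ0 ξ hξ' hξ.2)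
      rw [norm_mul, norm_real]
      refine mul_le_mul (hBb ξ hξ') ?_ (norm_nonneg _) ((norm_nonneg _).trans (hBb ξ hξ'))
      refine le_trans ?_ (hlog ξ hξ.1 hξ.2).1
      have h1 := hε n
      have h2 := hτ1 ξ hξ'
      have h3 : ‖τ ξ‖ ^ 2 ≤ 1 := pow_le_one₀ h0.le h2
      have h4 : Real.log ((‖τ ξ‖ ^ 2 + ε n) / (1 + ε n)) ≤ 0 := by
        refine Real.log_nonpos (by positivity) ?_
        rw [div_le_one (by positivity)]; linarith
      have h5 : Real.log (‖τ ξ‖ ^ 2) ≤ Real.log ((‖τ ξ‖ ^ 2 + ε n) / (1 + ε n)) := by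
        refine Real.log_le_log (by positivity) ?_
        rw [le_div_iff₀ (by positivity)]; nlinarith
      rw [Real.log_pow] at h5
      push_cast at h5
      simp only [L, Real.norm_eq_abs]
      rw [abs_le]
      constructor <;> linarith
    · filter_upwards [hae] with ξ hξ
      have h0 := norm_pos_iff.2 (hτ0 ξ (ball_subset_closedBall hξ.1) hξ.2)
      refine Tendsto.const_mul _ ((Complex.continuous_ofReal.tendsto _).comp ?_)
      have h1 : Tendsto (fun n => (‖τ ξ‖ ^ 2 + ε n) / (1 + ε n)) atTop (𝓝 (‖τ ξ‖ ^ 2)) := by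
        have := (hε0.const_add (‖τ ξ‖ ^ 2)).div (hε0.const_add 1) (by norm_num)
        rw [add_zero, add_zero, div_one] at this
        exact this
      have h2 := ((Real.continuousAt_log (by positivity)).tendsto.comp h1).const_mul (1 / 2)
      rw [Real.log_pow] at h2
      push_cast at h2
      rw [show 1 / 2 * (2 * Real.log ‖τ ξ‖) = Real.log ‖τ ξ‖ by ring] at h2
      exact h2
  have t2 : Tendsto (fun n => ∫ ξ in ball (0 : ℂ) 1, F ξ * μ n ξ) atTop
      (𝓝 (∫ ξ in ball (0 : ℂ) 1, F ξ * ((1 / 2 : ℂ) *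
        conj (((1 - ‖z‖ ^ 2 : ℝ) : ℂ) / ((ξ - z) * (1 - conj z * ξ)))))) := by
    refine tendsto_integral_of_dominated_convergence _ (fun n =>
      (integrableOn_ball_of_continuousOn (hFc.mul (hμc n))).aestronglyMeasurable) (hdom BF)
      (fun n => ?_) ?_
    · filter_upwards [hae] with ξ hξ
      have hξ' := ball_subset_closedBall hξ.1
      have h0 := norm_pos_iff.2 (hτ0 ξ hξ' hξ.2)
      rw [norm_mul]
      refine mul_le_mul (hBF ξ hξ') ?_ (norm_nonneg _) ((norm_nonneg _).trans (hBF ξ hξ'))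
      refine le_trans ?_ (hkn ξ hξ.1)
      have h1 := hpos n ξ
      rw [← hτd ξ hξ' hξ.2, norm_mul, norm_real, Real.norm_of_nonneg (by positivity), norm_mul,
        norm_conj, norm_div, div_mul_eq_mul_div, div_le_div_iff₀ h1 h0]
      have h2 := (hε n).le
      nlinarith [mul_nonneg (norm_nonneg (deriv τ ξ)) h2,
        mul_nonneg (norm_nonneg (deriv τ ξ)) (sq_nonneg ‖τ ξ‖)]
    · filter_upwards [hae] with ξ hξ
      have h0 := hτ0 ξ (ball_subset_closedBall hξ.1) hξ.2
      have h0' := norm_pos_iff.2 h0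
      refine Tendsto.const_mul _ ?_
      have h1 : Tendsto (fun n => ((1 / 2 / (‖τ ξ‖ ^ 2 + ε n) : ℝ) : ℂ)) atTop
          (𝓝 ((1 / 2 / ‖τ ξ‖ ^ 2 : ℝ) : ℂ)) := by
        refine (Complex.continuous_ofReal.tendsto _).comp ?_
        have := (tendsto_const_nhds (x := (1 / 2 : ℝ)) (f := atTop)).div
          (hε0.const_add (‖τ ξ‖ ^ 2)) (by rw [add_zero]; positivity)
        rw [add_zero] at this
        exact this
      have h2 := h1.mul_const (τ ξ * conj (deriv τ ξ))
      convert h2 using 2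
      rw [← hτd ξ (ball_subset_closedBall hξ.1) hξ.2, map_div₀]
      have h3 : ((‖τ ξ‖ ^ 2 : ℝ) : ℂ) = τ ξ * conj (τ ξ) := by rw [mul_conj, normSq_eq_norm_sq]
      rw [ofReal_div, h3]
      have h4 : conj (τ ξ) ≠ 0 := (map_ne_zero _).2 h0
      field_simp
      push_cast
      ring
  refine ⟨?_, ?_⟩
  · refine integrableOn_ball_of_le_inv (z := z) (C := Bb * 2) ?_ fun ξ hξ h => ?_
    · refine (hb.mono (sdiff_subset.trans ball_subset_closedBall)).mul
        (Complex.continuous_ofReal.comp_continuousOn (ContinuousOn.log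
          (hτa.continuousOn.mono (sdiff_subset.trans ball_subset_closedBall)).norm
          fun ξ hξ => norm_ne_zero_iff.2 (hτ0 ξ (ball_subset_closedBall hξ.1) hξ.2)))
    · have hξ' := ball_subset_closedBall hξ
      rw [norm_mul, norm_real, Real.norm_eq_abs, abs_of_nonpos (by linarith [(hlog ξ hξ h).2]),
        mul_assoc]
      exact mul_le_mul (hBb ξ hξ') (hlog ξ hξ h).1 (hlog ξ hξ h).2
        ((norm_nonneg _).trans (hBb ξ hξ'))
  · have h1 := tendsto_nhds_unique t1 (t2.neg.congr fun n => (key n).symm)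
    rw [h1, ← integral_neg, ← integral_const_mul]
    congr 1
    ext ξ
    ring

end

lemma one_sub_mul_mem_slitPlane {c : ℂ} (h : ∀ t ∈ Icc (0 : ℝ) 1, 1 - t * c ≠ 0) {t : ℝ}
    (ht : t ∈ Icc (0 : ℝ) 1) : 1 - t * c ∈ slitPlane := by
  by_contra hn
  rw [mem_slitPlane_iff, not_or, not_lt, not_not] at hn
  obtain ⟨h1, h2⟩ := hn
  set s := -(1 - t * c).re with hs
  have hs0 : 0 ≤ s := by linarith
  have h3 : (1 : ℂ) - t * c = -(s : ℂ) := by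
    apply Complex.ext <;> simp [hs, h2]
  have h4 : ((1 + s : ℝ) : ℂ) ≠ 0 := by
    exact_mod_cast (by positivity : (1 + s : ℝ) ≠ 0)
  refine h (t / (1 + s)) ⟨div_nonneg ht.1 (by positivity), ?_⟩ ?_
  · rw [div_le_one (by positivity)]; linarith [ht.2]
  · rw [ofReal_div, div_mul_eq_mul_div, sub_eq_zero, eq_comm, div_eq_one_iff_eq h4]
    push_cast
    linear_combination -h3

lemma integral_div_sub_mul {A B : ℂ} (h : ∀ t ∈ Icc (0 : ℝ) 1, A - t * B ≠ 0) :
    ∫ t in (0 : ℝ)..1, B / (A - t * B) = -log ((A - B) / A) := by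
  have hA : A ≠ 0 := by simpa using h 0 (by simp)
  have h' : ∀ t ∈ Icc (0 : ℝ) 1, 1 - t * (B / A) ≠ 0 := fun t ht h0 => by
    refine h t ht ?_
    field_simp at h0
    simpa using h0
  have h1 : ∀ t ∈ uIcc (0 : ℝ) 1,
      HasDerivAt (fun t : ℝ => -log (1 - t * (B / A))) (B / (A - t * B)) t := fun t ht => by
    rw [uIcc_of_le zero_le_one] at ht
    have h2 := (((Complex.ofRealCLM.hasDerivAt (x := t)).mul_const (B / A)).const_sub 1).clog_real
      (one_sub_mul_mem_slitPlane h' ht)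
    refine h2.neg.congr_deriv ?_
    have h3 := h t ht
    have h4 := h' t ht
    simp only [ofRealCLM_apply, ofReal_one, one_mul]
    field_simp
  rw [intervalIntegral.integral_eq_sub_of_hasDerivAt h1]
  · simp only [ofReal_one, one_mul, ofReal_zero, zero_mul, sub_zero, log_one, neg_zero]
    congr 2
    field_simp
  · refine ContinuousOn.intervalIntegrable ?_
    rw [uIcc_of_le zero_le_one]
    exact continuousOn_const.div (by fun_prop) h

/-- The point of parameter `t` on the segment from `p` to `q`. -/
noncomputable def segPt (p q : ℂ) (t : ℝ) : ℂ := p + t * (q - p)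

/-- The integral of `g dz` over the segment from `p` to `q`. -/
noncomputable def segInt (g : ℂ → ℂ) (p q : ℂ) : ℂ := ∫ t in (0 : ℝ)..1, g (segPt p q t) * (q - p)

/-- The logarithmic derivative of the Blaschke factor with zero `z`. -/
noncomputable def polePart (z ξ : ℂ) : ℂ :=
  ((1 - ‖z‖ ^ 2 : ℝ) : ℂ) / ((ξ - z) * (1 - conj z * ξ))

/-- A branch of `log ((ξ - p) (1 - p̄ ξ) / ((ξ - q) (1 - q̄ ξ)))` outside the segment `[p, q]`. -/
noncomputable def segLog (p q ξ : ℂ) : ℂ :=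
  -log ((ξ - q) / (ξ - p)) - log ((1 - conj q * ξ) / (1 - conj p * ξ))

lemma continuous_segPt (p q : ℂ) : Continuous (segPt p q) := by unfold segPt; fun_prop

lemma segPt_mem_segment (p q : ℂ) {t : ℝ} (ht : t ∈ Icc (0 : ℝ) 1) : segPt p q t ∈ segment ℝ p q := by
  rw [segment_eq_image']
  exact ⟨t, ht, by simp [segPt]⟩

lemma volume_segment (p q : ℂ) : volume (segment ℝ p q) = 0 := by
  refine measure_mono_null (t := (affineSpan ℝ {p, q} : Set ℂ)) ?_
    (Measure.addHaar_affineSubspace volume _ fun h => ?_)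
  · rw [← convexHull_pair]
    exact convexHull_subset_affineSpan _
  · have h1 : Module.finrank ℝ (vectorSpan ℝ ({p, q} : Set ℂ)) ≤ 1 :=
      collinear_iff_finrank_le_one.1 (collinear_pair ℝ p q)
    rw [← direction_affineSpan, h, AffineSubspace.direction_top, finrank_top,
      finrank_real_complex] at h1
    omega

lemma setIntegral_inv_norm_sub_le {z : ℂ} (hz : z ∈ ball (0 : ℂ) 1) :
    ∫ ξ in ball (0 : ℂ) 1, ‖ξ - z‖⁻¹ ≤ 16 * π / (1 - ‖z‖ ^ 2) ^ 2 := by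
  have h0 := one_sub_normSq_pos hz
  have h1 : IntegrableOn (poleKer z) (ball 0 1) := by
    simpa using integrableOn_poleKer_mul hz (g := fun _ => 1) continuousOn_const
  calc ∫ ξ in ball (0 : ℂ) 1, ‖ξ - z‖⁻¹
      ≤ ∫ ξ in ball (0 : ℂ) 1, 8 / (1 - ‖z‖ ^ 2) ^ 2 * poleKer z ξ := by
        refine setIntegral_mono_on (integrableOn_inv_norm_sub z 1) (h1.const_mul _)
          measurableSet_ball fun ξ hξ => ?_
        rw [poleKer, ← div_div, ← mul_div_assoc, inv_eq_one_div]
        have h2 := norm_pos_iff.2 (one_sub_conj_mul_ne_zero hz (ball_subset_closedBall hξ))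
        gcongr
        rw [div_mul_div_comm, le_div_iff₀ (by positivity), one_mul, mul_comm]
        gcongr
        have h3 : ‖1 - conj z * ξ‖ ≤ 2 := by
          refine (norm_sub_le _ _).trans ?_
          rw [norm_mul, norm_conj, norm_one]
          nlinarith [mem_ball_zero_iff.1 hξ, mem_ball_zero_iff.1 hz, norm_nonneg ξ, norm_nonneg z]
        calc ‖1 - conj z * ξ‖ ^ 3 ≤ 2 ^ 3 := by gcongr
          _ = 8 := by norm_num
    _ = _ := by rw [integral_const_mul, setIntegral_poleKer hz]; ring

lemma integrable_prod_of_continuousOn {Φ : ℝ × ℂ → ℂ}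
    (hΦ : ContinuousOn Φ (Icc (0 : ℝ) 1 ×ˢ closedBall (0 : ℂ) 1)) :
    Integrable Φ ((volume.restrict (Ioc (0 : ℝ) 1)).prod (volume.restrict (ball (0 : ℂ) 1))) := by
  rw [Measure.prod_restrict, ← Measure.volume_eq_prod]
  exact (hΦ.integrableOn_compact (isCompact_Icc.prod (isCompact_closedBall _ _))).mono_set
    (prod_mono Ioc_subset_Icc_self ball_subset_closedBall)

section
variable {p q : ℂ} (hp : p ∈ ball (0 : ℂ) 1) (hq : q ∈ ball (0 : ℂ) 1)
include hp hq

lemma segment_subset_ball : segment ℝ p q ⊆ ball (0 : ℂ) 1 :=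
  (convex_ball (0 : ℂ) 1).segment_subset hp hq

lemma segPt_mem_ball {t : ℝ} (ht : t ∈ Icc (0 : ℝ) 1) : segPt p q t ∈ ball (0 : ℂ) 1 :=
  segment_subset_ball hp hq (segPt_mem_segment p q ht)

lemma integrable_prod_pole {b : ℂ → ℂ} (hb : ContinuousOn b (closedBall 0 1)) :
    Integrable (fun x : ℝ × ℂ => b x.2 * ((q - p) / (x.2 - segPt p q x.1)))
      ((volume.restrict (Ioc (0 : ℝ) 1)).prod (volume.restrict (ball (0 : ℂ) 1))) := by
  obtain ⟨B, hB⟩ := (isCompact_closedBall (0 : ℂ) 1).exists_bound_of_continuousOn hb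
  have hB0 : 0 ≤ B := (norm_nonneg _).trans (hB 0 (by simp))
  have hm : AEStronglyMeasurable (fun x : ℝ × ℂ => b x.2 * ((q - p) / (x.2 - segPt p q x.1)))
      ((volume.restrict (Ioc (0 : ℝ) 1)).prod (volume.restrict (ball (0 : ℂ) 1))) := by
    refine AEStronglyMeasurable.mul ?_ (Measurable.aestronglyMeasurable ?_)
    · exact ((hb.mono ball_subset_closedBall).aestronglyMeasurable measurableSet_ball).comp_snd
    · exact measurable_const.div (measurable_snd.sub
        ((continuous_segPt p q).measurable.comp measurable_fst))
  obtain ⟨ρ, hρ⟩ : ∃ ρ, ∀ t ∈ Icc (0 : ℝ) 1, 16 * π / (1 - ‖segPt p q t‖ ^ 2) ^ 2 ≤ ρ := by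
    have hc : ContinuousOn (fun t : ℝ => 16 * π / (1 - ‖segPt p q t‖ ^ 2) ^ 2) (Icc 0 1) := by
      refine continuousOn_const.div ?_ fun t ht => ?_
      · have := continuous_segPt p q
        fun_prop
      · have := one_sub_normSq_pos (segPt_mem_ball hp hq ht)
        positivity
    obtain ⟨ρ, hρ⟩ := isCompact_Icc.bddAbove_image hc
    exact ⟨ρ, fun t ht => hρ ⟨t, ht, rfl⟩⟩
  have hle : ∀ t : ℝ, ∀ ξ ∈ ball (0 : ℂ) 1, ‖b ξ * ((q - p) / (ξ - segPt p q t))‖ ≤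
      B * ‖q - p‖ * ‖ξ - segPt p q t‖⁻¹ := fun t ξ hξ => by
    rw [norm_mul, norm_div, div_eq_mul_inv, ← mul_assoc]
    gcongr
    exact hB ξ (ball_subset_closedBall hξ)
  rw [integrable_prod_iff hm]
  constructor
  · refine Eventually.of_forall fun t => ?_
    refine integrableOn_ball_of_le_inv (z := segPt p q t) (C := B * ‖q - p‖) ?_
      fun ξ hξ _ => hle t ξ hξ
    have hc : ContinuousOn (fun ξ => (q - p) / (ξ - segPt p q t)) (ball 0 1 \ {segPt p q t}) :=
      continuousOn_const.div (by fun_prop) fun ξ hξ => sub_ne_zero.2 hξ.2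
    exact (hb.mono (sdiff_subset.trans ball_subset_closedBall)).mul hc
  · refine (integrable_const (B * ‖q - p‖ * ρ)).mono' hm.norm.integral_prod_right' ?_
    filter_upwards [ae_restrict_mem measurableSet_Ioc] with t ht
    rw [Real.norm_of_nonneg (integral_nonneg fun _ => norm_nonneg _)]
    have ht' := Ioc_subset_Icc_self ht
    calc _ ≤ ∫ ξ in ball (0 : ℂ) 1, B * ‖q - p‖ * ‖ξ - segPt p q t‖⁻¹ := by
          refine integral_mono_of_nonneg (Eventually.of_forall fun _ => norm_nonneg _)
            ((integrableOn_inv_norm_sub _ 1).const_mul _) ?_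
          filter_upwards [ae_restrict_mem measurableSet_ball] with ξ hξ
          exact hle t ξ hξ
      _ ≤ B * ‖q - p‖ * ρ := by
          rw [integral_const_mul]
          gcongr
          exact (setIntegral_inv_norm_sub_le (segPt_mem_ball hp hq ht')).trans (hρ t ht')

lemma integral_segPt_pole {ξ : ℂ} (hξ : ξ ∉ segment ℝ p q) :
    ∫ t in (0 : ℝ)..1, (q - p) / (ξ - segPt p q t) = -log ((ξ - q) / (ξ - p)) := by
  have h1 := integral_div_sub_mul (A := ξ - p) (B := q - p) fun t ht h => hξ (by
    have : ξ = segPt p q t := by rw [segPt]; linear_combination h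
    rw [this]; exact segPt_mem_segment p q ht)
  rw [show ξ - p - (q - p) = ξ - q by ring] at h1
  rw [← h1]
  congr 1
  ext t
  rw [segPt, sub_sub]

lemma integral_segPt_reflected {ξ : ℂ} (hξ : ξ ∈ closedBall (0 : ℂ) 1) :
    ∫ t in (0 : ℝ)..1, ξ * conj (q - p) / (1 - conj (segPt p q t) * ξ) =
      -log ((1 - conj q * ξ) / (1 - conj p * ξ)) := by
  have e : ∀ t : ℝ, 1 - conj (segPt p q t) * ξ = 1 - conj p * ξ - t * (ξ * conj (q - p)) :=
    fun t => by simp [segPt]; ring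
  have h1 := integral_div_sub_mul (A := 1 - conj p * ξ) (B := ξ * conj (q - p)) fun t ht => by
    rw [← e]
    exact one_sub_conj_mul_ne_zero (segPt_mem_ball hp hq ht) hξ
  rw [show 1 - conj p * ξ - ξ * conj (q - p) = 1 - conj q * ξ by rw [map_sub]; ring] at h1
  rw [← h1]
  simp only [e]

lemma integral_segPt_reflected_sq {ξ : ℂ} (hξ : ξ ∈ closedBall (0 : ℂ) 1) :
    ∫ t in (0 : ℝ)..1, conj (q - p) / (1 - conj (segPt p q t) * ξ) ^ 2 =
      conj q / (1 - conj q * ξ) - conj p / (1 - conj p * ξ) := by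
  have hne : ∀ t ∈ Icc (0 : ℝ) 1, 1 - conj (segPt p q t) * ξ ≠ 0 := fun t ht =>
    one_sub_conj_mul_ne_zero (segPt_mem_ball hp hq ht) hξ
  have hcs : Continuous fun t => conj (segPt p q t) := continuous_conj.comp (continuous_segPt p q)
  have e : ∀ t : ℝ, conj (segPt p q t) = conj p + t * conj (q - p) := fun t => by simp [segPt]
  have h1 : ∀ t ∈ uIcc (0 : ℝ) 1, HasDerivAt (fun t : ℝ => conj (segPt p q t) /
      (1 - conj (segPt p q t) * ξ)) (conj (q - p) / (1 - conj (segPt p q t) * ξ) ^ 2) t :=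
    fun t ht => by
    rw [uIcc_of_le zero_le_one] at ht
    have h2 : HasDerivAt (fun t : ℝ => conj (segPt p q t)) (conj (q - p)) t := by
      simp only [e]
      simpa using ((Complex.ofRealCLM.hasDerivAt (x := t)).mul_const (conj (q - p))).const_add (conj p)
    refine (h2.div ((h2.mul_const ξ).const_sub 1) (hne t ht)).congr_deriv ?_
    congr 1
    ring
  rw [intervalIntegral.integral_eq_sub_of_hasDerivAt h1]
  · simp [segPt]
  · refine ContinuousOn.intervalIntegrable ?_
    rw [uIcc_of_le zero_le_one]
    exact continuousOn_const.div
      ((continuous_const.sub (hcs.mul continuous_const)).pow 2).continuousOn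
      fun t ht => pow_ne_zero 2 (hne t ht)

lemma one_sub_div_one_sub_mem_slitPlane {ξ : ℂ} (hξ : ξ ∈ closedBall (0 : ℂ) 1) :
    (1 - conj q * ξ) / (1 - conj p * ξ) ∈ slitPlane := by
  have h0 := one_sub_conj_mul_ne_zero hp hξ
  rw [mul_comm] at h0
  have h1 := one_sub_mul_mem_slitPlane (c := ξ * conj (q - p) / (1 - conj p * ξ)) (t := 1)
    (fun t ht h => one_sub_conj_mul_ne_zero (segPt_mem_ball hp hq ht) hξ (by
      rw [mul_comm (conj p)] at h
      field_simp at h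
      refine Eq.trans ?_ (h.trans (mul_zero _))
      rw [segPt]
      simp only [map_add, map_mul, map_sub, conj_ofReal]
      ring)) (by simp)
  convert h1 using 1
  rw [mul_comm (conj p)]
  field_simp
  simp only [ofReal_one, map_sub]
  ring

omit hp hq in
lemma sub_div_sub_mem_slitPlane {ξ : ℂ} (hξ : ξ ∉ segment ℝ p q) :
    (ξ - q) / (ξ - p) ∈ slitPlane := by
  have h0 : ξ - p ≠ 0 := sub_ne_zero.2 fun h => hξ (h ▸ left_mem_segment ℝ p q)
  have h1 := one_sub_mul_mem_slitPlane (c := (q - p) / (ξ - p)) (t := 1) (fun t ht h => hξ (by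
      have : ξ = segPt p q t := by
        field_simp at h
        rw [segPt]
        linear_combination h
      rw [this]
      exact segPt_mem_segment p q ht)) (by simp)
  convert h1 using 1
  field_simp
  simp

lemma hasDerivAt_segLog {ξ : ℂ} (hξ : ξ ∈ closedBall (0 : ℂ) 1) (hs : ξ ∉ segment ℝ p q) :
    HasDerivAt (segLog p q) (polePart p ξ - polePart q ξ +
      2 * (conj q / (1 - conj q * ξ) - conj p / (1 - conj p * ξ))) ξ := by
  have h0 : ξ - p ≠ 0 := sub_ne_zero.2 fun h => hs (h ▸ left_mem_segment ℝ p q)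
  have h1 : ξ - q ≠ 0 := sub_ne_zero.2 fun h => hs (h ▸ right_mem_segment ℝ p q)
  have h2 := one_sub_conj_mul_ne_zero hp hξ
  have h3 := one_sub_conj_mul_ne_zero hq hξ
  have d : ∀ z : ℂ, HasDerivAt (fun w => 1 - conj z * w) (-conj z) ξ := fun z => by
    simpa using ((hasDerivAt_id ξ).const_mul (conj z)).const_sub 1
  have d1 := ((((hasDerivAt_id ξ).sub_const q).div ((hasDerivAt_id ξ).sub_const p) h0).clog
    (sub_div_sub_mem_slitPlane hs)).neg.sub
    (((d q).div (d p) h2).clog (one_sub_div_one_sub_mem_slitPlane hp hq hξ))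
  refine d1.congr_deriv ?_
  simp only [polePart, id, Pi.div_apply]
  have e : ∀ z : ℂ, ((1 - ‖z‖ ^ 2 : ℝ) : ℂ) = 1 - conj z * z := fun z => by
    rw [conj_mul']; push_cast; rfl
  rw [e, e]
  simp only [mul_comm (conj _)] at h2 h3 ⊢
  field_simp
  ring

lemma analyticAt_segLog {ξ : ℂ} (hξ : ξ ∈ closedBall (0 : ℂ) 1) (hs : ξ ∉ segment ℝ p q) :
    AnalyticAt ℂ (segLog p q) ξ := by
  have h0 : ξ - p ≠ 0 := sub_ne_zero.2 fun h => hs (h ▸ left_mem_segment ℝ p q)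
  have h2 := one_sub_conj_mul_ne_zero hp hξ
  have e1 : AnalyticAt ℂ (fun ξ => (ξ - q) / (ξ - p)) ξ := by fun_prop (disch := exact h0)
  have e2 : AnalyticAt ℂ (fun ξ => (1 - conj q * ξ) / (1 - conj p * ξ)) ξ := by
    fun_prop (disch := exact h2)
  exact (e1.clog (sub_div_sub_mem_slitPlane hs)).neg.sub
    (e2.clog (one_sub_div_one_sub_mem_slitPlane hp hq hξ))

omit hp hq in
lemma segLog_im_of_mem_sphere {ξ : ℂ} (hξ : ξ ∈ sphere (0 : ℂ) 1) (hs : ξ ∉ segment ℝ p q) :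
    (segLog p q ξ).im = 0 := by
  have h0 : ξ ≠ 0 := fun h => by simp [h] at hξ
  have e : ∀ z, 1 - conj z * ξ = ξ * conj (ξ - z) := fun z => by
    rw [map_sub, mul_sub, mul_conj_of_mem_sphere hξ]; ring
  have h1 : (1 - conj q * ξ) / (1 - conj p * ξ) = conj ((ξ - q) / (ξ - p)) := by
    rw [e, e, mul_div_mul_left _ _ h0, map_div₀]
  have h2 := sub_div_sub_mem_slitPlane hs
  rw [segLog, h1, log_conj _ (slitPlane_arg_ne_pi h2)]
  simp

/-- Integration of the Cauchy–Pompeiu formula along a segment. -/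
lemma segInt_eq_setIntegral {F a b : ℂ → ℂ} (hF : ∀ z ∈ closedBall (0 : ℂ) 1, HasWirt F (a z) (b z) z)
    (ha : ContinuousOn a (closedBall 0 1)) (hb : ContinuousOn b (closedBall 0 1)) :
    IntegrableOn (fun ξ => b ξ * -log ((ξ - q) / (ξ - p))) (ball 0 1) ∧
    π * segInt F p q = (∫ ξ in ball (0 : ℂ) 1,
      (b ξ * conj (-log ((1 - conj q * ξ) / (1 - conj p * ξ))) +
        F ξ * conj (conj q / (1 - conj q * ξ) - conj p / (1 - conj p * ξ)))) -
      ∫ ξ in ball (0 : ℂ) 1, b ξ * -log ((ξ - q) / (ξ - p)) := by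
  have hFc : ContinuousOn F (closedBall 0 1) := fun ξ hξ => (hF ξ hξ).continuousAt.continuousWithinAt
  have hcs := continuous_segPt p q
  have hne : ∀ x ∈ Icc (0 : ℝ) 1 ×ˢ closedBall (0 : ℂ) 1, 1 - conj (segPt p q x.1) * x.2 ≠ 0 :=
    fun x hx => one_sub_conj_mul_ne_zero (segPt_mem_ball hp hq hx.1) hx.2
  have hcd : Continuous fun x : ℝ × ℂ => 1 - conj (segPt p q x.1) * x.2 := by fun_prop
  set μ := volume.restrict (Ioc (0 : ℝ) 1) with hμ
  set ν := volume.restrict (ball (0 : ℂ) 1) with hν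
  have hs2 : MapsTo (Prod.snd : ℝ × ℂ → ℂ) (Icc (0 : ℝ) 1 ×ˢ closedBall (0 : ℂ) 1)
    (closedBall 0 1) := fun x hx => hx.2
  have hΦ : Integrable (fun x : ℝ × ℂ => b x.2 *
      conj (x.2 * conj (q - p) / (1 - conj (segPt p q x.1) * x.2)) +
      F x.2 * conj (conj (q - p) / (1 - conj (segPt p q x.1) * x.2) ^ 2)) (μ.prod ν) := by
    refine integrable_prod_of_continuousOn (ContinuousOn.add ?_ ?_)
    · exact (hb.comp continuousOn_snd hs2).mul (continuous_conj.comp_continuousOn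
        (ContinuousOn.div (by fun_prop) hcd.continuousOn hne))
    · exact (hFc.comp continuousOn_snd hs2).mul (continuous_conj.comp_continuousOn
        (ContinuousOn.div (by fun_prop) (hcd.pow 2).continuousOn fun x hx => pow_ne_zero 2 (hne x hx)))
  have hΨ : Integrable (fun x : ℝ × ℂ => b x.2 * ((q - p) / (x.2 - segPt p q x.1))) (μ.prod ν) :=
    integrable_prod_pole hp hq hb
  have eΨ : ∀ᵐ ξ ∂ν, ∫ t, b ξ * ((q - p) / (ξ - segPt p q t)) ∂μ = b ξ * -log ((ξ - q) / (ξ - p)) := by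
    have h1 : ∀ᵐ ξ ∂ν, ξ ∉ segment ℝ p q :=
      ae_restrict_of_ae (measure_eq_zero_iff_ae_notMem.1 (volume_segment p q))
    filter_upwards [h1] with ξ h1
    rw [integral_const_mul, ← integral_segPt_pole hp hq h1, intervalIntegral.integral_of_le zero_le_one]
  have eΦ : ∀ᵐ ξ ∂ν, ∫ t, (b ξ * conj (ξ * conj (q - p) / (1 - conj (segPt p q t) * ξ)) +
      F ξ * conj (conj (q - p) / (1 - conj (segPt p q t) * ξ) ^ 2)) ∂μ =
      b ξ * conj (-log ((1 - conj q * ξ) / (1 - conj p * ξ))) +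
        F ξ * conj (conj q / (1 - conj q * ξ) - conj p / (1 - conj p * ξ)) := by
    filter_upwards [ae_restrict_mem measurableSet_ball] with ξ hξ
    have hξ' := ball_subset_closedBall hξ
    have hcd' : ContinuousOn (fun t : ℝ => 1 - conj (segPt p q t) * ξ) (Icc 0 1) := by fun_prop
    have hne' : ∀ t ∈ Icc (0 : ℝ) 1, 1 - conj (segPt p q t) * ξ ≠ 0 := fun t ht => hne (t, ξ) ⟨ht, hξ'⟩
    have i1 : Integrable (fun t => conj (ξ * conj (q - p) / (1 - conj (segPt p q t) * ξ))) μ :=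
      ((continuous_conj.comp_continuousOn
        (continuousOn_const.div hcd' hne')).integrableOn_Icc).mono_set Ioc_subset_Icc_self
    have i2 : Integrable (fun t => conj (conj (q - p) / (1 - conj (segPt p q t) * ξ) ^ 2)) μ :=
      ((continuous_conj.comp_continuousOn (continuousOn_const.div (hcd'.pow 2)
        fun t ht => pow_ne_zero 2 (hne' t ht))).integrableOn_Icc).mono_set Ioc_subset_Icc_self
    rw [integral_add (i1.const_mul _) (i2.const_mul _), integral_const_mul, integral_const_mul,
      integral_conj, integral_conj, ← integral_segPt_reflected hp hq hξ',
      ← integral_segPt_reflected_sq hp hq hξ', intervalIntegral.integral_of_le zero_le_one,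
      intervalIntegral.integral_of_le zero_le_one]
  have sw : ∀ Θ : ℝ × ℂ → ℂ, Integrable Θ (μ.prod ν) →
      ∫ ξ, ∫ t, Θ (t, ξ) ∂μ ∂ν = ∫ t, ∫ ξ, Θ (t, ξ) ∂ν ∂μ := fun Θ h =>
    (integral_integral_swap (f := fun t ξ => Θ (t, ξ)) h).symm
  refine ⟨hΨ.integral_prod_right.congr eΨ, ?_⟩
  rw [← integral_congr_ae eΨ, ← integral_congr_ae eΦ, sw _ hΦ, sw _ hΨ, ← integral_sub hΦ.integral_prod_left hΨ.integral_prod_left, segInt,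
    ← intervalIntegral.integral_const_mul, intervalIntegral.integral_of_le zero_le_one]
  refine setIntegral_congr_fun measurableSet_Ioc fun t ht => ?_
  have h2 := cauchy_pompeiu_reflected hF ha hb (segPt_mem_ball hp hq (Ioc_subset_Icc_self ht))
  calc π * (F (segPt p q t) * (q - p)) = (q - p) * (π * F (segPt p q t)) := by ring
    _ = _ := by
      rw [h2, mul_sub, ← integral_const_mul, ← integral_const_mul]
      congr 1
      · congr 1
        ext ξ
        simp only [map_div₀, map_mul, conj_conj, map_one]
        ring
      · congr 1
        ext ξ
        ring

lemma segInt_re_eq {F a b : ℂ → ℂ} (hF : ∀ z ∈ closedBall (0 : ℂ) 1, HasWirt F (a z) (b z) z)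
    (ha : ContinuousOn a (closedBall 0 1)) (hb : ContinuousOn b (closedBall 0 1)) :
    IntegrableOn (fun ξ => (b ξ).im * (segLog p q ξ).im) (ball 0 1) ∧
    π * (segInt F p q).re =
      (∫ ξ in ball (0 : ℂ) 1, F ξ * conj (conj q / (1 - conj q * ξ) - conj p / (1 - conj p * ξ))).re -
      (∫ ξ in ball (0 : ℂ) 1, F ξ * conj (polePart q ξ)).re / 2 +
      (∫ ξ in ball (0 : ℂ) 1, F ξ * conj (polePart p ξ)).re / 2 +
      ∫ ξ in ball (0 : ℂ) 1, (b ξ).im * (segLog p q ξ).im := by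
  obtain ⟨i1, e1⟩ := segInt_eq_setIntegral hp hq hF ha hb
  obtain ⟨ip, ep⟩ := integral_wirt_log hF ha hb hp
  obtain ⟨iq, eq⟩ := integral_wirt_log hF ha hb hq
  have hFc : ContinuousOn F (closedBall 0 1) := fun ξ hξ => (hF ξ hξ).continuousAt.continuousWithinAt
  have hne : ∀ {z}, z ∈ ball (0 : ℂ) 1 → ∀ ξ ∈ closedBall (0 : ℂ) 1, 1 - conj z * ξ ≠ 0 :=
    fun hz ξ hξ => one_sub_conj_mul_ne_zero hz hξ
  have iR : IntegrableOn (fun ξ => F ξ * conj (conj q / (1 - conj q * ξ) - conj p / (1 - conj p * ξ)))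
      (ball 0 1) := integrableOn_ball_of_continuousOn (hFc.mul (continuous_conj.comp_continuousOn
    ((continuousOn_const.div (by fun_prop) (hne hq)).sub
      (continuousOn_const.div (by fun_prop) (hne hp)))))
  have iL : IntegrableOn (fun ξ => b ξ * conj (-log ((1 - conj q * ξ) / (1 - conj p * ξ))))
      (ball 0 1) := integrableOn_ball_of_continuousOn (hb.mul (continuous_conj.comp_continuousOn
    (ContinuousOn.neg (ContinuousOn.clog
      (ContinuousOn.div (by fun_prop) (by fun_prop) (hne hp)) fun ξ hξ =>
        one_sub_div_one_sub_mem_slitPlane hp hq hξ))))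
  have key : ∀ᵐ ξ ∂volume.restrict (ball (0 : ℂ) 1), (b ξ).im * (segLog p q ξ).im =
      (b ξ * conj (-log ((1 - conj q * ξ) / (1 - conj p * ξ))) - b ξ * -log ((ξ - q) / (ξ - p)) -
        b ξ * (Real.log ‖moeb (-q) ξ‖ : ℂ) + b ξ * (Real.log ‖moeb (-p) ξ‖ : ℂ)).re := by
    filter_upwards [ae_restrict_mem measurableSet_ball,
      ae_restrict_of_ae (measure_eq_zero_iff_ae_notMem.1 (volume_segment p q))] with ξ hξ hs
    have hp0 := norm_ne_zero_iff.2 (hne hp ξ (ball_subset_closedBall hξ))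
    have hq0 := norm_ne_zero_iff.2 (hne hq ξ (ball_subset_closedBall hξ))
    have hpξ : ‖ξ - p‖ ≠ 0 := norm_ne_zero_iff.2 <| sub_ne_zero.2 fun h =>
      hs (h ▸ left_mem_segment ℝ p q)
    have hqξ : ‖ξ - q‖ ≠ 0 := norm_ne_zero_iff.2 <| sub_ne_zero.2 fun h =>
      hs (h ▸ right_mem_segment ℝ p q)
    have hm : ∀ z, moeb (-z) ξ = (ξ - z) / (1 - conj z * ξ) := fun z => by
      simp only [moeb, map_neg]; ring_nf
    simp only [segLog, hm, sub_re, add_re, sub_im, neg_im, mul_re, conj_re, conj_im, neg_re, log_re,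
      ofReal_re, ofReal_im, norm_div]
    rw [Real.log_div hqξ hq0, Real.log_div hpξ hp0, Real.log_div hq0 hp0, Real.log_div hqξ hpξ]
    ring
  have iK := ((iL.sub i1).sub iq).add ip
  refine ⟨iK.re.congr (key.mono fun ξ h => h.symm), ?_⟩
  rw [integral_congr_ae key]
  have e2 : ∀ f : ℂ → ℂ, IntegrableOn f (ball 0 1) →
      ∫ ξ in ball (0 : ℂ) 1, (f ξ).re = (∫ ξ in ball (0 : ℂ) 1, f ξ).re := fun f hf => integral_re hf
  erw [e2 _ iK]
  rw [integral_add' ((iL.sub i1).sub iq) ip, integral_sub' (iL.sub i1) iq,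
    integral_sub' iL i1, ep, eq]
  rw [integral_add iL iR] at e1
  have e3 := congrArg re e1
  rw [re_ofReal_mul] at e3
  rw [e3]
  have e4 : ∀ w : ℂ, (-(1 / 2 : ℂ) * w).re = -(w.re / 2) := fun w => by
    rw [show -(1 / 2 : ℂ) = ((-(1 / 2) : ℝ) : ℂ) by push_cast; ring, re_ofReal_mul]; ring
  simp only [add_re, sub_re, e4, polePart]
  ring

end

/-- The Schwarz–Pick estimate in terms of the pseudo-hyperbolic distance. -/
lemma norm_sub_le_norm_moeb {h : ℂ → ℂ} {M : ℝ} (hh : AnalyticOnNhd ℂ h (closedBall 0 1))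
    (hM : ∀ z ∈ closedBall (0 : ℂ) 1, ‖h z‖ ≤ M) {z ξ : ℂ} (hz : z ∈ ball (0 : ℂ) 1)
    (hξ : ξ ∈ ball (0 : ℂ) 1) : ‖h ξ - h z‖ ≤ 2 * M * ‖moeb (-z) ξ‖ := by
  have hτ : moeb (-z) ξ ∈ ball (0 : ℂ) 1 := moeb_mem_ball (neg_mem_ball hz) hξ
  have h0 : moeb z 0 = z := by simp [moeb]
  have hd : DifferentiableOn ℂ (fun w => h (moeb z w)) (ball 0 1) := fun w hw =>
    ((hh _ (moeb_mem_closedBall hz (ball_subset_closedBall hw))).differentiableAt.comp w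
      (analyticAt_moeb hz (ball_subset_closedBall hw)).differentiableAt).differentiableWithinAt
  have h1 := Complex.dist_le_div_mul_dist_of_mapsTo_ball (R₂ := 2 * M) hd (fun w hw => by
    rw [mem_closedBall, dist_eq_norm, two_mul]
    exact (norm_sub_le _ _).trans (add_le_add
      (hM _ (moeb_mem_closedBall hz (ball_subset_closedBall hw)))
      (hM _ (moeb_mem_closedBall hz (by simp))))) hτ
  simpa only [moeb_moeb_neg hz (ball_subset_closedBall hξ), h0, div_one, dist_eq_norm,
    sub_zero] using h1

/-- The derivative of the disc automorphism taking `z` to `0`. -/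
noncomputable def moebDer (z ξ : ℂ) : ℂ := ((1 - ‖z‖ ^ 2 : ℝ) : ℂ) / (1 - conj z * ξ) ^ 2

lemma analyticOnNhd_moebDer {z : ℂ} (hz : z ∈ ball (0 : ℂ) 1) :
    AnalyticOnNhd ℂ (moebDer z) (closedBall 0 1) := fun ξ hξ => by
  have := one_sub_conj_mul_ne_zero hz hξ
  unfold moebDer
  fun_prop (disch := exact pow_ne_zero 2 this)

lemma norm_moebDer {z : ℂ} (hz : z ∈ ball (0 : ℂ) 1) (ξ : ℂ) :
    ‖moebDer z ξ‖ = (1 - ‖z‖ ^ 2) / ‖1 - conj z * ξ‖ ^ 2 := by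
  rw [moebDer, norm_div, norm_real, Real.norm_of_nonneg (one_sub_normSq_pos hz).le, norm_pow]

lemma norm_polePart_le {h : ℂ → ℂ} {M : ℝ} (hh : AnalyticOnNhd ℂ h (closedBall 0 1))
    (hM : ∀ z ∈ closedBall (0 : ℂ) 1, ‖h z‖ ≤ M) {z ξ : ℂ} (hz : z ∈ ball (0 : ℂ) 1)
    (hξ : ξ ∈ ball (0 : ℂ) 1) (hz1 : ‖h z‖ < 1) (hξ1 : 3 / 2 < ‖h ξ‖) :
    ‖polePart z ξ‖ ≤ 4 * M * ‖moebDer z ξ‖ := by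
  have h1 := norm_sub_le_norm_moeb hh hM hz hξ
  have h2 := norm_sub_norm_le (h ξ) (h z)
  have h3 := norm_pos_iff.2 (one_sub_conj_mul_ne_zero hz (ball_subset_closedBall hξ))
  have e : ‖moeb (-z) ξ‖ = ‖ξ - z‖ / ‖1 - conj z * ξ‖ := by
    rw [← norm_div, moeb, map_neg]; ring_nf
  have h4 : 1 / 2 < 2 * M * (‖ξ - z‖ / ‖1 - conj z * ξ‖) := by rw [← e]; linarith
  have h5 : 0 < ‖ξ - z‖ := (norm_nonneg _).lt_of_ne fun h0 => by
    rw [← h0] at h4; norm_num at h4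
  rw [norm_moebDer hz, polePart, norm_div, norm_mul, norm_real,
    Real.norm_of_nonneg (one_sub_normSq_pos hz).le]
  rw [← mul_div_assoc, lt_div_iff₀ h3] at h4
  rw [← mul_div_assoc, div_le_div_iff₀ (by positivity) (by positivity)]
  have := one_sub_normSq_pos hz
  have h6 : (1 - ‖z‖ ^ 2) * ‖1 - conj z * ξ‖ * ‖1 - conj z * ξ‖ ≤
      (1 - ‖z‖ ^ 2) * ‖1 - conj z * ξ‖ * (4 * M * ‖ξ - z‖) := by gcongr; linarith
  linarith

/-- The boundary of the chain `∑ c e [e.1, e.2]`. -/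
noncomputable def chainBdry (s : Finset (ℂ × ℂ)) (c : ℂ × ℂ → ℝ) : ℂ →₀ ℝ :=
  ∑ e ∈ s, c e • (Finsupp.single e.2 1 - Finsupp.single e.1 1)

lemma chainBdry_sum {E : Type*} [AddCommGroup E] [Module ℝ E] (s : Finset (ℂ × ℂ)) (c : ℂ × ℂ → ℝ)
    (f : ℂ → E) : ∑ z ∈ (chainBdry s c).support, chainBdry s c z • f z =
      ∑ e ∈ s, c e • (f e.2 - f e.1) := by
  have h := Finsupp.linearCombination_apply ℝ (v := f) (chainBdry s c)
  rw [Finsupp.sum] at h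
  rw [← h, chainBdry, map_sum]
  simp

lemma exists_of_mem_support_chainBdry {s : Finset (ℂ × ℂ)} {c : ℂ × ℂ → ℝ} {z : ℂ}
    (hz : z ∈ (chainBdry s c).support) : ∃ e ∈ s, z = e.1 ∨ z = e.2 := by
  by_contra! hn
  rw [Finsupp.mem_support_iff, chainBdry, Finsupp.finsetSum_apply] at hz
  refine hz (Finset.sum_eq_zero fun e he => ?_)
  have := hn e he
  simp [Finsupp.single_eq_of_ne this.1, Finsupp.single_eq_of_ne this.2]

/-- The conjugate Poisson kernel. -/
noncomputable def conjPoisson (z ζ : ℂ) : ℝ := ((ζ + z) / (ζ - z)).im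

lemma sub_ne_zero_of_sphere_ball {ζ z : ℂ} (hζ : ζ ∈ sphere (0 : ℂ) 1) (hz : z ∈ ball (0 : ℂ) 1) :
    ζ - z ≠ 0 := fun h => by
  rw [sub_eq_zero.1 h, mem_sphere_zero_iff_norm] at hζ
  exact absurd (mem_ball_zero_iff.1 hz) (by linarith)

lemma continuousOn_conjPoisson {z : ℂ} (hz : z ∈ ball (0 : ℂ) 1) :
    ContinuousOn (conjPoisson z) (sphere 0 1) :=
  continuous_im.comp_continuousOn (ContinuousOn.div (by fun_prop) (by fun_prop)
    fun _ hζ => sub_ne_zero_of_sphere_ball hζ hz)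

lemma two_mul_reflected_eq {ζ z : ℂ} (hζ : ζ ∈ sphere (0 : ℂ) 1) (hz : z ∈ ball (0 : ℂ) 1) :
    2 * ζ * (conj z / (1 - conj z * ζ)) =
      (((1 - ‖z‖ ^ 2) / ‖1 - conj z * ζ‖ ^ 2 - 1 : ℝ) : ℂ) - conjPoisson z ζ * I := by
  have h1 := sub_ne_zero_of_sphere_ball hζ hz
  have hζ' := sphere_subset_closedBall hζ
  have h2 := one_sub_conj_mul_ne_zero hz hζ'
  have e : conj ((ζ + z) / (ζ - z)) = 1 + 2 * ζ * (conj z / (1 - conj z * ζ)) := by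
    have h3 := mul_conj_of_mem_sphere hζ
    have h4 : conj ζ - conj z ≠ 0 := by
      rw [← map_sub]; exact (map_ne_zero _).2 h1
    rw [map_div₀, map_add, map_sub]
    field_simp
    linear_combination (-2 * conj z) * h3
  have e2 : ((ζ + z) / (ζ - z)).re = (1 - ‖z‖ ^ 2) / ‖1 - conj z * ζ‖ ^ 2 := by
    have h5 : ‖1 - conj z * ζ‖ = ‖ζ - z‖ := by
      rw [← mul_conj_of_mem_sphere hζ, mul_comm ζ, ← sub_mul, norm_mul,
        mem_sphere_zero_iff_norm.1 hζ, mul_one, ← map_sub, norm_conj]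
    have h6 := mem_sphere_zero_iff_norm.1 hζ
    rw [h5, div_re, ← add_div, ← normSq_eq_norm_sq, ← normSq_eq_norm_sq]
    congr 1
    have h7 : normSq ζ = 1 := by rw [normSq_eq_norm_sq, h6]; norm_num
    rw [← h7]
    simp only [normSq_apply, add_re, sub_re, add_im, sub_im]
    ring
  rw [← e2, conjPoisson, eq_sub_of_add_eq' e.symm]
  generalize (ζ + z) / (ζ - z) = w
  apply Complex.ext <;> simp

/-- The `L¹` norm on the circle of the reflected part of a chain. -/
lemma circInt_reflected_le (m : ℂ →₀ ℝ) (hm : ∀ z ∈ m.support, z ∈ ball (0 : ℂ) 1) :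
    (circInt fun ζ => ‖∑ z ∈ m.support, (m z : ℂ) * (conj z / (1 - conj z * ζ))‖) ≤
      4 * π * ∑ z ∈ m.support, |m z| + circInt fun ζ => |∑ z ∈ m.support, m z * conjPoisson z ζ| := by
  have hP : ∀ z ∈ m.support, ContinuousOn (fun ζ => (1 - ‖z‖ ^ 2) / ‖1 - conj z * ζ‖ ^ 2)
      (sphere (0 : ℂ) 1) := fun z hz => ContinuousOn.div (by fun_prop) (by fun_prop)
    fun ζ hζ => pow_ne_zero 2 (norm_ne_zero_iff.2
      (one_sub_conj_mul_ne_zero (hm z hz) (sphere_subset_closedBall hζ)))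
  have hP1 : ContinuousOn (fun ζ => ∑ z ∈ m.support, |m z| *
      ((1 - ‖z‖ ^ 2) / ‖1 - conj z * ζ‖ ^ 2 + 1)) (sphere (0 : ℂ) 1) :=
    continuousOn_finsetSum _ fun z hz => continuousOn_const.mul ((hP z hz).add continuousOn_const)
  have hQ1 : ContinuousOn (fun ζ => |∑ z ∈ m.support, m z * conjPoisson z ζ|) (sphere (0 : ℂ) 1) :=
    (continuousOn_finsetSum _ fun z hz =>
      continuousOn_const.mul (continuousOn_conjPoisson (hm z hz))).abs
  have hintg : (circInt fun ζ => ∑ z ∈ m.support, |m z| *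
      ((1 - ‖z‖ ^ 2) / ‖1 - conj z * ζ‖ ^ 2 + 1)) = 4 * π * ∑ z ∈ m.support, |m z| := by
    have hi : ∀ z ∈ m.support, IntervalIntegrable (fun θ => |m z| *
        ((1 - ‖z‖ ^ 2) / ‖1 - conj z * circleMap 0 1 θ‖ ^ 2 + 1)) volume 0 (2 * π) := fun z hz =>
      intervalIntegrable_circ (F := fun ζ => |m z| * ((1 - ‖z‖ ^ 2) / ‖1 - conj z * ζ‖ ^ 2 + 1))
        (continuousOn_const.mul ((hP z hz).add continuousOn_const)) _ _
    rw [circInt, intervalIntegral.integral_finsetSum hi, Finset.mul_sum]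
    refine Finset.sum_congr rfl fun z hz => ?_
    change circInt (fun ζ => |m z| * ((1 - ‖z‖ ^ 2) / ‖1 - conj z * ζ‖ ^ 2 + 1)) = _
    rw [circInt_const_mul, circInt_add (hP z hz) continuousOn_const, circInt_poisson (hm z hz),
      circInt_const]
    ring
  rw [← hintg, ← circInt_add hP1 hQ1]
  refine circInt_mono ?_ (hP1.add hQ1) fun ζ hζ => ?_
  · refine (continuousOn_finsetSum _ fun z hz => continuousOn_const.mul
      (ContinuousOn.div (by fun_prop) (by fun_prop) fun ζ hζ =>
        one_sub_conj_mul_ne_zero (hm z hz) (sphere_subset_closedBall hζ))).norm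
  have hζ1 := mem_sphere_zero_iff_norm.1 hζ
  have e : 2 * ζ * ∑ z ∈ m.support, (m z : ℂ) * (conj z / (1 - conj z * ζ)) =
      ((∑ z ∈ m.support, m z * ((1 - ‖z‖ ^ 2) / ‖1 - conj z * ζ‖ ^ 2 - 1) : ℝ) : ℂ) -
        ((∑ z ∈ m.support, m z * conjPoisson z ζ : ℝ) : ℂ) * I := by
    push_cast
    rw [Finset.mul_sum, Finset.sum_mul, ← Finset.sum_sub_distrib]
    refine Finset.sum_congr rfl fun z hz => ?_
    have := two_mul_reflected_eq hζ (hm z hz)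
    push_cast at this
    linear_combination (m z : ℂ) * this
  have e2 := congrArg norm e
  rw [norm_mul, norm_mul, hζ1, mul_one, Complex.norm_two] at e2
  have h1 : ‖((∑ z ∈ m.support, m z * ((1 - ‖z‖ ^ 2) / ‖1 - conj z * ζ‖ ^ 2 - 1) : ℝ) : ℂ)‖ ≤
      ∑ z ∈ m.support, |m z| * ((1 - ‖z‖ ^ 2) / ‖1 - conj z * ζ‖ ^ 2 + 1) := by
    rw [norm_real, Real.norm_eq_abs]
    refine (Finset.abs_sum_le_sum_abs _ _).trans (Finset.sum_le_sum fun z hz => ?_)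
    rw [abs_mul]
    gcongr
    have : 0 ≤ (1 - ‖z‖ ^ 2) / ‖1 - conj z * ζ‖ ^ 2 :=
      div_nonneg (one_sub_normSq_pos (hm z hz)).le (by positivity)
    rw [abs_le]
    constructor <;> linarith
  have h2 : ‖((∑ z ∈ m.support, m z * conjPoisson z ζ : ℝ) : ℂ) * I‖ =
      |∑ z ∈ m.support, m z * conjPoisson z ζ| := by
    rw [norm_mul, norm_I, mul_one, norm_real, Real.norm_eq_abs]
  have h3 := norm_sub_le ((∑ z ∈ m.support, m z * ((1 - ‖z‖ ^ 2) / ‖1 - conj z * ζ‖ ^ 2 - 1) : ℝ) : ℂ)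
    (((∑ z ∈ m.support, m z * conjPoisson z ζ : ℝ) : ℂ) * I)
  rw [← e2, h2] at h3
  nlinarith [norm_nonneg (∑ z ∈ m.support, (m z : ℂ) * (conj z / (1 - conj z * ζ)))]

/-- The data, on a set `X`, of a real one-form `2 Re (g dz)` with `g = ∑ conj T_l F_l'`, whose
coefficients obey Carleson type bounds and which is closed where all the `h_i` are small. -/
structure IsWolffForm {ι κ : Type*} [Fintype ι] (X : Set ℂ) (M C₀ C₁ : ℝ) (F T a b : ι → ℂ → ℂ)
    (h : κ → ℂ → ℂ) : Prop where
  analytic : ∀ l, AnalyticOnNhd ℂ (F l) X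
  bound : ∀ l, ∀ z ∈ X, ‖F l z‖ ≤ M
  wirt : ∀ l, ∀ z ∈ X, HasWirt (T l) (a l z) (b l z) z
  cont_hol : ∀ l, ContinuousOn (a l) X
  cont_bar : ∀ l, ContinuousOn (b l) X
  bound_coeff : ∀ l, ∀ z ∈ X, ‖T l z‖ ≤ C₀
  bound_deriv : ∀ l, ∀ z ∈ X, ‖a l z‖ ^ 2 ≤ C₁ * ∑ j, ‖deriv (F j) z‖ ^ 2
  analytic_cell : ∀ i, AnalyticOnNhd ℂ (h i) X
  bound_cell : ∀ i, ∀ z ∈ X, ‖h i z‖ ≤ M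
  closed : ∀ z ∈ X, (∀ i, ‖h i z‖ < 4) → (∑ l, conj (a l z) * deriv (F l) z).im = 0

/-- The coefficient of the one-form. -/
noncomputable def formCoeff {ι : Type*} [Fintype ι] (F T : ι → ℂ → ℂ) (z : ℂ) : ℂ :=
  ∑ l, conj (T l z) * deriv (F l) z

namespace IsWolffForm
variable {ι κ : Type*} [Fintype ι] {M C₀ C₁ : ℝ} {F T a b : ι → ℂ → ℂ} {h : κ → ℂ → ℂ} {X : Set ℂ}

lemma hasWirt_formCoeff (H : IsWolffForm X M C₀ C₁ F T a b h) {z : ℂ} (hz : z ∈ X) :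
    HasWirt (formCoeff F T) (∑ l, (conj (b l z) * deriv (F l) z + conj (T l z) * deriv (deriv (F l)) z))
      (∑ l, conj (a l z) * deriv (F l) z) z := by
  refine (HasWirt.sum (s := Finset.univ) fun l _ => ((H.wirt l z hz).star.mul
    (HasWirt.of_hasDerivAt ((H.analytic l).deriv z hz).differentiableAt.hasDerivAt))).congr_coeff rfl ?_
  simp

variable (H : IsWolffForm (closedBall 0 1) M C₀ C₁ F T a b h)
include H

lemma continuousOn_coeff (l : ι) : ContinuousOn (T l) (closedBall 0 1) := fun z hz =>
  (H.wirt l z hz).continuousAt.continuousWithinAt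

/-- The chain formula for a Wolff form. -/
lemma sum_segInt_eq (s : Finset (ℂ × ℂ)) (c : ℂ × ℂ → ℝ)
    (hs : ∀ e ∈ s, e.1 ∈ ball (0 : ℂ) 1 ∧ e.2 ∈ ball (0 : ℂ) 1) :
    π * ∑ e ∈ s, c e * (segInt (formCoeff F T) e.1 e.2).re =
      (∫ ξ in ball (0 : ℂ) 1, formCoeff F T ξ * conj (∑ z ∈ (chainBdry s c).support,
        (chainBdry s c z : ℂ) * (conj z / (1 - conj z * ξ)))).re -
      (∑ z ∈ (chainBdry s c).support, chainBdry s c z *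
        (∫ ξ in ball (0 : ℂ) 1, formCoeff F T ξ * conj (polePart z ξ)).re) / 2 +
      ∫ ξ in ball (0 : ℂ) 1, (∑ l, conj (a l ξ) * deriv (F l) ξ).im *
        (∑ e ∈ s, (c e : ℂ) * segLog e.1 e.2 ξ).im := by
  have ca : ContinuousOn (fun z => ∑ l, (conj (b l z) * deriv (F l) z +
      conj (T l z) * deriv (deriv (F l)) z)) (closedBall 0 1) := by
    refine continuousOn_finsetSum _ fun l _ => ?_
    exact ((continuous_conj.comp_continuousOn (H.cont_bar l)).mul (H.analytic l).deriv.continuousOn).add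
      ((continuous_conj.comp_continuousOn (H.continuousOn_coeff l)).mul
        (H.analytic l).deriv.deriv.continuousOn)
  have cb : ContinuousOn (fun z => ∑ l, conj (a l z) * deriv (F l) z) (closedBall 0 1) :=
    continuousOn_finsetSum _ fun l _ =>
      (continuous_conj.comp_continuousOn (H.cont_hol l)).mul (H.analytic l).deriv.continuousOn
  have hF := fun z hz => H.hasWirt_formCoeff (z := z) hz
  have hFc : ContinuousOn (formCoeff F T) (closedBall 0 1) := fun ξ hξ =>
    (hF ξ hξ).continuousAt.continuousWithinAt
  have hseg := fun e (he : e ∈ s) => segInt_re_eq (hs e he).1 (hs e he).2 hF ca cb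
  have i1 : ∀ e ∈ s, IntegrableOn (fun ξ => formCoeff F T ξ * conj (conj e.2 / (1 - conj e.2 * ξ) -
      conj e.1 / (1 - conj e.1 * ξ))) (ball 0 1) := fun e he =>
    integrableOn_ball_of_continuousOn (hFc.mul (continuous_conj.comp_continuousOn
      ((continuousOn_const.div (by fun_prop) fun ξ hξ => one_sub_conj_mul_ne_zero (hs e he).2 hξ).sub
      (continuousOn_const.div (by fun_prop) fun ξ hξ => one_sub_conj_mul_ne_zero (hs e he).1 hξ))))
  have h1 : ∀ ξ, ∑ z ∈ (chainBdry s c).support, (chainBdry s c z : ℂ) * (conj z / (1 - conj z * ξ)) =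
      ∑ e ∈ s, (c e : ℂ) * (conj e.2 / (1 - conj e.2 * ξ) - conj e.1 / (1 - conj e.1 * ξ)) := fun ξ => by
    simpa only [real_smul] using chainBdry_sum s c fun z => conj z / (1 - conj z * ξ)
  have h2 := chainBdry_sum s c fun z =>
    (∫ ξ in ball (0 : ℂ) 1, formCoeff F T ξ * conj (polePart z ξ)).re
  simp only [smul_eq_mul] at h2
  have h3 : (∫ ξ in ball (0 : ℂ) 1, formCoeff F T ξ * conj (∑ z ∈ (chainBdry s c).support,
        (chainBdry s c z : ℂ) * (conj z / (1 - conj z * ξ)))).re =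
      ∑ e ∈ s, c e * (∫ ξ in ball (0 : ℂ) 1, formCoeff F T ξ *
        conj (conj e.2 / (1 - conj e.2 * ξ) - conj e.1 / (1 - conj e.1 * ξ))).re := by
    have e0 : ∀ ξ, formCoeff F T ξ * conj (∑ z ∈ (chainBdry s c).support,
        (chainBdry s c z : ℂ) * (conj z / (1 - conj z * ξ))) =
        ∑ e ∈ s, (c e : ℂ) * (formCoeff F T ξ *
          conj (conj e.2 / (1 - conj e.2 * ξ) - conj e.1 / (1 - conj e.1 * ξ))) := fun ξ => by
      rw [h1, map_sum, Finset.mul_sum]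
      refine Finset.sum_congr rfl fun e _ => ?_
      rw [map_mul, conj_ofReal]
      ring
    simp only [e0]
    rw [integral_finsetSum _ fun e he => (i1 e he).const_mul _, re_sum]
    refine Finset.sum_congr rfl fun e _ => ?_
    rw [integral_const_mul, re_ofReal_mul]
  have h4 : ∫ ξ in ball (0 : ℂ) 1, (∑ l, conj (a l ξ) * deriv (F l) ξ).im *
        (∑ e ∈ s, (c e : ℂ) * segLog e.1 e.2 ξ).im =
      ∑ e ∈ s, c e * ∫ ξ in ball (0 : ℂ) 1, (∑ l, conj (a l ξ) * deriv (F l) ξ).im *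
        (segLog e.1 e.2 ξ).im := by
    simp only [im_sum, im_ofReal_mul, ← integral_const_mul]
    rw [← integral_finsetSum _ fun e he => ?_]
    · refine integral_congr_ae (Eventually.of_forall fun ξ => ?_)
      simp only [Finset.mul_sum]
      exact Finset.sum_congr rfl fun e _ => by ring
    · have := (hseg e he).1.const_mul (c e)
      simp only [im_sum] at this
      exact this
  rw [h2, h3, h4, Finset.sum_div, ← Finset.sum_sub_distrib, ← Finset.sum_add_distrib, Finset.mul_sum]
  refine Finset.sum_congr rfl fun e he => ?_
  rw [mul_left_comm, (hseg e he).2]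
  ring

end IsWolffForm

lemma circInt_finset_sum {α : Type*} (s : Finset α) (f : α → ℂ → ℝ)
    (hf : ∀ j ∈ s, ContinuousOn (f j) (sphere 0 1)) :
    (circInt fun z => ∑ j ∈ s, f j z) = ∑ j ∈ s, circInt (f j) :=
  intervalIntegral.integral_finsetSum fun j hj => intervalIntegrable_circ (hf j hj) _ _

lemma setIntegral_poleKer_sum {α : Type*} (s : Finset α) (f : α → ℂ → ℝ)
    (hf : ∀ j ∈ s, ContinuousOn (f j) (closedBall 0 1)) {ζ : ℂ} (hζ : ζ ∈ ball (0 : ℂ) 1) :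
    ∫ ξ in ball (0 : ℂ) 1, poleKer ζ ξ * ∑ j ∈ s, f j ξ =
      ∑ j ∈ s, ∫ ξ in ball (0 : ℂ) 1, poleKer ζ ξ * f j ξ := by
  simp only [Finset.mul_sum]
  exact integral_finsetSum _ fun j hj => integrableOn_poleKer_mul hζ (hf j hj)

/-- The Carleson estimate for a finite sum of moduli of analytic functions. -/
lemma carleson_average_sum_bound {α : Type*} (s : Finset α) {F : ℂ → ℂ} {M : ℝ} {k : α → ℂ → ℂ}
    (hF : AnalyticOnNhd ℂ F (closedBall 0 1)) (hM : ∀ z ∈ closedBall (0 : ℂ) 1, ‖F z‖ ≤ M)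
    (hk : ∀ j ∈ s, AnalyticOnNhd ℂ (k j) (closedBall 0 1)) :
    ∫ ζ in ball (0 : ℂ) 1, (1 - ‖ζ‖ ^ 2) * ‖deriv F ζ‖ ^ 2 * (∫ ξ in ball (0 : ℂ) 1,
      poleKer ζ ξ * ∑ j ∈ s, ‖k j ξ‖) ≤
      (2 * π * Real.exp (M ^ 2) + 16 * π * M ^ 2) * circInt fun z => ∑ j ∈ s, ‖k j z‖ := by
  have hc : ContinuousOn (fun ζ : ℂ => (1 - ‖ζ‖ ^ 2) * ‖deriv F ζ‖ ^ 2) (closedBall 0 1) :=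
    ContinuousOn.mul (by fun_prop) (hF.deriv.continuousOn.norm.pow 2)
  rw [circInt_finset_sum _ _ fun j hj => (hk j hj).continuousOn.norm.mono sphere_subset_closedBall,
    Finset.mul_sum]
  rw [setIntegral_congr_fun measurableSet_ball fun ζ hζ => by
    rw [setIntegral_poleKer_sum s (fun j ξ => ‖k j ξ‖) (fun j hj => (hk j hj).continuousOn.norm) hζ,
      Finset.mul_sum] ]
  rw [integral_finsetSum _ fun j hj =>
    integrableOn_mul_poleKer_potential (hk j hj).continuousOn.norm hc]
  exact Finset.sum_le_sum fun j hj => carleson_average_bound hF hM (hk j hj)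

namespace IsWolffForm

/-- The integral of a Wolff form over a chain inside the cell is controlled by its boundary. -/
theorem chain_estimate (ι : Type*) [Fintype ι] (M C₀ C₁ : ℝ) (hM : 0 ≤ M) (hC₀ : 0 ≤ C₀)
    (hC₁ : 0 ≤ C₁) : ∃ C, 0 ≤ C ∧ ∀ (κ : Type) (F T a b : ι → ℂ → ℂ) (h : κ → ℂ → ℂ),
      IsWolffForm (closedBall 0 1) M C₀ C₁ F T a b h → ∀ (s : Finset (ℂ × ℂ)) (c : ℂ × ℂ → ℝ),
      (∀ e ∈ s, e.1 ∈ ball (0 : ℂ) 1 ∧ e.2 ∈ ball (0 : ℂ) 1) →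
      (∀ e ∈ s, ∀ z ∈ segment ℝ e.1 e.2, ∀ i, ‖h i z‖ < 1) →
      |∑ e ∈ s, c e * (segInt (formCoeff F T) e.1 e.2).re| ≤
        C * (∑ z ∈ (chainBdry s c).support, |chainBdry s c z| +
          circInt fun ζ => |∑ z ∈ (chainBdry s c).support, chainBdry s c z * conjPoisson z ζ|) := by
  obtain ⟨CW, hCW0, hCW⟩ := wolff_bound (ι := ι) M C₀ C₁ hC₀ hC₁
  obtain ⟨CP, hCP0, hCP⟩ := wolff_pole_bound (ι := ι) M C₀ C₁ hC₀ hC₁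
  obtain ⟨CK, hCK0, hCK⟩ := abs_im_le_poleKer_average M
  set n : ℝ := ((Fintype.card ι : ℕ) : ℝ) with hn
  have hn0 : 0 ≤ n := by positivity
  set CB : ℝ := (C₁ * n + 1) / 2 * CK * (n * (2 * π * Real.exp (M ^ 2) + 16 * π * M ^ 2)) with hCB
  have hCB0 : 0 ≤ CB := by positivity
  refine ⟨π⁻¹ * (n * CW * (4 * π) + n * CP / 2 + CB * (8 * π * M + 8 * π)), by positivity, ?_⟩
  intro κ F T a b h H s c hs hcell
  set m := chainBdry s c with hm
  set N := ∑ z ∈ m.support, |m z| with hN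
  set Q := circInt fun ζ => |∑ z ∈ m.support, m z * conjPoisson z ζ| with hQ
  have hN0 : 0 ≤ N := Finset.sum_nonneg fun _ _ => abs_nonneg _
  have hQ0 : 0 ≤ Q := circInt_nonneg fun _ _ => abs_nonneg _
  have hmb : ∀ z ∈ m.support, z ∈ ball (0 : ℂ) 1 := fun z hz => by
    obtain ⟨e, he, rfl | rfl⟩ := exists_of_mem_support_chainBdry hz
    exacts [(hs e he).1, (hs e he).2]
  have hmc : ∀ z ∈ m.support, ∀ i, ‖h i z‖ < 1 := fun z hz => by
    obtain ⟨e, he, rfl | rfl⟩ := exists_of_mem_support_chainBdry hz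
    exacts [hcell e he _ (left_mem_segment ℝ _ _), hcell e he _ (right_mem_segment ℝ _ _)]
  set R : ℂ → ℂ := fun ξ => ∑ z ∈ m.support, (m z : ℂ) * (conj z / (1 - conj z * ξ)) with hR
  have hRa : AnalyticOnNhd ℂ R (closedBall 0 1) := fun ξ hξ =>
    Finset.analyticAt_fun_sum _ fun z hz => by
      have := one_sub_conj_mul_ne_zero (hmb z hz) hξ
      fun_prop (disch := exact this)
  have hRint : (circInt fun ζ => ‖R ζ‖) ≤ 4 * π * N + Q := circInt_reflected_le m hmb
  have hRint0 : 0 ≤ circInt fun ζ => ‖R ζ‖ := circInt_nonneg fun _ _ => norm_nonneg _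
  -- the three terms of the chain formula
  have t1 : ‖∫ ξ in ball (0 : ℂ) 1, formCoeff F T ξ * conj (R ξ)‖ ≤ n * CW * (4 * π * N + Q) := by
    have hi : ∀ l ∈ Finset.univ, IntegrableOn (fun ξ => conj (T l ξ * conj (deriv (F l) ξ) * R ξ))
        (ball 0 1) := fun l _ => integrableOn_ball_of_continuousOn
      (continuous_conj.comp_continuousOn (((H.continuousOn_coeff l).mul
        (continuous_conj.comp_continuousOn (H.analytic l).deriv.continuousOn)).mul hRa.continuousOn))
    have e : ∀ ξ, formCoeff F T ξ * conj (R ξ) =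
        ∑ l, conj (T l ξ * conj (deriv (F l) ξ) * R ξ) := fun ξ => by
      simp only [formCoeff, Finset.sum_mul, map_mul, conj_conj]
    simp only [e]
    rw [integral_finsetSum _ hi]
    refine (norm_sum_le_of_le _ fun l _ => ?_).trans (b := ∑ _l : ι, CW * (4 * π * N + Q)) ?_
    · rw [integral_conj, norm_conj]
      exact (hCW F (F l) (T l) (a l) (b l) R H.analytic H.bound (H.analytic l) (H.bound l) (H.wirt l)
        (H.cont_hol l) (H.cont_bar l) (H.bound_coeff l) (H.bound_deriv l) hRa).trans (by gcongr)
    · simp [hn, mul_assoc]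
  have t2 : ∀ z ∈ m.support, ‖∫ ξ in ball (0 : ℂ) 1, formCoeff F T ξ * conj (polePart z ξ)‖ ≤
      n * CP := fun z hz => by
    have hi : ∀ l ∈ Finset.univ, IntegrableOn (fun ξ =>
        conj (T l ξ * conj (deriv (F l) ξ) * polePart z ξ)) (ball 0 1) := fun l _ => by
      have hw : ContinuousOn (fun ξ => T l ξ * conj (deriv (F l) ξ) *
          (((1 - ‖z‖ ^ 2 : ℝ) : ℂ) / (1 - conj z * ξ))) (closedBall 0 1) :=
        ((H.continuousOn_coeff l).mul
          (continuous_conj.comp_continuousOn (H.analytic l).deriv.continuousOn)).mul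
          (continuousOn_const.div (by fun_prop) fun ξ hξ => one_sub_conj_mul_ne_zero (hmb z hz) hξ)
      obtain ⟨B, hB⟩ := (isCompact_closedBall (0 : ℂ) 1).exists_bound_of_continuousOn hw
      have e : ∀ ξ, T l ξ * conj (deriv (F l) ξ) * polePart z ξ = T l ξ * conj (deriv (F l) ξ) *
          (((1 - ‖z‖ ^ 2 : ℝ) : ℂ) / (1 - conj z * ξ)) / (ξ - z) := fun ξ => by
        rw [polePart, mul_div_assoc _ _ (ξ - z), div_div, mul_comm (ξ - z)]
      simp only [e]
      refine integrableOn_ball_of_le_inv (z := z) (C := B) (continuous_conj.comp_continuousOn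
        ((hw.mono (diff_subset.trans ball_subset_closedBall)).div (by fun_prop)
          fun ξ hξ => sub_ne_zero.2 hξ.2)) fun ξ hξ _ => ?_
      rw [norm_conj, norm_div, div_eq_mul_inv]
      gcongr
      exact hB ξ (ball_subset_closedBall hξ)
    have e : ∀ ξ, formCoeff F T ξ * conj (polePart z ξ) =
        ∑ l, conj (T l ξ * conj (deriv (F l) ξ) * polePart z ξ) := fun ξ => by
      simp only [formCoeff, Finset.sum_mul, map_mul, conj_conj]
    simp only [e]
    rw [integral_finsetSum _ hi]
    refine (norm_sum_le_of_le _ fun l _ => ?_).trans (b := ∑ _l : ι, CP) ?_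
    · rw [integral_conj, norm_conj]
      exact hCP F (F l) (T l) (a l) (b l) z H.analytic H.bound (H.analytic l) (H.bound l) (H.wirt l)
        (H.cont_hol l) (H.cont_bar l) (H.bound_coeff l) (H.bound_deriv l) (hmb z hz)
    · simp [hn]
  have t3 : |∫ ξ in ball (0 : ℂ) 1, (∑ l, conj (a l ξ) * deriv (F l) ξ).im *
      (∑ e ∈ s, (c e : ℂ) * segLog e.1 e.2 ξ).im| ≤ CB * (8 * π * M * N + 2 * (4 * π * N + Q)) := by
    set 𝓗 : ℂ → ℂ := fun ξ => ∑ e ∈ s, (c e : ℂ) * segLog e.1 e.2 ξ with h𝓗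
    set k : Option ℂ → ℂ → ℂ := fun j ξ => j.elim (2 * R ξ) fun z => (4 * M * m z : ℝ) * moebDer z ξ
      with hk
    set J := Finset.insertNone m.support with hJ
    have hka : ∀ j ∈ J, AnalyticOnNhd ℂ (k j) (closedBall 0 1) := by
      rintro (_ | z) hj
      · exact analyticOnNhd_const.mul hRa
      · exact analyticOnNhd_const.mul
          (analyticOnNhd_moebDer (hmb z (Finset.some_mem_insertNone.1 hj)))
    have hEsum : ∀ ξ, ∑ j ∈ J, ‖k j ξ‖ =
        2 * ‖R ξ‖ + ∑ z ∈ m.support, 4 * M * |m z| * ‖moebDer z ξ‖ := fun ξ => by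
      rw [hJ, Finset.sum_insertNone]
      simp [hk, abs_of_nonneg hM]
    have hE0 : ∀ ξ, 0 ≤ ∑ j ∈ J, ‖k j ξ‖ := fun ξ => Finset.sum_nonneg fun _ _ => norm_nonneg _
    have hEc : ContinuousOn (fun ξ => ∑ j ∈ J, ‖k j ξ‖) (closedBall 0 1) :=
      continuousOn_finsetSum _ fun j hj => (hka j hj).continuousOn.norm
    have hEint : (circInt fun ξ => ∑ j ∈ J, ‖k j ξ‖) ≤ 8 * π * M * N + 2 * (4 * π * N + Q) := by
      have hmd : ∀ z ∈ m.support, circInt (fun ξ => ‖moebDer z ξ‖) = 2 * π := fun z hz => by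
        simp only [norm_moebDer (hmb z hz)]
        exact circInt_poisson (hmb z hz)
      have hmdc : ∀ z ∈ m.support, ContinuousOn (fun ξ => ‖moebDer z ξ‖) (sphere 0 1) :=
        fun z hz => (analyticOnNhd_moebDer (hmb z hz)).continuousOn.norm.mono sphere_subset_closedBall
      simp only [hEsum]
      rw [circInt_add (F := fun ξ => 2 * ‖R ξ‖)
        (G := fun ξ => ∑ z ∈ m.support, 4 * M * |m z| * ‖moebDer z ξ‖)
        (continuousOn_const.mul (hRa.continuousOn.norm.mono sphere_subset_closedBall))
        (continuousOn_finsetSum _ fun z hz => continuousOn_const.mul (hmdc z hz)),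
        circInt_const_mul, circInt_finset_sum m.support (fun z ξ => 4 * M * |m z| * ‖moebDer z ξ‖)
          fun z hz => continuousOn_const.mul (hmdc z hz)]
      have : ∑ z ∈ m.support, circInt (fun ξ => 4 * M * |m z| * ‖moebDer z ξ‖) = 8 * π * M * N := by
        rw [hN, Finset.mul_sum]
        refine Finset.sum_congr rfl fun z hz => ?_
        rw [circInt_const_mul, hmd z hz]
        ring
      rw [this]
      linarith
    have hoff : ∀ ξ i, 1 ≤ ‖h i ξ‖ → ∀ e ∈ s, ξ ∉ segment ℝ e.1 e.2 := fun ξ i hi e he hξ =>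
      absurd (hcell e he ξ hξ i) (not_lt.2 hi)
    have h𝓗d : ∀ ξ ∈ ball (0 : ℂ) 1, ∀ i, 3 / 2 < ‖h i ξ‖ →
        ‖deriv 𝓗 ξ‖ ≤ ∑ j ∈ J, ‖k j ξ‖ := fun ξ hξ i hi => by
      have hd : HasDerivAt 𝓗 (∑ z ∈ m.support, m z •
          (-polePart z ξ + 2 * (conj z / (1 - conj z * ξ)))) ξ := by
        rw [hm, chainBdry_sum]
        refine (HasDerivAt.fun_sum fun e he => (hasDerivAt_segLog (hs e he).1 (hs e he).2
          (ball_subset_closedBall hξ) (hoff ξ i (by linarith) e he)).const_mul (c e : ℂ)).congr_deriv ?_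
        refine Finset.sum_congr rfl fun e _ => ?_
        rw [real_smul]
        ring
      rw [hd.deriv, hEsum]
      simp only [real_smul, mul_add, Finset.sum_add_distrib]
      rw [add_comm]
      refine (norm_add_le _ _).trans (add_le_add (le_of_eq ?_) (norm_sum_le_of_le _ fun z hz => ?_))
      · rw [show (2 : ℝ) * ‖R ξ‖ = ‖2 * R ξ‖ by rw [norm_mul, norm_ofNat], hR, Finset.mul_sum]
        exact congrArg _ (Finset.sum_congr rfl fun z _ => by ring)
      · rw [norm_mul, norm_neg, norm_real, Real.norm_eq_abs]
        have := norm_polePart_le (H.analytic_cell i) (H.bound_cell i) (hmb z hz) hξ (hmc z hz i) hi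
        nlinarith [abs_nonneg (m z)]
    have hu : ∀ ζ ∈ ball (0 : ℂ) 1, ∀ i, 4 ≤ ‖h i ζ‖ → |(𝓗 ζ).im| ≤
        CK * ((1 - ‖ζ‖ ^ 2) * ∫ ξ in ball (0 : ℂ) 1, poleKer ζ ξ * ∑ j ∈ J, ‖k j ξ‖) :=
      fun ζ hζ i hi => hCK (h i) 𝓗 _ (H.analytic_cell i) (H.bound_cell i)
        (fun z hz hz1 => Finset.analyticAt_fun_sum _ fun e he => analyticAt_const.mul
          (analyticAt_segLog (hs e he).1 (hs e he).2 hz (hoff z i (by linarith) e he)))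
        (fun z hz hz1 => by
          rw [h𝓗, im_sum]
          refine Finset.sum_eq_zero fun e he => ?_
          rw [im_ofReal_mul, segLog_im_of_mem_sphere hz (hoff z i (by linarith) e he), mul_zero])
        hEc (fun z _ => hE0 z) (fun z hz hz1 => h𝓗d z hz i hz1) ζ hζ hi
    have hS : ∀ ζ ∈ ball (0 : ℂ) 1, |(∑ l, conj (a l ζ) * deriv (F l) ζ).im| ≤
        (C₁ * n + 1) / 2 * ∑ l, ‖deriv (F l) ζ‖ ^ 2 := fun ζ hζ => by
      have hl : ∀ l ∈ Finset.univ, ‖conj (a l ζ) * deriv (F l) ζ‖ ≤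
          (C₁ * ∑ j, ‖deriv (F j) ζ‖ ^ 2) / 2 + ‖deriv (F l) ζ‖ ^ 2 / 2 := fun l _ => by
        rw [norm_mul, norm_conj]
        have := H.bound_deriv l ζ (ball_subset_closedBall hζ)
        nlinarith [sq_nonneg (‖a l ζ‖ - ‖deriv (F l) ζ‖)]
      refine (abs_im_le_norm _).trans ((norm_sum_le_of_le _ hl).trans (le_of_eq ?_))
      rw [Finset.sum_add_distrib, Finset.sum_const, Finset.card_univ, nsmul_eq_mul,
        ← Finset.sum_div, ← hn]
      ring
    set B : ι → ℂ → ℝ := fun l ζ => (1 - ‖ζ‖ ^ 2) * ‖deriv (F l) ζ‖ ^ 2 *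
      ∫ ξ in ball (0 : ℂ) 1, poleKer ζ ξ * ∑ j ∈ J, ‖k j ξ‖ with hB
    have hBi : ∀ l ∈ Finset.univ, IntegrableOn (B l) (ball 0 1) := fun l _ =>
      integrableOn_mul_poleKer_potential hEc
        (ContinuousOn.mul (by fun_prop) ((H.analytic l).deriv.continuousOn.norm.pow 2))
    have hpt : ∀ ζ ∈ ball (0 : ℂ) 1, ‖(∑ l, conj (a l ζ) * deriv (F l) ζ).im * (𝓗 ζ).im‖ ≤
        (C₁ * n + 1) / 2 * CK * ∑ l, B l ζ := fun ζ hζ => by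
      have hP : 0 ≤ ∫ ξ in ball (0 : ℂ) 1, poleKer ζ ξ * ∑ j ∈ J, ‖k j ξ‖ :=
        integral_nonneg fun ξ => mul_nonneg (poleKer_nonneg _ _) (hE0 ξ)
      have hz := one_sub_normSq_pos hζ
      by_cases h4 : ∀ i, ‖h i ζ‖ < 4
      · rw [H.closed ζ (ball_subset_closedBall hζ) h4, zero_mul, norm_zero]
        exact mul_nonneg (by positivity) (Finset.sum_nonneg fun l _ => by positivity)
      · push Not at h4
        obtain ⟨i, hi⟩ := h4
        rw [norm_mul, Real.norm_eq_abs, Real.norm_eq_abs]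
        refine (mul_le_mul (hS ζ hζ) (hu ζ hζ i hi) (abs_nonneg _) (by positivity)).trans (le_of_eq ?_)
        simp only [hB, Finset.mul_sum, Finset.sum_mul]
        exact Finset.sum_congr rfl fun l _ => by ring
    have := norm_integral_le_of_norm_le (μ := volume.restrict (ball (0 : ℂ) 1))
      ((integrable_finset_sum _ hBi).const_mul ((C₁ * n + 1) / 2 * CK))
      (ae_restrict_of_forall_mem measurableSet_ball hpt)
    refine this.trans ?_
    rw [integral_const_mul, integral_finsetSum _ hBi]
    refine (mul_le_mul_of_nonneg_left (Finset.sum_le_sum fun l _ =>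
      carleson_average_sum_bound J (H.analytic l) (H.bound l) hka) (by positivity)).trans ?_
    rw [Finset.sum_const, Finset.card_univ, nsmul_eq_mul, ← hn]
    have hCB' : CB * (8 * π * M * N + 2 * (4 * π * N + Q)) = (C₁ * n + 1) / 2 * CK * (n *
        ((2 * π * Real.exp (M ^ 2) + 16 * π * M ^ 2) * (8 * π * M * N + 2 * (4 * π * N + Q)))) := by
      rw [hCB]
      ring
    rw [hCB']
    gcongr
  have t2' : |(∑ z ∈ m.support, m z *
      (∫ ξ in ball (0 : ℂ) 1, formCoeff F T ξ * conj (polePart z ξ)).re) / 2| ≤ n * CP * N / 2 := by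
    rw [abs_div, abs_two]
    gcongr
    rw [hN, Finset.mul_sum]
    refine (Finset.abs_sum_le_sum_abs _ _).trans (Finset.sum_le_sum fun z hz => ?_)
    rw [abs_mul, mul_comm]
    gcongr
    exact (abs_re_le_norm _).trans (t2 z hz)
  have key := H.sum_segInt_eq s c hs
  rw [← hm] at key
  have t1' := (abs_re_le_norm _).trans t1
  have hfin : |π * ∑ e ∈ s, c e * (segInt (formCoeff F T) e.1 e.2).re| ≤
      n * CW * (4 * π * N + Q) + n * CP * N / 2 + CB * (8 * π * M * N + 2 * (4 * π * N + Q)) := by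
    rw [key]
    exact (abs_add_le _ _).trans (add_le_add ((abs_sub _ _).trans (add_le_add t1' t2')) t3)
  rw [abs_mul, abs_of_pos Real.pi_pos, ← le_inv_mul_iff₀ Real.pi_pos] at hfin
  refine hfin.trans ?_
  rw [mul_assoc π⁻¹]
  gcongr
  have hp := Real.pi_gt_three
  have h1 : 4 * π * N + Q ≤ 4 * π * (N + Q) := by nlinarith
  have h2 : N ≤ N + Q := by linarith
  calc _ ≤ n * CW * (4 * π * (N + Q)) + n * CP * (N + Q) / 2 +
        CB * (8 * π * M * (N + Q) + 2 * (4 * π * (N + Q))) := by gcongr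
    _ = _ := by ring

end IsWolffForm

namespace IsWolffForm
variable {ι κ : Type*} [Fintype ι] {M C₀ C₁ : ℝ} {F T a b : ι → ℂ → ℂ} {h : κ → ℂ → ℂ}

lemma dilate (H : IsWolffForm (ball 0 1) M C₀ C₁ F T a b h) {r : ℝ} (hr0 : 0 < r) (hr1 : r < 1) :
    IsWolffForm (closedBall 0 1) M C₀ C₁ (fun l z => F l (r * z)) (fun l z => T l (r * z))
      (fun l z => r * a l (r * z)) (fun l z => r * b l (r * z)) (fun i z => h i (r * z)) := by
  have hm : MapsTo (fun z : ℂ => (r : ℂ) * z) (closedBall 0 1) (ball 0 1) := fun z hz => by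
    rw [mem_closedBall_zero_iff] at hz
    rw [mem_ball_zero_iff, norm_mul, norm_real, Real.norm_of_nonneg hr0.le]
    nlinarith
  have ha : ∀ z : ℂ, AnalyticAt ℂ (fun z : ℂ => (r : ℂ) * z) z := fun z => by fun_prop
  have hc : ContinuousOn (fun z : ℂ => (r : ℂ) * z) (closedBall 0 1) := by fun_prop
  have hd : ∀ l z, deriv (fun z => F l (r * z)) z = r * deriv (F l) (r * z) := fun l z => by
    rw [deriv_comp_mul_left, smul_eq_mul]
  refine ⟨fun l z hz => (H.analytic l _ (hm hz)).comp (ha z), fun l z hz => H.bound l _ (hm hz),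
    fun l z hz => ?_, fun l => continuousOn_const.mul ((H.cont_hol l).comp hc hm),
    fun l => continuousOn_const.mul ((H.cont_bar l).comp hc hm),
    fun l z hz => H.bound_coeff l _ (hm hz), fun l z hz => ?_,
    fun i z hz => (H.analytic_cell i _ (hm hz)).comp (ha z), fun i z hz => H.bound_cell i _ (hm hz),
    fun z hz h4 => ?_⟩
  · have := (H.wirt l _ (hm hz)).comp_inner ((hasDerivAt_id z).const_mul (r : ℂ))
    refine this.congr_coeff ?_ ?_ <;> simp [mul_comm]
  · simp only [hd, norm_mul, mul_pow, ← Finset.mul_sum]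
    have := H.bound_deriv l _ (hm hz)
    rw [mul_left_comm]
    gcongr
  · simp only [hd, map_mul, conj_ofReal]
    have := H.closed _ (hm hz) h4
    have e : ∑ l, (r : ℂ) * conj (a l (r * z)) * (r * deriv (F l) (r * z)) =
        ((r ^ 2 : ℝ) : ℂ) * ∑ l, conj (a l (r * z)) * deriv (F l) (r * z) := by
      rw [Finset.mul_sum]
      push_cast
      exact Finset.sum_congr rfl fun l _ => by ring
    rw [e, im_ofReal_mul, this, mul_zero]

lemma formCoeff_dilate (F T : ι → ℂ → ℂ) (r : ℝ) (z : ℂ) :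
    formCoeff (fun l z => F l (r * z)) (fun l z => T l (r * z)) z = r * formCoeff F T (r * z) := by
  simp only [formCoeff, deriv_comp_mul_left, smul_eq_mul, Finset.mul_sum]
  exact Finset.sum_congr rfl fun l _ => by ring

lemma continuousOn_formCoeff {X : Set ℂ} (H : IsWolffForm X M C₀ C₁ F T a b h) :
    ContinuousOn (formCoeff F T) X := fun _ hz =>
  (H.hasWirt_formCoeff hz).continuousAt.continuousWithinAt

lemma tendsto_segInt_dilate {g : ℂ → ℂ} (hg : ContinuousOn g (ball 0 1)) {p q : ℂ}
    (hp : p ∈ ball (0 : ℂ) 1) (hq : q ∈ ball (0 : ℂ) 1) :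
    Tendsto (fun r : ℝ => segInt (fun z => r * g (r * z)) p q) (𝓝[<] 1) (𝓝 (segInt g p q)) := by
  set ρ := max ‖p‖ ‖q‖ with hρ
  have hρ1 : ρ < 1 := max_lt (mem_ball_zero_iff.1 hp) (mem_ball_zero_iff.1 hq)
  have hsub : closedBall (0 : ℂ) ρ ⊆ ball 0 1 := closedBall_subset_ball hρ1
  have hseg : ∀ t ∈ Icc (0 : ℝ) 1, segPt p q t ∈ closedBall (0 : ℂ) ρ := fun t ht =>
    (convex_closedBall (0 : ℂ) ρ).segment_subset (by simp [hρ]) (by simp [hρ])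
      (segPt_mem_segment p q ht)
  have hmul : ∀ r ∈ Ioo (0 : ℝ) 1, ∀ z ∈ closedBall (0 : ℂ) ρ, (r : ℂ) * z ∈ closedBall (0 : ℂ) ρ := by
    intro r hr z hz
    rw [mem_closedBall_zero_iff] at hz ⊢
    rw [norm_mul, norm_real, Real.norm_of_nonneg hr.1.le]
    nlinarith [hr.1, hr.2, norm_nonneg z]
  obtain ⟨B, hB⟩ := (isCompact_closedBall (0 : ℂ) ρ).exists_bound_of_continuousOn (hg.mono hsub)
  have hev : ∀ᶠ r : ℝ in 𝓝[<] 1, r ∈ Ioo (0 : ℝ) 1 :=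
    Ioo_mem_nhdsLT one_pos
  refine intervalIntegral.tendsto_integral_filter_of_dominated_convergence
    (fun _ => B * ‖q - p‖) ?_ ?_ (intervalIntegrable_const) ?_
  · filter_upwards [hev] with r hr
    rw [uIoc_of_le zero_le_one]
    refine ContinuousOn.aestronglyMeasurable ?_ measurableSet_Ioc
    refine (continuousOn_const.mul (hg.comp (continuousOn_const.mul
      (continuous_segPt p q).continuousOn) fun t ht => ?_)).mul continuousOn_const
    exact hsub (hmul r hr _ (hseg t (Ioc_subset_Icc_self ht)))
  · filter_upwards [hev] with r hr
    refine Eventually.of_forall fun t ht => ?_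
    rw [uIoc_of_le zero_le_one] at ht
    have := hB _ (hmul r hr _ (hseg t (Ioc_subset_Icc_self ht)))
    rw [norm_mul, norm_mul, norm_real, Real.norm_of_nonneg hr.1.le]
    gcongr
    nlinarith [hr.1, hr.2, norm_nonneg (g (r * segPt p q t))]
  · refine Eventually.of_forall fun t ht => ?_
    rw [uIoc_of_le zero_le_one] at ht
    have hz := hsub (hseg t (Ioc_subset_Icc_self ht))
    have hr : Tendsto (fun r : ℝ => (r : ℂ)) (𝓝[<] 1) (𝓝 1) := by
      simpa using (continuous_ofReal.tendsto 1).mono_left nhdsWithin_le_nhds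
    have h1 : Tendsto (fun r : ℝ => (r : ℂ) * segPt p q t) (𝓝[<] 1) (𝓝 (segPt p q t)) := by
      simpa using hr.mul_const (segPt p q t)
    simpa using ((hr.mul ((hg.continuousAt (isOpen_ball.mem_nhds hz)).tendsto.comp h1))).mul_const
      (q - p)

/-- The chain estimate for Wolff forms on the open disc. -/
theorem chain_estimate_ball (ι : Type*) [Fintype ι] (M C₀ C₁ : ℝ) (hM : 0 ≤ M) (hC₀ : 0 ≤ C₀)
    (hC₁ : 0 ≤ C₁) : ∃ C, 0 ≤ C ∧ ∀ (κ : Type) [Finite κ] (F T a b : ι → ℂ → ℂ) (h : κ → ℂ → ℂ),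
      IsWolffForm (ball 0 1) M C₀ C₁ F T a b h → ∀ (s : Finset (ℂ × ℂ)) (c : ℂ × ℂ → ℝ),
      (∀ e ∈ s, e.1 ∈ ball (0 : ℂ) 1 ∧ e.2 ∈ ball (0 : ℂ) 1) →
      (∀ e ∈ s, ∀ z ∈ segment ℝ e.1 e.2, ∀ i, ‖h i z‖ < 1) →
      |∑ e ∈ s, c e * (segInt (formCoeff F T) e.1 e.2).re| ≤
        C * (∑ z ∈ (chainBdry s c).support, |chainBdry s c z| +
          circInt fun ζ => |∑ z ∈ (chainBdry s c).support, chainBdry s c z * conjPoisson z ζ|) := by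
  obtain ⟨C, hC0, hC⟩ := chain_estimate ι M C₀ C₁ hM hC₀ hC₁
  refine ⟨C, hC0, fun κ _ F T a b h H s c hs hcell => ?_⟩
  have hcell' : ∀ᶠ r : ℝ in 𝓝 1, ∀ e ∈ s, ∀ z ∈ segment ℝ e.1 e.2, ∀ i, ‖h i (r * z)‖ < 1 := by
    rw [Filter.eventually_all_finset]
    intro e he
    refine IsCompact.eventually_forall_of_forall_eventually ?_ fun z hz => ?_
    · rw [segment_eq_image_lineMap]
      exact isCompact_Icc.image AffineMap.lineMap_continuous
    rw [Filter.eventually_all]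
    intro i
    have hzb := segment_subset_ball (hs e he).1 (hs e he).2 hz
    have hc : ContinuousAt (fun x : ℝ × ℂ => ‖h i (x.1 * x.2)‖) (1, z) := by
      refine ContinuousAt.norm (ContinuousAt.comp (g := h i) ?_ (by fun_prop))
      simpa using (H.analytic_cell i z hzb).continuousAt
    refine hc.eventually_lt continuousAt_const ?_
    simpa using hcell e he z hz i
  have ht : Tendsto (fun r : ℝ => |∑ e ∈ s, c e * (segInt (formCoeff (fun l z => F l (r * z))
      (fun l z => T l (r * z))) e.1 e.2).re|) (𝓝[<] 1)
      (𝓝 |∑ e ∈ s, c e * (segInt (formCoeff F T) e.1 e.2).re|) := by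
    refine (tendsto_finsetSum _ fun e he => ((continuous_re.tendsto _).comp ?_).const_mul _).abs
    have := tendsto_segInt_dilate H.continuousOn_formCoeff (hs e he).1 (hs e he).2
    simp only [← formCoeff_dilate] at this
    exact this
  refine le_of_tendsto ht ?_
  filter_upwards [Ioo_mem_nhdsLT one_pos, hcell'.filter_mono nhdsWithin_le_nhds] with r hr hr'
  exact hC κ _ _ _ _ _ (H.dilate hr.1 hr.2) s c hs hr'

end IsWolffForm

/-- A functional dominated by the pull-back of a seminorm extends along the map. -/
lemma exists_dual_of_abs_le {V X : Type*} [AddCommGroup V] [Module ℝ V] [AddCommGroup X] [Module ℝ X]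
    (L : V →ₗ[ℝ] X) (A : V →ₗ[ℝ] ℝ) (p : Seminorm ℝ X) (h : ∀ v, |A v| ≤ p (L v)) :
    ∃ Λ : X →ₗ[ℝ] ℝ, (∀ v, Λ (L v) = A v) ∧ ∀ x, |Λ x| ≤ p x := by
  have hk : LinearMap.ker L ≤ LinearMap.ker A := fun v hv => by
    have := h v
    rw [LinearMap.mem_ker.1 hv, map_zero] at this
    exact abs_nonpos_iff.1 this
  let f : LinearMap.range L →ₗ[ℝ] ℝ :=
    ((LinearMap.ker L).liftQ A hk) ∘ₗ L.quotKerEquivRange.symm.toLinearMap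
  have hf : ∀ v, f ⟨L v, LinearMap.mem_range_self L v⟩ = A v := fun v => by
    have : L.quotKerEquivRange.symm ⟨L v, LinearMap.mem_range_self L v⟩ =
        (LinearMap.ker L).mkQ v := L.quotKerEquivRange_symm_apply_image v _
    simp [f, this]
  obtain ⟨Λ, h1, h2⟩ := Module.Dual.exists_extension_of_le_seminorm_real _ f (p := p) (by
    rintro ⟨_, v, rfl⟩
    rw [hf]
    exact (le_abs_self _).trans (h v))
  exact ⟨Λ, fun v => (h1 ⟨L v, LinearMap.mem_range_self L v⟩).trans (hf v), h2⟩

/-- The seminorm `∑ |m z| + ∮ |Re φ|` controlling chains. -/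
noncomputable def chainSeminorm : Seminorm ℝ ((ℂ →₀ ℝ) × circCont) :=
  Seminorm.of (fun x : (ℂ →₀ ℝ) × circCont => (x.1.sum fun _ c => |c|) + circInt fun ζ => |(x.2.1 ζ).re|)
    (fun x y : (ℂ →₀ ℝ) × circCont => by
      have h1 : ((x.1 + y.1).sum fun _ c => |c|) ≤ (x.1.sum fun _ c => |c|) + y.1.sum fun _ c => |c| := by
        classical
        rw [Finsupp.sum_of_support_subset (x.1 + y.1) Finsupp.support_add _ (by simp),
          Finsupp.sum_of_support_subset x.1 (Finset.subset_union_left (s₂ := y.1.support)) _ (by simp),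
          Finsupp.sum_of_support_subset y.1 (Finset.subset_union_right (s₁ := x.1.support)) _ (by simp),
          ← Finset.sum_add_distrib]
        exact Finset.sum_le_sum fun z _ => abs_add_le _ _
      have hc : ∀ φ : circCont, ContinuousOn (fun ζ => |(φ.1 ζ).re|) (sphere 0 1) := fun φ =>
        (continuous_re.comp_continuousOn φ.2).abs
      have h2 : (circInt fun ζ => |((x + y).2.1 ζ).re|) ≤
          (circInt fun ζ => |(x.2.1 ζ).re|) + circInt fun ζ => |(y.2.1 ζ).re| := by
        rw [← circInt_add (hc _) (hc _)]
        exact circInt_mono (hc _) ((hc _).add (hc _)) fun z _ => abs_add_le _ _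
      exact (add_le_add h1 h2).trans (le_of_eq (by ring)))
    (fun (r : ℝ) (x : (ℂ →₀ ℝ) × circCont) => by
      have h1 : ((r • x).1.sum fun _ c => |c|) = ‖r‖ * x.1.sum fun _ c => |c| := by
        rw [Prod.smul_fst, Finsupp.sum_smul_index (by simp), Finsupp.sum, Finsupp.sum, Finset.mul_sum]
        simp [abs_mul]
      have h2 : (circInt fun ζ => |((r • x).2.1 ζ).re|) = ‖r‖ * circInt fun ζ => |(x.2.1 ζ).re| := by
        rw [← circInt_const_mul]
        simp [abs_mul]
      rw [h1, h2, mul_add])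

lemma chainSeminorm_apply (m : ℂ →₀ ℝ) (φ : circCont) : chainSeminorm (m, φ) =
    (∑ z ∈ m.support, |m z|) + circInt fun ζ => |(φ.1 ζ).re| := rfl

/-- The Herglotz kernel `(ζ + z) / (ζ - z)` on the circle. -/
noncomputable def herglotzKer (z : ℂ) : circCont :=
  (2 : ℂ) • cauchyKer z - ⟨fun _ => 1, continuousOn_const⟩

lemma herglotzKer_apply {z ζ : ℂ} (hz : z ∈ ball (0 : ℂ) 1) (hζ : ζ ∈ sphere (0 : ℂ) 1) :
    (herglotzKer z).1 ζ = (ζ + z) / (ζ - z) := by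
  have := sub_ne_zero_of_sphere_ball hζ hz
  have e : (herglotzKer z).1 ζ = 2 * (cauchyKer z).1 ζ - 1 := by simp [herglotzKer]
  rw [e, cauchyKer_apply hz]
  field_simp
  ring

lemma circInt_abs_re_herglotzKer {z : ℂ} (hz : z ∈ ball (0 : ℂ) 1) :
    (circInt fun ζ => |((herglotzKer z).1 ζ).re|) = 2 * π := by
  rw [← circInt_poisson hz]
  refine circInt_congr fun ζ hζ => ?_
  rw [herglotzKer_apply hz hζ]
  have h1 := sub_ne_zero_of_sphere_ball hζ hz
  have hζ' := mem_sphere_zero_iff_norm.1 hζ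
  have e : ((ζ + z) / (ζ - z)).re = (1 - ‖z‖ ^ 2) / ‖1 - conj z * ζ‖ ^ 2 := by
    have h2 : ‖1 - conj z * ζ‖ = ‖ζ - z‖ := by
      have := mul_conj_of_mem_sphere hζ
      rw [← norm_conj (ζ - z), show 1 - conj z * ζ = ζ * conj (ζ - z) by
        rw [map_sub, mul_sub, this]; ring, norm_mul, hζ', one_mul]
    rw [h2, div_re, ← normSq_eq_norm_sq, ← normSq_eq_norm_sq, ← add_div]
    congr 1
    have h3 : normSq ζ = 1 := by rw [normSq_eq_norm_sq, hζ', one_pow]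
    rw [normSq_apply] at h3 ⊢
    simp only [add_re, sub_re, add_im, sub_im]
    linear_combination h3
  rw [e, abs_of_nonneg]
  have := one_sub_normSq_pos hz
  positivity

namespace IsWolffForm

/-- Inside the cell, a Wolff form is the differential of the conjugate of a bounded harmonic function
up to a bounded function. -/
theorem exists_primitive (ι : Type*) [Fintype ι] (M C₀ C₁ : ℝ) (hM : 0 ≤ M) (hC₀ : 0 ≤ C₀)
    (hC₁ : 0 ≤ C₁) : ∃ C, 0 ≤ C ∧ ∀ (κ : Type) [Finite κ] (F T a b : ι → ℂ → ℂ) (h : κ → ℂ → ℂ),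
      IsWolffForm (ball 0 1) M C₀ C₁ F T a b h → ∃ (W : ℂ → ℂ) (y : ℂ → ℝ),
      DifferentiableOn ℂ W (ball 0 1) ∧ (∀ z ∈ ball (0 : ℂ) 1, |(W z).re| ≤ C) ∧ (∀ z, |y z| ≤ C) ∧
      ∀ p ∈ ball (0 : ℂ) 1, ∀ q ∈ ball (0 : ℂ) 1, (∀ z ∈ segment ℝ p q, ∀ i, ‖h i z‖ < 1) →
        (segInt (formCoeff F T) p q).re = (W q).im - (W p).im + (y q - y p) := by
  obtain ⟨C, hC0, hC⟩ := chain_estimate_ball ι M C₀ C₁ hM hC₀ hC₁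
  refine ⟨C * (2 * π), by positivity, fun κ _ F T a b h H => ?_⟩
  let S : Set (ℂ × ℂ) := {e | (e.1 ∈ ball (0 : ℂ) 1 ∧ e.2 ∈ ball (0 : ℂ) 1) ∧
    ∀ z ∈ segment ℝ e.1 e.2, ∀ i, ‖h i z‖ < 1}
  let L : ((ℂ × ℂ) →₀ ℝ) →ₗ[ℝ] (ℂ →₀ ℝ) × circCont := Finsupp.linearCombination ℝ fun e =>
    (Finsupp.single e.2 1 - Finsupp.single e.1 1, -(I • (herglotzKer e.2 - herglotzKer e.1)))
  let A : ((ℂ × ℂ) →₀ ℝ) →ₗ[ℝ] ℝ := Finsupp.linearCombination ℝ fun e =>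
    (segInt (formCoeff F T) e.1 e.2).re
  have hL : ∀ v : (ℂ × ℂ) →₀ ℝ, L v = (chainBdry v.support v,
      ∑ e ∈ v.support, v e • -(I • (herglotzKer e.2 - herglotzKer e.1))) := fun v => by
    simp only [L, Finsupp.linearCombination_apply, Finsupp.sum, chainBdry, Prod.smul_mk]
    ext1 <;> simp [Prod.fst_sum, Prod.snd_sum]
  obtain ⟨Λ, hΛ1, hΛ2⟩ := exists_dual_of_abs_le (V := Finsupp.supported ℝ ℝ S) (L ∘ₗ (Finsupp.supported ℝ ℝ S).subtype)
    (A ∘ₗ (Finsupp.supported ℝ ℝ S).subtype) (C.toNNReal • chainSeminorm) (by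
      rintro ⟨v, hv⟩
      have hv' : ∀ e ∈ v.support, e ∈ S := fun e he => hv he
      have h1 := hC κ F T a b h H v.support v (fun e he => (hv' e he).1) fun e he => (hv' e he).2
      simp only [LinearMap.comp_apply, Submodule.subtype_apply, Seminorm.smul_apply, hL,
        chainSeminorm_apply, NNReal.smul_def, Real.coe_toNNReal C hC0, smul_eq_mul]
      simp only [A, Finsupp.linearCombination_apply, Finsupp.sum, smul_eq_mul]
      convert h1 using 3
      refine circInt_congr fun ζ hζ => congrArg _ ?_
      have h2 := chainBdry_sum v.support v fun z => conjPoisson z ζ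
      simp only [smul_eq_mul] at h2
      rw [h2]
      simp only [AddSubmonoidClass.coe_finsetSum, Finset.sum_apply, re_sum]
      refine Finset.sum_congr rfl fun e he => ?_
      have hb := (hv' e he).1
      have e1 := herglotzKer_apply hb.1 hζ
      have e2 := herglotzKer_apply hb.2 hζ
      simp [conjPoisson, ← e1, ← e2]
      ring)
  have hΛ3 : ∀ m φ, |Λ (m, φ)| ≤ C * (∑ z ∈ m.support, |m z| + circInt fun ζ => |(φ.1 ζ).re|) :=
    fun m φ => by simpa [NNReal.smul_def, hC0, chainSeminorm_apply, mul_add] using hΛ2 (m, φ)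
  let Λ₂ : Module.Dual ℝ circCont := Λ ∘ₗ LinearMap.inr ℝ (ℂ →₀ ℝ) circCont
  have hΛ₂ : ∀ φ, |Λ₂ φ| ≤ C * circInt fun ζ => |(φ.1 ζ).re| := fun φ => by
    simpa [Λ₂] using hΛ3 0 φ
  have hΛ₂' : ∀ (φ : circCont) (N : ℝ), (∀ z ∈ sphere (0 : ℂ) 1, ‖φ.1 z‖ ≤ N) →
      |Λ₂ φ| ≤ C * (2 * π * N) := fun φ N hN => by
    refine (hΛ₂ φ).trans ?_
    gcongr
    rw [← circInt_const]
    exact circInt_mono (continuous_re.comp_continuousOn φ.2).abs continuousOn_const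
      fun z hz => (abs_re_le_norm _).trans (hN z hz)
  let ℓ : circCont →ₗ[ℂ] ℂ := Λ₂.extendRCLike
  have hℓ : ∀ φ, ℓ φ = (Λ₂ φ : ℂ) - I * (Λ₂ (I • φ) : ℂ) := fun φ => Λ₂.extendRCLike_apply φ
  refine ⟨fun z => ℓ (herglotzKer z), fun z => Λ (Finsupp.single z 1, 0), ?_, fun z hz => ?_,
    fun z => ?_, fun p hp q hq hpq => ?_⟩
  · have := differentiableOn_cauchyKer ℓ (C * (2 * π) + C * (2 * π)) fun φ N hN => by
      rw [hℓ, add_mul]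
      refine (norm_sub_le _ _).trans (add_le_add ?_ ?_)
      · rw [norm_real, Real.norm_eq_abs, mul_assoc]
        exact hΛ₂' φ N hN
      · rw [norm_mul, norm_I, one_mul, norm_real, Real.norm_eq_abs, mul_assoc]
        exact hΛ₂' (I • φ) N fun z hz => by simpa using hN z hz
    simp only [herglotzKer, map_sub, map_smul, smul_eq_mul]
    exact (this.const_mul 2).sub (differentiableOn_const _)
  · have : (ℓ (herglotzKer z)).re = Λ₂ (herglotzKer z) := by rw [hℓ]; simp
    rw [this, ← circInt_abs_re_herglotzKer hz]
    exact hΛ₂ _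
  · refine (hΛ3 _ _).trans ?_
    have : ∑ w ∈ (Finsupp.single z (1 : ℝ)).support, |Finsupp.single z (1 : ℝ) w| = 1 := by
      rw [Finsupp.support_single_ne_zero _ one_ne_zero]
      simp
    rw [this]
    have h0 : (circInt fun ζ => |((0 : circCont).1 ζ).re|) = 0 := by simp [circInt]
    rw [h0]
    gcongr
    linarith [Real.pi_gt_three]
  · have hv : Finsupp.single (p, q) (1 : ℝ) ∈ Finsupp.supported ℝ ℝ S :=
      Finsupp.single_mem_supported ℝ 1 ⟨⟨hp, hq⟩, hpq⟩
    have h1 := hΛ1 ⟨_, hv⟩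
    simp only [LinearMap.comp_apply, Submodule.subtype_apply, A, L,
      Finsupp.linearCombination_single, one_smul] at h1
    rw [← h1]
    have h2 : ∀ φ, (ℓ φ).im = -Λ₂ (I • φ) := fun φ => by rw [hℓ]; simp
    rw [← sub_im, ← map_sub, h2]
    have h3 : ((Finsupp.single q 1 - Finsupp.single p 1, -(I • (herglotzKer q - herglotzKer p))) :
        (ℂ →₀ ℝ) × circCont) = (Finsupp.single q 1, 0) - (Finsupp.single p 1, 0) -
        LinearMap.inr ℝ (ℂ →₀ ℝ) circCont (I • (herglotzKer q - herglotzKer p)) := by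
      ext1 <;> simp
    rw [h3, map_sub, map_sub]
    simp only [Λ₂, LinearMap.comp_apply]
    ring

end IsWolffForm

section
variable {ι κ : Type*} [Fintype ι] [Fintype κ] [DecidableEq κ]

/-- The sesquilinear expression `∑ A j k * w j * conj (w k)`. -/
noncomputable def hermForm (A : ι → ι → ℂ) (w : ι → ℂ) : ℂ := ∑ j, ∑ k, A j k * w j * conj (w k)

/-- The conjugate coefficients of the form `d arg (hermForm A w)`, cut off outside a polydisc. -/
noncomputable def phaseCoeff (e : κ → ι) (A : ι → ι → ℂ) (l : ι) (w : ι → ℂ) : ℂ :=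
  polyCut (fun i => w (e i)) * (I * ((∑ k, conj (A l k) * w k) / conj (hermForm A w) -
    (∑ j, A j l * w j) / hermForm A w))

lemma hasWirt_hermForm {A : ι → ι → ℂ} {F : ι → ℂ → ℂ} {F' : ι → ℂ} {z : ℂ}
    (hF : ∀ j, HasDerivAt (F j) (F' j) z) :
    HasWirt (fun x => hermForm A fun j => F j x) (∑ j, ∑ k, A j k * F' j * conj (F k z))
      (∑ j, ∑ k, A j k * F j z * conj (F' k)) z := by
  refine HasWirt.sum (s := Finset.univ) fun j _ => HasWirt.sum (s := Finset.univ) fun k _ => ?_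
  refine (((HasWirt.of_hasDerivAt (hF j)).const_mul (A j k)).mul
    (HasWirt.of_hasDerivAt (hF k)).star).congr_coeff ?_ ?_ <;> simp

lemma contDiff_hermForm (A : ι → ι → ℂ) : ContDiff ℝ 1 (hermForm A) := by
  have h : ContDiff ℝ 1 (conj : ℂ → ℂ) := (conjCLE : ℂ →L[ℝ] ℂ).contDiff
  unfold hermForm
  exact ContDiff.sum fun j _ => ContDiff.sum fun k _ =>
    (contDiff_const.mul (contDiff_apply ℝ ℂ j)).mul (h.comp (contDiff_apply ℝ ℂ k))

lemma contDiffOn_phaseCoeff (e : κ → ι) (A : ι → ι → ℂ) (l : ι) : ContDiffOn ℝ 1 (phaseCoeff e A l)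
    ({w | hermForm A w ≠ 0} ∪ ⋃ i, {w | 7 < ‖w (e i)‖}) := by
  have hc : ContDiff ℝ 1 (conj : ℂ → ℂ) := (conjCLE : ℂ →L[ℝ] ℂ).contDiff
  have hA := contDiff_hermForm A
  rintro w (hw | hw)
  · have hw' : conj (hermForm A w) ≠ 0 := (map_ne_zero _).2 hw
    have h1 : ContDiffAt ℝ 1 (fun w : ι → ℂ => polyCut fun i => w (e i)) w :=
      ((contDiff_polyCut (n := 1)).comp
        (contDiff_pi.2 fun i => contDiff_apply ℝ ℂ (e i))).contDiffAt
    have h2 : ContDiffAt ℝ 1 (fun w : ι → ℂ => ∑ k, conj (A l k) * w k) w :=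
      (ContDiff.sum fun k _ => contDiff_const.mul (contDiff_apply ℝ ℂ k)).contDiffAt
    have h3 : ContDiffAt ℝ 1 (fun w : ι → ℂ => ∑ j, A j l * w j) w :=
      (ContDiff.sum fun k _ => contDiff_const.mul (contDiff_apply ℝ ℂ k)).contDiffAt
    change ContDiffWithinAt ℝ 1 (fun w => phaseCoeff e A l w) _ w
    simp only [phaseCoeff, div_eq_mul_inv]
    exact (h1.mul (contDiffAt_const.mul ((h2.mul ((hc.comp hA).contDiffAt.inv hw')).sub
      (h3.mul (hA.contDiffAt.inv hw))))).contDiffWithinAt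
  · obtain ⟨i, hi⟩ := mem_iUnion.1 hw
    refine ((contDiffAt_const (c := (0 : ℂ))).congr_of_eventuallyEq ?_).contDiffWithinAt
    filter_upwards [(isOpen_lt continuous_const (by fun_prop)).mem_nhds hi] with v hv
    rw [phaseCoeff, polyCut_eq_zero (j := i) (le_of_lt hv), zero_mul]

omit [DecidableEq κ] in
lemma isOpen_phaseDomain (e : κ → ι) (A : ι → ι → ℂ) :
    IsOpen ({w | hermForm A w ≠ 0} ∪ ⋃ i, {w | 7 < ‖w (e i)‖}) :=
  (isOpen_ne_fun (contDiff_hermForm A).continuous continuous_const).union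
    (isOpen_iUnion fun i => isOpen_lt continuous_const (by fun_prop))

section
variable {e : κ → ι} {A : ι → ι → ℂ} {F : ι → ℂ → ℂ} {z : ℂ}

lemma formCoeff_phaseCoeff (h : ∀ i, ‖F (e i) z‖ ≤ 5) :
    formCoeff F (fun l x => phaseCoeff e A l fun j => F j x) z =
      -I * ((∑ j, ∑ k, A j k * deriv (F j) z * conj (F k z)) / hermForm A (fun j => F j z) -
        conj (∑ j, ∑ k, A j k * F j z * conj (deriv (F k) z)) / conj (hermForm A fun j => F j z)) := by
  have e1 : ∀ l, conj (phaseCoeff e A l fun j => F j z) = -I *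
      ((∑ k, A l k * conj (F k z)) / hermForm A (fun j => F j z) -
        (∑ j, conj (A j l * F j z)) / conj (hermForm A fun j => F j z)) := fun l => by
    rw [phaseCoeff, polyCut_eq_one h]
    simp [map_sum]
  rw [Finset.sum_comm (f := fun j k => A j k * F j z * conj (deriv (F k) z))]
  simp only [formCoeff, e1, map_sum, mul_sub, sub_mul, Finset.sum_sub_distrib, Finset.sum_div,
    Finset.mul_sum, Finset.sum_mul]
  congr 1 <;> refine Finset.sum_congr rfl fun j _ => Finset.sum_congr rfl fun k _ => ?_
  · ring
  · simp only [map_mul, conj_conj]; ring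

lemma im_formCoeff_phaseCoeff_bar {U : Set ℂ} (hU : IsOpen U) (hz : z ∈ U)
    (hF : ∀ j, DifferentiableOn ℂ (F j) U) (h : ∀ x ∈ U, ∀ i, ‖F (e i) x‖ ≤ 5)
    (hq : hermForm A (fun j => F j z) ≠ 0) {a b : ℂ}
    (hw : HasWirt (formCoeff F fun l x => phaseCoeff e A l fun j => F j x) a b z) : b.im = 0 := by
  have d1 : ∀ j, HasDerivAt (F j) (deriv (F j) z) z := fun j =>
    ((hF j).differentiableAt (hU.mem_nhds hz)).hasDerivAt
  have d2 : ∀ j, HasDerivAt (deriv (F j)) (deriv (deriv (F j)) z) z := fun j =>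
    (((hF j).deriv hU).differentiableAt (hU.mem_nhds hz)).hasDerivAt
  have hq' : conj (hermForm A fun j => F j z) ≠ 0 := (map_ne_zero _).2 hq
  have wp := HasWirt.sum (s := Finset.univ) fun j _ => HasWirt.sum (s := Finset.univ) fun k _ =>
    ((HasWirt.of_hasDerivAt (d2 j)).const_mul (A j k)).mul (HasWirt.of_hasDerivAt (d1 k)).star
  have ws := (HasWirt.sum (s := Finset.univ) fun j _ => HasWirt.sum (s := Finset.univ) fun k _ =>
    ((HasWirt.of_hasDerivAt (d1 j)).const_mul (A j k)).mul (HasWirt.of_hasDerivAt (d2 k)).star).star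
  have wq := hasWirt_hermForm (A := A) d1
  have wg := ((wp.mul (wq.inv hq)).sub (ws.mul (wq.star.inv hq'))).const_mul (-I)
  have e1 := (hw.unique (wg.congr_of_eventuallyEq (Filter.mem_of_superset (hU.mem_nhds hz)
    fun x hx => by rw [mem_setOf_eq, formCoeff_phaseCoeff (h x hx)]; simp only [div_eq_mul_inv]))).2
  rw [e1]
  simp only [map_sum, map_mul, map_zero, mul_zero, zero_mul, add_zero, zero_add, conj_conj]
  generalize hermForm A (fun j => F j z) = q at *
  set L := ∑ j, ∑ k, A j k * deriv (F j) z * conj (deriv (F k) z) with hL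
  set p := ∑ j, ∑ k, A j k * deriv (F j) z * conj (F k z) with hp
  set s := ∑ j, ∑ k, A j k * F j z * conj (deriv (F k) z) with hs
  have c1 : ∑ j, ∑ k, conj (A j k) * conj (deriv (F j) z) * deriv (F k) z = conj L := by
    simp [hL, map_sum]
  have c2 : ∑ j, ∑ k, conj (A j k) * conj (F j z) * deriv (F k) z = conj s := by
    simp [hs, map_sum]
  have c3 : ∑ j, ∑ k, conj (A j k) * conj (deriv (F j) z) * F k z = conj p := by
    simp [hp, map_sum]
  rw [c1, c2, c3]
  rw [show -I * (L * q⁻¹ + p * (-s / q ^ 2) - (conj L * (conj q)⁻¹ + conj s * (-conj p / conj q ^ 2))) =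
    -I * ((L * q⁻¹ + p * (-s / q ^ 2)) - conj (L * q⁻¹ + p * (-s / q ^ 2))) by
      simp only [map_add, map_mul, map_inv₀, map_div₀, map_neg, map_pow]; ring, sub_conj]
  simp [mul_im]
end
end

section
variable {ι κ : Type*} [Fintype ι] [Fintype κ] [DecidableEq κ]

lemma isWolffForm_phaseCoeff (e : κ → ι) (A : ι → ι → ℂ) (M : ℝ) {δ : ℝ} (hδ : 0 < δ) :
    ∃ C₀ C₁ : ℝ, 0 ≤ C₀ ∧ 0 ≤ C₁ ∧ ∀ F : ι → ℂ → ℂ, (∀ j, DifferentiableOn ℂ (F j) (ball 0 1)) →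
      (∀ j, ∀ z ∈ ball (0 : ℂ) 1, ‖F j z‖ ≤ M) →
      (∀ z ∈ ball (0 : ℂ) 1, (∀ i, ‖F (e i) z‖ < 8) → δ ≤ ‖hermForm A fun j => F j z‖) →
      ∃ a b, IsWolffForm (ball 0 1) M C₀ C₁ F (fun l x => phaseCoeff e A l fun j => F j x) a b
        fun i => F (e i) := by
  classical
  set V := {w | hermForm A w ≠ 0} ∪ ⋃ i, {w : ι → ℂ | 7 < ‖w (e i)‖} with hV
  have hVo : IsOpen V := isOpen_phaseDomain e A
  have hcA := (contDiff_hermForm A).continuous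
  set K := closedBall (0 : ι → ℂ) |M| ∩ ({w | δ ≤ ‖hermForm A w‖} ∪ ⋃ i, {w | 8 ≤ ‖w (e i)‖}) with hK
  have hKc : IsCompact K := (isCompact_closedBall _ _).inter_right
    ((isClosed_le continuous_const hcA.norm).union
      (isClosed_iUnion_of_finite fun i => isClosed_le continuous_const (by fun_prop)))
  have hKV : K ⊆ V := by
    rintro w ⟨-, hw | hw⟩
    · exact Or.inl (norm_pos_iff.1 (hδ.trans_le hw))
    · obtain ⟨i, hi⟩ := mem_iUnion.1 hw
      exact Or.inr (mem_iUnion.2 ⟨i, lt_of_lt_of_le (by norm_num : (7 : ℝ) < 8) hi⟩)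
  have hG := contDiffOn_phaseCoeff e A
  choose C₀ hC₀ using fun l => hKc.exists_bound_of_continuousOn ((hG l).continuousOn.mono hKV)
  choose B hB using fun l j =>
    hKc.exists_bound_of_continuousOn ((continuousOn_pdHol hVo (hG l) j).mono hKV)
  refine ⟨∑ l, |C₀ l|, Fintype.card ι * ∑ l, ∑ j, B l j ^ 2, by positivity, by positivity,
    fun F hF hM hq => ?_⟩
  have hFK : ∀ z ∈ ball (0 : ℂ) 1, (fun j => F j z) ∈ K := fun z hz => by
    refine ⟨mem_closedBall_zero_iff.2 ((pi_norm_le_iff_of_nonneg (abs_nonneg M)).2 fun j =>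
      (hM j z hz).trans (le_abs_self M)), ?_⟩
    by_cases h : ∀ i, ‖F (e i) z‖ < 8
    · exact Or.inl (hq z hz h)
    · push Not at h
      exact Or.inr (mem_iUnion.2 h)
  have hFc : ContinuousOn (fun z j => F j z) (ball 0 1) :=
    continuousOn_pi.2 fun j => (hF j).continuousOn
  have hFV : MapsTo (fun z j => F j z) (ball 0 1) V := fun z hz => hKV (hFK z hz)
  have hFd : ∀ j, ∀ z ∈ ball (0 : ℂ) 1, HasDerivAt (F j) (deriv (F j) z) z := fun j z hz =>
    ((hF j).differentiableAt (isOpen_ball.mem_nhds hz)).hasDerivAt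
  have hFd' : ∀ j, ContinuousOn (deriv (F j)) (ball 0 1) := fun j =>
    ((hF j).deriv isOpen_ball).continuousOn
  have hw : ∀ l, ∀ z ∈ ball (0 : ℂ) 1, HasWirt (fun x => phaseCoeff e A l fun j => F j x)
      (∑ j, pdHol (phaseCoeff e A l) j (fun j => F j z) * deriv (F j) z)
      (∑ j, pdBar (phaseCoeff e A l) j (fun j => F j z) * conj (deriv (F j) z)) z := fun l z hz =>
    HasWirt.comp_pi (((hG l).contDiffAt (hVo.mem_nhds (hFV hz))).differentiableAt one_ne_zero)
      fun j => hFd j z hz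
  refine ⟨_, _, fun j => (hF j).analyticOnNhd isOpen_ball, hM, hw, fun l => ?_, fun l => ?_,
    fun l z hz => ?_, fun l z hz => ?_, fun i => (hF _).analyticOnNhd isOpen_ball,
    fun i => hM (e i), fun z hz hz4 => ?_⟩
  · exact continuousOn_finsetSum _ fun j _ =>
      ((continuousOn_pdHol hVo (hG l) j).comp hFc hFV).mul (hFd' j)
  · exact continuousOn_finsetSum _ fun j _ => ((continuousOn_pdBar hVo (hG l) j).comp hFc hFV).mul
      (continuous_conj.comp_continuousOn (hFd' j))
  · exact ((hC₀ l _ (hFK z hz)).trans (le_abs_self _)).trans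
      (Finset.single_le_sum (f := fun l => |C₀ l|) (fun l _ => abs_nonneg _) (Finset.mem_univ l))
  · calc ‖∑ j, pdHol (phaseCoeff e A l) j (fun j => F j z) * deriv (F j) z‖ ^ 2
        ≤ (∑ j, B l j * ‖deriv (F j) z‖) ^ 2 := by
          gcongr
          refine (norm_sum_le _ _).trans (Finset.sum_le_sum fun j _ => ?_)
          rw [norm_mul]
          gcongr
          exact hB l j _ (hFK z hz)
      _ ≤ (∑ j, B l j ^ 2) * ∑ j, ‖deriv (F j) z‖ ^ 2 := Finset.sum_mul_sq_le_sq_mul_sq _ _ _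
      _ ≤ _ := by
          gcongr
          have h1 : ∑ j, B l j ^ 2 ≤ ∑ l, ∑ j, B l j ^ 2 :=
            Finset.single_le_sum (f := fun l => ∑ j, B l j ^ 2) (fun l _ => by positivity)
              (Finset.mem_univ l)
          have h2 : (1 : ℝ) ≤ Fintype.card ι := by exact_mod_cast Fintype.card_pos_iff.2 ⟨l⟩
          have h3 : 0 ≤ ∑ l, ∑ j, B l j ^ 2 := by positivity
          nlinarith
  · set U := ball (0 : ℂ) 1 ∩ ⋂ i, (F (e i)) ⁻¹' ball 0 4 with hU
    have hUe : U = ball (0 : ℂ) 1 ∩ (fun z j => F j z) ⁻¹' ⋂ i, {w : ι → ℂ | ‖w (e i)‖ < 4} := by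
      ext x; simp [hU]
    have hUo : IsOpen U := by
      rw [hUe]
      exact hFc.isOpen_inter_preimage isOpen_ball
        (isOpen_iInter_of_finite fun i => isOpen_lt (by fun_prop) continuous_const)
    have hU4 : ∀ x ∈ U, ∀ i, ‖F (e i) x‖ < 4 := fun x hx i => by
      simpa using mem_iInter.1 hx.2 i
    have hzU : z ∈ U := ⟨hz, mem_iInter.2 fun i => by simpa using hz4 i⟩
    refine im_formCoeff_phaseCoeff_bar (e := e) (A := A) hUo hzU
      (fun j => (hF j).mono inter_subset_left) (fun x hx i => by linarith [hU4 x hx i])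
      (norm_pos_iff.1 (hδ.trans_le (hq z hz fun i => by linarith [hz4 i])))
      (((HasWirt.sum (s := Finset.univ) fun l _ => (hw l z hz).star.mul (HasWirt.of_hasDerivAt
        (((hF l).deriv isOpen_ball).differentiableAt (isOpen_ball.mem_nhds hz)).hasDerivAt))).congr_coeff
          rfl ?_)
    simp

/-- Along a curve on which `q` does not vanish, `q` is transported by the integral of its
logarithmic derivative. -/
lemma eq_mul_exp_integral {φ φ' : ℝ → ℂ} (h : ∀ t ∈ Icc (0 : ℝ) 1, HasDerivAt φ (φ' t) t)
    (hc : ContinuousOn φ' (Icc 0 1)) (h0 : ∀ t ∈ Icc (0 : ℝ) 1, φ t ≠ 0) :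
    φ 1 = φ 0 * exp (∫ t in (0 : ℝ)..1, φ' t / φ t) := by
  have hψ : ContinuousOn (fun t => φ' t / φ t) (Icc 0 1) :=
    hc.div (fun t ht => (h t ht).continuousAt.continuousWithinAt) h0
  have hi : IntervalIntegrable (fun t => φ' t / φ t) volume 0 1 :=
    hψ.intervalIntegrable_of_Icc zero_le_one
  set Ψ : ℝ → ℂ := fun s => ∫ t in (0 : ℝ)..s, φ' t / φ t with hΨ
  have hΨc : ContinuousOn Ψ (Icc 0 1) := by
    have := intervalIntegral.continuousOn_primitive_interval (a := 0) (b := 1)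
      ((intervalIntegrable_iff_integrableOn_Icc_of_le zero_le_one).1 hi |>.mono_set (by simp))
    simpa [uIcc_of_le] using this
  have hΨd : ∀ t ∈ Ioo (0 : ℝ) 1, HasDerivAt Ψ (φ' t / φ t) t := fun t ht => by
    refine intervalIntegral.integral_hasDerivAt_right
      (hi.mono_set (uIcc_subset_uIcc_left (by simp [uIcc_of_le, ht.1.le, ht.2.le])))
      ?_ (hψ.continuousAt (Icc_mem_nhds ht.1 ht.2))
    exact (hψ.mono Ioo_subset_Icc_self).stronglyMeasurableAtFilter isOpen_Ioo t ht
  have h1 := intervalIntegral.integral_eq_sub_of_hasDerivAt_of_le zero_le_one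
    (f := fun t => φ t * exp (-Ψ t)) (f' := fun _ => 0)
    (ContinuousOn.mul (fun t ht => (h t ht).continuousAt.continuousWithinAt) hΨc.neg.cexp)
    (fun t ht => by
      have ht' := Ioo_subset_Icc_self ht
      refine ((h t ht').mul (hΨd t ht).neg.cexp).congr_deriv ?_
      have := h0 t ht'
      field_simp
      simp) (by simp)
  have h2 : Ψ 0 = 0 := by simp [hΨ]
  simp only [intervalIntegral.integral_zero, h2, neg_zero, exp_zero, mul_one, exp_neg] at h1
  rw [← sub_eq_zero.1 h1.symm, mul_assoc, inv_mul_cancel₀ (exp_ne_zero _), mul_one]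
end

section
variable {ι : Type*} {κ : Type} [Fintype ι] [Fintype κ]

/-- The form of `phaseCoeff` integrates to the variation of the argument. -/
lemma eq_mul_exp_of_segment [DecidableEq κ] {e : κ → ι} {A : ι → ι → ℂ} {F : ι → ℂ → ℂ}
    (hF : ∀ j, DifferentiableOn ℂ (F j) (ball 0 1)) {p q : ℂ} (hs : segment ℝ p q ⊆ ball 0 1)
    (h5 : ∀ z ∈ segment ℝ p q, ∀ i, ‖F (e i) z‖ ≤ 5)
    (h0 : ∀ z ∈ segment ℝ p q, hermForm A (fun j => F j z) ≠ 0)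
    (hg : ContinuousOn (formCoeff F fun l x => phaseCoeff e A l fun j => F j x) (ball 0 1)) :
    ∃ J : ℂ, hermForm A (fun j => F j q) = hermForm A (fun j => F j p) * exp J ∧
      J.im = (segInt (formCoeff F fun l x => phaseCoeff e A l fun j => F j x) p q).re := by
  have hmem : ∀ t ∈ Icc (0 : ℝ) 1, segPt p q t ∈ segment ℝ p q := fun t => segPt_mem_segment p q
  have hcs : ContinuousOn (segPt p q) (Icc 0 1) := (continuous_segPt p q).continuousOn
  have hmb : MapsTo (segPt p q) (Icc 0 1) (ball (0 : ℂ) 1) := fun t ht => hs (hmem t ht)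
  have hFd : ∀ j, ∀ z ∈ ball (0 : ℂ) 1, HasDerivAt (F j) (deriv (F j) z) z := fun j z hz =>
    ((hF j).differentiableAt (isOpen_ball.mem_nhds hz)).hasDerivAt
  have c0 : ∀ j, ContinuousOn (fun t => F j (segPt p q t)) (Icc 0 1) := fun j =>
    (hF j).continuousOn.comp hcs hmb
  have c1 : ∀ j, ContinuousOn (fun t => deriv (F j) (segPt p q t)) (Icc 0 1) := fun j =>
    ((hF j).deriv isOpen_ball).continuousOn.comp hcs hmb
  have hd : ∀ t ∈ Icc (0 : ℝ) 1, HasDerivAt (fun t => hermForm A fun j => F j (segPt p q t))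
      ((∑ j, ∑ k, A j k * deriv (F j) (segPt p q t) * conj (F k (segPt p q t))) * (q - p) +
        (∑ j, ∑ k, A j k * F j (segPt p q t) * conj (deriv (F k) (segPt p q t))) * conj (q - p)) t :=
    fun t ht => (hasWirt_hermForm fun j => hFd j _ (hmb ht)).comp_curve 
      ((hasDerivAt_ofReal_mul_const (q - p) t).const_add p)
  have c2 : ContinuousOn (fun t =>
      (∑ j, ∑ k, A j k * deriv (F j) (segPt p q t) * conj (F k (segPt p q t))) * (q - p) +
        (∑ j, ∑ k, A j k * F j (segPt p q t) * conj (deriv (F k) (segPt p q t))) * conj (q - p))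
      (Icc 0 1) := by
    refine ContinuousOn.add (ContinuousOn.mul ?_ continuousOn_const)
      (ContinuousOn.mul ?_ continuousOn_const) <;>
    refine continuousOn_finsetSum _ fun j _ => continuousOn_finsetSum _ fun k _ => ?_
    · exact (continuousOn_const.mul (c1 j)).mul (continuous_conj.comp_continuousOn (c0 k))
    · exact (continuousOn_const.mul (c0 j)).mul (continuous_conj.comp_continuousOn (c1 k))
  have h0' : ∀ t ∈ Icc (0 : ℝ) 1, hermForm A (fun j => F j (segPt p q t)) ≠ 0 := fun t ht =>
    h0 _ (hmem t ht)
  have key := eq_mul_exp_integral hd c2 h0'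
  have i1 := (c2.div (fun t ht => (hd t ht).continuousAt.continuousWithinAt)
    h0').intervalIntegrable_of_Icc (μ := volume) zero_le_one
  have c3 := (hg.comp hcs hmb).mul (continuousOn_const (c := q - p))
  have i3 := c3.intervalIntegrable_of_Icc (μ := volume) zero_le_one
  have hs1 : segPt p q 1 = q := by simp [segPt]
  have hs0 : segPt p q 0 = p := by simp [segPt]
  rw [hs1, hs0] at key
  refine ⟨_, key, ?_⟩
  have e1 := imCLM.intervalIntegral_comp_comm i1
  have e2 := reCLM.intervalIntegral_comp_comm i3
  refine e1.symm.trans (Eq.trans ?_ e2)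
  refine intervalIntegral.integral_congr fun t ht => ?_
  rw [uIcc_of_le zero_le_one] at ht
  simp only [imCLM_apply, reCLM_apply, Pi.div_apply, Pi.mul_apply, Function.comp_apply]
  rw [formCoeff_phaseCoeff (h5 _ (hmem t ht))]
  generalize hermForm A (fun j => F j (segPt p q t)) = Q
  generalize ∑ j, ∑ k, A j k * deriv (F j) (segPt p q t) * conj (F k (segPt p q t)) = a
  generalize ∑ j, ∑ k, A j k * F j (segPt p q t) * conj (deriv (F k) (segPt p q t)) = b
  rw [← map_div₀, add_div, mul_div_right_comm, mul_div_right_comm]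
  generalize a / Q = a
  generalize b / Q = b
  simp only [add_im, mul_im, mul_re, sub_re, sub_im, neg_re, neg_im, I_re, I_im, conj_re, conj_im]
  ring

/-- The phase of a nonvanishing sesquilinear expression in bounded holomorphic functions is, on a
cell, the sum of the conjugate of a bounded harmonic function and of a bounded continuous function. -/
theorem exists_phase (e : κ → ι) (A : ι → ι → ℂ) {M : ℝ} (hM : 0 ≤ M) {δ : ℝ} (hδ : 0 < δ) :
    ∃ C, 0 ≤ C ∧ ∀ F : ι → ℂ → ℂ, (∀ j, DifferentiableOn ℂ (F j) (ball 0 1)) →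
      (∀ j, ∀ z ∈ ball (0 : ℂ) 1, ‖F j z‖ ≤ M) →
      (∀ z ∈ ball (0 : ℂ) 1, (∀ i, ‖F (e i) z‖ < 8) → δ ≤ ‖hermForm A fun j => F j z‖) →
      ∃ (W : ℂ → ℂ) (u : ℂ → ℝ), DifferentiableOn ℂ W (ball 0 1) ∧
        (∀ z ∈ ball (0 : ℂ) 1, |(W z).re| ≤ C) ∧ (∀ z, |u z| ≤ C) ∧
        ContinuousOn u (ball 0 1 ∩ {z | ∀ i, ‖F (e i) z‖ < 1}) ∧
        ∀ z, hermForm A (fun j => F j z) =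
          ‖hermForm A fun j => F j z‖ * exp (((W z).im + u z : ℝ) * I) := by
  classical
  obtain ⟨C₀, C₁, hC₀, hC₁, hC⟩ := isWolffForm_phaseCoeff e A M hδ
  obtain ⟨C, hC0, hW⟩ := IsWolffForm.exists_primitive ι M C₀ C₁ hM hC₀ hC₁
  refine ⟨C + π, by positivity, fun F hF hFM hq => ?_⟩
  obtain ⟨a, b, H⟩ := hC F hF hFM hq
  obtain ⟨W, y, hWd, hWC, hy, hseg⟩ := hW κ F _ a b _ H
  set Q : ℂ → ℂ := fun z => hermForm A fun j => F j z with hQ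
  set v : ℂ → ℂ := fun z => exp (-((W z).im + y z : ℝ) * I) * Q z with hv
  refine ⟨W, fun z => y z + arg (v z), hWd, fun z hz => (hWC z hz).trans (by linarith [Real.pi_pos]),
    fun z => (abs_add_le _ _).trans (add_le_add (hy z) (abs_arg_le_pi _)), ?_, fun z => ?_⟩
  · rintro p ⟨hp, hpU⟩
    set G := formCoeff F fun l x => phaseCoeff e A l fun j => F j x with hG
    have hUo : ∀ᶠ z in 𝓝 p, z ∈ ball (0 : ℂ) 1 ∧ ∀ i, ‖F (e i) z‖ < 1 :=
      Filter.Eventually.and (isOpen_ball.mem_nhds hp) (eventually_all.2 fun i =>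
        ((hF (e i)).continuousOn.continuousAt (isOpen_ball.mem_nhds hp)).norm.eventually
          (gt_mem_nhds (hpU i)))
    have hGc := (H.continuousOn_formCoeff.continuousAt (isOpen_ball.mem_nhds hp)).norm
    obtain ⟨r, hr, hrU⟩ := Metric.eventually_nhds_iff_ball.1
      (hUo.and (hGc.eventually (gt_mem_nhds (lt_add_one _))))
    have hs : ∀ z ∈ ball p r, segment ℝ p z ⊆ ball p r := fun z hz =>
      (convex_ball p r).segment_subset (mem_ball_self hr) hz
    have hloc : ∀ z ∈ ball p r, arg (v z) = arg (v p) ∧ |y z - y p + ((W z).im - (W p).im)| ≤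
        (‖G p‖ + 1) * ‖z - p‖ := fun z hz => by
      obtain ⟨J, hJ, hJi⟩ := eq_mul_exp_of_segment (e := e) (A := A) hF
        (fun x hx => (hrU x (hs z hz hx)).1.1)
        (fun x hx i => ((hrU x (hs z hz hx)).1.2 i).le.trans (by norm_num))
        (fun x hx => norm_pos_iff.1 (hδ.trans_le (hq x (hrU x (hs z hz hx)).1.1 fun i =>
          ((hrU x (hs z hz hx)).1.2 i).trans (by norm_num)))) H.continuousOn_formCoeff
      have h1 := hseg p hp z (hrU z hz).1.1 fun x hx => (hrU x (hs z hz hx)).1.2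
      constructor
      · have h2 : v z = (Real.exp J.re : ℝ) * v p := by
          change exp _ * hermForm A (fun j => F j z) = _ * (exp _ * hermForm A fun j => F j p)
          rw [hJ, mul_left_comm, ← mul_assoc, mul_comm (exp _) (hermForm A _), mul_assoc, ← exp_add,
            mul_left_comm, ofReal_exp, ← exp_add]
          congr 2
          rw [h1] at hJi
          apply Complex.ext <;> simp [hJi]
          ring
        rw [h2, arg_real_mul _ (Real.exp_pos _)]
      · rw [add_comm, ← h1]
        refine (abs_re_le_norm _).trans ?_
        rw [segInt]
        refine (intervalIntegral.norm_integral_le_of_norm_le_const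
          (C := (‖G p‖ + 1) * ‖z - p‖) fun t ht => ?_).trans (by simp)
        rw [uIoc_of_le zero_le_one] at ht
        rw [norm_mul]
        gcongr
        exact (hrU _ (hs z hz (segPt_mem_segment p z (Ioc_subset_Icc_self ht)))).2.le
    have hy : ContinuousAt (fun z => y z - y p + ((W z).im - (W p).im)) p := by
      rw [ContinuousAt]
      simp only [sub_self, add_zero]
      refine squeeze_zero_norm' (a := fun z => (‖G p‖ + 1) * ‖z - p‖)
        (Filter.mem_of_superset (ball_mem_nhds p hr) fun z hz => (hloc z hz).2) ?_
      have : Continuous fun z => (‖G p‖ + 1) * ‖z - p‖ := by fun_prop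
      simpa using this.tendsto p
    have hWc : ContinuousAt (fun z => (W z).im) p :=
      continuous_im.continuousAt.comp (hWd.continuousOn.continuousAt (isOpen_ball.mem_nhds hp))
    refine ContinuousAt.continuousWithinAt ?_
    refine ((hy.sub (hWc.sub (continuousAt_const (y := (W p).im)))).add
      (continuousAt_const (y := y p + arg (v p)))).congr ?_
    filter_upwards [ball_mem_nhds p hr] with z hz
    rw [(hloc z hz).1]
    simp only [Pi.add_apply, Pi.sub_apply]
    ring
  · have h1 := norm_mul_exp_arg_mul_I (v z)
    have h2 : ‖v z‖ = ‖Q z‖ := by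
      rw [hv]; simp only [norm_mul]
      rw [show -(((W z).im + y z : ℝ) : ℂ) * I = ((-((W z).im + y z) : ℝ) : ℂ) * I by push_cast; ring,
        norm_exp_ofReal_mul_I, one_mul]
    rw [h2] at h1
    calc Q z = exp (((W z).im + y z : ℝ) * I) * v z := by
          rw [hv, ← mul_assoc, ← exp_add, neg_mul, add_neg_cancel, exp_zero, one_mul]
      _ = exp (((W z).im + y z : ℝ) * I) * (‖Q z‖ * exp (arg (v z) * I)) := by rw [h1]
      _ = _ := by rw [mul_left_comm, ← exp_add]; push_cast; congr 2; ring
end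

/-- The restriction of `f` to the `n`-th disc, extended by zero. -/
noncomputable def slice (f : DiskN → ℂ) (n : ℕ) (z : ℂ) : ℂ :=
  open Classical in if hz : z ∈ ball (0 : ℂ) 1 then f (⟨z, hz⟩, n) else 0

lemma slice_of_mem {f : DiskN → ℂ} {n : ℕ} {z : ℂ} (hz : z ∈ ball (0 : ℂ) 1) :
    slice f n z = f (⟨z, hz⟩, n) := dif_pos hz

lemma slice_coe (f : DiskN → ℂ) (x : DiskN) : slice f x.2 x.1 = f x := dif_pos x.1.2

lemma mem_HinfAlg_iff {f : BoundedContinuousFunction DiskN ℂ} :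
    f ∈ HinfAlg ↔ ∀ n, DifferentiableOn ℂ (slice f n) (ball 0 1) := by
  refine forall_congr' fun n => ⟨fun ⟨g, hg, h⟩ => hg.congr fun z hz => ?_, fun h =>
    ⟨_, h, fun z hz => slice_of_mem hz⟩⟩
  rw [slice_of_mem hz, h z hz]

instance : CompleteSpace HinfAlg := by
  refine IsClosed.completeSpace_coe (hs := IsSeqClosed.isClosed fun F f hF h => ?_)
  refine mem_HinfAlg_iff.2 fun n => ?_
  refine TendstoLocallyUniformlyOn.differentiableOn (F := fun k => slice (F k) n) (φ := atTop) ?_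
    (Eventually.of_forall fun k => mem_HinfAlg_iff.1 (hF k) n) isOpen_ball
  refine TendstoUniformlyOn.tendstoLocallyUniformlyOn ?_
  rw [Metric.tendstoUniformlyOn_iff]
  intro ε hε
  filter_upwards [Metric.tendsto_nhds.1 h ε hε] with k hk z hz
  rw [slice_of_mem hz, slice_of_mem hz, dist_comm]
  exact (BoundedContinuousFunction.dist_coe_le_dist _).trans_lt hk

lemma exists_HinfAlg {s : ℕ → ℂ → ℂ} (hs : ∀ n, DifferentiableOn ℂ (s n) (ball 0 1)) {C : ℝ}
    (hC : ∀ n, ∀ z ∈ ball (0 : ℂ) 1, ‖s n z‖ ≤ C) : ∃ f : HinfAlg, ∀ x, f.1 x = s x.2 x.1 := by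
  have hc : Continuous fun x : DiskN => s x.2 x.1 := continuous_prod_of_discrete_right.2 fun n =>
    (hs n).continuousOn.comp_continuous continuous_subtype_val fun z => z.2
  refine ⟨⟨BoundedContinuousFunction.ofNormedAddCommGroup _ hc C fun x => hC _ _ x.1.2,
    fun n => ⟨s n, hs n, fun z hz => rfl⟩⟩, fun x => rfl⟩

/-- Evaluation at a point, as a character. -/
noncomputable def evalChar (x : DiskN) : WeakDual.characterSpace ℂ HinfAlg :=
  WeakDual.CharacterSpace.equivAlgHom.symm
    { toFun := fun f => f.1 x
      map_one' := rfl
      map_mul' := fun _ _ => rfl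
      map_zero' := rfl
      map_add' := fun _ _ => rfl
      commutes' := fun _ => rfl }

@[simp] lemma evalChar_apply (x : DiskN) (f : HinfAlg) : evalChar x f = f.1 x := rfl

lemma continuous_char_apply (f : HinfAlg) :
    Continuous fun ξ : WeakDual.characterSpace ℂ HinfAlg => ξ f :=
  (WeakDual.eval_continuous f).comp continuous_subtype_val

/-- The corona theorem: the points are dense among the characters. -/
lemma exists_forall_norm_sub_lt (ξ : WeakDual.characterSpace ℂ HinfAlg) (t : Finset HinfAlg)
    {ε : ℝ} (hε : 0 < ε) : ∃ x : DiskN, ∀ f ∈ t, ‖f.1 x - ξ f‖ < ε := by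
  by_contra! hcon
  obtain ⟨M, hM⟩ : ∃ M : ℝ, ∀ f : t, ‖(f : HinfAlg)‖ + ‖ξ f‖ ≤ M := Finite.exists_le _
  obtain ⟨C, -, hC⟩ := corona_disc t M (pow_pos hε 2)
  choose g hg hgC hg1 using fun n : ℕ => hC (fun f z => slice (f : HinfAlg).1 n z - ξ f)
    (fun f => (mem_HinfAlg_iff.1 (f : HinfAlg).2 n).sub_const _)
    (fun f z hz => (norm_sub_le _ _).trans (le_trans (by
      rw [slice_of_mem hz]; gcongr; exact (f : HinfAlg).1.norm_coe_le_norm _) (hM f)))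
    (fun z hz => by
      obtain ⟨f, hf, hle⟩ := hcon (⟨z, hz⟩, n)
      refine le_trans ?_ (Finset.single_le_sum (f := fun f : t =>
        ‖slice (f : HinfAlg).1 n z - ξ f‖ ^ 2) (fun _ _ => by positivity) (Finset.mem_univ ⟨f, hf⟩))
      rw [slice_of_mem hz]
      gcongr)
  choose G hG using fun f : t => exists_HinfAlg (fun n => hg n f) fun n => hgC n f
  have h1 : ∑ f : t, ((f : HinfAlg) - algebraMap ℂ HinfAlg (ξ f)) * G f = 1 := by
    ext x
    have := hg1 x.2 x.1 x.1.2
    simp only [slice_coe] at this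
    rw [AddSubmonoidClass.coe_finsetSum, BoundedContinuousFunction.sum_apply]
    simpa [hG] using this
  have h2 := congrArg ξ h1
  simp [map_sum, AlgHomClass.commutes] at h2

lemma exists_finset_ball_subset (ξ : WeakDual.characterSpace ℂ HinfAlg)
    {V : Set (WeakDual.characterSpace ℂ HinfAlg)} (hV : V ∈ 𝓝 ξ) :
    ∃ (t : Finset HinfAlg) (ε : ℝ), 0 < ε ∧ {η | ∀ f ∈ t, ‖η f - ξ f‖ < ε} ⊆ V := by
  have h₀ : IsInducing fun (η : WeakDual ℂ HinfAlg) (f : HinfAlg) => η f := ⟨rfl⟩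
  have h : IsInducing fun (η : WeakDual.characterSpace ℂ HinfAlg) (f : HinfAlg) => η f :=
    h₀.comp IsInducing.subtypeVal
  rw [h.nhds_eq_comap, mem_comap] at hV
  obtain ⟨B, hB, hBV⟩ := hV
  rw [nhds_pi, Filter.mem_pi'] at hB
  obtain ⟨t, S, hS, hSB⟩ := hB
  choose ε hε hεS using fun f => Metric.mem_nhds_iff.1 (hS f)
  obtain ⟨ε', h0, h1⟩ : ∃ ε' > 0, ∀ f ∈ t, ε' ≤ ε f := by
    rcases t.eq_empty_or_nonempty with rfl | ht
    · exact ⟨1, one_pos, by simp⟩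
    · exact ⟨t.inf' ht ε, (Finset.lt_inf'_iff _).2 fun f _ => hε f, fun f hf => Finset.inf'_le _ hf⟩
  refine ⟨t, ε', h0, fun η hη => hBV (hSB fun f hf => hεS f ?_)⟩
  rw [mem_ball, dist_eq_norm]
  exact (hη f hf).trans_le (h1 f hf)

lemma denseRange_evalChar : DenseRange evalChar := fun ξ => by
  refine mem_closure_iff_nhds.2 fun V hV => ?_
  obtain ⟨t, ε, hε, h⟩ := exists_finset_ball_subset ξ hV
  obtain ⟨x, hx⟩ := exists_forall_norm_sub_lt ξ t hε
  exact ⟨_, h fun f hf => hx f hf, x, rfl⟩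

lemma DenseRange.exists_continuousOn_extension {α X : Type*} [TopologicalSpace X] {i : α → X}
    (hi : DenseRange i) {U : Set X} (hU : IsOpen U) {u : α → ℝ}
    (h : ∀ ξ ∈ U, ∃ a, Tendsto u (comap i (𝓝 ξ)) (𝓝 a)) :
    ∃ v : X → ℝ, ContinuousOn v U ∧ ∀ ξ ∈ U, Tendsto u (comap i (𝓝 ξ)) (𝓝 (v ξ)) := by
  letI : TopologicalSpace α := TopologicalSpace.induced i inferInstance
  have di : IsDenseInducing i := ⟨⟨rfl⟩, hi⟩
  refine ⟨di.extend u, fun ξ hξ => (di.continuousAt_extend ?_).continuousWithinAt, fun ξ hξ => ?_⟩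
  · filter_upwards [hU.mem_nhds hξ] with η hη using h η hη
  · obtain ⟨a, ha⟩ := h ξ hξ
    rwa [di.extend_eq_of_tendsto ha]

lemma exists_indicator {κ : Type*} [Fintype κ] (h : κ → HinfAlg) {E E' : Set DiskN} (hE : IsOpen E)
    (hE' : IsOpen E') (hd : Disjoint E E') (hc : ∀ x, (∀ j, ‖(h j).1 x‖ < 8) → x ∈ E ∪ E') :
    ∃ e : HinfAlg, (∀ x ∈ E, (∀ j, ‖(h j).1 x‖ < 1) → ‖e.1 x - 1‖ ≤ 1 / 4) ∧
      ∀ x ∈ E', (∀ j, ‖(h j).1 x‖ < 1) → ‖e.1 x‖ ≤ 1 / 4 := by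
  obtain ⟨M, hM⟩ : ∃ M : ℝ, ∀ j, ‖h j‖ ≤ M := Finite.exists_le _
  obtain ⟨C, -, hC⟩ := exists_approx_indicator κ M
  have ho : ∀ {S : Set DiskN} (n : ℕ), IsOpen S →
      IsOpen (Subtype.val '' {z : ball (0 : ℂ) 1 | (z, n) ∈ S}) := fun n hS =>
    isOpen_ball.isOpenMap_subtype_val _ (hS.preimage (by fun_prop : Continuous fun z => (z, n)))
  choose s hs hsC hs1 hs0 using fun n : ℕ => hC (fun j => slice (h j).1 n) _ _
    (fun j => mem_HinfAlg_iff.1 (h j).2 n)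
    (fun j z hz => by
      rw [slice_of_mem hz]; exact ((h j).1.norm_coe_le_norm _).trans (hM j))
    (ho n hE) (ho n hE')
    ((disjoint_image_iff Subtype.val_injective).2 (hd.preimage fun z => (z, n)))
    (fun z hz hh => (hc (⟨z, hz⟩, n) fun j => by
      have := hh j
      rwa [slice_of_mem hz] at this).imp (fun H => ⟨_, H, rfl⟩) fun H => ⟨_, H, rfl⟩)
  obtain ⟨e, he⟩ := exists_HinfAlg hs hsC
  refine ⟨e, fun x hx hh => ?_, fun x hx hh => ?_⟩
  · rw [he]
    exact hs1 _ _ x.1.2 (fun j => by rw [slice_coe]; exact hh j) ⟨_, hx, rfl⟩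
  · rw [he]
    exact hs0 _ _ x.1.2 (fun j => by rw [slice_coe]; exact hh j) ⟨_, hx, rfl⟩

lemma comap_evalChar_neBot (ξ : WeakDual.characterSpace ℂ HinfAlg) : (comap evalChar (𝓝 ξ)).NeBot :=
  comap_neBot_iff_frequently.2 (mem_closure_iff_frequently.1 (denseRange_evalChar ξ))

lemma tendsto_comap_evalChar (ξ : WeakDual.characterSpace ℂ HinfAlg) (f : HinfAlg) :
    Tendsto (fun x => f.1 x) (comap evalChar (𝓝 ξ)) (𝓝 (ξ f)) :=
  ((continuous_char_apply f).tendsto ξ).comp tendsto_comap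

lemma le_of_mapClusterPt {ξ : WeakDual.characterSpace ℂ HinfAlg} {u : DiskN → ℝ}
    {U : Set (WeakDual.characterSpace ℂ HinfAlg)} (hU : IsOpen U) (hξ : ξ ∈ U)
    (hu : ContinuousOn u (evalChar ⁻¹' U)) (hev : Continuous evalChar) {a b c : ℝ}
    (hc : ∀ᶠ x in comap evalChar (𝓝 ξ), u x ≠ c)
    (ha : MapClusterPt a (comap evalChar (𝓝 ξ)) u) (hb : MapClusterPt b (comap evalChar (𝓝 ξ)) u)
    (hac : a < c) : b ≤ c := by
  by_contra! hcb
  obtain ⟨V, hV, hVs⟩ := mem_comap.1 (hc.and (preimage_mem_comap (hU.mem_nhds hξ)))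
  obtain ⟨t, ε, hε, ht⟩ := exists_finset_ball_subset ξ hV
  have hV' : ∀ x, (∀ f ∈ t, ‖f.1 x - ξ f‖ < ε) → u x ≠ c ∧ evalChar x ∈ U := fun x hx =>
    hVs (ht fun f hf => hx f hf)
  have ho := hU.preimage hev
  let h : t → HinfAlg := fun f => algebraMap ℂ HinfAlg (8 / ε : ℝ) *
    ((f : HinfAlg) - algebraMap ℂ HinfAlg (ξ f))
  have hh : ∀ f x, ‖(h f).1 x‖ = 8 / ε * ‖(f : HinfAlg).1 x - ξ f‖ := fun f x => by
    have : (h f).1 x = (8 / ε : ℝ) * ((f : HinfAlg).1 x - ξ f) := by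
      simp [h]
    rw [this, norm_mul, norm_real, Real.norm_of_nonneg (by positivity)]
  obtain ⟨e, he, he'⟩ := exists_indicator h (hu.isOpen_inter_preimage ho (isOpen_Iio (a := c)))
    (hu.isOpen_inter_preimage ho (isOpen_Ioi (a := c)))
    (disjoint_left.2 fun x h1 h2 => lt_asymm (a := u x) h1.2 h2.2) fun x hx => by
      obtain ⟨h1, h2⟩ := hV' x fun f hf => by
        have := hx ⟨f, hf⟩
        rw [hh, div_mul_eq_mul_div, div_lt_iff₀ hε] at this
        linarith
      exact (lt_or_gt_of_ne h1).imp (fun H => ⟨h2, H⟩) fun H => ⟨h2, H⟩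
  have hs : ∀ᶠ x in comap evalChar (𝓝 ξ), (∀ f, ‖(h f).1 x‖ < 1) ∧ evalChar x ∈ U ∧
      ‖e.1 x - ξ e‖ < 1 / 8 := by
    refine (eventually_all.2 fun f => ?_).and (Eventually.and
      (p := fun x => evalChar x ∈ U) (preimage_mem_comap (hU.mem_nhds hξ)) ?_)
    · filter_upwards [Metric.tendsto_nhds.1 (tendsto_comap_evalChar ξ f) (ε / 8) (by positivity)]
        with x hx
      rw [dist_eq_norm] at hx
      rw [hh, div_mul_eq_mul_div, div_lt_one hε]
      linarith
    · filter_upwards [Metric.tendsto_nhds.1 (tendsto_comap_evalChar ξ e) (1 / 8) (by norm_num)]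
        with x hx
      rwa [dist_eq_norm] at hx
  obtain ⟨x, hx, hx1, hx2, hx3⟩ := ((ha.frequently (Iio_mem_nhds hac)).and_eventually hs).exists
  obtain ⟨y, hy, hy1, hy2, hy3⟩ := ((hb.frequently (Ioi_mem_nhds hcb)).and_eventually hs).exists
  have k1 := he x ⟨hx2, hx⟩ hx1
  have k2 := he' y ⟨hy2, hy⟩ hy1
  have k3 : (1 : ℂ) = -(e.1 x - 1) + (e.1 x - ξ e) - (e.1 y - ξ e) + e.1 y := by ring
  have k4 := congrArg norm k3
  rw [norm_one] at k4
  have k5 := norm_add_le (-(e.1 x - 1) + (e.1 x - ξ e) - (e.1 y - ξ e)) (e.1 y)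
  have k6 := norm_sub_le (-(e.1 x - 1) + (e.1 x - ξ e)) (e.1 y - ξ e)
  have k7 := norm_add_le (-(e.1 x - 1)) (e.1 x - ξ e)
  rw [norm_neg] at k7
  linarith

lemma exists_tendsto_comap_evalChar {ξ : WeakDual.characterSpace ℂ HinfAlg} {u : DiskN → ℝ}
    {U : Set (WeakDual.characterSpace ℂ HinfAlg)} (hU : IsOpen U) (hξ : ξ ∈ U)
    (hu : ContinuousOn u (evalChar ⁻¹' U)) (hev : Continuous evalChar) {C : ℝ} (hC : ∀ x, |u x| ≤ C)
    {ψ : ℂ} (hψ : Tendsto (fun x => exp (u x * I)) (comap evalChar (𝓝 ξ)) (𝓝 ψ)) :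
    ∃ a, Tendsto u (comap evalChar (𝓝 ξ)) (𝓝 a) := by
  have : (comap evalChar (𝓝 ξ)).NeBot := comap_evalChar_neBot ξ
  have hcl : ∀ {a}, MapClusterPt a (comap evalChar (𝓝 ξ)) u → exp (a * I) = ψ := fun {a} ha => by
    have h1 : MapClusterPt (exp (a * I)) (comap evalChar (𝓝 ξ)) fun x => exp (u x * I) :=
      ha.continuousAt_comp (f := fun y : ℝ => exp (y * I)) (by fun_prop)
    exact eq_of_nhds_neBot (h1.neBot.mono (inf_le_inf_left _ hψ))
  have hlt : ∀ {a b}, MapClusterPt a (comap evalChar (𝓝 ξ)) u →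
      MapClusterPt b (comap evalChar (𝓝 ξ)) u → ¬ a < b := fun {a b} ha hb hab => by
    have h1 := (hcl ha).trans (hcl hb).symm
    obtain ⟨n, hn⟩ := exp_eq_exp_iff_exists_int.1 h1
    have h2 : a = b + n * (2 * π) := by
      have : ((a : ℂ)) = (b + n * (2 * π) : ℝ) := by
        apply mul_right_cancel₀ I_ne_zero
        rw [hn]; push_cast; ring
      exact_mod_cast this
    have h3 : (n : ℝ) ≤ -1 := by
      have : n < 0 := by
        by_contra! h0
        have : (0 : ℝ) ≤ n := by exact_mod_cast h0
        nlinarith [Real.pi_pos]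
      exact_mod_cast (by omega : n ≤ -1)
    have h4 : ∀ᶠ x in comap evalChar (𝓝 ξ), u x ≠ a + π := by
      have : ψ ≠ exp ((a + π : ℝ) * I) := by
        rw [← hcl ha]
        push_cast
        rw [add_mul, Complex.exp_add, exp_pi_mul_I]
        intro h
        have := exp_ne_zero (a * I)
        apply this
        linear_combination h / 2
      filter_upwards [hψ.eventually_ne this] with x hx hx'
      exact hx (by rw [hx'])
    have := le_of_mapClusterPt hU hξ hu hev h4 ha hb (by linarith [Real.pi_pos])
    nlinarith [Real.pi_pos]
  have hmem : ∀ᶠ y in map u (comap evalChar (𝓝 ξ)), y ∈ Icc (-C) C :=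
    Eventually.of_forall (f := comap evalChar (𝓝 ξ)) fun x => abs_le.1 (hC x)
  obtain ⟨a, -, ha⟩ := (isCompact_Icc (a := -C) (b := C)) (le_principal_iff.2 hmem)
  exact ⟨a, isCompact_Icc.le_nhds_of_unique_clusterPt hmem fun y _ hy =>
    le_antisymm (not_lt.1 (hlt ha hy)) (not_lt.1 (hlt hy ha))⟩

lemma continuous_evalChar : Continuous evalChar :=
  WeakDual.continuous_of_continuous_eval (fun f => f.1.continuous) |>.subtype_mk _

/-- The phase of a Hermitian form in the Gelfand transforms, on a polydisc where it is nonzero. -/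
theorem exists_gelfand_phase {ι : Type*} {κ : Type} [Fintype ι] [Fintype κ] (f : ι → HinfAlg)
    (e : κ → ι) (A : ι → ι → ℂ) {δ : ℝ} (hδ : 0 < δ)
    (hA : ∀ x, (∀ i, ‖(f (e i)).1 x‖ < 8) → δ ≤ ‖hermForm A fun j => (f j).1 x‖) :
    ∃ (w : HinfAlg) (v : WeakDual.characterSpace ℂ HinfAlg → ℝ),
      (∀ ξ : WeakDual.characterSpace ℂ HinfAlg, ξ w ≠ 0) ∧
      ContinuousOn v {ξ | ∀ i, ‖ξ (f (e i))‖ < 1} ∧ ∀ ξ : WeakDual.characterSpace ℂ HinfAlg,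
        (∀ i, ‖ξ (f (e i))‖ < 1) → hermForm A (fun j => ξ (f j)) * ‖ξ w‖ =
          ‖hermForm A fun j => ξ (f j)‖ * ξ w * exp (v ξ * I) := by
  obtain ⟨M, hM⟩ : ∃ M : ℝ, ∀ j, ‖f j‖ ≤ M := Finite.exists_le _
  obtain ⟨C, hC0, hC⟩ := exists_phase e A (abs_nonneg M) hδ
  choose W u hW hWC huC hu hWu using fun n : ℕ => hC (fun j => slice (f j).1 n)
    (fun j => mem_HinfAlg_iff.1 (f j).2 n)
    (fun j z hz => by
      rw [slice_of_mem hz]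
      exact ((f j).1.norm_coe_le_norm _).trans ((hM j).trans (le_abs_self M)))
    (fun z hz hh => by
      have := hA (⟨z, hz⟩, n)
      simp only [slice_of_mem hz] at hh ⊢
      exact this hh)
  obtain ⟨w, hw⟩ := exists_HinfAlg (s := fun n z => exp (W n z)) (fun n => (hW n).cexp)
    (C := Real.exp C) fun n z hz => by
      rw [norm_exp]; exact Real.exp_le_exp.2 (abs_le.1 (hWC n z hz)).2
  obtain ⟨w', hw'⟩ := exists_HinfAlg (s := fun n z => exp (-W n z)) (fun n => (hW n).neg.cexp)
    (C := Real.exp C) fun n z hz => by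
      rw [norm_exp]; exact Real.exp_le_exp.2 (by
        rw [neg_re]; linarith [(abs_le.1 (hWC n z hz)).1])
  have hww : w * w' = 1 := by
    ext x
    have : w.1 x * w'.1 x = 1 := by rw [hw, hw', ← Complex.exp_add, add_neg_cancel, Complex.exp_zero]
    simpa using this
  have hw0 : ∀ ξ : WeakDual.characterSpace ℂ HinfAlg, ξ w ≠ 0 := fun ξ h => by
    have := congrArg ξ hww
    simp [h] at this
  have hid : ∀ x, (hermForm A fun j => (f j).1 x) * ‖w.1 x‖ =
      ‖hermForm A fun j => (f j).1 x‖ * w.1 x * exp (u x.2 x.1 * I) := fun x => by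
    have h1 := hWu x.2 x.1
    simp only [slice_coe] at h1
    have h2 : w.1 x = ‖w.1 x‖ * exp ((W x.2 x.1).im * I) := by
      rw [hw, norm_exp, ofReal_exp, ← Complex.exp_add, re_add_im]
    rw [h2]
    conv_lhs => rw [h1]
    rw [ofReal_add, add_mul, Complex.exp_add]
    simp only [norm_mul, norm_exp_ofReal_mul_I, norm_real, norm_norm, mul_one]
    ring
  have hUo : IsOpen {ξ : WeakDual.characterSpace ℂ HinfAlg | ∀ i, ‖ξ (f (e i))‖ < 1} := by
    simp only [setOf_forall]
    exact isOpen_iInter_of_finite fun i => isOpen_lt (continuous_char_apply _).norm continuous_const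
  have hherm : ∀ ξ, Tendsto (fun x => hermForm A fun j => (f j).1 x) (comap evalChar (𝓝 ξ))
      (𝓝 (hermForm A fun j => ξ (f j))) := fun ξ =>
    ((contDiff_hermForm A).continuous.tendsto _).comp
      (tendsto_pi_nhds.2 fun j => tendsto_comap_evalChar ξ (f j))
  have huU : ContinuousOn (fun x : DiskN => u x.2 x.1)
      (evalChar ⁻¹' {ξ | ∀ i, ‖ξ (f (e i))‖ < 1}) := by
    refine continuousOn_prod_of_discrete_right.2 fun n => (hu n).comp
      continuous_subtype_val.continuousOn fun z hz => ⟨z.2, fun i => ?_⟩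
    rw [slice_of_mem z.2]
    exact hz i
  have hlim : ∀ ξ ∈ {ξ : WeakDual.characterSpace ℂ HinfAlg | ∀ i, ‖ξ (f (e i))‖ < 1},
      ∃ a, Tendsto (fun x : DiskN => u x.2 x.1) (comap evalChar (𝓝 ξ)) (𝓝 a) := fun ξ hξ => by
    have : (comap evalChar (𝓝 ξ)).NeBot := comap_evalChar_neBot ξ
    have hge : ∀ᶠ x in comap evalChar (𝓝 ξ), δ ≤ ‖hermForm A fun j => (f j).1 x‖ := by
      filter_upwards [preimage_mem_comap (hUo.mem_nhds hξ)] with x hx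
      exact hA x fun i => (hx i).trans (by norm_num)
    have h0 : hermForm A (fun j => ξ (f j)) ≠ 0 :=
      norm_pos_iff.1 (hδ.trans_le (ge_of_tendsto (hherm ξ).norm hge))
    refine exists_tendsto_comap_evalChar hUo hξ huU continuous_evalChar (fun x => huC x.2 x.1)
      (ψ := (hermForm A fun j => ξ (f j)) * ‖ξ w‖ / (‖hermForm A fun j => ξ (f j)‖ * ξ w)) ?_
    refine ((((hherm ξ).mul (tendsto_comap_evalChar ξ w).norm.ofReal).div
      ((hherm ξ).norm.ofReal.mul (tendsto_comap_evalChar ξ w))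
        (mul_ne_zero (by simpa using h0) (hw0 ξ)))).congr' ?_
    filter_upwards [hge] with x hx
    have h3 : w.1 x ≠ 0 := hw0 (evalChar x)
    have h4 : ((‖hermForm A fun j => (f j).1 x‖ : ℝ) : ℂ) ≠ 0 :=
      ofReal_ne_zero.2 (hδ.trans_le hx).ne'
    rw [Pi.div_apply, hid, mul_div_cancel_left₀ _ (mul_ne_zero h4 h3)]
  obtain ⟨v, hv, hvl⟩ := denseRange_evalChar.exists_continuousOn_extension hUo hlim
  refine ⟨w, v, hw0, hv, fun ξ hξ => ?_⟩
  have : (comap evalChar (𝓝 ξ)).NeBot := comap_evalChar_neBot ξ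
  refine tendsto_nhds_unique ((hherm ξ).mul (tendsto_comap_evalChar ξ w).norm.ofReal) ?_
  simp only [hid]
  exact ((hherm ξ).norm.ofReal.mul (tendsto_comap_evalChar ξ w)).mul
    ((by fun_prop : Continuous fun y : ℝ => exp (y * I)).tendsto (v ξ) |>.comp (hvl ξ hξ))

/-- Stone–Weierstrass for polynomials in Gelfand transforms and their conjugates. -/
lemma exists_gelfand_approx {K : Set (WeakDual.characterSpace ℂ HinfAlg)} (hK : IsCompact K)
    {g : WeakDual.characterSpace ℂ HinfAlg → ℂ} (hg : ContinuousOn g K) {ε : ℝ} (hε : 0 < ε) :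
    ∃ (J : Type) (_ : Fintype J) (p r : J → HinfAlg), ∀ ξ ∈ K,
      ‖∑ j, ξ (p j) * conj (ξ (r j)) - g ξ‖ < ε := by
  have : CompactSpace K := isCompact_iff_compactSpace.1 hK
  let S : StarSubalgebra ℂ C(K, ℂ) :=
    { carrier := {φ | ∃ (J : Type) (_ : Fintype J) (p r : J → HinfAlg), ∀ ξ : K,
        φ ξ = ∑ j, ξ.1 (p j) * conj (ξ.1 (r j))}
      mul_mem' := by
        rintro φ φ' ⟨J, _, p, r, h⟩ ⟨J', _, p', r', h'⟩
        refine ⟨J × J', inferInstance, fun j => p j.1 * p' j.2, fun j => r j.1 * r' j.2, fun ξ => ?_⟩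
        rw [ContinuousMap.mul_apply, h, h', Finset.sum_mul_sum, Fintype.sum_prod_type]
        refine Finset.sum_congr rfl fun j _ => Finset.sum_congr rfl fun j' _ => ?_
        simp only [map_mul]
        ring
      add_mem' := by
        rintro φ φ' ⟨J, _, p, r, h⟩ ⟨J', _, p', r', h'⟩
        refine ⟨J ⊕ J', inferInstance, Sum.elim p p', Sum.elim r r', fun ξ => ?_⟩
        simp [h, h']
      algebraMap_mem' := fun c =>
        ⟨Unit, inferInstance, fun _ => algebraMap ℂ HinfAlg c, fun _ => 1, fun ξ => by
          simp [AlgHomClass.commutes]⟩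
      star_mem' := by
        rintro φ ⟨J, _, p, r, h⟩
        exact ⟨J, inferInstance, r, p, fun ξ => by simp [h, mul_comm]⟩ }
  have hS : S.SeparatesPoints := fun ξ η hne => by
    obtain ⟨f, hf⟩ : ∃ f : HinfAlg, ξ.1 f ≠ η.1 f := by
      by_contra! h
      exact hne (Subtype.ext (WeakDual.CharacterSpace.ext h))
    exact ⟨_, ⟨⟨fun ζ : K => ζ.1 f, (continuous_char_apply f).comp continuous_subtype_val⟩,
      ⟨Unit, inferInstance, fun _ => f, fun _ => 1, fun ζ => by simp⟩, rfl⟩, hf⟩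
  have htop := ContinuousMap.starSubalgebra_topologicalClosure_eq_top_of_separatesPoints S hS
  have hmem : (⟨K.restrict g, hg.restrict⟩ : C(K, ℂ)) ∈ S.topologicalClosure := htop ▸ trivial
  obtain ⟨φ, ⟨J, _, p, r, h⟩, hφ⟩ := Metric.mem_closure_iff.1 hmem ε hε
  refine ⟨J, inferInstance, p, r, fun ξ hξ => ?_⟩
  have h1 := (ContinuousMap.dist_apply_le_dist (f := ⟨K.restrict g, hg.restrict⟩) (g := φ)
    ⟨ξ, hξ⟩).trans_lt hφ
  rw [dist_comm, dist_eq_norm, h] at h1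
  exact h1

lemma exists_polydisc {K Z : Set (WeakDual.characterSpace ℂ HinfAlg)} (hK : K.Nonempty)
    (hKconv : ∀ ξ : WeakDual.characterSpace ℂ HinfAlg, ξ ∉ K →
      ∃ f : HinfAlg, ∃ c : ℝ, (∀ η ∈ K, ‖η f‖ ≤ c) ∧ c < ‖ξ f‖)
    (hZ : IsCompact Z) (hd : Disjoint K Z) :
    ∃ (κ : Type) (_ : Fintype κ) (h : κ → HinfAlg), (∀ ξ ∈ K, ∀ i, ‖ξ (h i)‖ < 1) ∧
      ∀ ξ ∈ Z, ∃ i, 8 < ‖ξ (h i)‖ := by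
  have key : ∀ ξ ∈ Z, ∃ h : HinfAlg, (∀ η ∈ K, ‖η h‖ < 1) ∧ 8 < ‖ξ h‖ := fun ξ hξ => by
    obtain ⟨f, c, hc, hlt⟩ := hKconv ξ fun h => disjoint_left.1 hd h hξ
    obtain ⟨η₀, hη₀⟩ := hK
    have hc0 : 0 ≤ c := (norm_nonneg _).trans (hc η₀ hη₀)
    set b := (c + ‖ξ f‖) / 2 with hb
    have hb0 : 0 < b := by linarith
    obtain ⟨N, hN⟩ := pow_unbounded_of_one_lt 8 ((one_lt_div hb0).2 (by linarith : b < ‖ξ f‖))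
    have hN0 : N ≠ 0 := by rintro rfl; norm_num at hN
    have e : ∀ η : WeakDual.characterSpace ℂ HinfAlg,
        ‖η ((algebraMap ℂ HinfAlg (b⁻¹ : ℝ) * f) ^ N)‖ = (‖η f‖ / b) ^ N := fun η => by
      rw [map_pow, map_mul, AlgHomClass.commutes, norm_pow, norm_mul, Algebra.algebraMap_self_apply,
        norm_real, Real.norm_of_nonneg (by positivity), div_eq_inv_mul]
    refine ⟨(algebraMap ℂ HinfAlg (b⁻¹ : ℝ) * f) ^ N, fun η hη => ?_, by rwa [e]⟩
    rw [e]
    exact pow_lt_one₀ (by positivity) ((div_lt_one hb0).2 (by linarith [hc η hη])) hN0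
  choose! h hhK hhZ using key
  obtain ⟨t, htZ, ht⟩ := hZ.elim_nhds_subcover (fun ξ => {η | 8 < ‖η (h ξ)‖}) fun ξ hξ =>
    (isOpen_lt continuous_const (continuous_char_apply _).norm).mem_nhds (hhZ ξ hξ)
  refine ⟨t, inferInstance, fun i => h i, fun ξ hξ i => hhK i (htZ i i.2) ξ hξ, fun ξ hξ => ?_⟩
  obtain ⟨i, hi, hi'⟩ := mem_iUnion₂.1 (ht hξ)
  exact ⟨⟨i, hi⟩, hi'⟩

lemma exists_hermForm_eq (J κ : Type*) [Fintype J] [Fintype κ] :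
    ∃ A : (J ⊕ J) ⊕ κ → (J ⊕ J) ⊕ κ → ℂ, ∀ w, hermForm A w =
      ∑ j, w (Sum.inl (Sum.inl j)) * conj (w (Sum.inl (Sum.inr j))) := by
  classical
  refine ⟨fun a b => Sum.elim (Sum.elim (fun j => Sum.elim (Sum.elim (fun _ => 0)
    fun k => if j = k then 1 else 0) fun _ => 0) fun _ => 0) (fun _ => 0) a b, fun w => ?_⟩
  simp [hermForm]

/-- **Nonvanishing extension from holomorphically convex sets.** Let
`A = H^∞(𝔻 × ℕ)` and let `M(A)` be its maximal ideal space (character space with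
the Gelfand topology). If `K ⊆ M(A)` is compact and holomorphically convex
(for every `ξ ∉ K` there is `f ∈ A` with `max_{η ∈ K} |f̂(η)| < |f̂(ξ)|`, where
`f̂(ξ) = ξ f` is the Gelfand transform), then every continuous nonvanishing
function `g : K → ℂ∖{0}` extends to a continuous nonvanishing function
`g̃ : M(A) → ℂ∖{0}`. -/
theorem HinfN_nonvanishing_extension_of_holConvex
    (K : Set (WeakDual.characterSpace ℂ ↥HinfAlg))
    (hKcompact : IsCompact K)
    (hKconv : ∀ ξ : WeakDual.characterSpace ℂ ↥HinfAlg, ξ ∉ K →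
      ∃ f : ↥HinfAlg, ∃ c : ℝ, (∀ η ∈ K, ‖η f‖ ≤ c) ∧ c < ‖ξ f‖)
    (g : WeakDual.characterSpace ℂ ↥HinfAlg → ℂ)
    (hg : ContinuousOn g K) (hg0 : ∀ x ∈ K, g x ≠ 0) :
    ∃ G : WeakDual.characterSpace ℂ ↥HinfAlg → ℂ,
      Continuous G ∧ (∀ x, G x ≠ 0) ∧ ∀ x ∈ K, G x = g x := by
  rcases K.eq_empty_or_nonempty with rfl | hne
  · exact ⟨1, continuous_one, by simp, by simp⟩
  obtain ⟨ξ₀, hξ₀, hmin⟩ := hKcompact.exists_isMinOn hne hg.norm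
  set m := ‖g ξ₀‖
  have hm : 0 < m := norm_pos_iff.2 (hg0 ξ₀ hξ₀)
  have hgm : ∀ ξ ∈ K, m ≤ ‖g ξ‖ := fun ξ hξ => hmin hξ
  obtain ⟨J, _, p, r, hq⟩ := exists_gelfand_approx hKcompact hg (half_pos hm)
  let q : WeakDual.characterSpace ℂ HinfAlg → ℂ := fun ξ => ∑ j, ξ (p j) * conj (ξ (r j))
  have hqc : Continuous q := continuous_finsetSum _ fun j _ =>
    (continuous_char_apply _).mul (continuous_conj.comp (continuous_char_apply _))
  have hqK : ∀ ξ ∈ K, m / 2 < ‖q ξ‖ := fun ξ hξ => by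
    have h1 := norm_le_norm_add_norm_sub (q ξ) (g ξ)
    have h2 := hgm ξ hξ
    have h3 : ‖q ξ - g ξ‖ < m / 2 := hq ξ hξ
    linarith
  obtain ⟨κ, _, h, hhK, hhZ⟩ := exists_polydisc hne hKconv
    (isClosed_le hqc.norm (continuous_const (y := m / 4))).isCompact
    (disjoint_left.2 fun ξ h1 h2 => by
      have := hqK ξ h1
      rw [mem_setOf_eq] at h2
      linarith)
  obtain ⟨A, hA⟩ := exists_hermForm_eq J κ
  obtain ⟨w, v, hw, hv, hE⟩ := exists_gelfand_phase (Sum.elim (Sum.elim p r) h) Sum.inr A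
    (δ := m / 4) (by positivity) fun x hx => by
      rw [hA]
      by_contra! hlt
      obtain ⟨i, hi⟩ := hhZ (evalChar x) hlt.le
      exact lt_asymm hi (hx i)
  simp only [hA, Sum.elim_inl, Sum.elim_inr] at hv hE
  have hq0 : ∀ ξ ∈ K, q ξ ≠ 0 := fun ξ hξ => norm_pos_iff.1 (by linarith [hqK ξ hξ])
  have hL : ContinuousOn (fun ξ => log (g ξ / q ξ) + ((Real.log ‖q ξ‖ - Real.log ‖ξ w‖ : ℝ) : ℂ) +
      v ξ * I) K := by
    refine ((ContinuousOn.clog (hg.div hqc.continuousOn hq0) fun ξ hξ => ?_).add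
      (continuous_ofReal.comp_continuousOn ((hqc.norm.continuousOn.log fun ξ hξ =>
        (norm_pos_iff.2 (hq0 ξ hξ)).ne').sub ((continuous_char_apply w).norm.continuousOn.log
          fun ξ _ => (norm_pos_iff.2 (hw ξ)).ne')))).add
      ((continuous_ofReal.comp_continuousOn (hv.mono fun ξ hξ => hhK ξ hξ)).mul continuousOn_const)
    refine ball_one_subset_slitPlane ?_
    rw [mem_ball, dist_eq_norm, Pi.div_apply, div_sub_one (hq0 ξ hξ), norm_div,
      div_lt_one (norm_pos_iff.2 (hq0 ξ hξ)), norm_sub_rev]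
    exact (hq ξ hξ).trans (hqK ξ hξ)
  obtain ⟨L, hLK⟩ := ContinuousMap.exists_restrict_eq hKcompact.isClosed ⟨_, hL.restrict⟩
  refine ⟨fun ξ => exp (L ξ) * ξ w, L.continuous.cexp.mul (continuous_char_apply w),
    fun ξ => mul_ne_zero (exp_ne_zero _) (hw ξ), fun ξ hξ => ?_⟩
  have h1 : L ξ = _ := DFunLike.congr_fun hLK ⟨ξ, hξ⟩
  have hqn := norm_pos_iff.2 (hq0 ξ hξ)
  have hwn := norm_pos_iff.2 (hw ξ)
  have h2 : q ξ * ‖ξ w‖ = ‖q ξ‖ * ξ w * exp (v ξ * I) := hE ξ fun i => hhK ξ hξ i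
  dsimp only
  rw [h1]
  simp only [ContinuousMap.coe_mk, restrict_apply]
  rw [Complex.exp_add, Complex.exp_add, exp_log (div_ne_zero (hg0 ξ hξ) (hq0 ξ hξ)), ← ofReal_exp,
    Real.exp_sub, Real.exp_log hqn, Real.exp_log hwn, ofReal_div]
  have h3 : ((‖ξ w‖ : ℝ) : ℂ) ≠ 0 := ofReal_ne_zero.2 hwn.ne'
  have h4 := hq0 ξ hξ
  field_simp
  linear_combination -g ξ * h2
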